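/- Fix r ≥ 1. If for every nonzero resonant point t, max_{k ≤ 8r−4} sup over all indices 1 ≤ j_1,...,j_k ≤ N of || E[e^{itS_N} | X_{j_1},...,X_{j_k}] ||_{L¹} = o(σ_N^{−(r−1)}), then S_N obeys the (usual) Edgeworth expansion of order r. Moreover, if for every nonzero resonant point t and every ℓ, sup_{1≤j_1,...,j_ℓ≤N} || E[e^{itS_N} | X_{j_1},...,X_{j_ℓ}] ||_{L¹} = o_ℓ(σ_N^{−(r−1)}), then the Edgeworth expansion of order r holds in a conditionally stable way. -/

import Mathlib

open MeasureTheory ProbabilityTheory Filter Finset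
open scoped ENNReal Topology

noncomputable section

namespace EdgeworthMC

variable {Ω E : Type*} [MeasurableSpace Ω] [MeasurableSpace E]

/-- The standard Gaussian density `𝔤(u) = (2π)^{-1/2} e^{-u²/2}`. -/
def gaussDensity (u : ℝ) : ℝ := (Real.sqrt (2 * Real.pi))⁻¹ * Real.exp (-u ^ 2 / 2)

/-- `UEChain μ X κ C` : the process `X` is a Markov chain (with respect to the probability
measure `μ`) with transition kernels `κ n` from the state at time `n` to the state at time
`n+1`, and the chain is uniformly elliptic with ellipticity constant `C`:
`C⁻¹ ℙ(X_{n+1} ∈ A) ≤ ℙ(X_{n+1} ∈ A | X_n = x) ≤ C ℙ(X_{n+1} ∈ A)` for a.e. `x`. -/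
def UEChain (μ : Measure Ω) (X : ℕ → Ω → E) (κ : ℕ → Kernel E E) (C : ℝ) : Prop :=
  IsProbabilityMeasure μ ∧
  (∀ n, Measurable (X n)) ∧
  (∀ n, IsMarkovKernel (κ n)) ∧
  (∀ n (A : Set E), MeasurableSet A →
      (μ[fun ω => A.indicator (fun _ => (1 : ℝ)) (X (n + 1) ω) |
          ⨆ i : Fin (n + 1), MeasurableSpace.comap (X i) (inferInstance : MeasurableSpace E)]
        =ᵐ[μ] fun ω => (κ n (X n ω) A).toReal)) ∧
  (∀ n (A : Set E), MeasurableSet A → ∀ᵐ ω ∂μ,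
      κ n (X n ω) A ≤ ENNReal.ofReal C * Measure.map (X (n + 1)) μ A ∧
      Measure.map (X (n + 1)) μ A ≤ ENNReal.ofReal C * κ n (X n ω) A)

/-- Partial sums `S_N = ∑_{n=1}^N f_n(X_n)`. -/
def S (X : ℕ → Ω → E) (f : ℕ → E → ℤ) (N : ℕ) (ω : Ω) : ℤ :=
  ∑ n ∈ Finset.Icc 1 N, f n (X n ω)

/-- `V_N = Var(S_N)`. -/
def VN (μ : Measure Ω) (X : ℕ → Ω → E) (f : ℕ → E → ℤ) (N : ℕ) : ℝ :=
  variance (fun ω => ((S X f N ω : ℝ))) μ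

/-- `σ_N = √V_N`. -/
def sigN (μ : Measure Ω) (X : ℕ → Ω → E) (f : ℕ → E → ℤ) (N : ℕ) : ℝ :=
  Real.sqrt (VN μ X f N)

/-- `a_N = 𝔼(S_N)`. -/
def meanS (μ : Measure Ω) (X : ℕ → Ω → E) (f : ℕ → E → ℤ) (N : ℕ) : ℝ :=
  ∫ ω, ((S X f N ω : ℝ)) ∂μ

/-- The second largest value among the (finitely many) values of `p`, counted with
multiplicity: it equals `min_j max_{j' ≠ j} p j'`. -/
def secondLargest {ι : Type*} (p : ι → ℝ) : ℝ := ⨅ j, sSup (p '' {j}ᶜ)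

/-- `q_n(m)` : the second largest value among `ℙ(Y_n ≡ j mod m)`, `j = 0,…,m-1`. -/
def qres (μ : Measure Ω) (X : ℕ → Ω → E) (f : ℕ → E → ℤ) (n m : ℕ) : ℝ :=
  secondLargest (fun j : ZMod m => (μ {ω | ((f n (X n ω) : ZMod m)) = j}).toReal)

/-- `M_N = min_{2 ≤ m ≤ 2K} ∑_{n=1}^N q_n(m)`. -/
def MN (μ : Measure Ω) (X : ℕ → Ω → E) (f : ℕ → E → ℤ) (K N : ℕ) : ℝ :=
  sInf ((fun m => ∑ n ∈ Finset.Icc 1 N, qres μ X f n m) '' (Set.Icc 2 (2 * K)))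

/-- `S_N` obeys the Edgeworth expansion of order `r` : there are polynomials `P_{b,N}`,
with coefficients uniformly bounded in `N` and degrees not depending on `N`, such that
uniformly in `k ∈ ℤ`,
`ℙ(S_N = k) = ∑_{b=1}^r σ_N^{-b} P_{b,N}(k_N) 𝔤(k_N) + o(σ_N^{-r})`
where `k_N = (k - 𝔼 S_N)/σ_N`. -/
def Edgeworth (μ : Measure Ω) (X : ℕ → Ω → E) (f : ℕ → E → ℤ) (r : ℕ) : Prop :=
  ∃ (D : ℕ) (Cb : ℝ) (P : ℕ → ℕ → Polynomial ℝ),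
    (∀ b N, (P b N).natDegree ≤ D) ∧
    (∀ b N i, |(P b N).coeff i| ≤ Cb) ∧
    ∀ ε > 0, ∃ N₀, ∀ N ≥ N₀, ∀ k : ℤ,
      |(μ {ω | S X f N ω = k}).toReal -
          ∑ b ∈ Finset.Icc 1 r, (sigN μ X f N)⁻¹ ^ b *
            (P b N).eval (((k : ℝ) - meanS μ X f N) / sigN μ X f N) *
            gaussDensity (((k : ℝ) - meanS μ X f N) / sigN μ X f N)|
        ≤ ε * (sigN μ X f N)⁻¹ ^ r

/-- The σ-algebra generated by `X_{j 1}, …, X_{j ℓ}`. -/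
def sigmaOf (X : ℕ → Ω → E) {ℓ : ℕ} (j : Fin ℓ → ℕ) : MeasurableSpace Ω :=
  ⨆ i : Fin ℓ, MeasurableSpace.comap (X (j i)) (inferInstance : MeasurableSpace E)

/-- Conditional probability of the event `s` given the σ-algebra `m`. -/
def condProb (μ : Measure Ω) (m : MeasurableSpace Ω) (s : Set Ω) : Ω → ℝ :=
  μ[s.indicator (fun _ => (1 : ℝ)) | m]

/-- `S_N` obeys the Edgeworth expansion of order `r` in a conditionally stable way:
for every `ℓ`, the order `r` Edgeworth expansion holds for the conditional law of `S_N`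
given `X_{j_1},…,X_{j_ℓ}`, with error term `o_ℓ(σ_N^{-r})` and polynomial coefficient
bounds depending only on `ℓ` (and `r`), uniformly over all choices of indices
`1 ≤ j_1,…,j_ℓ ≤ N`. -/
def CondStableEdgeworth (μ : Measure Ω) (X : ℕ → Ω → E) (f : ℕ → E → ℤ) (r : ℕ) : Prop :=
  ∀ ℓ : ℕ, ∃ (D : ℕ) (Cb : ℝ), ∀ ε > 0, ∃ N₀, ∀ N ≥ N₀,
    ∀ j : Fin ℓ → ℕ, (∀ i, j i ∈ Finset.Icc 1 N) →
      ∃ P : ℕ → Ω → Polynomial ℝ,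
        (∀ b ω, (P b ω).natDegree ≤ D) ∧
        (∀ b ω i, |(P b ω).coeff i| ≤ Cb) ∧
        ∀ᵐ ω ∂μ, ∀ k : ℤ,
          |condProb μ (sigmaOf X j) {ω' | S X f N ω' = k} ω -
              ∑ b ∈ Finset.Icc 1 r, (sigN μ X f N)⁻¹ ^ b *
                (P b ω).eval (((k : ℝ) -
                    (μ[fun ω' => ((S X f N ω' : ℝ)) | sigmaOf X j]) ω) / sigN μ X f N) *
                gaussDensity (((k : ℝ) -
                    (μ[fun ω' => ((S X f N ω' : ℝ)) | sigmaOf X j]) ω) / sigN μ X f N)|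
            ≤ ε * (sigN μ X f N)⁻¹ ^ r

/-- `t` is a resonant point: `t = 2πl/m` with `0 < m ≤ 2K`, `0 ≤ l < m`. -/
def IsResonant (K : ℕ) (t : ℝ) : Prop :=
  ∃ l m : ℕ, 0 < m ∧ m ≤ 2 * K ∧ l < m ∧ t = 2 * Real.pi * l / m

/-- The conditional characteristic function `𝔼[e^{itS_N} | X_{j_1},…,X_{j_ℓ}]`. -/
def condChar (μ : Measure Ω) (X : ℕ → Ω → E) (f : ℕ → E → ℤ) (t : ℝ) (N : ℕ)
    {ℓ : ℕ} (j : Fin ℓ → ℕ) : Ω → ℂ :=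
  μ[fun ω => Complex.exp (Complex.I * (t : ℂ) * ((S X f N ω : ℤ) : ℂ)) | sigmaOf X j]

end EdgeworthMC

set_option linter.unusedSectionVars false

namespace EdgeworthMC

variable {Ω E : Type*} [MeasurableSpace Ω] [MeasurableSpace E]

/-! ### Bounded measurable functions and elliptic densities -/

/-- Bounded measurable complex functions. -/
def BddMeas (u : E → ℂ) : Prop := Measurable u ∧ ∃ b : ℝ, ∀ x, ‖u x‖ ≤ b

namespace BddMeas

variable {u w : E → ℂ}

lemma const (z : ℂ) : BddMeas (fun _ : E => z) := ⟨measurable_const, ‖z‖, fun _ => le_rfl⟩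

lemma of_norm_le {b : ℝ} (hu : Measurable u) (h : ∀ x, ‖u x‖ ≤ b) : BddMeas u := ⟨hu, b, h⟩

lemma mul (hu : BddMeas u) (hw : BddMeas w) : BddMeas (fun x => u x * w x) := by
  obtain ⟨hu, a, ha⟩ := hu
  obtain ⟨hw, b, hb⟩ := hw
  refine ⟨hu.mul hw, a * b, fun x => ?_⟩
  rw [norm_mul]
  exact mul_le_mul (ha x) (hb x) (norm_nonneg _) ((norm_nonneg _).trans (ha x))

lemma sub (hu : BddMeas u) (hw : BddMeas w) : BddMeas (fun x => u x - w x) := by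
  obtain ⟨hu, a, ha⟩ := hu
  obtain ⟨hw, b, hb⟩ := hw
  exact ⟨hu.sub hw, a + b, fun x => (norm_sub_le _ _).trans (add_le_add (ha x) (hb x))⟩

lemma integrable (hu : BddMeas u) (ν : Measure E) [IsFiniteMeasure ν] : Integrable u ν := by
  obtain ⟨hu, a, ha⟩ := hu
  exact Integrable.of_bound hu.aestronglyMeasurable a (ae_of_all _ ha)

end BddMeas

/-- Probability densities with respect to `ν` bounded between `c` and `c⁻¹`. -/
structure IsDens (ν : Measure E) (κ : E → ℝ) (c : ℝ) : Prop where
  meas : Measurable κ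
  pos : 0 < c
  lt_one : c < 1
  lower : ∀ x, c ≤ κ x
  upper : ∀ x, κ x ≤ c⁻¹
  mass : ∫ x, κ x ∂ν = 1

namespace IsDens

variable {ν : Measure E} [IsProbabilityMeasure ν] {κ κ' : E → ℝ} {c : ℝ} {g : E → ℂ}

lemma nonneg (h : IsDens ν κ c) (x : E) : 0 ≤ κ x := h.pos.le.trans (h.lower x)

lemma bddMeas (h : IsDens ν κ c) : BddMeas (fun x => (κ x : ℂ)) :=
  ⟨Complex.measurable_ofReal.comp h.meas, c⁻¹, fun x => by
    rw [Complex.norm_real, Real.norm_of_nonneg (h.nonneg x)]; exact h.upper x⟩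

lemma integrable_real (h : IsDens ν κ c) : Integrable κ ν :=
  Integrable.of_bound h.meas.aestronglyMeasurable c⁻¹
    (ae_of_all _ fun x => by rw [Real.norm_of_nonneg (h.nonneg x)]; exact h.upper x)

lemma integral_const_mul (h : IsDens ν κ c) (z : ℂ) : ∫ x, z * (κ x : ℂ) ∂ν = z := by
  rw [MeasureTheory.integral_const_mul, integral_complex_ofReal, h.mass]; simp

lemma norm_integral_le (h : IsDens ν κ c) {a : ℝ} (hg : ∀ x, ‖g x‖ ≤ a) :
    ‖∫ x, g x * (κ x : ℂ) ∂ν‖ ≤ a := by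
  have h1 : ‖∫ x, g x * (κ x : ℂ) ∂ν‖ ≤ ∫ x, a * κ x ∂ν := by
    refine norm_integral_le_of_norm_le (h.integrable_real.const_mul a) (ae_of_all _ fun x => ?_)
    rw [norm_mul, Complex.norm_real, Real.norm_of_nonneg (h.nonneg x)]
    exact mul_le_mul_of_nonneg_right (hg x) (h.nonneg x)
  rwa [MeasureTheory.integral_const_mul, h.mass, mul_one] at h1

lemma norm_integral_le_inv_mul (h : IsDens ν κ c) (hg : BddMeas g) :
    ‖∫ x, g x * (κ x : ℂ) ∂ν‖ ≤ c⁻¹ * ∫ x, ‖g x‖ ∂ν := by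
  rw [← MeasureTheory.integral_const_mul]
  refine norm_integral_le_of_norm_le ((hg.integrable ν).norm.const_mul _) (ae_of_all _ fun x => ?_)
  rw [norm_mul, Complex.norm_real, Real.norm_of_nonneg (h.nonneg x), mul_comm]
  exact mul_le_mul_of_nonneg_right (h.upper x) (norm_nonneg _)

/-- Integration against the nonnegative density `κ - c` of mass `1 - c`. -/
lemma norm_integral_excess_le (h : IsDens ν κ c) {a : ℝ} (hg : ∀ x, ‖g x‖ ≤ a) :
    ‖∫ x, g x * ((κ x - c : ℝ) : ℂ) ∂ν‖ ≤ (1 - c) * a := by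
  have hi : Integrable (fun x => κ x - c) ν := h.integrable_real.sub (integrable_const c)
  have h1 : ‖∫ x, g x * ((κ x - c : ℝ) : ℂ) ∂ν‖ ≤ ∫ x, a * (κ x - c) ∂ν := by
    refine norm_integral_le_of_norm_le (hi.const_mul a) (ae_of_all _ fun x => ?_)
    rw [norm_mul, Complex.norm_real, Real.norm_of_nonneg (sub_nonneg.2 (h.lower x))]
    exact mul_le_mul_of_nonneg_right (hg x) (sub_nonneg.2 (h.lower x))
  rw [MeasureTheory.integral_const_mul, integral_sub h.integrable_real (integrable_const c),
    h.mass] at h1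
  simpa [mul_comm] using h1

lemma integral_eq_excess_add (h : IsDens ν κ c) (hg : BddMeas g) :
    ∫ x, g x * (κ x : ℂ) ∂ν
      = ∫ x, g x * ((κ x - c : ℝ) : ℂ) ∂ν + c * ∫ x, g x ∂ν := by
  have hm : BddMeas (fun x => g x * ((κ x - c : ℝ) : ℂ)) := by
    have := hg.mul (h.bddMeas.sub (BddMeas.const (c : ℂ)))
    simpa using this
  rw [← MeasureTheory.integral_const_mul,
    ← integral_add (hm.integrable ν) ((hg.integrable ν).const_mul _)]
  congr 1
  ext x
  push_cast
  ring

/-- Two elliptic densities integrate a function of oscillation `a` to nearby values. -/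
lemma norm_integral_sub_le (h : IsDens ν κ c) (h' : IsDens ν κ' c) (hg : BddMeas g) {a : ℝ}
    (ho : ∀ x x', ‖g x - g x'‖ ≤ a) :
    ‖∫ x, g x * (κ x : ℂ) ∂ν - ∫ x, g x * (κ' x : ℂ) ∂ν‖ ≤ (1 - c) * a := by
  have hc : 0 < 1 - c := sub_pos.2 h.lt_one
  rw [h.integral_eq_excess_add hg, h'.integral_eq_excess_add hg, add_sub_add_right_eq_sub]
  set G : ℂ := ∫ x, g x * ((κ x - c : ℝ) : ℂ) ∂ν with hG
  have hm : ∀ {κ : E → ℝ}, IsDens ν κ c → BddMeas (fun x => g x * ((κ x - c : ℝ) : ℂ)) := by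
    intro κ h
    have := hg.mul (h.bddMeas.sub (BddMeas.const (c : ℂ)))
    simpa using this
  have hmass : ∀ {κ : E → ℝ}, IsDens ν κ c → ∫ x, ((κ x - c : ℝ) : ℂ) ∂ν = ((1 - c : ℝ) : ℂ) := by
    intro κ h
    rw [integral_complex_ofReal, integral_sub h.integrable_real (integrable_const c), h.mass]
    simp
  have hcst : ∀ {κ : E → ℝ}, IsDens ν κ c → BddMeas (fun x => ((κ x - c : ℝ) : ℂ)) := by
    intro κ h
    have := h.bddMeas.sub (BddMeas.const (c : ℂ))
    simpa using this
  have h1 : ∀ x', ‖G - ((1 - c : ℝ) : ℂ) * g x'‖ ≤ (1 - c) * a := by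
    intro x'
    have e : G - ((1 - c : ℝ) : ℂ) * g x'
        = ∫ x, (g x - g x') * ((κ x - c : ℝ) : ℂ) ∂ν := by
      simp_rw [sub_mul]
      rw [integral_sub ((hm h).integrable ν) (((hcst h).integrable ν).const_mul _),
        MeasureTheory.integral_const_mul, hmass h, mul_comm]
    rw [e]
    exact h.norm_integral_excess_le fun x => ho x x'
  have h2 : ((1 - c : ℝ) : ℂ) * (G - ∫ x, g x * ((κ' x - c : ℝ) : ℂ) ∂ν)
      = ∫ x, (G - ((1 - c : ℝ) : ℂ) * g x) * ((κ' x - c : ℝ) : ℂ) ∂ν := by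
    simp_rw [sub_mul, mul_assoc]
    rw [integral_sub (((hcst h').integrable ν).const_mul _)
      (((hm h').integrable ν).const_mul _), MeasureTheory.integral_const_mul,
      MeasureTheory.integral_const_mul, hmass h']
    ring
  have h3 := h'.norm_integral_excess_le h1
  rw [← h2, norm_mul, Complex.norm_real, Real.norm_of_nonneg hc.le] at h3
  exact le_of_mul_le_mul_left h3 hc

lemma norm_integral_le_of_mean (h : IsDens ν κ c) (hg : BddMeas g) (h1 : ∀ x, ‖g x‖ ≤ 1) :
    ‖∫ x, g x * (κ x : ℂ) ∂ν‖ ≤ 1 - c * (1 - ‖∫ x, g x ∂ν‖) := by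
  rw [h.integral_eq_excess_add hg]
  refine (norm_add_le _ _).trans ?_
  rw [norm_mul, Complex.norm_real, Real.norm_of_nonneg h.pos.le]
  have := h.norm_integral_excess_le h1
  linarith

end IsDens

/-- Families `k n y` of elliptic densities with respect to `ν n`. -/
structure IsBackwardKernel (ν : ℕ → Measure E) (k : ℕ → E → E → ℝ) (c : ℝ) : Prop where
  prob : ∀ n, IsProbabilityMeasure (ν n)
  meas : ∀ n, Measurable (Function.uncurry (k n))
  dens : ∀ n y, IsDens (ν n) (k n y) c

/-- The weighted averaging operator `u ↦ ∫ u w k(y, ·) dν`. -/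
def transfer (ν : Measure E) (k : E → E → ℝ) (w u : E → ℂ) (y : E) : ℂ :=
  ∫ x, u x * w x * (k y x : ℂ) ∂ν

/-- Iterates of the weighted averaging operators, started from the constant `1`. -/
def bwd (ν : ℕ → Measure E) (k : ℕ → E → E → ℝ) (w : ℕ → E → ℂ) : ℕ → E → ℂ
  | 0 => fun _ => 1
  | n + 1 => transfer (ν n) (k n) (w n) (bwd ν k w n)

section Transfer

variable {ν : Measure E} [IsProbabilityMeasure ν] {k : E → E → ℝ} {c : ℝ} {u v w w' : E → ℂ}

lemma transfer_bddMeas (hk : Measurable (Function.uncurry k)) (hd : ∀ y, IsDens ν (k y) c)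
    (hw : BddMeas w) (hu : BddMeas u) : BddMeas (transfer ν k w u) := by
  have huw := hu.mul hw
  obtain ⟨hm, b, hb⟩ := huw
  refine ⟨?_, b, fun y => (hd y).norm_integral_le hb⟩
  have : Measurable (Function.uncurry fun y x => u x * w x * (k y x : ℂ)) :=
    (hm.comp measurable_snd).mul (Complex.measurable_ofReal.comp hk)
  exact (this.stronglyMeasurable.integral_prod_right (ν := ν)).measurable

lemma transfer_sub (hd : ∀ y, IsDens ν (k y) c) (hw : BddMeas w) (hu : BddMeas u)
    (hv : BddMeas v) (y : E) :
    transfer ν k w (fun x => u x - v x) y = transfer ν k w u y - transfer ν k w v y := by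
  unfold transfer
  rw [← integral_sub (((hu.mul hw).mul (hd y).bddMeas).integrable ν)
    (((hv.mul hw).mul (hd y).bddMeas).integrable ν)]
  congr 1; ext x; ring

lemma transfer_const_mul (z : ℂ) (y : E) :
    transfer ν k w (fun x => z * u x) y = z * transfer ν k w u y := by
  unfold transfer
  rw [← MeasureTheory.integral_const_mul]
  congr 1; ext x; ring

lemma norm_transfer_le (hd : ∀ y, IsDens ν (k y) c) (hw : ∀ x, ‖w x‖ ≤ 1) {a : ℝ}
    (hu : ∀ x, ‖u x‖ ≤ a) (y : E) : ‖transfer ν k w u y‖ ≤ a := by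
  refine (hd y).norm_integral_le (g := fun x => u x * w x) fun x => ?_
  rw [norm_mul]
  exact (mul_le_of_le_one_right (norm_nonneg _) (hw x)).trans (hu x)

lemma norm_transfer_sub_weight_le (hd : ∀ y, IsDens ν (k y) c) (hw : BddMeas w)
    (hw' : BddMeas w') (hu : BddMeas u) {a : ℝ} (ha : ∀ x, ‖u x‖ ≤ a) (y : E) :
    ‖transfer ν k w' u y - transfer ν k w u y‖ ≤ a * (c⁻¹ * ∫ x, ‖w' x - w x‖ ∂ν) := by
  unfold transfer
  rw [← integral_sub (((hu.mul hw').mul (hd y).bddMeas).integrable ν)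
    (((hu.mul hw).mul (hd y).bddMeas).integrable ν)]
  have e : ∀ x, u x * w' x * (k y x : ℂ) - u x * w x * (k y x : ℂ)
      = (u x * (w' x - w x)) * (k y x : ℂ) := fun x => by ring
  simp_rw [e]
  refine ((hd y).norm_integral_le_inv_mul (hu.mul (hw'.sub hw))).trans ?_
  rw [mul_left_comm, ← MeasureTheory.integral_const_mul a]
  refine mul_le_mul_of_nonneg_left (integral_mono ((hu.mul (hw'.sub hw)).integrable ν).norm
    (((hw'.sub hw).integrable ν).norm.const_mul _) fun x => ?_) (inv_nonneg.2 (hd y).pos.le)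
  simp only [norm_mul]
  exact mul_le_mul_of_nonneg_right (ha x) (norm_nonneg _)

end Transfer

/-! ### Contraction along sites with weights close to one -/

/-- A nowhere vanishing function with small relative oscillation. -/
def NearConst (c : ℝ) (u : E → ℂ) : Prop :=
  (∀ z, u z ≠ 0) ∧ ∀ x x' z, ‖u x - u x'‖ ≤ c / 16 * ‖u z‖

/-- Bounded weights which are close to one in `L¹`. -/
def GoodWeight (ν : Measure E) (c : ℝ) (w : E → ℂ) : Prop :=
  BddMeas w ∧ ∫ x, ‖w x - 1‖ ∂ν ≤ c ^ 3 / 128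

section Contraction

variable {ν : Measure E} [IsProbabilityMeasure ν] {k : E → E → ℝ} {c : ℝ} {u w R : E → ℂ}

lemma NearConst.norm_le (hn : NearConst c u) (x z : E) : ‖u x‖ ≤ (1 + c / 16) * ‖u z‖ := by
  have h1 := hn.2 x z z
  have h2 := norm_le_norm_add_norm_sub' (u x) (u z)
  linarith

lemma norm_integral_weight_sub_one_le (hc0 : 0 < c) (hc1 : c < 1) (hn : NearConst c u)
    (hu : BddMeas u) (hw : GoodWeight ν c w) {g : E → ℂ} (hg : BddMeas g) {A : ℝ}
    (hA : ∀ x, ‖g x‖ ≤ A) {κ : E → ℝ} (hκ : IsDens ν κ c) (z : E) :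
    ‖∫ x, g x * (u x * (w x - 1)) * (κ x : ℂ) ∂ν‖ ≤ c ^ 2 / 64 * ‖u z‖ * A := by
  have hA0 : 0 ≤ A := (norm_nonneg _).trans (hA z)
  have hw1 := hw.1.sub (BddMeas.const 1)
  refine (hκ.norm_integral_le_inv_mul (hg.mul (hu.mul hw1))).trans ?_
  have h1 : ∫ x, ‖g x * (u x * (w x - 1))‖ ∂ν
      ≤ ∫ x, (A * (2 * ‖u z‖)) * ‖w x - 1‖ ∂ν := by
    refine integral_mono ((hg.mul (hu.mul hw1)).integrable ν).norm
      ((hw1.integrable ν).norm.const_mul _) fun x => ?_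
    simp only [norm_mul, ← mul_assoc]
    refine mul_le_mul_of_nonneg_right ?_ (norm_nonneg _)
    rw [mul_assoc]
    refine mul_le_mul (hA x) ((hn.norm_le x z).trans ?_) (norm_nonneg _) hA0
    exact mul_le_mul_of_nonneg_right (by linarith) (norm_nonneg _)
  rw [MeasureTheory.integral_const_mul] at h1
  have h2 : A * (2 * ‖u z‖) * ∫ x, ‖w x - 1‖ ∂ν ≤ A * (2 * ‖u z‖) * (c ^ 3 / 128) :=
    mul_le_mul_of_nonneg_left hw.2 (by positivity)
  calc c⁻¹ * ∫ x, ‖g x * (u x * (w x - 1))‖ ∂ν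
      ≤ c⁻¹ * (A * (2 * ‖u z‖) * (c ^ 3 / 128)) :=
        mul_le_mul_of_nonneg_left (h1.trans h2) (inv_nonneg.2 hc0.le)
    _ = c ^ 2 / 64 * ‖u z‖ * A := by field_simp; ring

lemma transfer_eq_add (hd : ∀ y, IsDens ν (k y) c) (hu : BddMeas u) (hw : BddMeas w) (y : E) :
    transfer ν k w u y
      = ∫ x, u x * (k y x : ℂ) ∂ν + ∫ x, 1 * (u x * (w x - 1)) * (k y x : ℂ) ∂ν := by
  have hk := (hd y).bddMeas
  have hw1 := hw.sub (BddMeas.const 1)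
  have := integral_add (μ := ν) ((hu.mul hk).integrable ν)
    ((((BddMeas.const 1).mul (hu.mul hw1)).mul hk).integrable ν)
  rw [← this, transfer]
  congr 1; ext x; ring

lemma NearConst.norm_transfer_sub_le [Nonempty E] (hd : ∀ y, IsDens ν (k y) c)
    (hn : NearConst c u) (hu : BddMeas u) (hw : GoodWeight ν c w) (y z : E) :
    ‖transfer ν k w u y - u z‖ ≤ c / 8 * ‖u z‖ := by
  have hk := hd y
  rw [transfer_eq_add hd hu hw.1]
  have h1 := norm_integral_weight_sub_one_le hk.pos hk.lt_one hn hu hw (BddMeas.const 1)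
    (A := 1) (by simp) hk z
  have h2 : ‖∫ x, (u x - u z) * (k y x : ℂ) ∂ν‖ ≤ c / 16 * ‖u z‖ :=
    hk.norm_integral_le fun x => hn.2 x z z
  have h3 : ∫ x, (u x - u z) * (k y x : ℂ) ∂ν = ∫ x, u x * (k y x : ℂ) ∂ν - u z := by
    simp_rw [sub_mul]
    rw [integral_sub ((hu.mul hk.bddMeas).integrable ν)
      (((BddMeas.const _).mul hk.bddMeas).integrable ν), hk.integral_const_mul]
  rw [h3] at h2
  rw [add_sub_right_comm]
  refine (norm_add_le _ _).trans ?_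
  have h4 : c ^ 2 ≤ c := by nlinarith [hk.pos, hk.lt_one]
  have := mul_le_mul_of_nonneg_right h4 (norm_nonneg (u z))
  have := mul_nonneg hk.pos.le (norm_nonneg (u z))
  linarith

lemma NearConst.norm_transfer_ge [Nonempty E] (hd : ∀ y, IsDens ν (k y) c)
    (hn : NearConst c u) (hu : BddMeas u) (hw : GoodWeight ν c w) (y z : E) :
    7 / 8 * ‖u z‖ ≤ ‖transfer ν k w u y‖ := by
  have h1 := hn.norm_transfer_sub_le hd hu hw y z
  have h2 := norm_le_norm_add_norm_sub (transfer ν k w u y) (u z)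
  have := mul_le_mul_of_nonneg_right (hd y).lt_one.le (norm_nonneg (u z))
  linarith

lemma NearConst.map_transfer [Nonempty E] (hd : ∀ y, IsDens ν (k y) c) (hn : NearConst c u)
    (hu : BddMeas u) (hw : GoodWeight ν c w) : NearConst c (transfer ν k w u) := by
  obtain ⟨z⟩ := ‹Nonempty E›
  have hz := norm_pos_iff.2 (hn.1 z)
  refine ⟨fun y => ?_, fun y y' y'' => ?_⟩
  · have := hn.norm_transfer_ge hd hu hw y z
    rw [← norm_pos_iff]
    linarith
  have hk := hd y
  have hc := hk.pos
  have hc1 := hk.lt_one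
  have h4 := (hd y).norm_integral_sub_le (hd y') hu fun x x' => hn.2 x x' z
  have h1 := norm_integral_weight_sub_one_le hc hc1 hn hu hw (BddMeas.const 1)
    (A := 1) (by simp) (hd y) z
  have h1' := norm_integral_weight_sub_one_le hc hc1 hn hu hw (BddMeas.const 1)
    (A := 1) (by simp) (hd y') z
  have h5 : ‖transfer ν k w u y - transfer ν k w u y'‖
      ≤ (1 - c) * (c / 16 * ‖u z‖) + (c ^ 2 / 64 * ‖u z‖ + c ^ 2 / 64 * ‖u z‖) := by
    rw [transfer_eq_add hd hu hw.1, transfer_eq_add hd hu hw.1, add_sub_add_comm]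
    refine (norm_add_le _ _).trans (add_le_add h4 ((norm_sub_le _ _).trans (add_le_add ?_ ?_)))
    · simpa using h1
    · simpa using h1'
  have h6 := hn.norm_transfer_sub_le hd hu hw y'' z
  have h7 := norm_le_norm_add_norm_sub (transfer ν k w u y'') (u z)
  nlinarith

/-- The quotient of the images of `R u` and `u` is an average of `R`, up to a small error. -/
lemma NearConst.norm_ratio_sub_le [Nonempty E] (hd : ∀ y, IsDens ν (k y) c)
    (hn : NearConst c u) (hu : BddMeas u) (hw : GoodWeight ν c w) (hR : BddMeas R) {A : ℝ}
    (hA : ∀ x x', ‖R x - R x'‖ ≤ A) (y z : E) :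
    ‖transfer ν k w (fun x => R x * u x) y / transfer ν k w u y - R z
        - ∫ x, (R x - R z) * (k y x : ℂ) ∂ν‖ ≤ c / 4 * A := by
  have hk := hd y
  have hA0 : 0 ≤ A := (norm_nonneg _).trans (hA z z)
  have hz := norm_pos_iff.2 (hn.1 z)
  set τ := transfer ν k w u y with hτ
  have hτge := hn.norm_transfer_ge hd hu hw y z
  have hτ0 : τ ≠ 0 := by rw [← norm_pos_iff]; linarith
  have hτpos := norm_pos_iff.2 hτ0
  have hw1 := hw.1.sub (BddMeas.const 1)
  have hg := hR.sub (BddMeas.const (R z))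
  have h1 := norm_integral_weight_sub_one_le hk.pos hk.lt_one hn hu hw hg
    (fun x => hA x z) hk z
  have h2 : ‖∫ x, (R x - R z) * (u x - τ) * (k y x : ℂ) ∂ν‖ ≤ A * (c / 8 * (8 / 7 * ‖τ‖)) := by
    refine hk.norm_integral_le fun x => ?_
    rw [norm_mul]
    refine mul_le_mul (hA x z) ?_ (norm_nonneg _) hA0
    rw [norm_sub_rev]
    refine (hn.norm_transfer_sub_le hd hu hw y x).trans ?_
    have := hn.norm_transfer_ge hd hu hw y x
    exact mul_le_mul_of_nonneg_left (by rw [hτ]; linarith) (by linarith [hk.pos])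
  have e : transfer ν k w (fun x => R x * u x) y / τ - R z
        - ∫ x, (R x - R z) * (k y x : ℂ) ∂ν
      = (∫ x, (R x - R z) * (u x * (w x - 1)) * (k y x : ℂ) ∂ν
          + ∫ x, (R x - R z) * (u x - τ) * (k y x : ℂ) ∂ν) / τ := by
    rw [eq_div_iff hτ0, sub_mul, sub_mul, div_mul_cancel₀ _ hτ0]
    have hb := hk.bddMeas
    have i1 := ((hR.mul hu).mul hw.1).mul hb |>.integrable ν
    have i2 := ((BddMeas.const (R z)).mul ((hu.mul hw.1).mul hb)).integrable ν
    have i12 := ((((hR.mul hu).mul hw.1).mul hb).sub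
      ((BddMeas.const (R z)).mul ((hu.mul hw.1).mul hb))).integrable ν
    have i3 := ((hg.mul hb).mul (BddMeas.const τ)).integrable ν
    have i4 := ((hg.mul (hu.mul hw1)).mul hb).integrable ν
    have i5 := ((hg.mul (hu.sub (BddMeas.const τ))).mul hb).integrable ν
    rw [← integral_add i4 i5]
    conv_lhs => rw [hτ]; arg 1; arg 2; unfold transfer
    rw [← MeasureTheory.integral_const_mul, ← hτ, ← MeasureTheory.integral_mul_const,
      transfer, ← integral_sub i1 i2, ← integral_sub i12 i3]
    congr 1; ext x; ring
  rw [e, norm_div, div_le_iff₀ hτpos]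
  refine (norm_add_le _ _).trans ((add_le_add h1 h2).trans ?_)
  have h4 : c ^ 2 ≤ c := by nlinarith [hk.pos, hk.lt_one]
  have h5 : c ^ 2 / 64 * ‖u z‖ * A ≤ c / 64 * (8 / 7 * ‖τ‖) * A := by
    have : ‖u z‖ ≤ 8 / 7 * ‖τ‖ := by rw [hτ]; linarith
    have := hk.pos
    gcongr
  have := mul_nonneg hk.pos.le (mul_nonneg hτpos.le hA0)
  nlinarith

lemma NearConst.ratio_osc_le [Nonempty E] (hd : ∀ y, IsDens ν (k y) c)
    (hn : NearConst c u) (hu : BddMeas u) (hw : GoodWeight ν c w) (hR : BddMeas R) {A : ℝ}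
    (hA : ∀ x x', ‖R x - R x'‖ ≤ A) (y y' : E) :
    ‖transfer ν k w (fun x => R x * u x) y / transfer ν k w u y
      - transfer ν k w (fun x => R x * u x) y' / transfer ν k w u y'‖ ≤ (1 - c / 2) * A := by
  obtain ⟨z⟩ := ‹Nonempty E›
  have h1 := hn.norm_ratio_sub_le hd hu hw hR hA y z
  have h2 := hn.norm_ratio_sub_le hd hu hw hR hA y' z
  have h3 := (hd y).norm_integral_sub_le (hd y') (hR.sub (BddMeas.const (R z)))
    (a := A) fun x x' => by simpa using hA x x'
  set a := transfer ν k w (fun x => R x * u x) y / transfer ν k w u y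
  set b := transfer ν k w (fun x => R x * u x) y' / transfer ν k w u y'
  set p := ∫ x, (R x - R z) * (k y x : ℂ) ∂ν
  set q := ∫ x, (R x - R z) * (k y' x : ℂ) ∂ν
  have e : a - b = (a - R z - p) - (b - R z - q) + (p - q) := by ring
  rw [e]
  refine (norm_add_le _ _).trans ((add_le_add (norm_sub_le _ _) le_rfl).trans ?_)
  linarith

lemma NearConst.norm_ratio_sub_le_two_mul [Nonempty E] (hd : ∀ y, IsDens ν (k y) c)
    (hn : NearConst c u) (hu : BddMeas u) (hw : GoodWeight ν c w) (hR : BddMeas R) {A : ℝ}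
    (hA : ∀ x x', ‖R x - R x'‖ ≤ A) (y z : E) :
    ‖transfer ν k w (fun x => R x * u x) y / transfer ν k w u y - R z‖ ≤ 2 * A := by
  have h1 := hn.norm_ratio_sub_le hd hu hw hR hA y z
  have h2 := (hd y).norm_integral_le fun x => hA x z
  have hA0 : 0 ≤ A := (norm_nonneg _).trans (hA z z)
  have h3 := norm_le_norm_add_norm_sub'
    (transfer ν k w (fun x => R x * u x) y / transfer ν k w u y - R z)
    (∫ x, (R x - R z) * (k y x : ℂ) ∂ν)
  have := mul_le_mul_of_nonneg_right (hd y).lt_one.le hA0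
  linarith

end Contraction

/-! ### Iterated averaging operators -/

section Iterates

variable {ν : ℕ → Measure E} {k : ℕ → E → E → ℝ} {c : ℝ} {w w' wh : ℕ → E → ℂ}

lemma IsBackwardKernel.nonempty (hB : IsBackwardKernel ν k c) : Nonempty E :=
  have := hB.prob 0
  (ν 0).nonempty_of_neZero

lemma IsBackwardKernel.pos (hB : IsBackwardKernel ν k c) : 0 < c := by
  obtain ⟨y⟩ := hB.nonempty
  exact (hB.dens 0 y).pos

lemma IsBackwardKernel.lt_one (hB : IsBackwardKernel ν k c) : c < 1 := by
  obtain ⟨y⟩ := hB.nonempty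
  exact (hB.dens 0 y).lt_one

lemma bwd_bddMeas (hB : IsBackwardKernel ν k c) (hw : ∀ n, BddMeas (w n)) (n : ℕ) :
    BddMeas (bwd ν k w n) := by
  induction n with
  | zero => exact BddMeas.const 1
  | succ n ih =>
    have := hB.prob n
    exact transfer_bddMeas (hB.meas n) (hB.dens n) (hw n) ih

lemma bwd_congr {n : ℕ} (h : ∀ i < n, w i = w' i) : bwd ν k w n = bwd ν k w' n := by
  induction n with
  | zero => rfl
  | succ n ih =>
    simp only [bwd]
    rw [ih fun i hi => h i (by omega), h n (by omega)]

lemma bwd_nearConst (hB : IsBackwardKernel ν k c) {n : ℕ} (hw : ∀ n, BddMeas (w n))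
    (hg : ∀ i < n, GoodWeight (ν i) c (w i)) : NearConst c (bwd ν k w n) := by
  have := hB.nonempty
  induction n with
  | zero =>
    refine ⟨fun _ => one_ne_zero, fun _ _ _ => ?_⟩
    simp only [bwd, sub_self, norm_zero, norm_one]
    linarith [hB.pos]
  | succ n ih =>
    have := hB.prob n
    exact (ih fun i hi => hg i (by omega)).map_transfer (hB.dens n) (bwd_bddMeas hB hw n)
      (hg n (by omega))

lemma norm_bwd_le_of_le (hB : IsBackwardKernel ν k c) (hw : ∀ n x, ‖w n x‖ ≤ 1) {a : ℝ}
    {j n : ℕ} (hj : ∀ x, ‖bwd ν k w j x‖ ≤ a) (hn : j ≤ n) (x : E) :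
    ‖bwd ν k w n x‖ ≤ a := by
  induction n, hn using Nat.le_induction generalizing x with
  | base => exact hj x
  | succ n hn ih =>
    have := hB.prob n
    exact norm_transfer_le (hB.dens n) (hw n) ih x

lemma norm_bwd_le_one (hB : IsBackwardKernel ν k c) (hw : ∀ n x, ‖w n x‖ ≤ 1) (n : ℕ) (x : E) :
    ‖bwd ν k w n x‖ ≤ 1 :=
  norm_bwd_le_of_le hB hw (j := 0) (by simp [bwd]) (Nat.zero_le n) x

/-- Two steps of averaging gain from a weight with small mean. -/
lemma norm_bwd_add_two_le (hB : IsBackwardKernel ν k c) (hm : ∀ n, Measurable (w n))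
    (hw : ∀ n x, ‖w n x‖ ≤ 1) {a : ℝ} {n : ℕ} (ha : ∀ x, ‖bwd ν k w n x‖ ≤ a) (y : E) :
    ‖bwd ν k w (n + 2) y‖ ≤ (1 - c ^ 2 * (1 - ‖∫ x, w (n + 1) x ∂ν (n + 1)‖)) * a := by
  have := hB.prob n
  have := hB.prob (n + 1)
  have hb : ∀ n, BddMeas (w n) := fun n => .of_norm_le (hm n) (hw n)
  have hu := bwd_bddMeas hB hb n
  have hk := hB.dens (n + 1) y
  have hc := hB.pos
  have ha0 : 0 ≤ a := (norm_nonneg _).trans (ha y)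
  have hv : ∀ x, ‖bwd ν k w n x * w n x‖ ≤ a := fun x => by
    rw [norm_mul]
    exact (mul_le_of_le_one_right (norm_nonneg _) (hw n x)).trans (ha x)
  set U : ℂ := c * ∫ x, bwd ν k w n x * w n x ∂ν n with hU
  have hUn : ‖U‖ ≤ c * a := by
    rw [hU, norm_mul, Complex.norm_real, Real.norm_of_nonneg hc.le]
    refine mul_le_mul_of_nonneg_left ?_ hc.le
    simpa using norm_integral_le_of_norm_le_const (ae_of_all _ hv) (μ := ν n)
  have hrest : ∀ x, ‖bwd ν k w (n + 1) x - U‖ ≤ (1 - c) * a := fun x => by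
    have h1 := (hB.dens n x).integral_eq_excess_add (hu.mul (hb n))
    have h2 := (hB.dens n x).norm_integral_excess_le hv
    have h3 : bwd ν k w (n + 1) x = ∫ z, bwd ν k w n z * w n z * (k n x z : ℂ) ∂ν n := rfl
    rw [h3, h1, add_sub_cancel_right]
    exact h2
  have hu1 := bwd_bddMeas hB hb (n + 1)
  have e : bwd ν k w (n + 2) y
      = U * ∫ x, w (n + 1) x * (k (n + 1) y x : ℂ) ∂ν (n + 1)
        + ∫ x, (bwd ν k w (n + 1) x - U) * w (n + 1) x * (k (n + 1) y x : ℂ) ∂ν (n + 1) := by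
    have h3 : bwd ν k w (n + 2) y
      = ∫ z, bwd ν k w (n + 1) z * w (n + 1) z * (k (n + 1) y z : ℂ) ∂ν (n + 1) := rfl
    rw [h3, ← MeasureTheory.integral_const_mul, ← integral_add]
    · congr 1; ext x; ring
    · exact ((BddMeas.const U).mul ((hb (n + 1)).mul hk.bddMeas)).integrable _
    · exact (((hu1.sub (BddMeas.const U)).mul (hb (n + 1))).mul hk.bddMeas).integrable _
  have h1 := hk.norm_integral_le_of_mean (hb (n + 1)) (hw (n + 1))
  have h2 : ‖∫ x, (bwd ν k w (n + 1) x - U) * w (n + 1) x * (k (n + 1) y x : ℂ) ∂ν (n + 1)‖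
      ≤ (1 - c) * a :=
    hk.norm_integral_le (g := fun x => (bwd ν k w (n + 1) x - U) * w (n + 1) x) fun x => by
      rw [norm_mul]
      exact (mul_le_of_le_one_right (norm_nonneg _) (hw (n + 1) x)).trans (hrest x)
  rw [e]
  refine (norm_add_le _ _).trans ?_
  rw [norm_mul]
  have h3 := mul_le_mul hUn h1 (norm_nonneg _) (by positivity)
  nlinarith

/-- Exponential decay from the defects `1 - |∫ w_i|`. -/
lemma sq_norm_bwd_le (hB : IsBackwardKernel ν k c) (hm : ∀ n, Measurable (w n))
    (hw : ∀ n x, ‖w n x‖ ≤ 1) (n : ℕ) (y : E) :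
    ‖bwd ν k w (n + 1) y‖ ^ 2
      ≤ ∏ i ∈ Finset.range n, (1 - c ^ 2 * (1 - ‖∫ x, w (i + 1) x ∂ν (i + 1)‖)) := by
  set D : ℕ → ℝ := fun i => 1 - c ^ 2 * (1 - ‖∫ x, w (i + 1) x ∂ν (i + 1)‖) with hD
  suffices h : ∃ a b : ℝ, a * b = ∏ i ∈ Finset.range n, D i ∧
      (∀ x, ‖bwd ν k w n x‖ ≤ a) ∧ ∀ x, ‖bwd ν k w (n + 1) x‖ ≤ b by
    obtain ⟨a, b, hab, ha, hb⟩ := h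
    rw [← hab, sq]
    refine mul_le_mul ?_ (hb y) (norm_nonneg _) ((norm_nonneg _).trans (ha y))
    exact norm_bwd_le_of_le hB hw ha (Nat.le_succ n) y
  induction n with
  | zero =>
    exact ⟨1, 1, by simp, fun x => norm_bwd_le_one hB hw _ x, fun x => norm_bwd_le_one hB hw _ x⟩
  | succ n ih =>
    obtain ⟨a, b, hab, ha, hb⟩ := ih
    refine ⟨b, D n * a, ?_, hb, fun x => norm_bwd_add_two_le hB hm hw ha x⟩
    rw [Finset.prod_range_succ, ← hab]; ring

end Iterates

/-! ### Quotients of iterates -/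

section Quotients

variable {ν : ℕ → Measure E} {k : ℕ → E → E → ℝ} {c : ℝ} {w w' wh wh' : ℕ → E → ℂ}

lemma NearConst.bddMeas_div [Nonempty E] {u v : E → ℂ} (hc : 0 < c) (hn : NearConst c u)
    (hu : BddMeas u) (hv : BddMeas v) : BddMeas (fun x => v x / u x) := by
  obtain ⟨z⟩ := ‹Nonempty E›
  obtain ⟨hvm, b, hb⟩ := hv
  have hz := norm_pos_iff.2 (hn.1 z)
  refine ⟨hvm.div hu.1, b / (‖u z‖ / (1 + c / 16)), fun x => ?_⟩
  rw [norm_div]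
  have h1 := hn.norm_le z x
  refine div_le_div₀ ((norm_nonneg _).trans (hb x)) (hb x) (by positivity) ?_
  rw [div_le_iff₀ (by positivity)]
  linarith

/-- One step for the quotient `v / u` under a weight close to one. -/
lemma NearConst.div_transfer {ν : Measure E} [IsProbabilityMeasure ν] {k : E → E → ℝ}
    {u v w : E → ℂ} (hd : ∀ y, IsDens ν (k y) c) (hn : NearConst c u) (hu : BddMeas u)
    (hv : BddMeas v) (hw : GoodWeight ν c w) {A : ℝ}
    (hA : ∀ x x', ‖v x / u x - v x' / u x'‖ ≤ A) :
    (∀ y y', ‖transfer ν k w v y / transfer ν k w u y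
        - transfer ν k w v y' / transfer ν k w u y'‖ ≤ (1 - c / 2) * A) ∧
    ∀ y z, ‖transfer ν k w v y / transfer ν k w u y - v z / u z‖ ≤ 2 * A := by
  have : Nonempty E := ν.nonempty_of_neZero
  obtain ⟨z⟩ := this
  have : Nonempty E := ⟨z⟩
  have hR := hn.bddMeas_div (hd z).pos hu hv
  have e : (fun x => v x / u x * u x) = v := by
    ext x; exact div_mul_cancel₀ _ (hn.1 x)
  refine ⟨fun y y' => ?_, fun y z => ?_⟩
  · have := hn.ratio_osc_le hd hu hw hR hA y y'
    rwa [e] at this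
  · have := hn.norm_ratio_sub_le_two_mul hd hu hw hR hA y z
    rwa [e] at this

lemma norm_bwd_div_sub_one_le_of_update (hB : IsBackwardKernel ν k c)
    (hw : ∀ i, BddMeas (w i)) (hw' : ∀ i, BddMeas (w' i)) {n : ℕ}
    (hg : ∀ i ≤ n, GoodWeight (ν i) c (w i)) (he : ∀ i < n, w' i = w i) (y : E) :
    ‖bwd ν k w' (n + 1) y / bwd ν k w (n + 1) y - 1‖
      ≤ 2 * c⁻¹ * ∫ x, ‖w' n x - w n x‖ ∂ν n := by
  have := hB.prob n
  have := hB.nonempty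
  have hc := hB.pos
  have hc1 := hB.lt_one
  have hn : NearConst c (bwd ν k w n) := bwd_nearConst hB hw fun i hi => hg i (by omega)
  have hu := bwd_bddMeas hB hw n
  have hge := hn.norm_transfer_ge (hB.dens n) hu (hg n le_rfl) y y
  have hy := norm_pos_iff.2 (hn.1 y)
  have h1 := norm_transfer_sub_weight_le (hB.dens n) (hw n) (hw' n) hu
    (fun x => hn.norm_le x y) y
  have hpos : 0 < ‖bwd ν k w (n + 1) y‖ := lt_of_lt_of_le (by positivity) hge
  rw [div_sub_one (norm_pos_iff.1 hpos), norm_div, div_le_iff₀ hpos]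
  have e1 : bwd ν k w' (n + 1) y = transfer (ν n) (k n) (w' n) (bwd ν k w n) y := by
    simp only [bwd]; rw [bwd_congr he]
  rw [e1]
  refine h1.trans ?_
  have h2 : (1 + c / 16) * ‖bwd ν k w n y‖ ≤ 2 * ‖bwd ν k w (n + 1) y‖ := by
    have : (1 + c / 16) * ‖bwd ν k w n y‖ ≤ 17 / 16 * ‖bwd ν k w n y‖ := by gcongr; linarith
    refine this.trans ?_
    refine le_trans ?_ (mul_le_mul_of_nonneg_left hge zero_le_two)
    linarith
  have h3 : 0 ≤ c⁻¹ * ∫ x, ‖w' n x - w n x‖ ∂ν n :=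
    mul_nonneg (inv_nonneg.2 hc.le) (integral_nonneg fun _ => norm_nonneg _)
  have := mul_le_mul_of_nonneg_right h2 h3
  linarith

/-- Effect of changing a single weight. -/
lemma norm_bwd_div_sub_one_le (hB : IsBackwardKernel ν k c)
    (hw : ∀ i, BddMeas (w i)) (hw' : ∀ i, BddMeas (w' i)) {n N : ℕ} (hnN : n < N)
    (hg : ∀ i < N, GoodWeight (ν i) c (w i)) (he : ∀ i, i ≠ n → w' i = w i) (y : E) :
    ‖bwd ν k w' N y / bwd ν k w N y - 1‖
      ≤ 18 / c ^ 2 * ∫ x, ‖w' n x - w n x‖ ∂ν n := by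
  have hc := hB.pos
  have hc1 := hB.lt_one
  set β := 2 * c⁻¹ * ∫ x, ‖w' n x - w n x‖ ∂ν n with hβ
  have hβ0 : 0 ≤ β := mul_nonneg (by positivity) (integral_nonneg fun _ => norm_nonneg _)
  suffices h : ∃ A b : ℝ, b + 4 / c * A ≤ β + 4 / c * (2 * β) ∧
      (∀ x x', ‖bwd ν k w' N x / bwd ν k w N x - bwd ν k w' N x' / bwd ν k w N x'‖ ≤ A) ∧
      ∀ x, ‖bwd ν k w' N x / bwd ν k w N x - 1‖ ≤ b by
    obtain ⟨A, b, hAb, hA, hb⟩ := h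
    have hA0 : 0 ≤ A := (norm_nonneg _).trans (hA y y)
    refine (hb y).trans ?_
    have h1 : 0 ≤ 4 / c * A := by positivity
    have h2 : b ≤ β * (1 + 8 / c) := by
      have : β * (1 + 8 / c) = β + 4 / c * (2 * β) := by ring
      linarith
    refine h2.trans ?_
    have h3 : 1 + 8 / c ≤ 9 / c := by
      have : 1 ≤ 1 / c := by rw [le_div_iff₀ hc]; linarith
      have e : 9 / c = 1 / c + 8 / c := by ring
      linarith
    refine (mul_le_mul_of_nonneg_left h3 hβ0).trans (le_of_eq ?_)
    rw [hβ]; field_simp; ring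
  induction N, hnN using Nat.le_induction with
  | base =>
    have h1 := norm_bwd_div_sub_one_le_of_update hB hw hw' (n := n)
      (fun i hi => hg i (by omega)) (fun i hi => he i (by omega))
    refine ⟨2 * β, β, le_rfl, fun x x' => ?_, h1⟩
    rw [← sub_sub_sub_cancel_right _ _ 1]
    refine (norm_sub_le _ _).trans ?_
    linarith [h1 x, h1 x']
  | succ N hN ih =>
    obtain ⟨A, b, hAb, hA, hb⟩ := ih fun i hi => hg i (by omega)
    have := hB.prob N
    obtain ⟨h1, h2⟩ := (bwd_nearConst hB hw fun i hi => hg i (by omega)).div_transfer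
      (hB.dens N) (bwd_bddMeas hB hw N) (bwd_bddMeas hB hw' N) (hg N (by omega)) hA
    have e1 : bwd ν k w' (N + 1) = transfer (ν N) (k N) (w N) (bwd ν k w' N) := by
      simp only [bwd]; rw [he N (by omega)]
    rw [e1]
    refine ⟨(1 - c / 2) * A, b + 2 * A, ?_, h1, fun x => ?_⟩
    · have : 4 / c * ((1 - c / 2) * A) = 4 / c * A - 2 * A := by field_simp; ring
      linarith
    · have := norm_le_norm_add_norm_sub'
        (transfer (ν N) (k N) (w N) (bwd ν k w' N) x / bwd ν k w (N + 1) x - 1)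
        (bwd ν k w' N x / bwd ν k w N x - 1)
      rw [sub_sub_sub_cancel_right] at this
      have := h2 x x
      simp only [bwd] at *
      linarith [hb x]

/-- Loss of memory: after `L` steps with common weights close to one, the two iterates are
almost proportional. -/
lemma exists_osc_div_le (hB : IsBackwardKernel ν k c)
    (hw : ∀ i, Measurable (w i)) (hwh : ∀ i, Measurable (wh i))
    (hw1 : ∀ i x, ‖w i x‖ ≤ 1) (hwh1 : ∀ i x, ‖wh i x‖ ≤ 1) {n L : ℕ}
    (hg : ∀ i < n, GoodWeight (ν i) c (wh i)) (he : ∀ i < n, n ≤ i + L → w i = wh i) :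
    ∃ A : ℝ, (∀ x x', ‖bwd ν k w n x / bwd ν k wh n x - bwd ν k w n x' / bwd ν k wh n x'‖ ≤ A) ∧
      ∀ x, A * ‖bwd ν k wh n x‖ ≤ 4 * (1 - c / 2) ^ L := by
  have hc := hB.pos
  have hc1 := hB.lt_one
  have hb : ∀ i, BddMeas (w i) := fun i => .of_norm_le (hw i) (hw1 i)
  have hbh : ∀ i, BddMeas (wh i) := fun i => .of_norm_le (hwh i) (hwh1 i)
  have hρ : 0 ≤ (1 - c / 2) ^ L := pow_nonneg (by linarith) _
  rcases le_or_gt n L with hL | hL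
  · have e : bwd ν k w n = bwd ν k wh n := bwd_congr fun i hi => he i hi (by omega)
    have hn := bwd_nearConst hB hbh hg
    refine ⟨0, fun x x' => ?_, fun x => by simpa using hρ⟩
    rw [e, div_self (hn.1 x), div_self (hn.1 x')]; simp
  obtain ⟨a, rfl⟩ : ∃ a, n = a + L := ⟨n - L, by omega⟩
  obtain ⟨z⟩ := hB.nonempty
  have hna : NearConst c (bwd ν k wh a) := bwd_nearConst hB hbh fun i hi => hg i (by omega)
  have hz := norm_pos_iff.2 (hna.1 z)
  set A := 2 * ((1 + c / 16) / ‖bwd ν k wh a z‖) with hA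
  have hA0 : 0 ≤ A := by positivity
  have key : ∀ j ≤ L, ∀ x x', ‖bwd ν k w (a + j) x / bwd ν k wh (a + j) x
      - bwd ν k w (a + j) x' / bwd ν k wh (a + j) x'‖ ≤ (1 - c / 2) ^ j * A := by
    intro j hj
    induction j with
    | zero =>
      have h1 : ∀ x, ‖bwd ν k w a x / bwd ν k wh a x‖ ≤ (1 + c / 16) / ‖bwd ν k wh a z‖ := by
        intro x
        have hx := norm_pos_iff.2 (hna.1 x)
        rw [norm_div, div_le_div_iff₀ hx hz]
        have h2 := hna.norm_le z x
        have h3 := mul_le_mul_of_nonneg_right (norm_bwd_le_one hB hw1 a x) hz.le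
        linarith
      intro x x'
      rw [add_zero, pow_zero, one_mul, hA]
      refine (norm_sub_le _ _).trans ?_
      linarith [h1 x, h1 x']
    | succ j ih =>
      have := hB.prob (a + j)
      obtain ⟨h1, -⟩ := (bwd_nearConst hB hbh fun i hi => hg i (by omega)).div_transfer
        (hB.dens (a + j)) (bwd_bddMeas hB hbh (a + j)) (bwd_bddMeas hB hb (a + j))
        (hg (a + j) (by omega)) (ih (by omega))
      have e1 : bwd ν k w (a + (j + 1))
          = transfer (ν (a + j)) (k (a + j)) (wh (a + j)) (bwd ν k w (a + j)) := by
        rw [← add_assoc]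
        simp only [bwd]; rw [he (a + j) (by omega) (by omega)]
      intro x x'
      rw [e1, pow_succ', mul_assoc]
      exact h1 x x'
  refine ⟨_, key L le_rfl, fun x => ?_⟩
  have h1 := norm_bwd_le_of_le hB hwh1 (fun x => hna.norm_le x z) (Nat.le_add_right a L) x
  have h2 : A * ‖bwd ν k wh (a + L) x‖ ≤ 4 := by
    refine (mul_le_mul_of_nonneg_left h1 hA0).trans ?_
    have : A * ((1 + c / 16) * ‖bwd ν k wh a z‖) = 2 * (1 + c / 16) ^ 2 := by
      rw [hA]; field_simp
    rw [this]
    nlinarith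
  calc (1 - c / 2) ^ L * A * ‖bwd ν k wh (a + L) x‖
      = (1 - c / 2) ^ L * (A * ‖bwd ν k wh (a + L) x‖) := by ring
    _ ≤ (1 - c / 2) ^ L * 4 := mul_le_mul_of_nonneg_left h2 hρ
    _ = _ := by ring

/-- Sup-norm contraction for differences of two rank one functions of two variables. -/
lemma norm_transfer_mul_sub_le {ν : Measure E} [IsProbabilityMeasure ν] {k : E → E → ℝ}
    {u v p q w wh : E → ℂ} (hd : ∀ y, IsDens ν (k y) c) (hw : Measurable w)
    (hwh : Measurable wh) (hw1 : ∀ x, ‖w x‖ ≤ 1) (hwh1 : ∀ x, ‖wh x‖ ≤ 1) (hu : BddMeas u)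
    (hv : BddMeas v) (hp : BddMeas p) (hq : BddMeas q) {A : ℝ}
    (h : ∀ x y, ‖u x * p y - v x * q y‖ ≤ A) (x y : E) :
    ‖transfer ν k w u x * transfer ν k wh p y
      - transfer ν k w v x * transfer ν k wh q y‖ ≤ A := by
  have hbw : BddMeas w := .of_norm_le hw hw1
  have hbwh : BddMeas wh := .of_norm_le hwh hwh1
  have h1 : ∀ x, ‖u x * transfer ν k wh p y - v x * transfer ν k wh q y‖ ≤ A := by
    intro x
    have := norm_transfer_le hd hwh1 (h x) y
    rwa [transfer_sub hd hbwh ((BddMeas.const _).mul hp) ((BddMeas.const _).mul hq),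
      transfer_const_mul, transfer_const_mul] at this
  have := norm_transfer_le hd hw1 (u := fun x => transfer ν k wh p y * u x
    - transfer ν k wh q y * v x) (a := A) (fun x => by
      simpa only [mul_comm] using h1 x) x
  rwa [transfer_sub hd hbw ((BddMeas.const _).mul hu) ((BddMeas.const _).mul hv),
      transfer_const_mul, transfer_const_mul, mul_comm, mul_comm (transfer ν k wh q y)] at this

/-- Changing a common weight at a site `n` far from all the sites where `w` and `wh` differ
multiplies both iterates by almost the same factor. -/
lemma norm_bwd_cross_le (hB : IsBackwardKernel ν k c)
    (hw : ∀ i, Measurable (w i)) (hwh : ∀ i, Measurable (wh i))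
    (hw' : ∀ i, Measurable (w' i)) (hwh' : ∀ i, Measurable (wh' i))
    (hw1 : ∀ i x, ‖w i x‖ ≤ 1) (hwh1 : ∀ i x, ‖wh i x‖ ≤ 1)
    (hw1' : ∀ i x, ‖w' i x‖ ≤ 1) (hwh1' : ∀ i x, ‖wh' i x‖ ≤ 1) {n N L : ℕ} (hnN : n < N)
    (hg : ∀ i < N, GoodWeight (ν i) c (wh i))
    (he : ∀ i < N, n ≤ i + L → i ≤ n + L → w i = wh i)
    (hn : w' n = wh' n) (hne : ∀ i, i ≠ n → w' i = w i) (hneh : ∀ i, i ≠ n → wh' i = wh i)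
    (y : E) :
    ‖bwd ν k w' N y * bwd ν k wh N y - bwd ν k w N y * bwd ν k wh' N y‖
      ≤ 16 * c⁻¹ * (1 - c / 2) ^ L * ∫ x, ‖wh' n x - wh n x‖ ∂ν n := by
  have hc := hB.pos
  have hc1 := hB.lt_one
  have hb : ∀ i, BddMeas (w i) := fun i => .of_norm_le (hw i) (hw1 i)
  have hbh : ∀ i, BddMeas (wh i) := fun i => .of_norm_le (hwh i) (hwh1 i)
  have hb' : ∀ i, BddMeas (w' i) := fun i => .of_norm_le (hw' i) (hw1' i)
  have hbh' : ∀ i, BddMeas (wh' i) := fun i => .of_norm_le (hwh' i) (hwh1' i)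
  have hρ : 0 ≤ (1 - c / 2) ^ L := pow_nonneg (by linarith) _
  set u := bwd ν k w with hu
  set v := bwd ν k wh with hv
  set u' := bwd ν k w' with hu'
  set v' := bwd ν k wh' with hv'
  have bu : ∀ j, BddMeas (u j) := bwd_bddMeas hB hb
  have bv : ∀ j, BddMeas (v j) := bwd_bddMeas hB hbh
  have bu' : ∀ j, BddMeas (u' j) := bwd_bddMeas hB hb'
  have bv' : ∀ j, BddMeas (v' j) := bwd_bddMeas hB hbh'
  have eun : u' n = u n := bwd_congr fun i hi => hne i (by omega)
  have evn : v' n = v n := bwd_congr fun i hi => hneh i (by omega)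
  have ewn : w n = wh n := he n hnN (by omega) (by omega)
  have su : ∀ j, u (j + 1) = transfer (ν j) (k j) (w j) (u j) := fun j => rfl
  have sv : ∀ j, v (j + 1) = transfer (ν j) (k j) (wh j) (v j) := fun j => rfl
  have su' : ∀ j, n < j → u' (j + 1) = transfer (ν j) (k j) (w j) (u' j) := fun j hj => by
    rw [← hne j (by omega)]; rfl
  have sv' : ∀ j, n < j → v' (j + 1) = transfer (ν j) (k j) (wh j) (v' j) := fun j hj => by
    rw [← hneh j (by omega)]; rfl
  set ε := ∫ x, ‖wh' n x - wh n x‖ ∂ν n with hε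
  have hε0 : 0 ≤ ε := integral_nonneg fun _ => norm_nonneg _
  obtain ⟨z⟩ := hB.nonempty
  have nv : ∀ j ≤ N, NearConst c (v j) := fun j hj =>
    bwd_nearConst hB hbh fun i hi => hg i (by omega)
  have hvn := nv n hnN.le
  obtain ⟨A, hA, hA'⟩ := exists_osc_div_le hB hw hwh hw1 hwh1 (n := n) (L := L)
    (fun i hi => hg i (by omega)) (fun i hi h => he i (by omega) (by omega) (by omega))
  set d := u n z / v n z with hd
  have hX : ∀ x, ‖u n x - d * v n x‖ ≤ 4 * (1 - c / 2) ^ L := fun x => by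
    refine le_trans (le_of_eq ?_)
      ((mul_le_mul_of_nonneg_right (hA x z) (norm_nonneg (v n x))).trans (hA' x))
    rw [← norm_mul, sub_mul, div_mul_cancel₀ _ (hvn.1 x)]
  have hdv : ∀ j, n ≤ j → ∀ x, ‖d‖ * ‖v j x‖ ≤ 2 := fun j hj x => by
    have h1 := norm_bwd_le_of_le hB hwh1 (fun x => hvn.norm_le x z) hj x
    have hz := norm_pos_iff.2 (hvn.1 z)
    refine (mul_le_mul_of_nonneg_left h1 (norm_nonneg d)).trans ?_
    rw [hd, norm_div, mul_left_comm, div_mul_cancel₀ _ hz.ne']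
    have := norm_bwd_le_one hB hw1 n z
    have h0 : 0 ≤ ‖u n z‖ := norm_nonneg _
    nlinarith
  -- the part of the difference which does not see `d`
  have rest : ∀ j, n < j → j ≤ N → j ≤ n + 1 + L → ∀ x y,
      ‖(u' j x - d * v' j x) * v j y - (u j x - d * v j x) * v' j y‖
        ≤ 8 * c⁻¹ * (1 - c / 2) ^ L * ε := by
    intro j hj
    induction j, hj using Nat.le_induction with
    | base =>
      intro _ _ x y
      have := hB.prob n
      have e1 : u' (n + 1) x - d * v' (n + 1) x
          = transfer (ν n) (k n) (wh' n) (fun x => u n x - d * v n x) x := by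
        rw [transfer_sub (hB.dens n) (hbh' n) (bu n) ((BddMeas.const d).mul (bv n)),
          transfer_const_mul, ← evn, ← eun, ← hn]
        simp only [hu', hv', bwd, hn]
      have e2 : u (n + 1) x - d * v (n + 1) x
          = transfer (ν n) (k n) (wh n) (fun x => u n x - d * v n x) x := by
        rw [transfer_sub (hB.dens n) (hbh n) (bu n) ((BddMeas.const d).mul (bv n)),
          transfer_const_mul, su, sv, ewn]
      have bX := (bu n).sub ((BddMeas.const d).mul (bv n))
      have h1 := norm_transfer_sub_weight_le (hB.dens n) (hbh n) (hbh' n) bX hX x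
      rw [← e1, ← e2] at h1
      have h2 := norm_transfer_sub_weight_le (hB.dens n) (hbh n) (hbh' n) (bv n)
        (norm_bwd_le_one hB hwh1 n) y
      have e3 : transfer (ν n) (k n) (wh' n) (v n) y = v' (n + 1) y := by
        rw [← evn]; rfl
      rw [e3, ← sv] at h2
      have h3 : ‖u (n + 1) x - d * v (n + 1) x‖ ≤ 4 * (1 - c / 2) ^ L := by
        rw [e2]; exact norm_transfer_le (hB.dens n) (hwh1 n) hX x
      have h4 : ‖v (n + 1) y‖ ≤ 1 := norm_bwd_le_one hB hwh1 _ y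
      set a := u' (n + 1) x - d * v' (n + 1) x
      set b := u (n + 1) x - d * v (n + 1) x
      have e : a * v (n + 1) y - b * v' (n + 1) y
          = (a - b) * v (n + 1) y - b * (v' (n + 1) y - v (n + 1) y) := by ring
      rw [e]
      refine (norm_sub_le _ _).trans ?_
      rw [norm_mul, norm_mul]
      have h5 := mul_le_mul h1 h4 (norm_nonneg _) (by positivity)
      have h6 := mul_le_mul h3 h2 (norm_nonneg _) (by positivity)
      rw [← hε] at h5 h6
      calc _ ≤ _ := add_le_add h5 h6
        _ = _ := by ring
    | succ j hj ih =>
      intro h1 h2 x y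
      have := hB.prob j
      have ih := ih (by omega) (by omega)
      have ew : w j = wh j := he j (by omega) (by omega) (by omega)
      have := norm_transfer_mul_sub_le (hB.dens j) (hwh j) (hwh j) (hwh1 j) (hwh1 j)
        ((bu' j).sub ((BddMeas.const d).mul (bv' j))) ((bu j).sub ((BddMeas.const d).mul (bv j)))
        (bv j) (bv' j) ih x y
      rwa [transfer_sub (hB.dens j) (hbh j) (bu' j) ((BddMeas.const d).mul (bv' j)),
        transfer_sub (hB.dens j) (hbh j) (bu j) ((BddMeas.const d).mul (bv j)),
        transfer_const_mul, transfer_const_mul, ← sv, ← sv' j (by omega), ← ew, ← su,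
        ← su' j (by omega)] at this
  have cross : ∀ j x y, u' j x * v j y - u j x * v' j y
      = ((u' j x - d * v' j x) * v j y - (u j x - d * v j x) * v' j y)
        + d * (v' j x * v j y - v j x * v' j y) := fun j x y => by ring
  rcases le_or_gt N (n + 1 + L) with hN | hN
  · rw [cross, mul_comm (v' N y), sub_self, mul_zero, add_zero]
    refine (rest N hnN le_rfl hN y y).trans ?_
    have : 0 ≤ c⁻¹ * (1 - c / 2) ^ L * ε := by positivity
    nlinarith
  have osc : ∀ j ≤ L, ∀ x y, ‖v' (n + 1 + j) x / v (n + 1 + j) x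
      - v' (n + 1 + j) y / v (n + 1 + j) y‖ ≤ (1 - c / 2) ^ j * (4 * c⁻¹ * ε) := by
    intro j hj
    induction j with
    | zero =>
      intro x y
      have h1 := norm_bwd_div_sub_one_le_of_update hB hbh hbh' (n := n)
        (fun i hi => hg i (by omega)) (fun i hi => hneh i (by omega))
      rw [pow_zero, one_mul, ← sub_sub_sub_cancel_right _ _ 1]
      refine (norm_sub_le _ _).trans ((add_le_add (h1 x) (h1 y)).trans (le_of_eq ?_))
      rw [hε]; ring
    | succ j ih =>
      have := hB.prob (n + 1 + j)
      obtain ⟨h1, -⟩ := (nv (n + 1 + j) (by omega)).div_transfer (hB.dens (n + 1 + j))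
        (bv _) (bv' _) (hg (n + 1 + j) (by omega)) (ih (by omega))
      intro x y
      rw [← add_assoc, sv, sv' _ (by omega), pow_succ', mul_assoc]
      exact h1 x y
  have start : ∀ x y, ‖u' (n + 1 + L) x * v (n + 1 + L) y - u (n + 1 + L) x * v' (n + 1 + L) y‖
      ≤ 16 * c⁻¹ * (1 - c / 2) ^ L * ε := by
    intro x y
    rw [cross]
    refine (norm_add_le _ _).trans ?_
    have h1 := rest (n + 1 + L) (by omega) hN.le le_rfl x y
    have h2 : ‖d * (v' (n + 1 + L) x * v (n + 1 + L) y - v (n + 1 + L) x * v' (n + 1 + L) y)‖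
        ≤ 2 * (1 * ((1 - c / 2) ^ L * (4 * c⁻¹ * ε))) := by
      have hx := (nv (n + 1 + L) hN.le).1 x
      have hy := (nv (n + 1 + L) hN.le).1 y
      have e : d * (v' (n + 1 + L) x * v (n + 1 + L) y - v (n + 1 + L) x * v' (n + 1 + L) y)
          = d * v (n + 1 + L) x * (v (n + 1 + L) y * (v' (n + 1 + L) x / v (n + 1 + L) x
            - v' (n + 1 + L) y / v (n + 1 + L) y)) := by field_simp
      rw [e, norm_mul, norm_mul d, norm_mul (v (n + 1 + L) y)]
      have h3 := hdv (n + 1 + L) (by omega) x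
      have h4 : ‖v (n + 1 + L) y‖ ≤ 1 := norm_bwd_le_one hB hwh1 _ y
      exact mul_le_mul h3 (mul_le_mul h4 (osc L le_rfl x y) (norm_nonneg _) zero_le_one)
        (by positivity) zero_le_two
    calc _ ≤ _ := add_le_add h1 h2
      _ = _ := by ring
  have fin : ∀ j, n + 1 + L ≤ j → ∀ x y, ‖u' j x * v j y - u j x * v' j y‖
      ≤ 16 * c⁻¹ * (1 - c / 2) ^ L * ε := by
    intro j hj
    induction j, hj using Nat.le_induction with
    | base => exact start
    | succ j hj ih =>
      have := hB.prob j
      intro x y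
      rw [su, sv, su' _ (by omega), sv' _ (by omega)]
      exact norm_transfer_mul_sub_le (hB.dens j) (hw j) (hwh j) (hw1 j) (hwh1 j) (bu' j)
        (bu j) (bv j) (bv' j) ih x y
  exact fin N hN.le y y

end Quotients

/-! ### Holomorphic dependence of the iterates on parameters -/

/-- Families of measurable functions depending on an entire parameter, locally uniformly
bounded in the parameter. -/
def HolBdd (u : ℂ → E → ℂ) : Prop :=
  (∀ h, Measurable (u h)) ∧ (∀ x, Differentiable ℂ fun h => u h x) ∧
    ∀ R : ℝ, ∃ b : ℝ, ∀ h, ‖h‖ ≤ R → ∀ x, ‖u h x‖ ≤ b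

namespace HolBdd

variable {u v : ℂ → E → ℂ}

lemma const {w : E → ℂ} (hw : BddMeas w) : HolBdd (fun _ => w) :=
  ⟨fun _ => hw.1, fun _ => differentiable_const _, fun _ => hw.2.imp fun _ hb _ _ => hb⟩

lemma bddMeas (hu : HolBdd u) (h : ℂ) : BddMeas (u h) :=
  ⟨hu.1 h, (hu.2.2 ‖h‖).imp fun _ hb => hb h le_rfl⟩

lemma mul (hu : HolBdd u) (hv : HolBdd v) : HolBdd (fun h x => u h x * v h x) := by
  refine ⟨fun h => (hu.1 h).mul (hv.1 h), fun x => (hu.2.1 x).mul (hv.2.1 x), fun R => ?_⟩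
  obtain ⟨a, ha⟩ := hu.2.2 R
  obtain ⟨b, hb⟩ := hv.2.2 R
  refine ⟨a * b, fun h hR x => ?_⟩
  rw [norm_mul]
  exact mul_le_mul (ha h hR x) (hb h hR x) (norm_nonneg _) ((norm_nonneg _).trans (ha h hR x))

lemma differentiable_integral (hu : HolBdd u) (ν : Measure E) [IsFiniteMeasure ν] :
    Differentiable ℂ fun h => ∫ x, u h x ∂ν := by
  intro h₀
  obtain ⟨b, hb⟩ := hu.2.2 (‖h₀‖ + 2)
  have hlim : ∀ x, Tendsto (fun n : ℕ => ((n : ℂ) + 1) * (u (h₀ + ((n : ℂ) + 1)⁻¹) x - u h₀ x))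
      atTop (𝓝 (deriv (fun h => u h x) h₀)) := by
    intro x
    have h1 := (hu.2.1 x h₀).hasDerivAt.tendsto_slope_zero
    have h2 : Tendsto (fun n : ℕ => ((n : ℂ) + 1)⁻¹) atTop (𝓝[≠] 0) := by
      refine tendsto_nhdsWithin_iff.2 ⟨?_, Eventually.of_forall fun n => ?_⟩
      · simpa using tendsto_one_div_add_atTop_nhds_zero_nat (𝕜 := ℂ)
      · exact inv_ne_zero (Nat.cast_add_one_ne_zero n)
    simpa [Function.comp_def] using h1.comp h2
  have hmeas : Measurable fun x => deriv (fun h => u h x) h₀ :=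
    measurable_of_tendsto_metrizable
      (fun n => ((hu.1 _).sub (hu.1 _)).const_mul _) (tendsto_pi_nhds.2 hlim)
  refine (hasDerivAt_integral_of_dominated_loc_of_deriv_le (bound := fun _ => b)
    (F' := fun h x => deriv (fun h => u h x) h) (Metric.ball_mem_nhds h₀ one_pos)
    (Eventually.of_forall fun h => (hu.1 h).aestronglyMeasurable) ((hu.bddMeas h₀).integrable ν)
    hmeas.aestronglyMeasurable (ae_of_all _ fun x h hh => ?_) (integrable_const b)
    (ae_of_all _ fun x h _ => (hu.2.1 x h).hasDerivAt)).2.differentiableAt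
  have := Complex.norm_deriv_le_of_forall_mem_sphere_norm_le (f := fun h => u h x) (c := h)
    (C := b) one_pos (hu.2.1 x).diffContOnCl fun z hz => hb z ?_ x
  · simpa using this
  · rw [mem_sphere_iff_norm] at hz
    rw [Metric.mem_ball, dist_eq_norm] at hh
    have h1 := norm_le_norm_add_norm_sub' z h
    have h2 := norm_le_norm_add_norm_sub' h h₀
    linarith

end HolBdd

section Holomorphic

variable {ν : ℕ → Measure E} {k : ℕ → E → E → ℝ} {c : ℝ} {w w' : ℂ → ℕ → E → ℂ}

lemma holBdd_bwd (hB : IsBackwardKernel ν k c) (hw : ∀ n, HolBdd fun h => w h n) (n : ℕ) :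
    HolBdd fun h => bwd ν k (w h) n := by
  induction n with
  | zero => exact HolBdd.const (BddMeas.const 1)
  | succ n ih =>
    have := hB.prob n
    refine ⟨fun h => (bwd_bddMeas hB (fun n => (hw n).bddMeas h) (n + 1)).1, fun y => ?_,
      fun R => ?_⟩
    · exact ((ih.mul (hw n)).mul (HolBdd.const (hB.dens n y).bddMeas)).differentiable_integral _
    · obtain ⟨b, hb⟩ := (ih.mul (hw n)).2.2 R
      exact ⟨b, fun h hR y => (hB.dens n y).norm_integral_le (hb h hR)⟩

/-- The quotient of two iterates whose weights are all close to one is the exponential of a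
holomorphic function, of size controlled by the `L¹` distances of the weights. -/
lemma exists_exp_eq_bwd_div (hB : IsBackwardKernel ν k c) (hw : ∀ n, HolBdd fun h => w h n)
    (hw' : ∀ n, HolBdd fun h => w' h n) {s : Set ℂ} (N : ℕ)
    (hg : ∀ h ∈ s, ∀ i < N, GoodWeight (ν i) c (w h i))
    (hg' : ∀ h ∈ s, ∀ i < N, GoodWeight (ν i) c (w' h i)) (y : E) :
    ∃ ψ : ℂ → ℂ, DifferentiableOn ℂ ψ s ∧ ∀ h ∈ s,
      bwd ν k (w' h) N y = bwd ν k (w h) N y * Complex.exp (ψ h) ∧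
      ‖ψ h‖ ≤ 27 / c ^ 2 * ∑ n ∈ Finset.range N, ∫ x, ‖w' h n x - w h n x‖ ∂ν n := by
  have hc := hB.pos
  have hc1 := hB.lt_one
  let hyb : ℕ → ℂ → ℕ → E → ℂ := fun j h i => if i < j then w' h i else w h i
  have hhyb : ∀ j i, HolBdd fun h => hyb j h i := fun j i => by
    by_cases hi : i < j
    · simpa [hyb, hi] using hw' i
    · simpa [hyb, hi] using hw i
  have hghyb : ∀ j, ∀ h ∈ s, ∀ i < N, GoodWeight (ν i) c (hyb j h i) := fun j h hh i hi => by
    by_cases hij : i < j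
    · simpa [hyb, hij] using hg' h hh i hi
    · simpa [hyb, hij] using hg h hh i hi
  let m : ℕ → ℂ → ℂ := fun j h => bwd ν k (hyb (j + 1) h) N y / bwd ν k (hyb j h) N y
  have hne : ∀ j, ∀ h ∈ s, bwd ν k (hyb j h) N y ≠ 0 := fun j h hh =>
    (bwd_nearConst hB (fun n => (hhyb j n).bddMeas h) (hghyb j h hh)).1 y
  have hm1 : ∀ j < N, ∀ h ∈ s, ‖m j h - 1‖ ≤ 18 / c ^ 2 * ∫ x, ‖w' h j x - w h j x‖ ∂ν j := by
    intro j hj h hh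
    have := norm_bwd_div_sub_one_le hB (fun n => (hhyb j n).bddMeas h)
      (fun n => (hhyb (j + 1) n).bddMeas h) hj (hghyb j h hh) (fun i hi => ?_) y
    · have e1 : hyb (j + 1) h j = w' h j := by simp [hyb]
      have e2 : hyb j h j = w h j := by simp [hyb]
      rw [e1, e2] at this
      exact this
    · simp only [hyb]
      split_ifs <;> first | rfl | omega
  have hmhalf : ∀ j < N, ∀ h ∈ s, ‖m j h - 1‖ ≤ 1 / 2 := by
    intro j hj h hh
    refine (hm1 j hj h hh).trans ?_
    have := hB.prob j
    have h1 := hg h hh j hj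
    have h2 := hg' h hh j hj
    have h3 : ∫ x, ‖w' h j x - w h j x‖ ∂ν j
        ≤ ∫ x, (‖w' h j x - 1‖ + ‖w h j x - 1‖) ∂ν j := by
      refine integral_mono ((h2.1.sub h1.1).integrable _).norm
        (((h2.1.sub (.const 1)).integrable _).norm.add ((h1.1.sub (.const 1)).integrable _).norm)
        fun x => ?_
      have := norm_sub_le (w' h j x - 1) (w h j x - 1)
      simpa using this
    rw [integral_add ((h2.1.sub (.const 1)).integrable _).norm
      ((h1.1.sub (.const 1)).integrable _).norm] at h3
    have h4 : ∫ x, ‖w' h j x - w h j x‖ ∂ν j ≤ c ^ 3 / 64 := by linarith [h1.2, h2.2]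
    refine (mul_le_mul_of_nonneg_left h4 (by positivity)).trans ?_
    have : 18 / c ^ 2 * (c ^ 3 / 64) = 18 / 64 * c := by field_simp
    rw [this]; linarith
  refine ⟨fun h => ∑ j ∈ Finset.range N, Complex.log (m j h), ?_, fun h hh => ⟨?_, ?_⟩⟩
  · refine DifferentiableOn.fun_sum fun j hj => ?_
    refine DifferentiableOn.clog (DifferentiableOn.div
      ((holBdd_bwd hB (hhyb (j + 1)) N).2.1 y).differentiableOn
      ((holBdd_bwd hB (hhyb j) N).2.1 y).differentiableOn (hne j)) fun h hh => ?_
    have := Complex.mem_slitPlane_of_norm_lt_one (z := m j h - 1)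
      ((hmhalf j (Finset.mem_range.1 hj) h hh).trans_lt (by norm_num))
    simpa using this
  · have h0 : hyb 0 h = w h := by ext i; simp [hyb]
    have hN : bwd ν k (hyb N h) N y = bwd ν k (w' h) N y :=
      congrFun (bwd_congr fun i hi => by simp [hyb, hi]) y
    have key : ∀ j ≤ N, bwd ν k (hyb j h) N y
        = bwd ν k (w h) N y * Complex.exp (∑ i ∈ Finset.range j, Complex.log (m i h)) := by
      intro j hj
      induction j with
      | zero => simp [h0]
      | succ j ih =>
        have hmj : m j h ≠ 0 := div_ne_zero (hne _ h hh) (hne _ h hh)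
        rw [Finset.sum_range_succ, Complex.exp_add, ← mul_assoc, ← ih (by omega),
          Complex.exp_log hmj]
        simp only [m]
        rw [mul_div_cancel₀ _ (hne j h hh)]
    rw [← hN, key N le_rfl]
  · refine (norm_sum_le _ _).trans ?_
    rw [Finset.mul_sum]
    refine Finset.sum_le_sum fun j hj => ?_
    have h1 := Complex.norm_log_one_add_half_le_self (hmhalf j (Finset.mem_range.1 hj) h hh)
    rw [add_sub_cancel] at h1
    have h2 := hm1 j (Finset.mem_range.1 hj) h hh
    have e : 27 / c ^ 2 * ∫ x, ‖w' h j x - w h j x‖ ∂ν j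
      = 3 / 2 * (18 / c ^ 2 * ∫ x, ‖w' h j x - w h j x‖ ∂ν j) := by ring
    rw [e]
    linarith

end Holomorphic

section Decay

lemma BddMeas.integrable_re {u : E → ℂ} (hu : BddMeas u) (ν : Measure E) [IsFiniteMeasure ν] :
    Integrable (fun x => (u x).re) ν := (hu.integrable ν).re

/-- A unimodular weight equal to one with probability at least `a` has a small mean as soon as
its real part is often away from one. -/
lemma norm_integral_le_one_sub {ν : Measure E} [IsProbabilityMeasure ν] {w : E → ℂ}
    (hw : Measurable w) (hw1 : ∀ x, ‖w x‖ ≤ 1) {a : ℝ} (ha : a ≤ ν.real {x | w x = 1}) :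
    ‖∫ x, w x ∂ν‖ ≤ 1 - a * ∫ x, (1 - (w x).re) ∂ν := by
  set A : Set E := {x | w x = 1} with hA
  have hAm : MeasurableSet A := hw (measurableSet_singleton 1)
  have hb : BddMeas w := .of_norm_le hw hw1
  set p := ν.real A with hp
  set z := ∫ x in Aᶜ, w x ∂ν with hz
  have hp1 : p ≤ 1 := measureReal_le_one
  have hp0 : 0 ≤ p := measureReal_nonneg
  have hsplit : ∫ x, w x ∂ν = p + z := by
    rw [← integral_add_compl hAm (hb.integrable ν), ← hz]
    congr 1
    rw [setIntegral_congr_fun (g := fun _ => (1 : ℂ)) hAm fun x hx => hx]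
    simp [hp]
  have hzle : ‖z‖ ≤ 1 - p := by
    have h1 := norm_setIntegral_le_of_norm_le_const (μ := ν) (s := Aᶜ) (f := w) (C := 1)
      (measure_lt_top _ _) (fun x _ => hw1 x)
    rwa [one_mul, probReal_compl_eq_one_sub hAm] at h1
  have hint : ∫ x, (1 - (w x).re) ∂ν = 1 - p - z.re := by
    rw [integral_sub (integrable_const _) (hb.integrable_re ν)]
    have h1 : ∫ x, (w x).re ∂ν = (∫ x, w x ∂ν).re := integral_re (hb.integrable ν)
    rw [h1, hsplit]
    simp
    ring
  set e := ∫ x, (1 - (w x).re) ∂ν with he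
  have he0 : 0 ≤ e := integral_nonneg fun x => by
    have := (Complex.re_le_norm (w x)).trans (hw1 x)
    simp only [Pi.zero_apply]; linarith
  have hsq : ‖∫ x, w x ∂ν‖ ^ 2 ≤ 1 - 2 * p * e := by
    rw [hsplit, hint]
    have h1 : ‖(p : ℂ) + z‖ ^ 2 = p ^ 2 + 2 * p * z.re + ‖z‖ ^ 2 := by
      rw [← Complex.normSq_eq_norm_sq, ← Complex.normSq_eq_norm_sq, Complex.normSq_apply,
        Complex.normSq_apply]
      simp; ring
    rw [h1]
    have h2 : ‖z‖ ^ 2 ≤ (1 - p) ^ 2 := pow_le_pow_left₀ (norm_nonneg _) hzle 2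
    nlinarith
  have hpe : ‖∫ x, w x ∂ν‖ ≤ 1 - p * e := by
    have h3 : 0 ≤ 1 - p * e := by nlinarith [sq_nonneg ‖∫ x, w x ∂ν‖]
    refine abs_le_of_sq_le_sq' ?_ h3 |>.2
    nlinarith [sq_nonneg (p * e)]
  nlinarith [mul_le_mul_of_nonneg_right ha he0]

variable {ν : ℕ → Measure E} {k : ℕ → E → E → ℝ} {c : ℝ} {w : ℕ → E → ℂ}

/-- Exponential decay of the iterates in terms of the accumulated defect of the weights. -/
lemma norm_bwd_le_exp (hB : IsBackwardKernel ν k c) (hm : ∀ n, Measurable (w n))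
    (hw : ∀ n x, ‖w n x‖ ≤ 1) {a : ℝ} (ha : ∀ n, a ≤ (ν n).real {x | w n x = 1}) (N : ℕ)
    (y : E) :
    ‖bwd ν k w N y‖
      ≤ 2 * Real.exp (-(c ^ 2 * a / 2 * ∑ i ∈ Finset.range N, ∫ x, (1 - (w i x).re) ∂ν i)) := by
  have hc := hB.pos
  have hc1 := hB.lt_one
  cases N with
  | zero => simp [bwd]
  | succ n =>
    set e : ℕ → ℝ := fun i => ∫ x, (1 - (w i x).re) ∂ν i with he
    have hd : ∀ i, a * e i ≤ 1 - ‖∫ x, w i x ∂ν i‖ := fun i => by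
      have := hB.prob i
      linarith [norm_integral_le_one_sub (hm i) (hw i) (ha i)]
    have h1 := sq_norm_bwd_le hB hm hw n y
    have h2 : ∏ i ∈ Finset.range n, (1 - c ^ 2 * (1 - ‖∫ x, w (i + 1) x ∂ν (i + 1)‖))
        ≤ ∏ i ∈ Finset.range n, Real.exp (-(c ^ 2 * (a * e (i + 1)))) := by
      refine Finset.prod_le_prod (fun i _ => ?_) fun i _ => ?_
      · have : c ^ 2 ≤ 1 := pow_le_one₀ hc.le hc1.le
        have h3 := norm_nonneg (∫ x, w (i + 1) x ∂ν (i + 1))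
        nlinarith [sq_nonneg c]
      · refine le_trans ?_ (Real.add_one_le_exp _)
        have := mul_le_mul_of_nonneg_left (hd (i + 1)) (sq_nonneg c)
        linarith
    rw [← Real.exp_sum, Finset.sum_neg_distrib, ← Finset.mul_sum, ← Finset.mul_sum] at h2
    have hsum : ∑ i ∈ Finset.range (n + 1), e i = ∑ i ∈ Finset.range n, e (i + 1) + e 0 :=
      Finset.sum_range_succ' _ _
    have h0 : a * e 0 ≤ 1 := by linarith [hd 0, norm_nonneg (∫ x, w 0 x ∂ν 0)]
    have h5 : Real.exp (-(c ^ 2 * (a * ∑ i ∈ Finset.range n, e (i + 1))))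
        ≤ (2 * Real.exp (-(c ^ 2 * a / 2 * ∑ i ∈ Finset.range (n + 1), e i))) ^ 2 := by
      rw [mul_pow, ← Real.exp_nat_mul, hsum]
      have h6 : Real.exp (-(c ^ 2 * (a * ∑ i ∈ Finset.range n, e (i + 1))))
          ≤ Real.exp (1 + (2 : ℕ) * -(c ^ 2 * a / 2
            * (∑ i ∈ Finset.range n, e (i + 1) + e 0))) := by
        refine Real.exp_le_exp.2 ?_
        have : c ^ 2 ≤ 1 := pow_le_one₀ hc.le hc1.le
        have h7 : c ^ 2 * (a * e 0) ≤ 1 := by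
          rcases le_total 0 (a * e 0) with h | h <;> nlinarith [sq_nonneg c]
        push_cast
        linarith
      refine h6.trans ?_
      rw [Real.exp_add]
      refine mul_le_mul_of_nonneg_right ?_ (Real.exp_pos _).le
      have := Real.exp_one_lt_d9
      norm_num; linarith
    exact abs_le_of_sq_le_sq' ((h1.trans h2).trans h5) (by positivity) |>.2

end Decay

section Taylor

/-- Taylor expansion, with Cauchy estimates, of a bounded holomorphic function on a disc. -/
lemma exists_taylor_of_differentiableOn {f : ℂ → ℂ} {R M : ℝ} (hR : 0 < R)
    (hf : DifferentiableOn ℂ f (Metric.ball 0 R)) (hM : ∀ z ∈ Metric.ball (0 : ℂ) R, ‖f z‖ ≤ M) :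
    ∃ a : ℕ → ℂ, (∀ j, ‖a j‖ ≤ M * (2 / R) ^ j) ∧ a 0 = f 0 ∧
      (∀ z, ‖z‖ < R / 2 → HasSum (fun j => a j * z ^ j) (f z)) ∧
      ∀ n z, ‖z‖ ≤ R / 4 →
        ‖f z - ∑ j ∈ Finset.range n, a j * z ^ j‖ ≤ 2 * M * (2 * ‖z‖ / R) ^ n := by
  have hM0 : 0 ≤ M := (norm_nonneg _).trans (hM 0 (by simpa using hR))
  lift R to NNReal using hR.le
  have hR' : (0 : ℝ) < R := hR
  have hsub : Metric.closedBall (0 : ℂ) ((R / 2 : NNReal) : ℝ) ⊆ Metric.ball 0 R :=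
    Metric.closedBall_subset_ball (by push_cast; linarith)
  have hfp := DifferentiableOn.hasFPowerSeriesOnBall (hf.mono hsub)
    (R := R / 2) (half_pos (NNReal.coe_pos.1 hR'))
  set p := cauchyPowerSeries f 0 ((R / 2 : NNReal) : ℝ) with hp
  have hcoef : ∀ j, ‖p.coeff j‖ ≤ M * (2 / R) ^ j := by
    intro j
    have h1 := norm_cauchyPowerSeries_le f 0 ((R / 2 : NNReal) : ℝ) j
    have h2 : ‖p.coeff j‖ ≤ ‖p j‖ := by
      rw [← FormalMultilinearSeries.norm_apply_eq_norm_coef]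
    refine h2.trans (h1.trans ?_)
    have h3 : (∫ θ : ℝ in (0)..2 * Real.pi, ‖f (circleMap 0 ((R / 2 : NNReal) : ℝ) θ)‖)
        ≤ M * (2 * Real.pi) := by
      have h4 := intervalIntegral.norm_integral_le_of_norm_le_const
        (a := 0) (b := 2 * Real.pi) (C := M)
        (f := fun θ => ‖f (circleMap 0 ((R / 2 : NNReal) : ℝ) θ)‖) fun θ _ => by
          rw [norm_norm]
          exact hM _ (hsub (circleMap_mem_closedBall _ (by positivity) _))
      rw [sub_zero, abs_of_pos Real.two_pi_pos] at h4
      exact (le_abs_self _).trans h4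
    have h5 : |((R / 2 : NNReal) : ℝ)|⁻¹ = 2 / R := by
      rw [abs_of_nonneg (by positivity)]
      push_cast
      rw [inv_div]
    rw [h5]
    refine mul_le_mul_of_nonneg_right ?_ (by positivity)
    rw [inv_mul_le_iff₀ Real.two_pi_pos]
    linarith
  have hsum : ∀ z : ℂ, ‖z‖ < R / 2 → HasSum (fun j => p.coeff j * z ^ j) (f z) := by
    intro z hz
    have := hfp.hasSum (y := z) (by
      rw [mem_eball_zero_iff]
      rw [← ofReal_norm]
      have : ((R / 2 : NNReal) : ℝ≥0∞) = ENNReal.ofReal (R / 2 : ℝ) := by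
        rw [← ENNReal.ofReal_coe_nnreal]; norm_num
      rw [this]
      exact (ENNReal.ofReal_lt_ofReal_iff (by positivity)).2 hz)
    rw [zero_add] at this
    simpa only [FormalMultilinearSeries.apply_eq_pow_smul_coeff, smul_eq_mul, mul_comm] using this
  refine ⟨p.coeff, hcoef, ?_, hsum, fun n z hz => ?_⟩
  · have h1 := hsum 0 (by simpa using hR')
    have h2 : HasSum (fun j => p.coeff j * (0 : ℂ) ^ j) (p.coeff 0) := by
      have := hasSum_single (f := fun j => p.coeff j * (0 : ℂ) ^ j) 0
        (fun j hj => by simp [hj])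
      simpa using this
    exact h2.unique h1
  · have h1 := hsum z (by linarith)
    have h2 := (hasSum_nat_add_iff' n).2 h1
    rw [← h2.tsum_eq]
    set ρ := 2 * ‖z‖ / R with hρ
    have hρ0 : 0 ≤ ρ := by positivity
    have hρ1 : ρ ≤ 1 / 2 := by rw [hρ, div_le_iff₀ hR']; linarith
    have h3 : HasSum (fun i : ℕ => M * ρ ^ n * ρ ^ i) (M * ρ ^ n * (1 - ρ)⁻¹) :=
      (hasSum_geometric_of_lt_one hρ0 (by linarith)).mul_left _
    have h4 : ‖∑' i, p.coeff (i + n) * z ^ (i + n)‖ ≤ M * ρ ^ n * (1 - ρ)⁻¹ := by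
      refine tsum_of_norm_bounded h3 fun i => ?_
      rw [norm_mul, norm_pow]
      refine (mul_le_mul_of_nonneg_right (hcoef (i + n)) (by positivity)).trans (le_of_eq ?_)
      rw [mul_assoc, ← mul_pow, hρ, mul_assoc, ← pow_add, add_comm n i]
      congr 2
      ring
    refine h4.trans ?_
    have h5 : (1 - ρ)⁻¹ ≤ 2 := by
      rw [inv_le_comm₀ (by linarith) (by norm_num)]; linarith
    calc M * ρ ^ n * (1 - ρ)⁻¹ ≤ M * ρ ^ n * 2 := by gcongr
      _ = 2 * M * ρ ^ n := by ring

end Taylor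

/-- The weight `x ↦ e^{i z g(x)}`. -/
def phase (z : ℂ) (g : E → ℤ) (x : E) : ℂ := Complex.exp (Complex.I * z * (g x : ℂ))

section Phase

variable {g : E → ℤ} {G : ℝ}

lemma measurable_phase (hg : Measurable g) (z : ℂ) : Measurable (phase z g) := by
  unfold phase
  have : Measurable fun x => ((g x : ℤ) : ℂ) := measurable_from_top.comp hg
  fun_prop

lemma norm_phase_ofReal (t : ℝ) (x : E) : ‖phase (t : ℂ) g x‖ = 1 := by
  unfold phase
  have : Complex.I * (t : ℂ) * (g x : ℂ) = ((t * g x : ℝ) : ℂ) * Complex.I := by push_cast; ring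
  rw [this, Complex.norm_exp_ofReal_mul_I]

lemma phase_re_ofReal (t : ℝ) (x : E) : (phase (t : ℂ) g x).re = Real.cos (t * g x) := by
  unfold phase
  have : Complex.I * (t : ℂ) * (g x : ℂ) = ((t * g x : ℝ) : ℂ) * Complex.I := by push_cast; ring
  rw [this, Complex.exp_ofReal_mul_I_re]

lemma phase_add (z z' : ℂ) (x : E) : phase (z + z') g x = phase z g x * phase z' g x := by
  unfold phase
  rw [← Complex.exp_add]
  ring_nf

lemma phase_zero (x : E) : phase 0 g x = 1 := by simp [phase]

lemma phase_of_eq_zero {x : E} (h : g x = 0) (z : ℂ) : phase z g x = 1 := by simp [phase, h]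

lemma norm_phase_exponent_le (hG : ∀ x, |(g x : ℝ)| ≤ G) (z : ℂ) (x : E) :
    ‖Complex.I * z * (g x : ℂ)‖ ≤ ‖z‖ * G := by
  rw [norm_mul, norm_mul, Complex.norm_I, one_mul, Complex.norm_intCast]
  exact mul_le_mul_of_nonneg_left (hG x) (norm_nonneg _)

lemma norm_phase_le (hG : ∀ x, |(g x : ℝ)| ≤ G) (z : ℂ) (x : E) :
    ‖phase z g x‖ ≤ Real.exp (‖z‖ * G) :=
  (Complex.norm_exp_le_exp_norm _).trans (Real.exp_le_exp.2 (norm_phase_exponent_le hG z x))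

lemma norm_phase_sub_one_le (hG : ∀ x, |(g x : ℝ)| ≤ G) {z : ℂ} (hz : ‖z‖ * G ≤ 1) (x : E) :
    ‖phase z g x - 1‖ ≤ 2 * (‖z‖ * G) := by
  have h1 := norm_phase_exponent_le hG z x
  refine (Complex.norm_exp_sub_one_le (h1.trans hz)).trans ?_
  linarith

lemma holBdd_phase (hg : Measurable g) (hG : ∀ x, |(g x : ℝ)| ≤ G) :
    HolBdd fun z => phase z g := by
  refine ⟨measurable_phase hg, fun x => ?_, fun R => ⟨Real.exp (R * |G|), fun z hz x => ?_⟩⟩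
  · unfold phase
    fun_prop
  · refine (norm_phase_le (fun x => (hG x).trans (le_abs_self G)) z x).trans
      (Real.exp_le_exp.2 ?_)
    exact mul_le_mul_of_nonneg_right hz (abs_nonneg _)

lemma integral_norm_le_of_support {ν : Measure E} [IsProbabilityMeasure ν] {u : E → ℂ} {A : Set E}
    (hA : MeasurableSet A) {b : ℝ} (hu : ∀ x, ‖u x‖ ≤ b) (hu0 : ∀ x ∉ A, u x = 0) :
    ∫ x, ‖u x‖ ∂ν ≤ b * ν.real A := by
  have h1 : ∀ x, ‖u x‖ ≤ A.indicator (fun _ => b) x := fun x => by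
    by_cases hx : x ∈ A
    · rw [Set.indicator_of_mem hx]; exact hu x
    · rw [Set.indicator_of_notMem hx, hu0 x hx, norm_zero]
  have h2 : ∫ x, A.indicator (fun _ => b) x ∂ν = b * ν.real A := by
    rw [integral_indicator_const _ hA, smul_eq_mul, mul_comm]
  rw [← h2]
  exact integral_mono_of_nonneg (ae_of_all _ fun x => norm_nonneg _)
    ((integrable_const b).indicator hA) (ae_of_all _ h1)

lemma integral_norm_phase_sub_one_le {ν : Measure E} [IsProbabilityMeasure ν]
    (hg : Measurable g) (hG : ∀ x, |(g x : ℝ)| ≤ G) {z : ℂ} (hz : ‖z‖ * G ≤ 1) :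
    ∫ x, ‖phase z g x - 1‖ ∂ν ≤ 2 * (‖z‖ * G) * ν.real {x | g x ≠ 0} :=
  integral_norm_le_of_support (hg (measurableSet_singleton 0).compl) (norm_phase_sub_one_le hG hz)
    fun x hx => by
      have : g x = 0 := by simpa using hx
      rw [phase_of_eq_zero this, sub_self]

end Phase

/-- Radius of the disc on which the phases `e^{ihg}`, `|g| ≤ G`, are good weights. -/
def rad (c G : ℝ) : ℝ := c ^ 3 / (1024 * G)

section Gaussian

variable {ν : ℕ → Measure E} {k : ℕ → E → E → ℝ} {c : ℝ} {w : ℕ → E → ℂ} {g : ℕ → E → ℤ} {G : ℝ}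

lemma rad_pos (hc : 0 < c) (hG : 1 ≤ G) : 0 < rad c G := by unfold rad; positivity

lemma mul_rad_eq (hG : 1 ≤ G) : rad c G * G = c ^ 3 / 1024 := by
  unfold rad; field_simp

lemma norm_mul_le_of_mem_ball (hG : 1 ≤ G) {h : ℂ} (hh : h ∈ Metric.ball (0 : ℂ) (rad c G)) :
    ‖h‖ * G ≤ c ^ 3 / 1024 := by
  rw [mem_ball_zero_iff] at hh
  rw [← mul_rad_eq hG]
  exact mul_le_mul_of_nonneg_right hh.le (by linarith)

lemma cube_div_le_one (hB : IsBackwardKernel ν k c) : c ^ 3 / 1024 ≤ 1 := by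
  have := pow_le_one₀ (n := 3) hB.pos.le hB.lt_one.le
  linarith

lemma conj_bwd (N : ℕ) (y : E) :
    (starRingEnd ℂ) (bwd ν k w N y) = bwd ν k (fun n x => (starRingEnd ℂ) (w n x)) N y := by
  induction N generalizing y with
  | zero => simp [bwd]
  | succ n ih =>
    simp only [bwd, transfer]
    rw [← integral_conj]
    congr 1
    ext x
    simp [ih]

lemma conj_phase (t : ℝ) (g : E → ℤ) (x : E) :
    (starRingEnd ℂ) (phase (t : ℂ) g x) = phase ((-t : ℝ) : ℂ) g x := by
  unfold phase
  rw [← Complex.exp_conj]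
  simp

lemma bwd_one (hB : IsBackwardKernel ν k c) (N : ℕ) (y : E) :
    bwd ν k (fun _ _ => 1) N y = 1 := by
  induction N generalizing y with
  | zero => rfl
  | succ n ih =>
    simp only [bwd, transfer, ih, mul_one]
    have := hB.prob n
    exact (hB.dens n y).integral_const_mul 1

lemma goodWeight_phase (hB : IsBackwardKernel ν k c) (hg : ∀ n, Measurable (g n)) (hG1 : 1 ≤ G)
    (hG : ∀ n x, |(g n x : ℝ)| ≤ G) {h : ℂ} (hh : h ∈ Metric.ball (0 : ℂ) (rad c G)) (n : ℕ) :
    GoodWeight (ν n) c (phase h (g n)) := by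
  have := hB.prob n
  have h1 := norm_mul_le_of_mem_ball hG1 hh
  refine ⟨(holBdd_phase (hg n) (hG n)).bddMeas h,
    (integral_norm_phase_sub_one_le (hg n) (hG n) (h1.trans (cube_div_le_one hB))).trans ?_⟩
  have h2 : (ν n).real {x | g n x ≠ 0} ≤ 1 := measureReal_le_one
  have h3 : (0 : ℝ) ≤ (ν n).real {x | g n x ≠ 0} := measureReal_nonneg
  have hc := hB.pos
  have h4 : (0 : ℝ) ≤ ‖h‖ * G := by positivity
  have h5 : 0 < c ^ 3 := by positivity
  nlinarith

lemma bddMeas_one : BddMeas (fun _ : E => (1 : ℂ)) := .const 1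

/-- Near the origin the characteristic function is the exponential of a holomorphic function
which is controlled by the total amount of randomness. -/
lemma exists_exp_eq_bwd_phase (hB : IsBackwardKernel ν k c) (hg : ∀ n, Measurable (g n))
    (hG1 : 1 ≤ G) (hG : ∀ n x, |(g n x : ℝ)| ≤ G) (N : ℕ) (y : E) :
    ∃ ψ : ℂ → ℂ, DifferentiableOn ℂ ψ (Metric.ball 0 (rad c G)) ∧
      ∀ h ∈ Metric.ball (0 : ℂ) (rad c G),
        bwd ν k (fun n => phase h (g n)) N y = Complex.exp (ψ h) ∧
        ‖ψ h‖ ≤ 54 * G / c ^ 2 * ‖h‖ * ∑ n ∈ Finset.range N, (ν n).real {x | g n x ≠ 0} := by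
  have hc := hB.pos
  obtain ⟨ψ, hψ, h1⟩ := exists_exp_eq_bwd_div (s := Metric.ball (0 : ℂ) (rad c G))
    (w := fun _ _ _ => 1) (w' := fun h n => phase h (g n)) hB
    (fun n => HolBdd.const bddMeas_one) (fun n => holBdd_phase (hg n) (hG n)) N
    (fun h _ i _ => ⟨bddMeas_one, by simp; positivity⟩)
    (fun h hh i _ => goodWeight_phase hB hg hG1 hG hh i) y
  refine ⟨ψ, hψ, fun h hh => ⟨?_, ?_⟩⟩
  · rw [(h1 h hh).1, bwd_one hB, one_mul]
  · refine (h1 h hh).2.trans ?_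
    have h2 := norm_mul_le_of_mem_ball hG1 hh
    have h3 : ∑ n ∈ Finset.range N, ∫ x, ‖phase h (g n) x - 1‖ ∂ν n
        ≤ ∑ n ∈ Finset.range N, 2 * (‖h‖ * G) * (ν n).real {x | g n x ≠ 0} :=
      Finset.sum_le_sum fun n _ => by
        have := hB.prob n
        exact integral_norm_phase_sub_one_le (hg n) (hG n) (h2.trans (cube_div_le_one hB))
    rw [← Finset.mul_sum] at h3
    refine (mul_le_mul_of_nonneg_left h3 (by positivity)).trans (le_of_eq ?_)
    ring

/-- A Gaussian lower bound for the characteristic function near the origin. -/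
lemma norm_bwd_phase_ge (hB : IsBackwardKernel ν k c) (hg : ∀ n, Measurable (g n))
    (hG1 : 1 ≤ G) (hG : ∀ n x, |(g n x : ℝ)| ≤ G) (N : ℕ) (y : E) {h : ℝ}
    (hh : |h| ≤ rad c G / 4) :
    Real.exp (-(432 * G / (c ^ 2 * rad c G)
        * (h ^ 2 * ∑ n ∈ Finset.range N, (ν n).real {x | g n x ≠ 0})))
      ≤ ‖bwd ν k (fun n => phase (h : ℂ) (g n)) N y‖ := by
  have hc := hB.pos
  have hδ := rad_pos hc hG1
  set δ := rad c G with hδ'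
  obtain ⟨ψ, hψ, h1⟩ := exists_exp_eq_bwd_phase hB hg hG1 hG N y
  set W := ∑ n ∈ Finset.range N, (ν n).real {x | g n x ≠ 0} with hW
  have hW0 : 0 ≤ W := Finset.sum_nonneg fun n _ => measureReal_nonneg
  obtain ⟨a, -, ha0, -, ha⟩ := exists_taylor_of_differentiableOn
    (M := 54 * G / c ^ 2 * δ * W) hδ hψ fun z hz => by
      refine (h1 z hz).2.trans ?_
      have : ‖z‖ ≤ δ := by simpa using (mem_ball_zero_iff.1 hz).le
      gcongr
  have hψ0 : ψ 0 = 0 := by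
    have := (h1 0 (by simpa using hδ)).2
    simpa using this
  have hT : ∀ t : ℝ, |t| ≤ δ / 4 → ‖ψ t - a 1 * t‖ ≤ 432 * G / (c ^ 2 * δ) * (t ^ 2 * W) := by
    intro t ht
    have h2 := ha 2 (t : ℂ) (by simpa using ht)
    rw [Finset.sum_range_succ, Finset.sum_range_one, ha0, hψ0] at h2
    simp only [zero_mul, zero_add, pow_one, Complex.norm_real, Real.norm_eq_abs] at h2
    refine h2.trans (le_of_eq ?_)
    rw [div_pow, mul_pow, sq_abs]
    field_simp
    ring
  have hmem : ∀ t : ℝ, |t| ≤ δ / 4 → (t : ℂ) ∈ Metric.ball (0 : ℂ) δ := fun t ht => by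
    rw [mem_ball_zero_iff, Complex.norm_real, Real.norm_eq_abs]; linarith
  have hnh : |-h| ≤ δ / 4 := by rwa [abs_neg]
  set D := bwd ν k (fun n => phase (h : ℂ) (g n)) N y with hD
  have hsq : ((‖D‖ ^ 2 : ℝ) : ℂ) = Complex.exp (ψ h + ψ ((-h : ℝ) : ℂ)) := by
    rw [Complex.exp_add, ← (h1 _ (hmem h hh)).1, ← (h1 _ (hmem (-h) hnh)).1]
    have : bwd ν k (fun n => phase ((-h : ℝ) : ℂ) (g n)) N y = (starRingEnd ℂ) D := by
      rw [hD, conj_bwd]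
      congr 1
      ext n x
      rw [conj_phase]
    rw [this, ← hD, Complex.mul_conj, Complex.normSq_eq_norm_sq]
  set A := 432 * G / (c ^ 2 * δ) * (h ^ 2 * W) with hA
  have hsum : ‖ψ h + ψ ((-h : ℝ) : ℂ)‖ ≤ 2 * A := by
    have e : ψ h + ψ ((-h : ℝ) : ℂ)
        = (ψ h - a 1 * h) + (ψ ((-h : ℝ) : ℂ) - a 1 * ((-h : ℝ) : ℂ)) := by push_cast; ring
    rw [e]
    refine (norm_add_le _ _).trans ?_
    have h3 := hT h hh
    have h4 := hT (-h) hnh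
    rw [neg_sq] at h4
    linarith
  have hge : Real.exp (-(2 * A)) ≤ ‖D‖ ^ 2 := by
    have h5 : ‖D‖ ^ 2 = Real.exp ((ψ h + ψ ((-h : ℝ) : ℂ)).re) := by
      rw [← Complex.norm_exp, ← hsq, Complex.norm_real, Real.norm_of_nonneg (by positivity)]
    rw [h5]
    refine Real.exp_le_exp.2 ?_
    have := Complex.abs_re_le_norm (ψ h + ψ ((-h : ℝ) : ℂ))
    linarith [neg_abs_le ((ψ h + ψ ((-h : ℝ) : ℂ)).re)]
  have h6 : Real.exp (-A) ^ 2 ≤ ‖D‖ ^ 2 := by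
    rw [← Real.exp_nat_mul]
    convert hge using 2
    push_cast; ring
  exact abs_le_of_sq_le_sq' h6 (norm_nonneg _) |>.2

end Gaussian

section Perturbation

variable {ν : ℕ → Measure E} {k : ℕ → E → E → ℝ} {c : ℝ} {g : ℕ → E → ℤ} {G : ℝ}
  {ζ ζh : ℕ → E → ℂ}

lemma integral_norm_mul_sub_le {ν : Measure E} [IsProbabilityMeasure ν] {ζ u : E → ℂ}
    (hζ : Measurable ζ) (hζ1 : ∀ x, ‖ζ x‖ ≤ 1) (hu : ∀ x, ‖u x‖ ≤ 2) :
    ∫ x, ‖ζ x * u x - u x‖ ∂ν ≤ 4 * ν.real {x | ζ x ≠ 1} := by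
  refine integral_norm_le_of_support (hζ (measurableSet_singleton 1).compl) (fun x => ?_)
    fun x hx => ?_
  · have e : ζ x * u x - u x = (ζ x - 1) * u x := by ring
    have h1 : ‖ζ x - 1‖ ≤ 2 := (norm_sub_le _ _).trans (by rw [norm_one]; linarith [hζ1 x])
    rw [e, norm_mul]
    nlinarith [hu x, norm_nonneg (ζ x - 1), norm_nonneg (u x)]
  · have : ζ x = 1 := by simpa using hx
    rw [this, one_mul, sub_self]

lemma norm_phase_le_two (hB : IsBackwardKernel ν k c) (hG1 : 1 ≤ G)
    (hG : ∀ n x, |(g n x : ℝ)| ≤ G) {z : ℂ} (hz : z ∈ Metric.ball (0 : ℂ) (rad c G)) (n : ℕ)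
    (x : E) : ‖phase z (g n) x‖ ≤ 2 := by
  have h1 := norm_mul_le_of_mem_ball hG1 hz
  have h3 := pow_le_one₀ (n := 3) hB.pos.le hB.lt_one.le
  have h2 := norm_phase_sub_one_le (hG n) (h1.trans (cube_div_le_one hB)) x
  have h4 := norm_le_norm_add_norm_sub' (phase z (g n) x) 1
  rw [norm_one] at h4
  linarith

lemma goodWeight_mul_phase (hB : IsBackwardKernel ν k c) (hg : ∀ n, Measurable (g n))
    (hG1 : 1 ≤ G) (hG : ∀ n x, |(g n x : ℝ)| ≤ G) {n : ℕ} (hζ : Measurable (ζ n))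
    (hζ1 : ∀ x, ‖ζ n x‖ ≤ 1) (hq : (ν n).real {x | ζ n x ≠ 1} ≤ c ^ 3 / 1024) {z : ℂ}
    (hz : z ∈ Metric.ball (0 : ℂ) (rad c G)) :
    GoodWeight (ν n) c (fun x => ζ n x * phase z (g n) x) := by
  have := hB.prob n
  have hc := hB.pos
  have hph := (holBdd_phase (hg n) (hG n)).bddMeas z
  have hζb : BddMeas (ζ n) := .of_norm_le hζ hζ1
  refine ⟨hζb.mul hph, ?_⟩
  have h1 : ∫ x, ‖ζ n x * phase z (g n) x - 1‖ ∂ν n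
      ≤ ∫ x, (‖ζ n x * phase z (g n) x - phase z (g n) x‖ + ‖phase z (g n) x - 1‖) ∂ν n := by
    refine integral_mono (((hζb.mul hph).sub (.const 1)).integrable _).norm
      ((((hζb.mul hph).sub hph).integrable _).norm.add ((hph.sub (.const 1)).integrable _).norm)
      fun x => ?_
    exact norm_sub_le_norm_sub_add_norm_sub _ _ _
  rw [integral_add (((hζb.mul hph).sub hph).integrable _).norm
    ((hph.sub (.const 1)).integrable _).norm] at h1
  have h2 := integral_norm_mul_sub_le (ν := ν n) hζ hζ1 (norm_phase_le_two hB hG1 hG hz n)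
  have h3 := norm_mul_le_of_mem_ball hG1 hz
  have h4 := integral_norm_phase_sub_one_le (ν := ν n) (hg n) (hG n)
    (h3.trans (cube_div_le_one hB))
  have h5 : (ν n).real {x | g n x ≠ 0} ≤ 1 := measureReal_le_one
  have h6 : (0 : ℝ) ≤ ‖z‖ * G := by positivity
  have h7 : 0 < c ^ 3 := by positivity
  nlinarith

lemma phase_ite (A : Prop) [Decidable A] (z : ℂ) (g : E → ℤ) :
    phase (if A then z else 0) g = phase z (if A then g else 0) := by
  split_ifs
  · rfl
  · ext x; simp [phase]

/-- Lower bound for phases switched on only on a set of sites. -/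
lemma norm_bwd_phase_ite_ge (hB : IsBackwardKernel ν k c) (hg : ∀ n, Measurable (g n))
    (hG1 : 1 ≤ G) (hG : ∀ n x, |(g n x : ℝ)| ≤ G) (N : ℕ) (y : E) {h : ℝ}
    (hh : |h| ≤ rad c G / 4) (A : ℕ → Prop) [DecidablePred A] :
    Real.exp (-(432 * G / (c ^ 2 * rad c G)
        * (h ^ 2 * ∑ n ∈ Finset.range N with A n, (ν n).real {x | g n x ≠ 0})))
      ≤ ‖bwd ν k (fun n => phase (if A n then (h : ℂ) else 0) (g n)) N y‖ := by
  have h1 := norm_bwd_phase_ge (g := fun n => if A n then g n else 0) hB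
    (fun n => by split_ifs; exacts [hg n, measurable_const]) hG1
    (fun n x => by split_ifs; exacts [hG n x, by simp; linarith]) N y hh
  simp only [phase_ite]
  have e : ∑ n ∈ Finset.range N with A n, (ν n).real {x | g n x ≠ 0}
      = ∑ n ∈ Finset.range N, (ν n).real {x | (if A n then g n else 0) x ≠ 0} := by
    rw [Finset.sum_filter]
    refine Finset.sum_congr rfl fun n _ => ?_
    split_ifs <;> simp
  rw [e]
  exact h1

lemma ite_mem_ball {A : Prop} [Decidable A] {z z' : ℂ} {δ : ℝ} (hz : z ∈ Metric.ball (0 : ℂ) δ)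
    (hz' : z' ∈ Metric.ball (0 : ℂ) δ) : (if A then z else z') ∈ Metric.ball (0 : ℂ) δ := by
  split_ifs <;> assumption

/-- Multiplying the phases by weights which are mostly equal to one changes the characteristic
function by the exponential of a holomorphic function. -/
lemma exists_exp_eq_bwd_mul_phase (hB : IsBackwardKernel ν k c) (hg : ∀ n, Measurable (g n))
    (hG1 : 1 ≤ G) (hG : ∀ n x, |(g n x : ℝ)| ≤ G) (hζ : ∀ n, Measurable (ζ n))
    (hζ1 : ∀ n x, ‖ζ n x‖ ≤ 1) (N : ℕ)
    (hq : ∀ n < N, (ν n).real {x | ζ n x ≠ 1} ≤ c ^ 3 / 1024) (y : E)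
    (A : ℕ → Prop) [DecidablePred A] {z₀ : ℂ} (hz₀ : z₀ ∈ Metric.ball (0 : ℂ) (rad c G)) :
    ∃ ψ : ℂ → ℂ, DifferentiableOn ℂ ψ (Metric.ball 0 (rad c G)) ∧
      ∀ z ∈ Metric.ball (0 : ℂ) (rad c G),
        bwd ν k (fun n x => ζ n x * phase (if A n then z₀ else z) (g n) x) N y
          = bwd ν k (fun n => phase (if A n then z₀ else z) (g n)) N y * Complex.exp (ψ z) ∧
        ‖ψ z‖ ≤ 108 / c ^ 2 * ∑ n ∈ Finset.range N, (ν n).real {x | ζ n x ≠ 1} := by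
  have hc := hB.pos
  have hhol : ∀ n, HolBdd fun z => phase (if A n then z₀ else z) (g n) := fun n => by
    by_cases hA : A n
    · simpa [hA] using HolBdd.const ((holBdd_phase (hg n) (hG n)).bddMeas z₀)
    · simpa [hA] using holBdd_phase (hg n) (hG n)
  obtain ⟨ψ, hψ, h1⟩ := exists_exp_eq_bwd_div (s := Metric.ball (0 : ℂ) (rad c G))
    (w := fun z n => phase (if A n then z₀ else z) (g n))
    (w' := fun z n x => ζ n x * phase (if A n then z₀ else z) (g n) x) hB hhol
    (fun n => (HolBdd.const (.of_norm_le (hζ n) (hζ1 n))).mul (hhol n)) N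
    (fun z hz n _ => goodWeight_phase hB hg hG1 hG (ite_mem_ball hz₀ hz) n)
    (fun z hz n hn => goodWeight_mul_phase hB hg hG1 hG (hζ n) (hζ1 n) (hq n hn)
      (ite_mem_ball hz₀ hz)) y
  refine ⟨ψ, hψ, fun z hz => ⟨(h1 z hz).1, (h1 z hz).2.trans ?_⟩⟩
  have h3 : ∑ n ∈ Finset.range N, ∫ x, ‖ζ n x * phase (if A n then z₀ else z) (g n) x
        - phase (if A n then z₀ else z) (g n) x‖ ∂ν n
      ≤ ∑ n ∈ Finset.range N, 4 * (ν n).real {x | ζ n x ≠ 1} :=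
    Finset.sum_le_sum fun n _ => by
      have := hB.prob n
      exact integral_norm_mul_sub_le (hζ n) (hζ1 n)
        (norm_phase_le_two hB hG1 hG (ite_mem_ball hz₀ hz) n)
  rw [← Finset.mul_sum] at h3
  refine (mul_le_mul_of_nonneg_left h3 (by positivity)).trans (le_of_eq ?_)
  ring

lemma ofReal_mem_ball {δ h : ℝ} (hδ : 0 < δ) (hh : |h| ≤ δ / 4) :
    (h : ℂ) ∈ Metric.ball (0 : ℂ) δ := by
  rw [mem_ball_zero_iff, Complex.norm_real, Real.norm_eq_abs]; linarith

lemma norm_bwd_mul_phase_ite_ge (hB : IsBackwardKernel ν k c) (hg : ∀ n, Measurable (g n))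
    (hG1 : 1 ≤ G) (hG : ∀ n x, |(g n x : ℝ)| ≤ G) (hζ : ∀ n, Measurable (ζ n))
    (hζ1 : ∀ n x, ‖ζ n x‖ ≤ 1) (N : ℕ)
    (hq : ∀ n < N, (ν n).real {x | ζ n x ≠ 1} ≤ c ^ 3 / 1024) (y : E) {h : ℝ}
    (hh : |h| ≤ rad c G / 4) (A : ℕ → Prop) [DecidablePred A] :
    Real.exp (-(108 / c ^ 2 * ∑ n ∈ Finset.range N, (ν n).real {x | ζ n x ≠ 1}
        + 432 * G / (c ^ 2 * rad c G)
          * (h ^ 2 * ∑ n ∈ Finset.range N, (ν n).real {x | g n x ≠ 0})))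
      ≤ ‖bwd ν k (fun n x => ζ n x * phase (if A n then (h : ℂ) else 0) (g n) x) N y‖ := by
  have hδ := rad_pos hB.pos hG1
  have h0 : (0 : ℂ) ∈ Metric.ball (0 : ℂ) (rad c G) := by simpa using hδ
  obtain ⟨ψ, -, h1⟩ := exists_exp_eq_bwd_mul_phase hB hg hG1 hG hζ hζ1 N hq y A
    (ofReal_mem_ball hδ hh)
  obtain ⟨h2, h3⟩ := h1 0 h0
  rw [h2, norm_mul, Complex.norm_exp, neg_add, Real.exp_add, mul_comm]
  have h4 := norm_bwd_phase_ite_ge hB hg hG1 hG N y hh A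
  have hc := hB.pos
  refine mul_le_mul (le_trans (Real.exp_le_exp.2 ?_) h4) (Real.exp_le_exp.2 ?_)
    (Real.exp_pos _).le (norm_nonneg _)
  · refine neg_le_neg ?_
    gcongr
    exact Finset.filter_subset _ _
  · have := Complex.abs_re_le_norm (ψ 0)
    linarith [neg_abs_le (ψ 0).re]

/-- Comparison of the effect of the weights `ζ` in the presence and in the absence of phases
outside of a set of sites. -/
lemma norm_bwd_mul_phase_le (hB : IsBackwardKernel ν k c) (hg : ∀ n, Measurable (g n))
    (hG1 : 1 ≤ G) (hG : ∀ n x, |(g n x : ℝ)| ≤ G) (hζ : ∀ n, Measurable (ζ n))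
    (hζ1 : ∀ n x, ‖ζ n x‖ ≤ 1) (N : ℕ)
    (hq : ∀ n < N, (ν n).real {x | ζ n x ≠ 1} ≤ c ^ 3 / 1024) (y : E) {h : ℝ}
    (hh : |h| ≤ rad c G / 4) (A : ℕ → Prop) [DecidablePred A] :
    ‖bwd ν k (fun n x => ζ n x * phase (h : ℂ) (g n) x) N y‖
        * ‖bwd ν k (fun n => phase (if A n then (h : ℂ) else 0) (g n)) N y‖
      ≤ ‖bwd ν k (fun n x => ζ n x * phase (if A n then (h : ℂ) else 0) (g n) x) N y‖
        * ‖bwd ν k (fun n => phase (h : ℂ) (g n)) N y‖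
        * Real.exp (432 / (c ^ 2 * rad c G)
          * (|h| * ∑ n ∈ Finset.range N, (ν n).real {x | ζ n x ≠ 1})) := by
  have hδ := rad_pos hB.pos hG1
  have hc := hB.pos
  have h0 : (0 : ℂ) ∈ Metric.ball (0 : ℂ) (rad c G) := by simpa using hδ
  have hhm := ofReal_mem_ball hδ hh
  obtain ⟨ψ, hψ, h1⟩ := exists_exp_eq_bwd_mul_phase hB hg hG1 hG hζ hζ1 N hq y A hhm
  set Q := ∑ n ∈ Finset.range N, (ν n).real {x | ζ n x ≠ 1} with hQ
  obtain ⟨a, -, ha0, -, ha⟩ := exists_taylor_of_differentiableOn hδ hψ fun z hz => (h1 z hz).2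
  have h2 := ha 1 (h : ℂ) (by simpa using hh)
  rw [Finset.sum_range_one, ha0, pow_zero, mul_one, pow_one, Complex.norm_real,
    Real.norm_eq_abs] at h2
  have h3 := (h1 0 h0).1
  have h4 := (h1 h hhm).1
  simp only [ite_self] at h4
  rw [h3, h4, norm_mul, norm_mul, Complex.norm_exp, Complex.norm_exp]
  have h5 : Real.exp (ψ h).re ≤ Real.exp (ψ 0).re
      * Real.exp (432 / (c ^ 2 * rad c G) * (|h| * Q)) := by
    rw [← Real.exp_add]
    refine Real.exp_le_exp.2 ?_
    have h6 := (Complex.re_le_norm (ψ h - ψ 0)).trans h2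
    rw [Complex.sub_re] at h6
    have e : 2 * (108 / c ^ 2 * Q) * (2 * |h| / rad c G)
        = 432 / (c ^ 2 * rad c G) * (|h| * Q) := by field_simp; ring
    linarith
  set X := ‖bwd ν k (fun n => phase (h : ℂ) (g n)) N y‖
  set Y := ‖bwd ν k (fun n => phase (if A n then (h : ℂ) else 0) (g n)) N y‖
  calc X * Real.exp (ψ h).re * Y
      ≤ X * (Real.exp (ψ 0).re * Real.exp (432 / (c ^ 2 * rad c G) * (|h| * Q))) * Y := by gcongr
    _ = _ := by ring

end Perturbation

section Resonance

variable {ν : ℕ → Measure E} {k : ℕ → E → E → ℝ} {c : ℝ} {g : ℕ → E → ℤ} {G : ℝ}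
  {ζ ζh : ℕ → E → ℂ}

/-- Switching on the phases outside of `U`, where the weights `ζ` and `ζh` agree, changes the
two characteristic functions by almost the same factor. -/
lemma norm_bwd_le_of_switch (hB : IsBackwardKernel ν k c) (hg : ∀ n, Measurable (g n))
    (hG1 : 1 ≤ G) (hG : ∀ n x, |(g n x : ℝ)| ≤ G) (hζ : ∀ n, Measurable (ζ n))
    (hζ1 : ∀ n x, ‖ζ n x‖ ≤ 1) (hζh : ∀ n, Measurable (ζh n)) (hζh1 : ∀ n x, ‖ζh n x‖ ≤ 1)
    (N : ℕ) (hq : ∀ n < N, (ν n).real {x | ζh n x ≠ 1} ≤ c ^ 3 / 1024) (y : E) {h : ℝ}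
    (hh : |h| ≤ rad c G / 4) (U : ℕ → Prop) [DecidablePred U] {L : ℕ}
    (hU : ∀ n < N, ¬ U n → ∀ i < N, n ≤ i + L → i ≤ n + L → ζ i = ζh i) {β : ℝ} (hβ : 0 < β)
    (hlow : ∀ n : ℕ, β ≤ ‖bwd ν k
      (fun i x => ζh i x * phase (if U i ∨ i < n then (h : ℂ) else 0) (g i) x) N y‖) :
    ‖bwd ν k (fun i x => ζ i x * phase (h : ℂ) (g i) x) N y‖
      ≤ ‖bwd ν k (fun i x => ζ i x * phase (if U i then (h : ℂ) else 0) (g i) x) N y‖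
          * (‖bwd ν k (fun i x => ζh i x * phase (h : ℂ) (g i) x) N y‖
          / ‖bwd ν k (fun i x => ζh i x * phase (if U i then (h : ℂ) else 0) (g i) x) N y‖)
        + 32 * c⁻¹ * (1 - c / 2) ^ L * (|h| * G)
          * (∑ n ∈ Finset.range N, (ν n).real {x | g n x ≠ 0}) / β ^ 2 := by
  have hc := hB.pos
  have hc1 := hB.lt_one
  have hδ := rad_pos hc hG1
  let wt : (ℕ → E → ℂ) → ℕ → ℕ → E → ℂ := fun ζ n i x =>
    ζ i x * phase (if U i ∨ i < n then (h : ℂ) else 0) (g i) x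
  let F : (ℕ → E → ℂ) → ℕ → ℂ := fun ζ n => bwd ν k (wt ζ n) N y
  have hif : ∀ (n i : ℕ), (if U i ∨ i < n then (h : ℂ) else 0)
      = (((if U i ∨ i < n then h else 0 : ℝ)) : ℂ) := fun n i => by split_ifs <;> simp
  have hwm : ∀ ζ : ℕ → E → ℂ, (∀ n, Measurable (ζ n)) → ∀ n i, Measurable (wt ζ n i) :=
    fun ζ hζ n i => (hζ i).mul (measurable_phase (hg i) _)
  have hw1 : ∀ ζ : ℕ → E → ℂ, (∀ n x, ‖ζ n x‖ ≤ 1) → ∀ n i x, ‖wt ζ n i x‖ ≤ 1 := by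
    intro ζ hζ n i x
    simp only [wt]
    rw [norm_mul, hif, norm_phase_ofReal, mul_one]
    exact hζ i x
  have hFN : ∀ ζ, F ζ N = bwd ν k (fun i x => ζ i x * phase (h : ℂ) (g i) x) N y := fun ζ =>
    congrFun (bwd_congr fun i hi => by simp [wt, hi]) y
  have hF0 : ∀ ζ, F ζ 0
      = bwd ν k (fun i x => ζ i x * phase (if U i then (h : ℂ) else 0) (g i) x) N y := fun ζ => by
    simp [F, wt]
  have hFh : ∀ n, F ζh n ≠ 0 := fun n h0 => by
    have := hlow n
    change β ≤ ‖F ζh n‖ at this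
    rw [h0, norm_zero] at this
    linarith
  set v : ℕ → ℝ := fun n => (ν n).real {x | g n x ≠ 0} with hv
  have hv0 : ∀ n, 0 ≤ v n := fun n => measureReal_nonneg
  have hρ : 0 ≤ 1 - c / 2 := by linarith
  set ε : ℝ := 32 * c⁻¹ * (1 - c / 2) ^ L * (|h| * G) with hε
  have hε0 : 0 ≤ ε := by positivity
  have hcross : ∀ n < N, ‖F ζ (n + 1) * F ζh n - F ζ n * F ζh (n + 1)‖ ≤ ε * v n := by
    intro n hn
    by_cases hUn : U n
    · have e : ∀ ζ, F ζ (n + 1) = F ζ n := fun ζ => by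
        simp only [F]
        congr 1
        ext i x
        simp only [wt]
        by_cases hi : i = n
        · subst hi; simp [hUn]
        · have : i < n + 1 ↔ i < n := by omega
          simp [this]
      rw [e, e, sub_self, norm_zero]
      exact mul_nonneg hε0 (hv0 n)
    · have hag := hU n hn hUn
      have hne : ∀ (ζ : ℕ → E → ℂ) (i : ℕ), i ≠ n → wt ζ (n + 1) i = wt ζ n i := by
        intro ζ i hi
        have : i < n + 1 ↔ i < n := by omega
        simp [wt, this]
      have h1 := norm_bwd_cross_le hB (hwm ζ hζ n) (hwm ζh hζh n) (hwm ζ hζ (n + 1))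
        (hwm ζh hζh (n + 1)) (hw1 ζ hζ1 n) (hw1 ζh hζh1 n) (hw1 ζ hζ1 (n + 1))
        (hw1 ζh hζh1 (n + 1)) hn
        (fun i hi => goodWeight_mul_phase hB hg hG1 hG (hζh i) (hζh1 i) (hq i hi)
          (ite_mem_ball (ofReal_mem_ball hδ hh) (by simpa using hδ)))
        (L := L) (fun i hi h1 h2 => by simp only [wt]; rw [hag i hi h1 h2])
        (by simp only [wt]; rw [hag n hn (by omega) (by omega)]) (hne ζ) (hne ζh) y
      refine h1.trans ?_
      have := hB.prob n
      have hsmall : ‖(h : ℂ)‖ * G ≤ 1 :=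
        (norm_mul_le_of_mem_ball hG1 (ofReal_mem_ball hδ hh)).trans (cube_div_le_one hB)
      have h2 : ∫ x, ‖wt ζh (n + 1) n x - wt ζh n n x‖ ∂ν n ≤ 2 * (‖(h : ℂ)‖ * G) * v n := by
        refine integral_norm_le_of_support (hg n (measurableSet_singleton 0).compl)
          (fun x => ?_) fun x hx => ?_
        · have e : wt ζh (n + 1) n x - wt ζh n n x = ζh n x * (phase (h : ℂ) (g n) x - 1) := by
            simp [wt, hUn, phase_zero]; ring
          rw [e, norm_mul]
          have h3 := norm_phase_sub_one_le (hG n) hsmall x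
          have h4 := hζh1 n x
          nlinarith [norm_nonneg (phase (h : ℂ) (g n) x - 1)]
        · have hx0 : g n x = 0 := by simpa using hx
          simp [wt, phase_of_eq_zero hx0]
      rw [Complex.norm_real, Real.norm_eq_abs] at h2
      refine (mul_le_mul_of_nonneg_left h2 (by positivity)).trans (le_of_eq ?_)
      rw [hε]; ring
  have hstep : ∀ n < N, ‖F ζ (n + 1) / F ζh (n + 1) - F ζ n / F ζh n‖ ≤ ε * v n / β ^ 2 := by
    intro n hn
    rw [div_sub_div _ _ (hFh _) (hFh _), norm_div, norm_mul]
    have h1 := hcross n hn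
    rw [mul_comm (F ζ n)] at h1
    have h2 : β ^ 2 ≤ ‖F ζh (n + 1)‖ * ‖F ζh n‖ := by
      rw [pow_two]
      exact mul_le_mul (hlow (n + 1)) (hlow n) hβ.le (norm_nonneg _)
    exact div_le_div₀ (mul_nonneg hε0 (hv0 n)) h1 (by positivity) h2
  have htel : ∀ n ≤ N, ‖F ζ n / F ζh n - F ζ 0 / F ζh 0‖
      ≤ ∑ i ∈ Finset.range n, ε * v i / β ^ 2 := by
    intro n hn
    induction n with
    | zero => simp
    | succ n ih =>
      rw [Finset.sum_range_succ]
      have := norm_sub_le_norm_sub_add_norm_sub (F ζ (n + 1) / F ζh (n + 1)) (F ζ n / F ζh n)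
        (F ζ 0 / F ζh 0)
      linarith [ih (by omega), hstep n (by omega)]
  have h1 := htel N le_rfl
  rw [← Finset.sum_div, ← Finset.mul_sum] at h1
  have h2 : F ζ N = (F ζ N / F ζh N - F ζ 0 / F ζh 0) * F ζh N + F ζ 0 * (F ζh N / F ζh 0) := by
    have := hFh N
    have := hFh 0
    field_simp
    ring
  have h3 : ‖F ζ N‖ ≤ ‖F ζ N / F ζh N - F ζ 0 / F ζh 0‖ * ‖F ζh N‖
      + ‖F ζ 0‖ * (‖F ζh N‖ / ‖F ζh 0‖) := by
    conv_lhs => rw [h2]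
    refine (norm_add_le _ _).trans (le_of_eq ?_)
    rw [norm_mul, norm_mul, norm_div]
  have h4 : ‖F ζh N‖ ≤ 1 := norm_bwd_le_one hB (hw1 ζh hζh1 N) N y
  rw [← hFN, ← hF0, ← hFN, ← hF0]
  have h5 : ‖F ζ N / F ζh N - F ζ 0 / F ζh 0‖ * ‖F ζh N‖
      ≤ ε * ∑ i ∈ Finset.range N, v i / β ^ 2 := by
    rw [← Finset.sum_div, ← mul_div_assoc]
    refine (mul_le_of_le_one_right (norm_nonneg _) h4).trans h1
  rw [← Finset.sum_div, ← mul_div_assoc] at h5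
  linarith

end Resonance

/-- The characteristic function near a resonant point is controlled by the one in which only few
sites carry a non-resonant phase. -/
theorem exists_resonance_bound {c G κ₀ : ℝ} (hc : 0 < c) (hc1 : c < 1) (hG1 : 1 ≤ G)
    (hκ₀ : 0 < κ₀) :
    ∃ A : ℝ, 0 < A ∧ ∃ κ : ℝ, 0 < κ ∧
      ∀ {ν : ℕ → Measure E} {k : ℕ → E → E → ℝ} {g : ℕ → E → ℤ} {ζ : ℕ → E → ℂ},
      IsBackwardKernel ν k c → (∀ n, Measurable (g n)) → (∀ n x, |(g n x : ℝ)| ≤ G) →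
      (∀ n, Measurable (ζ n)) → (∀ n x, ‖ζ n x‖ ≤ 1) → ∀ (N : ℕ) (y : E) {h s B W Q : ℝ},
      W = ∑ n ∈ Finset.range N, (ν n).real {x | g n x ≠ 0} →
      Q = ∑ n ∈ Finset.range N, (ν n).real {x | ζ n x ≠ 1} →
      |h| ≤ rad c G / 4 → 1 ≤ s → s ^ 3 ≤ W →
      ‖bwd ν k (fun n x => ζ n x * phase (h : ℂ) (g n) x) N y‖
        ≤ 2 * Real.exp (-(κ₀ * (Q + h ^ 2 * W))) →
      ‖bwd ν k (fun n => phase (h : ℂ) (g n)) N y‖ ≤ 2 * Real.exp (-(κ₀ * (h ^ 2 * W))) →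
      (∀ U ⊆ Finset.range N, (U.card : ℝ) ≤ A * s ^ 2 →
        ‖bwd ν k (fun n x => ζ n x * phase (if n ∈ U then (h : ℂ) else 0) (g n) x) N y‖ ≤ B) →
      ‖bwd ν k (fun n x => ζ n x * phase (h : ℂ) (g n) x) N y‖
        ≤ A * (Real.exp (-(κ * (h ^ 2 * W))) * B + W * Real.exp (-(κ * s))) := by
  set δ := rad c G with hδ'
  have hδ : 0 < δ := rad_pos hc hG1
  set η : ℝ := c ^ 3 / 1024 with hη
  have hη0 : 0 < η := by positivity
  set A₁ : ℝ := 108 / c ^ 2 with hA₁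
  set A₂ : ℝ := 432 * G / (c ^ 2 * δ) with hA₂
  set A₃ : ℝ := 432 / (c ^ 2 * δ) with hA₃
  have hA₁0 : 0 < A₁ := by positivity
  have hA₂0 : 0 < A₂ := by positivity
  have hA₃0 : 0 < A₃ := by positivity
  set L₀ : ℝ := 2 / c * (2 * (A₁ + A₂) + 1) with hL₀
  have hL₀0 : 0 < L₀ := by positivity
  set A₄ : ℝ := (2 * L₀ + 3) / η with hA₄
  have hA₄0 : 0 < A₄ := by positivity
  set A₅ : ℝ := 2 * Real.exp (A₃ + A₂ * A₄) with hA₅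
  have hA₅0 : 0 < A₅ := by positivity
  set A : ℝ := A₄ + A₅ + 32 * c⁻¹ + 2 with hA
  have hci : 0 < c⁻¹ := inv_pos.2 hc
  have hA0 : 0 < A := by positivity
  refine ⟨A, hA0, min κ₀ 1, lt_min hκ₀ one_pos, ?_⟩
  intro ν k g ζ hB hg hG hζ hζ1 N y h s B W Q hW hQ hh hs hsW hdec hdec0 hU
  have hW1 : 1 ≤ W := (one_le_pow₀ hs).trans hsW
  have hW0 : 0 ≤ W := by linarith
  have hQ0 : 0 ≤ Q := by rw [hQ]; exact Finset.sum_nonneg fun n _ => measureReal_nonneg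
  have hhW : 0 ≤ h ^ 2 * W := by positivity
  have hB0 : 0 ≤ B := (norm_nonneg _).trans (hU ∅ (by simp) (by simp; positivity))
  have hκs : Real.exp (-(κ₀ * s)) ≤ Real.exp (-(min κ₀ 1 * s)) := by
    refine Real.exp_le_exp.2 (neg_le_neg ?_)
    exact mul_le_mul_of_nonneg_right (min_le_left _ _) (by linarith)
  by_cases hcase : s ≤ Q + h ^ 2 * W
  · have h1 : Real.exp (-(κ₀ * (Q + h ^ 2 * W))) ≤ Real.exp (-(κ₀ * s)) :=
      Real.exp_le_exp.2 (neg_le_neg (mul_le_mul_of_nonneg_left hcase hκ₀.le))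
    have h2 : 2 * Real.exp (-(min κ₀ 1 * s)) ≤ A * (W * Real.exp (-(min κ₀ 1 * s))) := by
      rw [← mul_assoc]
      refine mul_le_mul_of_nonneg_right ?_ (Real.exp_pos _).le
      have : 2 ≤ A := by rw [hA]; linarith
      nlinarith
    have h3 : 0 ≤ A * (Real.exp (-(min κ₀ 1 * (h ^ 2 * W))) * B) := by positivity
    linarith [hdec]
  push Not at hcase
  have hQs : Q ≤ s := by linarith
  have hhs : h ^ 2 * W ≤ s := by linarith
  have hhs1 : h ^ 2 * s ^ 2 ≤ 1 := by
    have h1 : h ^ 2 * s ^ 3 ≤ s := (mul_le_mul_of_nonneg_left hsW (sq_nonneg h)).trans hhs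
    have h2 : h ^ 2 * s ^ 2 * s ≤ 1 * s := by rw [one_mul]; linarith [h1, pow_succ s 2]
    exact le_of_mul_le_mul_right h2 (by linarith)
  have hhs2 : |h| * s ≤ 1 := by
    refine abs_le_of_sq_le_sq' ?_ one_pos.le |>.2
    rw [mul_pow, sq_abs, one_pow]; exact hhs1
  classical
  set bad : Finset ℕ := {n ∈ Finset.range N | η < (ν n).real {x | ζ n x ≠ 1}} with hbad
  have hbadcard : (bad.card : ℝ) * η ≤ Q := by
    have h1 : ∑ n ∈ bad, η ≤ ∑ n ∈ bad, (ν n).real {x | ζ n x ≠ 1} :=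
      Finset.sum_le_sum fun n hn => (Finset.mem_filter.1 hn).2.le
    rw [Finset.sum_const, nsmul_eq_mul] at h1
    refine h1.trans ?_
    rw [hQ]
    exact Finset.sum_le_sum_of_subset_of_nonneg (Finset.filter_subset _ _)
      fun n _ _ => measureReal_nonneg
  set L : ℕ := ⌈L₀ * s⌉₊ with hL
  have hLge : L₀ * s ≤ L := Nat.le_ceil _
  have hLle : (L : ℝ) ≤ (L₀ + 1) * s := by
    have := (Nat.ceil_lt_add_one (show 0 ≤ L₀ * s by positivity)).le
    rw [← hL] at this
    linarith
  set U : Finset ℕ := {n ∈ Finset.range N | ∃ b ∈ bad, b ≤ n + L ∧ n ≤ b + L} with hUdef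
  have hUcard : (U.card : ℝ) ≤ A₄ * s ^ 2 := by
    have h1 : U ⊆ bad.biUnion fun b => Finset.Icc (b - L) (b + L) := by
      intro n hn
      obtain ⟨-, b, hb, h2, h3⟩ := Finset.mem_filter.1 hn
      exact Finset.mem_biUnion.2 ⟨b, hb, Finset.mem_Icc.2 ⟨by omega, h3⟩⟩
    have h2 : U.card ≤ bad.card * (2 * L + 1) := by
      refine (Finset.card_le_card h1).trans (Finset.card_biUnion_le_card_mul _ _ _ fun b _ => ?_)
      rw [Nat.card_Icc]; omega
    have h3 : (U.card : ℝ) ≤ bad.card * (2 * L + 1) := by exact_mod_cast h2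
    have h4 : (bad.card : ℝ) ≤ s / η := by
      rw [le_div_iff₀ hη0]; linarith
    have h5 : (2 * (L : ℝ) + 1) ≤ (2 * L₀ + 3) * s := by linarith
    calc (U.card : ℝ) ≤ bad.card * (2 * L + 1) := h3
      _ ≤ s / η * ((2 * L₀ + 3) * s) := by gcongr
      _ = A₄ * s ^ 2 := by rw [hA₄]; ring
  set ζh : ℕ → E → ℂ := fun n => if n ∈ bad then fun _ => 1 else ζ n with hζhdef
  have hζh : ∀ n, Measurable (ζh n) := fun n => by
    simp only [ζh]; split_ifs; exacts [measurable_const, hζ n]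
  have hζh1 : ∀ n x, ‖ζh n x‖ ≤ 1 := fun n x => by
    simp only [ζh]; split_ifs; exacts [by simp, hζ1 n x]
  have hqh : ∀ n, (ν n).real {x | ζh n x ≠ 1} ≤ (ν n).real {x | ζ n x ≠ 1} := fun n => by
    simp only [ζh]; split_ifs
    · simp
    · exact le_rfl
  have hqη : ∀ n < N, (ν n).real {x | ζh n x ≠ 1} ≤ η := fun n hn => by
    by_cases hb : n ∈ bad
    · simp [ζh, hb, hη0.le]
    · have h1 : ¬ η < (ν n).real {x | ζ n x ≠ 1} := fun h2 =>
        hb (Finset.mem_filter.2 ⟨Finset.mem_range.2 hn, h2⟩)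
      simp only [ζh, hb, if_false]
      exact not_lt.1 h1
  set Qh := ∑ n ∈ Finset.range N, (ν n).real {x | ζh n x ≠ 1} with hQh
  have hQhQ : Qh ≤ s := (Finset.sum_le_sum fun n _ => hqh n).trans (hQ ▸ hQs)
  have hag : ∀ n < N, ¬ n ∈ U → ∀ i < N, n ≤ i + L → i ≤ n + L → ζ i = ζh i := by
    intro n hn hnU i hi h1 h2
    have hib : i ∉ bad := fun hib =>
      hnU (Finset.mem_filter.2 ⟨Finset.mem_range.2 hn, i, hib, h2, h1⟩)
    simp [ζh, hib]
  set β := Real.exp (-((A₁ + A₂) * s)) with hβ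
  have hlow : ∀ n : ℕ, β ≤ ‖bwd ν k
      (fun i x => ζh i x * phase (if i ∈ U ∨ i < n then (h : ℂ) else 0) (g i) x) N y‖ := by
    intro n
    refine le_trans (Real.exp_le_exp.2 (neg_le_neg ?_))
      (norm_bwd_mul_phase_ite_ge hB hg hG1 hG hζh hζh1 N hqη y hh fun i => i ∈ U ∨ i < n)
    rw [← hW, ← hQh, add_mul]
    exact add_le_add (mul_le_mul_of_nonneg_left hQhQ hA₁0.le)
      (mul_le_mul_of_nonneg_left hhs hA₂0.le)
  have h1 := norm_bwd_le_of_switch hB hg hG1 hG hζ hζ1 hζh hζh1 N hqη y hh (fun n => n ∈ U) hag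
    (Real.exp_pos _) hlow
  have h2 := norm_bwd_mul_phase_le hB hg hG1 hG hζh hζh1 N hqη y hh fun n => n ∈ U
  have h3 := norm_bwd_phase_ite_ge hB hg hG1 hG N y hh fun n => n ∈ U
  have h4 := hU U (Finset.filter_subset _ _) (hUcard.trans (by
    refine mul_le_mul_of_nonneg_right ?_ (by positivity)
    rw [hA]; linarith))
  set F₀ := ‖bwd ν k (fun i x => ζ i x * phase (if i ∈ U then (h : ℂ) else 0) (g i) x) N y‖
  set Fh := ‖bwd ν k (fun i x => ζh i x * phase (h : ℂ) (g i) x) N y‖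
  set Fh₀ := ‖bwd ν k (fun i x => ζh i x * phase (if i ∈ U then (h : ℂ) else 0) (g i) x) N y‖
    with hFh₀
  set D := ‖bwd ν k (fun n => phase (h : ℂ) (g n)) N y‖
  set D₀ := ‖bwd ν k (fun n => phase (if n ∈ U then (h : ℂ) else 0) (g n)) N y‖
  have hFh₀0 : 0 < Fh₀ := by
    have := hlow 0
    simp only [Nat.not_lt_zero, or_false] at this
    exact (Real.exp_pos _).trans_le this
  have hD₀ : Real.exp (-(A₂ * A₄)) ≤ D₀ := by
    refine le_trans (Real.exp_le_exp.2 (neg_le_neg ?_)) h3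
    refine mul_le_mul_of_nonneg_left ?_ hA₂0.le
    have h5 : ∑ n ∈ Finset.range N with n ∈ U, (ν n).real {x | g n x ≠ 0} ≤ U.card := by
      calc ∑ n ∈ Finset.range N with n ∈ U, (ν n).real {x | g n x ≠ 0}
          ≤ ∑ n ∈ Finset.range N with n ∈ U, (1 : ℝ) :=
            Finset.sum_le_sum fun n _ => by
              have := hB.prob n
              exact measureReal_le_one
        _ ≤ U.card := by
          rw [Finset.sum_const, nsmul_eq_mul, mul_one]
          exact_mod_cast Finset.card_le_card fun n hn => (Finset.mem_filter.1 hn).2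
    calc h ^ 2 * ∑ n ∈ Finset.range N with n ∈ U, (ν n).real {x | g n x ≠ 0}
        ≤ h ^ 2 * (A₄ * s ^ 2) := mul_le_mul_of_nonneg_left (h5.trans hUcard) (sq_nonneg h)
      _ = A₄ * (h ^ 2 * s ^ 2) := by ring
      _ ≤ A₄ := mul_le_of_le_one_right hA₄0.le hhs1
  have hratio : Fh / Fh₀ ≤ A₅ * Real.exp (-(κ₀ * (h ^ 2 * W))) := by
    rw [div_le_iff₀ hFh₀0]
    have h5 : Real.exp (A₃ * (|h| * Qh)) ≤ Real.exp A₃ := by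
      refine Real.exp_le_exp.2 (mul_le_of_le_one_right hA₃0.le ?_)
      exact (mul_le_mul_of_nonneg_left hQhQ (abs_nonneg h)).trans hhs2
    have h6 : Fh * Real.exp (-(A₂ * A₄))
        ≤ Fh₀ * (2 * Real.exp (-(κ₀ * (h ^ 2 * W)))) * Real.exp A₃ :=
      calc Fh * Real.exp (-(A₂ * A₄)) ≤ Fh * D₀ :=
            mul_le_mul_of_nonneg_left hD₀ (norm_nonneg _)
        _ ≤ Fh₀ * D * Real.exp (A₃ * (|h| * Qh)) := h2
        _ ≤ _ := by gcongr
    have h7 : Fh = Fh * Real.exp (-(A₂ * A₄)) * Real.exp (A₂ * A₄) := by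
      rw [mul_assoc, ← Real.exp_add, neg_add_cancel, Real.exp_zero, mul_one]
    rw [h7, hA₅, Real.exp_add]
    refine (mul_le_mul_of_nonneg_right h6 (Real.exp_pos _).le).trans (le_of_eq (by ring))
  have hκ1 : Real.exp (-(κ₀ * (h ^ 2 * W))) ≤ Real.exp (-(min κ₀ 1 * (h ^ 2 * W))) :=
    Real.exp_le_exp.2 (neg_le_neg (mul_le_mul_of_nonneg_right (min_le_left _ _) hhW))
  have hκ2 : Real.exp (-s) ≤ Real.exp (-(min κ₀ 1 * s)) := by
    refine Real.exp_le_exp.2 (neg_le_neg ?_)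
    have := mul_le_mul_of_nonneg_right (min_le_right κ₀ 1) (show 0 ≤ s by linarith)
    linarith
  have hpow : (1 - c / 2) ^ L / β ^ 2 ≤ Real.exp (-s) := by
    rw [div_le_iff₀ (by positivity)]
    have h5 : (1 - c / 2) ^ L ≤ Real.exp (-(c / 2 * L)) := by
      have h6 : 1 - c / 2 ≤ Real.exp (-(c / 2)) := by
        have := Real.add_one_le_exp (-(c / 2)); linarith
      calc (1 - c / 2) ^ L ≤ Real.exp (-(c / 2)) ^ L := pow_le_pow_left₀ (by linarith) h6 L
        _ = _ := by rw [← Real.exp_nat_mul]; ring_nf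
    refine h5.trans ?_
    rw [hβ, ← Real.exp_nat_mul, ← Real.exp_add]
    refine Real.exp_le_exp.2 ?_
    have h6 : c / 2 * (L₀ * s) ≤ c / 2 * L := mul_le_mul_of_nonneg_left hLge (by linarith)
    have h7 : c / 2 * (L₀ * s) = (2 * (A₁ + A₂) + 1) * s := by rw [hL₀]; field_simp
    push_cast
    linarith
  have herr : 32 * c⁻¹ * (1 - c / 2) ^ L * (|h| * G)
      * (∑ n ∈ Finset.range N, (ν n).real {x | g n x ≠ 0}) / β ^ 2
      ≤ 32 * c⁻¹ * (W * Real.exp (-(min κ₀ 1 * s))) := by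
    rw [← hW]
    have h5 : |h| * G ≤ 1 := by
      have := (norm_mul_le_of_mem_ball hG1 (ofReal_mem_ball hδ hh)).trans (cube_div_le_one hB)
      rwa [Complex.norm_real, Real.norm_eq_abs] at this
    have h6 : 0 ≤ (1 - c / 2) ^ L / β ^ 2 :=
      div_nonneg (pow_nonneg (by linarith) _) (by positivity)
    calc 32 * c⁻¹ * (1 - c / 2) ^ L * (|h| * G) * W / β ^ 2
        = 32 * c⁻¹ * (W * ((1 - c / 2) ^ L / β ^ 2 * (|h| * G))) := by ring
      _ ≤ 32 * c⁻¹ * (W * (Real.exp (-(min κ₀ 1 * s)) * 1)) := by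
        gcongr
        exact hpow.trans hκ2
      _ = _ := by ring
  have hmain : F₀ * (Fh / Fh₀) ≤ A₅ * (Real.exp (-(min κ₀ 1 * (h ^ 2 * W))) * B) :=
    calc F₀ * (Fh / Fh₀) ≤ B * (A₅ * Real.exp (-(min κ₀ 1 * (h ^ 2 * W)))) :=
          mul_le_mul h4 (hratio.trans (mul_le_mul_of_nonneg_left hκ1 hA₅0.le))
            (by positivity) hB0
      _ = _ := by ring
  set e₁ := Real.exp (-(min κ₀ 1 * (h ^ 2 * W))) * B with he₁
  set e₂ := W * Real.exp (-(min κ₀ 1 * s)) with he₂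
  have he₁0 : 0 ≤ e₁ := by positivity
  have he₂0 : 0 ≤ e₂ := by positivity
  have h8 : A₅ * e₁ ≤ A * e₁ := mul_le_mul_of_nonneg_right (by rw [hA]; linarith) he₁0
  have h9 : 32 * c⁻¹ * e₂ ≤ A * e₂ := mul_le_mul_of_nonneg_right (by rw [hA]; linarith) he₂0
  rw [mul_add]
  linarith

section

/-! ### Decay of characteristic functions -/

lemma exists_pos_forall_le_of_finset {ι : Type*} (s : Finset ι) {p : ι → ℝ → Prop}
    (hp : ∀ i ∈ s, ∃ a : ℝ, 0 < a ∧ ∀ b, 0 < b → b ≤ a → p i b) :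
    ∃ a : ℝ, 0 < a ∧ ∀ i ∈ s, p i a := by
  have h : ∀ i ∈ s, ∀ᶠ b in 𝓝[>] (0 : ℝ), p i b := by
    intro i hi
    obtain ⟨a, ha, hb⟩ := hp i hi
    filter_upwards [Ioc_mem_nhdsGT ha] with b hb'
    exact hb b hb'.1 hb'.2
  have h1 : ∀ᶠ b in 𝓝[>] (0 : ℝ), ∀ i ∈ s, p i b := (Finset.eventually_all s).2 h
  obtain ⟨b, hb⟩ := (h1.and self_mem_nhdsWithin).exists
  exact ⟨b, hb.2, hb.1⟩

/-- Lower bound for `1 - cos` near a point `t₀`, with the resonant values of `g` separated. -/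
lemma exists_le_one_sub_cos (G : ℕ) (t₀ : ℝ) :
    ∃ κ : ℝ, 0 < κ ∧ ∀ h : ℝ, |h| ≤ κ → ∀ g : ℤ, |g| ≤ G →
      (Real.cos (t₀ * g) ≠ 1 → κ * (1 + h ^ 2) ≤ 1 - Real.cos ((t₀ + h) * g)) ∧
      (g ≠ 0 → κ * h ^ 2 ≤ 1 - Real.cos ((t₀ + h) * g)) := by
  have key := exists_pos_forall_le_of_finset (Finset.Icc (-(G : ℤ)) G)
    (p := fun g κ => ∀ h : ℝ, |h| ≤ κ →
      (Real.cos (t₀ * g) ≠ 1 → κ * (1 + h ^ 2) ≤ 1 - Real.cos ((t₀ + h) * g)) ∧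
      (g ≠ 0 → κ * h ^ 2 ≤ 1 - Real.cos ((t₀ + h) * g))) ?_
  · obtain ⟨κ, hκ, H⟩ := key
    exact ⟨κ, hκ, fun h hh g hg => H g (by rw [Finset.mem_Icc]; exact abs_le.1 hg) h hh⟩
  intro g _
  by_cases hg : g = 0
  · exact ⟨1, one_pos, fun b _ _ h _ => by subst hg; simp⟩
  by_cases hc : Real.cos (t₀ * g) = 1
  · have hg1 : (1 : ℝ) ≤ |(g : ℝ)| := by
      rw [← Int.cast_abs]; exact_mod_cast Int.one_le_abs hg
    refine ⟨min (2 / Real.pi ^ 2) (Real.pi / |(g : ℝ)|), by positivity, fun b hb hba h hh => ⟨fun h' => (h' hc).elim, fun _ => ?_⟩⟩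
    obtain ⟨n, hn⟩ := (Real.cos_eq_one_iff _).1 hc
    have e : (t₀ + h) * g = h * g + n * (2 * Real.pi) := by rw [hn]; ring
    rw [e, Real.cos_add_int_mul_two_pi]
    have hy : |h * g| ≤ Real.pi := by
      rw [abs_mul]
      have := hh.trans (hba.trans (min_le_right _ _))
      rwa [le_div_iff₀ (by positivity)] at this
    have h1 := Real.cos_le_one_sub_mul_cos_sq hy
    have h2 : h ^ 2 ≤ (h * g) ^ 2 := by
      rw [mul_pow, ← sq_abs (g : ℝ)]
      exact le_mul_of_one_le_right (sq_nonneg _) (one_le_pow₀ hg1)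
    have h3 : b * h ^ 2 ≤ 2 / Real.pi ^ 2 * (h * g) ^ 2 :=
      mul_le_mul (hba.trans (min_le_left _ _)) h2 (sq_nonneg _) (by positivity)
    linarith
  · have hc' : 0 < 1 - Real.cos (t₀ * g) := by
      have := lt_of_le_of_ne (Real.cos_le_one (t₀ * g)) hc
      linarith
    have hcont : Continuous fun h : ℝ => 1 - Real.cos ((t₀ + h) * g) := by fun_prop
    have h0 : ∀ᶠ h in 𝓝 (0 : ℝ), (1 - Real.cos (t₀ * g)) / 2 < 1 - Real.cos ((t₀ + h) * g) := by
      refine hcont.continuousAt.eventually (lt_mem_nhds ?_)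
      simp only [add_zero]; linarith
    obtain ⟨d, hd, hd'⟩ := Metric.eventually_nhds_iff.1 h0
    refine ⟨min (min (d / 2) 1) ((1 - Real.cos (t₀ * g)) / 4), by positivity, fun b hb hba h hh => ?_⟩
    have hb1 : b ≤ 1 := hba.trans ((min_le_left _ _).trans (min_le_right _ _))
    have hb2 : b ≤ d / 2 := hba.trans ((min_le_left _ _).trans (min_le_left _ _))
    have hb3 := hba.trans (min_le_right _ _)
    have h1 := @hd' h (by rw [Real.dist_eq, sub_zero]; linarith)
    have h2 : h ^ 2 ≤ 1 := by rw [← sq_abs]; exact pow_le_one₀ (abs_nonneg _) (hh.trans hb1)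
    have h3 : b * (1 + h ^ 2) ≤ 1 - Real.cos ((t₀ + h) * g) := by nlinarith
    exact ⟨fun _ => h3, fun _ => by nlinarith⟩

lemma exists_le_one_sub_cos_of_isCompact (G : ℕ) {T : Set ℝ} (hT : IsCompact T)
    (h : ∀ t ∈ T, ∀ g : ℤ, g ≠ 0 → |g| ≤ G → Real.cos (t * g) ≠ 1) :
    ∃ κ : ℝ, 0 < κ ∧ ∀ t ∈ T, ∀ g : ℤ, g ≠ 0 → |g| ≤ G → κ ≤ 1 - Real.cos (t * g) := by
  have key := exists_pos_forall_le_of_finset (Finset.Icc (-(G : ℤ)) G)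
    (p := fun g κ => ∀ t ∈ T, g ≠ 0 → κ ≤ 1 - Real.cos (t * g)) ?_
  · obtain ⟨κ, hκ, H⟩ := key
    exact ⟨κ, hκ, fun t ht g hg0 hg => H g (by rw [Finset.mem_Icc]; exact abs_le.1 hg) t ht hg0⟩
  intro g hgm
  have hgG : |g| ≤ G := abs_le.2 (Finset.mem_Icc.1 hgm)
  by_cases hg : g = 0
  · exact ⟨1, one_pos, fun _ _ _ _ _ h => (h hg).elim⟩
  rcases T.eq_empty_or_nonempty with rfl | hne
  · exact ⟨1, one_pos, fun _ _ _ _ h => h.elim⟩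
  obtain ⟨t₀, ht₀, hmin⟩ := hT.exists_isMinOn hne
    (f := fun t : ℝ => 1 - Real.cos (t * g)) (by fun_prop)
  refine ⟨1 - Real.cos (t₀ * g), ?_, fun b _ hb t ht _ => hb.trans (hmin ht)⟩
  have := lt_of_le_of_ne (Real.cos_le_one (t₀ * g)) (h t₀ ht₀ g hg hgG)
  linarith

variable {ν : ℕ → Measure E} {k : ℕ → E → E → ℝ} {c : ℝ} {g : ℕ → E → ℤ} {G : ℕ}

lemma setOf_eq_zero_le_phase (n : ℕ) (z : ℂ) :
    {x | g n x = 0} ⊆ {x | phase z (g n) x = 1} := fun _ hx => phase_of_eq_zero hx z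

lemma phase_ne_one_iff (t : ℝ) (g : E → ℤ) (x : E) :
    phase (t : ℂ) g x ≠ 1 ↔ Real.cos (t * g x) ≠ 1 := by
  rw [not_iff_not]
  constructor
  · intro h; rw [← phase_re_ofReal, h, Complex.one_re]
  · intro h
    have h1 : Real.sin (t * g x) = 0 := by
      have := Real.sin_sq_add_cos_sq (t * g x); rw [h] at this
      have : Real.sin (t * g x) ^ 2 = 0 := by linarith
      exact pow_eq_zero_iff (two_ne_zero) |>.1 this
    have e : phase (t : ℂ) g x = Complex.exp (((t * g x : ℝ) : ℂ) * Complex.I) := by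
      unfold phase; congr 1; push_cast; ring
    rw [e, Complex.exp_mul_I, ← Complex.ofReal_cos, ← Complex.ofReal_sin, h, h1]; simp

lemma measureReal_le_integral_of_indicator {ν : Measure E} [IsProbabilityMeasure ν] {A B : Set E}
    (hA : MeasurableSet A) (hB : MeasurableSet B) {a b : ℝ} {u : E → ℝ} (hu : Integrable u ν)
    (h : ∀ x, A.indicator (fun _ => a) x + B.indicator (fun _ => b) x ≤ u x) :
    a * ν.real A + b * ν.real B ≤ ∫ x, u x ∂ν := by
  have e : ∫ x, (A.indicator (fun _ => a) x + B.indicator (fun _ => b) x) ∂ν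
      = a * ν.real A + b * ν.real B := by
    rw [integral_add ((integrable_const a).indicator hA) ((integrable_const b).indicator hB),
      integral_indicator_const _ hA, integral_indicator_const _ hB]
    simp [mul_comm]
  rw [← e]
  exact integral_mono (((integrable_const a).indicator hA).add ((integrable_const b).indicator hB))
    hu h

/-- Decay of the characteristic function near a point `t₀`. -/
lemma exists_norm_bwd_phase_le_near (G : ℕ) {c a : ℝ} (hc : 0 < c) (ha0 : 0 < a) (t₀ : ℝ) :
    ∃ κ : ℝ, 0 < κ ∧ ∀ {ν : ℕ → Measure E} {k : ℕ → E → E → ℝ} {g : ℕ → E → ℤ},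
      IsBackwardKernel ν k c → (∀ n, Measurable (g n)) → (∀ n x, |g n x| ≤ G) →
      (∀ n, a ≤ (ν n).real {x | g n x = 0}) → ∀ (N : ℕ) (y : E) (h : ℝ), |h| ≤ κ →
      ‖bwd ν k (fun n => phase ((t₀ + h : ℝ) : ℂ) (g n)) N y‖ ≤ 2 * Real.exp (-(κ *
        (∑ n ∈ Finset.range N, (ν n).real {x | phase (t₀ : ℂ) (g n) x ≠ 1} +
          h ^ 2 * ∑ n ∈ Finset.range N, (ν n).real {x | g n x ≠ 0}))) := by
  obtain ⟨κ, hκ, H⟩ := exists_le_one_sub_cos G t₀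
  refine ⟨min κ (c ^ 2 * a / 2 * κ), by positivity, ?_⟩
  intro ν k g hB hg hG ha N y h hh
  have hprob := hB.prob
  have hm := fun n => measurable_phase (hg n) ((t₀ + h : ℝ) : ℂ)
  refine (norm_bwd_le_exp (a := a) hB hm (fun n x => (norm_phase_ofReal _ _).le)
    (fun n => (ha n).trans (measureReal_mono (setOf_eq_zero_le_phase n _))) N y).trans ?_
  refine mul_le_mul_of_nonneg_left (Real.exp_le_exp.2 (neg_le_neg ?_)) zero_le_two
  have h1 : ∀ n, κ * (ν n).real {x | phase (t₀ : ℂ) (g n) x ≠ 1} +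
      (κ * h ^ 2) * (ν n).real {x | g n x ≠ 0}
      ≤ ∫ x, (1 - (phase ((t₀ + h : ℝ) : ℂ) (g n) x).re) ∂ν n := by
    intro n
    refine measureReal_le_integral_of_indicator
      ((measurable_phase (hg n) _) (measurableSet_singleton 1).compl)
      ((hg n) (measurableSet_singleton 0).compl)
      ((integrable_const 1).sub (BddMeas.integrable_re (.of_norm_le (hm n)
        (fun x => (norm_phase_ofReal _ _).le)) _)) fun x => ?_
    obtain ⟨h2, h3⟩ := H h (hh.trans (min_le_left _ _)) (g n x) (hG n x)
    rw [phase_re_ofReal]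
    by_cases e1 : phase (t₀ : ℂ) (g n) x = 1
    · rw [Set.indicator_of_notMem (by simp [e1])]
      by_cases e2 : g n x = 0
      · rw [Set.indicator_of_notMem (by simp [e2]), e2]; simp
      · rw [Set.indicator_of_mem (by simpa using e2), zero_add]; exact h3 e2
    · have e2 : g n x ≠ 0 := fun e2 => e1 (phase_of_eq_zero e2 _)
      rw [Set.indicator_of_mem (by simpa using e1), Set.indicator_of_mem (by simpa using e2)]
      have := h2 ((phase_ne_one_iff t₀ (g n) x).1 e1)
      linarith
  have h2 := Finset.sum_le_sum fun n (_ : n ∈ Finset.range N) => h1 n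
  rw [Finset.sum_add_distrib, ← Finset.mul_sum, ← Finset.mul_sum] at h2
  have h3 : 0 ≤ ∑ n ∈ Finset.range N, (ν n).real {x | phase (t₀ : ℂ) (g n) x ≠ 1} +
          h ^ 2 * ∑ n ∈ Finset.range N, (ν n).real {x | g n x ≠ 0} := by positivity
  calc _ ≤ (c ^ 2 * a / 2 * κ) * _ := mul_le_mul_of_nonneg_right (min_le_right _ _) h3
    _ = c ^ 2 * a / 2 * (κ * ∑ n ∈ Finset.range N, (ν n).real {x | phase (t₀ : ℂ) (g n) x ≠ 1} +
          κ * h ^ 2 * ∑ n ∈ Finset.range N, (ν n).real {x | g n x ≠ 0}) := by ring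
    _ ≤ _ := mul_le_mul_of_nonneg_left h2 (by positivity)

/-- Decay of the characteristic function away from resonant points. -/
lemma exists_norm_bwd_phase_le_far (G : ℕ) {c a : ℝ} (hc : 0 < c) (ha0 : 0 < a) {T : Set ℝ}
    (hT : IsCompact T) (hTG : ∀ t ∈ T, ∀ g : ℤ, g ≠ 0 → |g| ≤ G → Real.cos (t * g) ≠ 1) :
    ∃ κ : ℝ, 0 < κ ∧ ∀ {ν : ℕ → Measure E} {k : ℕ → E → E → ℝ} {g : ℕ → E → ℤ},
      IsBackwardKernel ν k c → (∀ n, Measurable (g n)) → (∀ n x, |g n x| ≤ G) →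
      (∀ n, a ≤ (ν n).real {x | g n x = 0}) → ∀ (N : ℕ) (y : E), ∀ t ∈ T,
      ‖bwd ν k (fun n => phase (t : ℂ) (g n)) N y‖ ≤ 2 * Real.exp (-(κ *
        ∑ n ∈ Finset.range N, (ν n).real {x | g n x ≠ 0})) := by
  obtain ⟨κ, hκ, H⟩ := exists_le_one_sub_cos_of_isCompact G hT hTG
  refine ⟨c ^ 2 * a / 2 * κ, by positivity, ?_⟩
  intro ν k g hB hg hG ha N y t ht
  have hprob := hB.prob
  have hm := fun n => measurable_phase (hg n) (t : ℂ)
  refine (norm_bwd_le_exp (a := a) hB hm (fun n x => (norm_phase_ofReal _ _).le)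
    (fun n => (ha n).trans (measureReal_mono (setOf_eq_zero_le_phase n _))) N y).trans ?_
  refine mul_le_mul_of_nonneg_left (Real.exp_le_exp.2 (neg_le_neg ?_)) zero_le_two
  rw [mul_assoc (c ^ 2 * a / 2), Finset.mul_sum]
  refine mul_le_mul_of_nonneg_left (Finset.sum_le_sum fun n _ => ?_) (by positivity)
  have := measureReal_le_integral_of_indicator (ν := ν n) (A := ∅) (a := 0) (b := κ)
    MeasurableSet.empty ((hg n) (measurableSet_singleton 0).compl)
      ((integrable_const 1).sub (BddMeas.integrable_re (.of_norm_le (hm n)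
        (fun x => (norm_phase_ofReal _ _).le)) _)) fun x => ?_
  · rw [zero_mul, zero_add] at this
    exact this
  · rw [Set.indicator_of_notMem (by simp), zero_add, Pi.sub_apply, phase_re_ofReal]
    by_cases e2 : g n x = 0
    · rw [Set.indicator_of_notMem (by simp [e2]), e2]; simp
    · rw [Set.indicator_of_mem (by simpa using e2)]; exact H t ht _ e2 (hG n x)

end

section

/-! ### Small sets of non-resonant sites -/

/-- `Q` is the law on path space whose product moments are computed by the backward operators. -/
def IsPathLaw (ν : ℕ → Measure E) (k : ℕ → E → E → ℝ) (N : ℕ) (Q : Measure (ℕ → E)) : Prop :=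
  IsProbabilityMeasure Q ∧ ∀ w : ℕ → E → ℂ, (∀ n, BddMeas (w n)) → ∀ y,
    ∫ x, ∏ i ∈ Finset.range N, w i (x i) ∂Q = bwd ν k w N y

variable {ν : ℕ → Measure E} {k : ℕ → E → E → ℝ} {c : ℝ} {g : ℕ → E → ℤ} {ζ : ℕ → E → ℂ} {N : ℕ}
  {Q : Measure (ℕ → E)}

lemma prod_phase_ite (z : ℂ) {U : Finset ℕ} (hU : U ⊆ Finset.range N) (x : ℕ → E) :
    ∏ i ∈ Finset.range N, phase (if i ∈ U then z else 0) (g i) (x i)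
      = Complex.exp (Complex.I * z * ∑ i ∈ U, (g i (x i) : ℂ)) := by
  rw [Finset.mul_sum, Complex.exp_sum, ← Finset.prod_subset hU]
  · exact Finset.prod_congr rfl fun i hi => by rw [if_pos hi]; rfl
  · intro i _ hi; rw [if_neg hi, phase_zero]

/-- Taylor expansion of the characteristic function in the variable attached to a set `U`. -/
lemma norm_bwd_phase_ite_le_of_moments (hQ : IsPathLaw ν k N Q) (hg : ∀ n, Measurable (g n))
    {G : ℝ} (hG1 : 1 ≤ G) (hG : ∀ n x, |(g n x : ℝ)| ≤ G) (hζ : ∀ n, Measurable (ζ n))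
    (hζ1 : ∀ n x, ‖ζ n x‖ ≤ 1) {r : ℕ} {τ : ℝ} (hτ0 : 0 ≤ τ)
    (hτ : ∀ j < r, ∀ p : Fin j → ℕ, (∀ a, p a < N) →
      ‖∫ x, (∏ i ∈ Finset.range N, ζ i (x i)) * ∏ a, (g (p a) (x (p a)) : ℂ) ∂Q‖ ≤ τ)
    (y : E) (h : ℝ) {U : Finset ℕ} (hU : U ⊆ Finset.range N) :
    ‖bwd ν k (fun n x => ζ n x * phase (if n ∈ U then (h : ℂ) else 0) (g n) x) N y‖
      ≤ (r + G ^ r * Real.exp G + 1) * (τ + (|h| * U.card) ^ r) := by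
  have hQp := hQ.1
  have hm : ∀ n, Measurable fun x => ζ n x * phase (if n ∈ U then (h : ℂ) else 0) (g n) x :=
    fun n => (hζ n).mul (measurable_phase (hg n) _)
  have hn1 : ∀ n x, ‖ζ n x * phase (if n ∈ U then (h : ℂ) else 0) (g n) x‖ ≤ 1 := by
    intro n x
    rw [norm_mul]
    refine mul_le_one₀ (hζ1 n x) (norm_nonneg _) ?_
    split_ifs
    · exact (norm_phase_ofReal _ _).le
    · rw [phase_zero]; simp
  have hb : ∀ n, BddMeas fun x => ζ n x * phase (if n ∈ U then (h : ℂ) else 0) (g n) x :=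
    fun n => .of_norm_le (hm n) (hn1 n)
  rw [← hQ.2 _ hb y]
  set a : ℝ := |h| * U.card with ha
  have ha0 : 0 ≤ a := by positivity
  have hG0 : 0 ≤ G := by linarith
  by_cases ha1 : 1 ≤ a
  · have h1 : ‖∫ x, ∏ i ∈ Finset.range N, (ζ i (x i) *
        phase (if i ∈ U then (h : ℂ) else 0) (g i) (x i)) ∂Q‖ ≤ 1 := by
      refine (norm_integral_le_of_norm_le_const (C := 1) (ae_of_all _ fun x => ?_)).trans (by simp)
      rw [norm_prod]
      exact Finset.prod_le_one (fun _ _ => norm_nonneg _) fun i _ => hn1 i (x i)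
    have h2 : 1 ≤ a ^ r := one_le_pow₀ ha1
    have h3 : 0 ≤ G ^ r * Real.exp G := by positivity
    have h4 : (0 : ℝ) ≤ r := by positivity
    nlinarith
  push Not at ha1
  set Z : (ℕ → E) → ℂ := fun x => ∏ i ∈ Finset.range N, ζ i (x i) with hZ
  have hZm : Measurable Z := Finset.measurable_prod _ fun i _ => (hζ i).comp (measurable_pi_apply i)
  have hZ1 : ∀ x, ‖Z x‖ ≤ 1 := fun x => by
    rw [hZ]; simp only [norm_prod]
    exact Finset.prod_le_one (fun _ _ => norm_nonneg _) fun i _ => hζ1 i (x i)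
  set T : (ℕ → E) → ℝ := fun x => ∑ i ∈ U, (g i (x i) : ℝ) with hT
  have hgm : ∀ i, Measurable fun x : ℕ → E => (g i (x i) : ℝ) := fun i =>
    measurable_from_top.comp ((hg i).comp (measurable_pi_apply i))
  have hTm : Measurable T := Finset.measurable_sum _ fun i _ => hgm i
  have hT1 : ∀ x, |h * T x| ≤ G * a := fun x => by
    rw [abs_mul]
    have : |T x| ≤ U.card * G := by
      refine (Finset.abs_sum_le_sum_abs _ _).trans ?_
      exact (Finset.sum_le_sum fun i _ => hG i (x i)).trans (by simp)
    calc |h| * |T x| ≤ |h| * (U.card * G) := by gcongr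
      _ = G * a := by rw [ha]; ring
  have e1 : ∀ x : ℕ → E, ∏ i ∈ Finset.range N, (ζ i (x i) *
      phase (if i ∈ U then (h : ℂ) else 0) (g i) (x i))
      = ∑ j ∈ Finset.range r, ((Complex.I * h) ^ j / (j.factorial : ℂ)) * (Z x * (T x : ℂ) ^ j) +
        Z x * (Complex.exp ((h * T x : ℝ) * Complex.I) -
          ∑ j ∈ Finset.range r, ((h * T x : ℝ) * Complex.I) ^ j / j.factorial) := by
    intro x
    rw [Finset.prod_mul_distrib, prod_phase_ite _ hU, mul_sub]
    have e2 : ∑ j ∈ Finset.range r, ((Complex.I * h) ^ j / (j.factorial : ℂ)) * (Z x * (T x : ℂ) ^ j)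
        = ∑ j ∈ Finset.range r, Z x * (((h * T x : ℝ) * Complex.I) ^ j / j.factorial) :=
      Finset.sum_congr rfl fun j _ => by push_cast; ring
    rw [e2, ← Finset.mul_sum, add_sub_cancel]
    congr 2
    simp only [hT]; push_cast; ring
  have hTb : ∀ j : ℕ, Integrable (fun x => Z x * (T x : ℂ) ^ j) Q := by
    intro j
    refine Integrable.of_bound ((hZm.mul ((Complex.measurable_ofReal.comp hTm).pow_const j)).aestronglyMeasurable)
      ((U.card * G) ^ j) (ae_of_all _ fun x => ?_)
    rw [norm_mul, norm_pow, Complex.norm_real, Real.norm_eq_abs]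
    have : |T x| ≤ U.card * G := by
      refine (Finset.abs_sum_le_sum_abs _ _).trans ?_
      exact (Finset.sum_le_sum fun i _ => hG i (x i)).trans (by simp)
    calc ‖Z x‖ * |T x| ^ j ≤ 1 * (U.card * G) ^ j := by gcongr; exact hZ1 x
      _ = _ := one_mul _
  have hRm : Measurable fun x => Z x * (Complex.exp ((h * T x : ℝ) * Complex.I) -
          ∑ j ∈ Finset.range r, ((h * T x : ℝ) * Complex.I) ^ j / j.factorial) := by
    fun_prop
  have hRb : ∀ x, ‖Z x * (Complex.exp ((h * T x : ℝ) * Complex.I) -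
          ∑ j ∈ Finset.range r, ((h * T x : ℝ) * Complex.I) ^ j / j.factorial)‖ ≤ (G * a) ^ r * Real.exp G := by
    intro x
    rw [norm_mul]
    have hy : ‖((h * T x : ℝ) : ℂ) * Complex.I‖ ≤ G * a := by
      rw [norm_mul, Complex.norm_I, mul_one, Complex.norm_real]; exact hT1 x
    have hyG : G * a ≤ G := mul_le_of_le_one_right hG0 ha1.le
    calc _ ≤ 1 * (‖((h * T x : ℝ) : ℂ) * Complex.I‖ ^ r *
          Real.exp ‖((h * T x : ℝ) : ℂ) * Complex.I‖) :=
          mul_le_mul (hZ1 x) (Complex.norm_exp_sub_sum_le_norm_mul_exp _ _) (norm_nonneg _)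
            zero_le_one
      _ ≤ 1 * ((G * a) ^ r * Real.exp G) := by gcongr; exact hy.trans hyG
      _ = _ := one_mul _
  have hmom : ∀ j < r, ‖∫ x, Z x * (T x : ℂ) ^ j ∂Q‖ ≤ U.card ^ j * τ := by
    intro j hj
    have e3 : ∀ x, Z x * (T x : ℂ) ^ j = ∑ p ∈ Fintype.piFinset (fun _ : Fin j => U),
        Z x * ∏ a, (g (p a) (x (p a)) : ℂ) := by
      intro x
      rw [← Finset.mul_sum]
      congr 1
      simp only [hT]
      push_cast
      exact Finset.sum_pow' U (fun i => (g i (x i) : ℂ)) j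
    simp only [e3]
    rw [integral_finsetSum]
    · refine (norm_sum_le_of_le _ (fun p hp => hτ j hj p fun b => ?_)).trans ?_
      · exact Finset.mem_range.1 (hU (Fintype.mem_piFinset.1 hp b))
      · simp
    · intro p _
      refine Integrable.of_bound (hZm.mul (Finset.measurable_prod _ fun b _ =>
        measurable_from_top.comp ((hg _).comp (measurable_pi_apply _)))).aestronglyMeasurable
        (G ^ j) (ae_of_all _ fun x => ?_)
      rw [norm_mul]
      refine (mul_le_mul (hZ1 x) ?_ (norm_nonneg _) zero_le_one).trans (one_mul _).le
      rw [norm_prod]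
      calc _ ≤ ∏ _a : Fin j, G := by
            gcongr with b
            simpa using hG (p b) (x (p b))
        _ = _ := by simp
  simp only [e1]
  rw [integral_add (integrable_finsetSum _ fun j _ => (hTb j).const_mul _)
    (Integrable.of_bound hRm.aestronglyMeasurable _ (ae_of_all _ hRb)),
    integral_finsetSum _ fun j _ => (hTb j).const_mul _]
  refine (norm_add_le _ _).trans ?_
  have h1 : ‖∑ j ∈ Finset.range r, ∫ x, ((Complex.I * h) ^ j / (j.factorial : ℂ)) *
      (Z x * (T x : ℂ) ^ j) ∂Q‖ ≤ r * τ := by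
    have h0 : (r : ℝ) * τ = ∑ _j ∈ Finset.range r, τ := by simp
    rw [h0]
    refine norm_sum_le_of_le _ fun j hj => ?_
    rw [integral_const_mul, norm_mul, norm_div, norm_pow, norm_mul, Complex.norm_I, one_mul,
      Complex.norm_real, Complex.norm_natCast, Real.norm_eq_abs]
    have hf : (1 : ℝ) ≤ j.factorial := by exact_mod_cast j.factorial_pos
    calc |h| ^ j / (j.factorial : ℝ) * ‖∫ x, Z x * (T x : ℂ) ^ j ∂Q‖
        ≤ |h| ^ j / 1 * (U.card ^ j * τ) := by
          gcongr
          exact hmom j (Finset.mem_range.1 hj)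
      _ = a ^ j * τ := by rw [ha, mul_pow]; ring
      _ ≤ 1 * τ := by gcongr; exact pow_le_one₀ ha0 ha1.le
      _ = τ := one_mul _
  have h2 := norm_integral_le_of_norm_le_const (μ := Q) (ae_of_all _ hRb)
  simp only [probReal_univ, mul_one] at h2
  rw [mul_pow, mul_right_comm] at h2
  have h3 : 0 ≤ a ^ r := by positivity
  have h4 : 0 ≤ G ^ r * Real.exp G := by positivity
  have h5 : (0 : ℝ) ≤ r := by positivity
  nlinarith [mul_nonneg h5 h3, mul_nonneg h4 hτ0]

end

/-! ### Contribution of a neighbourhood of a resonant point -/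

lemma exists_pow_mul_exp_neg_sq_le (r : ℕ) {κ : ℝ} (hκ : 0 < κ) :
    ∃ A : ℝ, 0 < A ∧ ∀ x : ℝ, 0 ≤ x →
      x ^ r * Real.exp (-(κ * x ^ 2)) ≤ A * Real.exp (-(κ / 2 * x ^ 2)) := by
  refine ⟨1 + r.factorial * (2 / κ) ^ r, by positivity, fun x hx => ?_⟩
  have h1 : x ^ r ≤ 1 + (x ^ 2) ^ r := by
    rcases le_total x 1 with h | h
    · have := pow_le_one₀ (n := r) hx h
      have : 0 ≤ (x ^ 2) ^ r := by positivity
      linarith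
    · have : x ^ r ≤ (x ^ 2) ^ r := pow_le_pow_left₀ hx (by nlinarith) r
      linarith
  have h2 := Real.pow_div_factorial_le_exp (κ / 2 * x ^ 2) (by positivity) r
  have hf : (0 : ℝ) < r.factorial := by exact_mod_cast r.factorial_pos
  have h3 : (x ^ 2) ^ r ≤ r.factorial * (2 / κ) ^ r * Real.exp (κ / 2 * x ^ 2) := by
    rw [div_le_iff₀ hf] at h2
    calc (x ^ 2) ^ r = (2 / κ) ^ r * (κ / 2 * x ^ 2) ^ r := by
          rw [← mul_pow]; congr 1; field_simp
      _ ≤ (2 / κ) ^ r * (Real.exp (κ / 2 * x ^ 2) * r.factorial) := by gcongr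
      _ = _ := by ring
  have h4 : 1 ≤ Real.exp (κ / 2 * x ^ 2) := Real.one_le_exp (by positivity)
  calc x ^ r * Real.exp (-(κ * x ^ 2))
      ≤ ((1 + r.factorial * (2 / κ) ^ r) * Real.exp (κ / 2 * x ^ 2)) *
        Real.exp (-(κ * x ^ 2)) := by gcongr; linarith
    _ = _ := by rw [mul_assoc, ← Real.exp_add]; ring_nf

lemma tendsto_pow_mul_exp_neg_mul (n : ℕ) {κ : ℝ} (hκ : 0 < κ) :
    Tendsto (fun s : ℝ => s ^ n * Real.exp (-(κ * s))) atTop (𝓝 0) := by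
  have := Real.tendsto_pow_mul_exp_neg_atTop_nhds_zero n
  have h2 := (this.comp (tendsto_id.const_mul_atTop hκ)).const_mul ((κ ^ n)⁻¹)
  rw [mul_zero] at h2
  refine h2.congr fun s => ?_
  simp only [Function.comp, id]
  rw [mul_pow]
  field_simp

lemma continuous_bwd_phase {ν : ℕ → Measure E} {k : ℕ → E → E → ℝ} {c : ℝ} {g : ℕ → E → ℤ}
    {G : ℝ} (hB : IsBackwardKernel ν k c) (hg : ∀ n, Measurable (g n))
    (hG : ∀ n x, |(g n x : ℝ)| ≤ G) (N : ℕ) (y : E) :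
    Continuous fun t : ℝ => bwd ν k (fun n => phase (t : ℂ) (g n)) N y := by
  have := (holBdd_bwd hB (fun n => holBdd_phase (hg n) (hG n)) N).2.1 y
  exact this.continuous.comp Complex.continuous_ofReal

set_option maxHeartbeats 400000 in
theorem exists_integral_norm_bwd_le {c a : ℝ} {G r : ℕ} (hc : 0 < c) (hc1 : c < 1) (ha : 0 < a)
    (hG1 : 1 ≤ G) (hr : 1 ≤ r) (t₀ : ℝ) :
    ∃ δ₀ : ℝ, 0 < δ₀ ∧ ∀ δ, 0 < δ → δ ≤ δ₀ → ∀ ε > 0, ∃ η > 0, ∃ W₀ : ℝ,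
      ∀ {ν : ℕ → Measure E} {k : ℕ → E → E → ℝ} {g : ℕ → E → ℤ} {N : ℕ} {Q : Measure (ℕ → E)},
      IsBackwardKernel ν k c → IsPathLaw ν k N Q → (∀ n, Measurable (g n)) →
      (∀ n x, |g n x| ≤ G) → (∀ n, a ≤ (ν n).real {x | g n x = 0}) → ∀ (y : E) {W : ℝ},
      W = ∑ n ∈ Finset.range N, (ν n).real {x | g n x ≠ 0} → W₀ ≤ W →
      (∀ j < r, ∀ p : Fin j → ℕ, (∀ b, p b < N) →
        ‖∫ x, (∏ i ∈ Finset.range N, phase (t₀ : ℂ) (g i) (x i)) *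
          ∏ b, (g (p b) (x (p b)) : ℂ) ∂Q‖ ≤ η * (√W)⁻¹ ^ (r - 1)) →
      ∫ h in (-δ)..δ, ‖bwd ν k (fun n => phase ((t₀ + h : ℝ) : ℂ) (g n)) N y‖
        ≤ ε * (√W)⁻¹ ^ r := by
  obtain ⟨κ₁, hκ₁, H₁⟩ := exists_norm_bwd_phase_le_near (E := E) G hc ha t₀
  obtain ⟨κ₂, hκ₂, H₂⟩ := exists_norm_bwd_phase_le_near (E := E) G hc ha 0
  have hG1' : (1 : ℝ) ≤ G := by exact_mod_cast hG1
  have hρ := rad_pos hc hG1'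
  obtain ⟨A, hA, κ, hκ, H⟩ := exists_resonance_bound (E := E) hc hc1 hG1' (lt_min hκ₁ hκ₂)
  obtain ⟨A₁, hA₁, hexp⟩ := exists_pow_mul_exp_neg_sq_le r hκ
  set D : ℝ := r + (G : ℝ) ^ r * Real.exp G + 1 with hD
  have hD0 : 0 < D := by positivity
  set I₀ : ℝ := √(Real.pi / (κ / 2)) with hI₀
  have hI₀0 : 0 < I₀ := by positivity
  refine ⟨min (min κ₁ κ₂) (rad c G / 4), by positivity, fun δ hδ hδ₀ ε hε => ?_⟩
  set η : ℝ := ε / (2 * (A * D * I₀)) with hη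
  have hη0 : 0 < η := by positivity
  have hlim : Tendsto (fun s : ℝ => A * D * I₀ * (A ^ r * A₁ * (s ^ (2 * r))⁻¹) +
      2 * δ * A * (s ^ (4 * r * r + 8 * r) * Real.exp (-(κ * s)))) atTop (𝓝 0) := by
    have h1 : Tendsto (fun s : ℝ => (s ^ (2 * r))⁻¹) atTop (𝓝 0) :=
      tendsto_inv_atTop_zero.comp (tendsto_pow_atTop (by omega))
    have h2 := tendsto_pow_mul_exp_neg_mul (4 * r * r + 8 * r) hκ
    have := ((h1.const_mul (A ^ r * A₁)).const_mul (A * D * I₀)).add (h2.const_mul (2 * δ * A))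
    simpa using this
  obtain ⟨s₀, hs₀⟩ := eventually_atTop.1 (hlim.eventually (gt_mem_nhds (half_pos hε)))
  refine ⟨η, hη0, (max s₀ 1) ^ (8 * r), ?_⟩
  intro ν k g N Q hB hQ hg hG hga y W hW hWW hτ
  have hm1 : 1 ≤ max s₀ 1 := le_max_right _ _
  have hW1 : 1 ≤ W := (one_le_pow₀ hm1).trans hWW
  have hW0 : 0 ≤ W := by linarith
  have hr8 : 8 * r ≠ 0 := by omega
  set s : ℝ := W ^ ((8 * r : ℕ) : ℝ)⁻¹ with hs
  have hsW : s ^ (8 * r) = W := Real.rpow_inv_natCast_pow hW0 hr8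
  have hs0 : 0 ≤ s := Real.rpow_nonneg hW0 _
  have hsm : max s₀ 1 ≤ s := by
    by_contra hlt
    push Not at hlt
    have := pow_lt_pow_left₀ hlt hs0 hr8
    linarith
  have hs1 : 1 ≤ s := hm1.trans hsm
  have hsp : 0 < s := by linarith
  set L : ℝ := √W with hL
  have hLs : L = s ^ (4 * r) := by
    rw [hL, ← hsW, show 8 * r = 4 * r * 2 by ring, pow_mul s (4 * r) 2, Real.sqrt_sq (by positivity)]
  have hL0 : 0 < L := by rw [hLs]; positivity
  have hLW : L ^ 2 = W := Real.sq_sqrt hW0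
  have hs3 : s ^ 3 ≤ W := by rw [← hsW]; exact pow_le_pow_right₀ hs1 (by omega)
  have hGr : ∀ n x, |(g n x : ℝ)| ≤ G := fun n x => by
    rw [← Int.cast_abs]; exact_mod_cast hG n x
  set τ : ℝ := η * L⁻¹ ^ (r - 1) with hτ'
  have hτ0 : 0 ≤ τ := by positivity
  have hpt : ∀ h ∈ Set.Icc (-δ) δ, ‖bwd ν k (fun n => phase ((t₀ + h : ℝ) : ℂ) (g n)) N y‖
      ≤ (A * D * (τ + A ^ r * A₁ * s ^ (2 * r) * L⁻¹ ^ r)) * Real.exp (-(κ / 2 * W) * h ^ 2)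
        + A * (W * Real.exp (-(κ * s))) := by
    intro h hh
    have hhδ : |h| ≤ δ := abs_le.2 hh
    have hh1 : |h| ≤ κ₁ := hhδ.trans (hδ₀.trans ((min_le_left _ _).trans (min_le_left _ _)))
    have hh2 : |h| ≤ κ₂ := hhδ.trans (hδ₀.trans ((min_le_left _ _).trans (min_le_right _ _)))
    have hh3 : |h| ≤ rad c G / 4 := hhδ.trans (hδ₀.trans (min_le_right _ _))
    have e1 : (fun n => phase ((t₀ + h : ℝ) : ℂ) (g n))
        = fun n x => phase (t₀ : ℂ) (g n) x * phase (h : ℂ) (g n) x := by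
      funext n x; rw [Complex.ofReal_add, phase_add]
    have hd1 := H₁ hB hg hG hga N y h hh1
    have hd2 := H₂ hB hg hG hga N y h hh2
    rw [← hW] at hd1 hd2
    simp only [Complex.ofReal_zero, phase_zero, ne_eq, not_true_eq_false, Set.ofPred_false,
      measureReal_empty, Finset.sum_const_zero, zero_add] at hd2
    rw [e1] at hd1 ⊢
    have hQ0 : 0 ≤ ∑ n ∈ Finset.range N, (ν n).real {x | phase (t₀ : ℂ) (g n) x ≠ 1} :=
      Finset.sum_nonneg fun n _ => measureReal_nonneg
    have hhW : 0 ≤ h ^ 2 * W := by positivity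
    have key := H hB hg hGr (ζ := fun n => phase (t₀ : ℂ) (g n)) (fun n => measurable_phase (hg n) _)
      (fun n x => (norm_phase_ofReal _ _).le) N y (B := D * (τ + (|h| * (A * s ^ 2)) ^ r))
      hW rfl hh3 hs1 hs3
      (hd1.trans (mul_le_mul_of_nonneg_left (Real.exp_le_exp.2 (neg_le_neg
        (mul_le_mul_of_nonneg_right (min_le_left _ _) (by positivity)))) zero_le_two))
      (hd2.trans (mul_le_mul_of_nonneg_left (Real.exp_le_exp.2 (neg_le_neg
        (mul_le_mul_of_nonneg_right (min_le_right _ _) (by positivity)))) zero_le_two))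
      (fun U hU hUc => (norm_bwd_phase_ite_le_of_moments hQ hg hG1' hGr
        (fun n => measurable_phase (hg n) _) (fun n x => (norm_phase_ofReal _ _).le) hτ0 hτ y h
        hU).trans (by rw [← hD]; gcongr))
    refine key.trans ?_
    rw [mul_add A]
    refine add_le_add ?_ le_rfl
    have h3 := hexp (|h| * L) (by positivity)
    have h4 : (|h| * L) ^ 2 = h ^ 2 * W := by rw [mul_pow, hLW, sq_abs]
    rw [h4] at h3
    have e5 : Real.exp (-(κ / 2 * W) * h ^ 2) = Real.exp (-(κ / 2 * (h ^ 2 * W))) := by ring_nf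
    rw [e5]
    have h5 : Real.exp (-(κ * (h ^ 2 * W))) ≤ Real.exp (-(κ / 2 * (h ^ 2 * W))) :=
      Real.exp_le_exp.2 (neg_le_neg (mul_le_mul_of_nonneg_right (half_le_self hκ.le) hhW))
    have h6 : Real.exp (-(κ * (h ^ 2 * W))) * (|h| * (A * s ^ 2)) ^ r
        ≤ A ^ r * A₁ * s ^ (2 * r) * L⁻¹ ^ r * Real.exp (-(κ / 2 * (h ^ 2 * W))) := by
      have e6 : Real.exp (-(κ * (h ^ 2 * W))) * (|h| * (A * s ^ 2)) ^ r
          = A ^ r * s ^ (2 * r) * L⁻¹ ^ r * ((|h| * L) ^ r * Real.exp (-(κ * (h ^ 2 * W)))) := by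
        rw [pow_mul, inv_pow]; simp only [mul_pow]; field_simp
      rw [e6]
      calc _ ≤ A ^ r * s ^ (2 * r) * L⁻¹ ^ r * (A₁ * Real.exp (-(κ / 2 * (h ^ 2 * W)))) := by gcongr
        _ = _ := by ring
    calc A * (Real.exp (-(κ * (h ^ 2 * W))) * (D * (τ + (|h| * (A * s ^ 2)) ^ r)))
        = A * D * (Real.exp (-(κ * (h ^ 2 * W))) * τ +
          Real.exp (-(κ * (h ^ 2 * W))) * (|h| * (A * s ^ 2)) ^ r) := by ring
      _ ≤ A * D * (Real.exp (-(κ / 2 * (h ^ 2 * W))) * τ +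
          A ^ r * A₁ * s ^ (2 * r) * L⁻¹ ^ r * Real.exp (-(κ / 2 * (h ^ 2 * W)))) := by gcongr
      _ = _ := by ring
  have hb0 : 0 < κ / 2 * W := by positivity
  have hgi : Integrable fun h : ℝ => Real.exp (-(κ / 2 * W) * h ^ 2) :=
    integrable_exp_neg_mul_sq hb0
  have hgauss : ∫ h in (-δ)..δ, Real.exp (-(κ / 2 * W) * h ^ 2) ≤ I₀ * L⁻¹ := by
    rw [intervalIntegral.integral_of_le (by linarith)]
    refine (setIntegral_le_integral hgi (ae_of_all _ fun _ => (Real.exp_pos _).le)).trans ?_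
    rw [integral_gaussian, ← div_div, Real.sqrt_div' _ hW0, div_eq_mul_inv]
  have hcont : Continuous fun h : ℝ => ‖bwd ν k (fun n => phase ((t₀ + h : ℝ) : ℂ) (g n)) N y‖ :=
    ((continuous_bwd_phase hB hg hGr N y).comp (continuous_const.add continuous_id)).norm
  have hmono := intervalIntegral.integral_mono_on (by linarith : -δ ≤ δ)
    (hcont.intervalIntegrable _ _)
    (((hgi.intervalIntegrable (a := -δ) (b := δ)).const_mul
      (A * D * (τ + A ^ r * A₁ * s ^ (2 * r) * L⁻¹ ^ r))).add
      (intervalIntegrable_const (c := A * (W * Real.exp (-(κ * s)))))) hpt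
  refine hmono.trans ?_
  rw [intervalIntegral.integral_add ((hgi.intervalIntegrable).const_mul _)
    intervalIntegrable_const, intervalIntegral.integral_const_mul, intervalIntegral.integral_const,
    smul_eq_mul]
  have hfin := (hs₀ s ((le_max_left _ _).trans hsm)).le
  have e7 : L⁻¹ ^ r = L⁻¹ ^ (r - 1) * L⁻¹ := by rw [← pow_succ]; congr 1; omega
  calc _ ≤ A * D * (τ + A ^ r * A₁ * s ^ (2 * r) * L⁻¹ ^ r) * (I₀ * L⁻¹)
        + (δ - -δ) * (A * (W * Real.exp (-(κ * s)))) := by gcongr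
    _ = A * D * I₀ * η * L⁻¹ ^ r + (A * D * I₀ * (A ^ r * A₁ * (s ^ (2 * r) * L⁻¹)) +
        2 * δ * A * (W * L ^ r * Real.exp (-(κ * s)))) * L⁻¹ ^ r := by
        have e8 : W * Real.exp (-(κ * s)) = (W * L ^ r * Real.exp (-(κ * s))) * L⁻¹ ^ r := by
          rw [inv_pow]; field_simp
        rw [e8, hτ', e7]; ring
    _ = ε / 2 * L⁻¹ ^ r + (A * D * I₀ * (A ^ r * A₁ * (s ^ (2 * r))⁻¹) +
        2 * δ * A * (s ^ (4 * r * r + 8 * r) * Real.exp (-(κ * s)))) * L⁻¹ ^ r := by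
        have e9 : s ^ (2 * r) * L⁻¹ = (s ^ (2 * r))⁻¹ := by
          rw [hLs, show 4 * r = 2 * r + 2 * r by ring, pow_add]; field_simp
        have e10 : W * L ^ r = s ^ (4 * r * r + 8 * r) := by
          rw [← hsW, hLs, ← pow_mul, ← pow_add]; congr 1; ring
        have e11 : A * D * I₀ * η = ε / 2 := by rw [hη]; field_simp
        rw [e9, e10, e11]
    _ ≤ ε / 2 * L⁻¹ ^ r + ε / 2 * L⁻¹ ^ r := by gcongr
    _ = _ := by ring

/-! ### Fourier moments of the Gaussian -/

/-- The Gaussian factor with a Fourier character. -/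
def gaussChar (x u : ℝ) : ℂ := Complex.exp (-(Complex.I * u * x) - (u : ℂ) ^ 2 / 2)

lemma norm_gaussChar (x u : ℝ) : ‖gaussChar x u‖ = Real.exp (-(1 / 2 * u ^ 2)) := by
  rw [gaussChar, Complex.norm_exp]
  congr 1
  have : -(Complex.I * u * x) - (u : ℂ) ^ 2 / 2
      = ((-(u * x) : ℝ) : ℂ) * Complex.I + ((-(1 / 2 * u ^ 2) : ℝ) : ℂ) := by
    push_cast; ring
  rw [this, Complex.add_re, Complex.ofReal_re, Complex.re_ofReal_mul, Complex.I_re, mul_zero, zero_add]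

lemma continuous_gaussChar (x : ℝ) : Continuous (gaussChar x) := by
  unfold gaussChar; fun_prop

lemma integrable_pow_mul_gaussChar (l : ℕ) (x : ℝ) :
    Integrable fun u : ℝ => (u : ℂ) ^ l * gaussChar x u := by
  obtain ⟨A, -, hA⟩ := exists_pow_mul_exp_neg_sq_le l (κ := 1 / 2) (by norm_num)
  refine ((integrable_exp_neg_mul_sq (b := 1 / 4) (by norm_num)).const_mul A).mono'
    ((by have := continuous_gaussChar x; fun_prop : Continuous _).aestronglyMeasurable)
    (ae_of_all _ fun u => ?_)
  rw [norm_mul, norm_pow, Complex.norm_real, Real.norm_eq_abs, norm_gaussChar]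
  have := hA |u| (abs_nonneg u)
  rw [sq_abs] at this
  refine this.trans (le_of_eq ?_)
  congr 2; ring

lemma integral_gaussChar (x : ℝ) :
    ∫ u : ℝ, gaussChar x u = (√(2 * Real.pi) : ℝ) * Real.exp (-x ^ 2 / 2) := by
  have h := integral_cexp_quadratic (b := -(1 / 2 : ℂ)) (by norm_num) (-(Complex.I * x)) 0
  have e : ∀ u : ℝ, gaussChar x u
      = Complex.exp (-(1 / 2 : ℂ) * (u : ℂ) ^ 2 + -(Complex.I * x) * u + 0) := fun u => by
    rw [gaussChar]; congr 1; ring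
  simp only [e]
  rw [h]
  have e2 : ((Real.pi : ℂ) / - -(1 / 2 : ℂ)) = ((2 * Real.pi : ℝ) : ℂ) := by push_cast; ring
  rw [e2]
  congr 1
  · rw [Real.sqrt_eq_rpow, Complex.ofReal_cpow (by positivity)]; norm_num
  · rw [Complex.ofReal_exp]; congr 1; push_cast
    have : (Complex.I) ^ 2 = -1 := Complex.I_sq
    ring_nf
    rw [this]; ring

lemma integral_pow_succ_mul_gaussChar (l : ℕ) (x : ℝ) :
    ∫ u : ℝ, (u : ℂ) ^ (l + 1) * gaussChar x u
      = l * (∫ u : ℝ, (u : ℂ) ^ (l - 1) * gaussChar x u) +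
        -(Complex.I * x) * ∫ u : ℝ, (u : ℂ) ^ l * gaussChar x u := by
  have hd : ∀ u : ℝ, HasDerivAt (fun u : ℝ => (u : ℂ) ^ l * gaussChar x u)
      (l * ((u : ℂ) ^ (l - 1) * gaussChar x u) + -(Complex.I * x) * ((u : ℂ) ^ l * gaussChar x u)
        - (u : ℂ) ^ (l + 1) * gaussChar x u) u := by
    intro u
    have h0 : HasDerivAt (fun u : ℝ => (u : ℂ)) 1 u := Complex.ofRealCLM.hasDerivAt
    have h1 := h0.fun_pow l
    have h2 : HasDerivAt (gaussChar x) (gaussChar x u * (-(Complex.I * 1 * x) -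
        ((2 : ℕ) * (u : ℂ) ^ 1 * 1) / 2)) u := by
      have h3 := ((h0.const_mul Complex.I).mul_const (x : ℂ)).neg
      exact (h3.sub ((h0.fun_pow 2).div_const 2)).cexp
    refine (h1.mul h2).congr_deriv ?_
    push_cast; ring
  have i₀ := (integrable_pow_mul_gaussChar (l - 1) x).const_mul (l : ℂ)
  have i₁ := (integrable_pow_mul_gaussChar l x).const_mul (-(Complex.I * x))
  have i₂ : Integrable fun u : ℝ => l * ((u : ℂ) ^ (l - 1) * gaussChar x u) +
      -(Complex.I * x) * ((u : ℂ) ^ l * gaussChar x u) := i₀.add i₁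
  have i₃ := integrable_pow_mul_gaussChar (l + 1) x
  have h0 := integral_eq_zero_of_hasDerivAt_of_integrable hd (i₂.sub i₃)
    (integrable_pow_mul_gaussChar l x)
  rw [integral_sub i₂ i₃, integral_add i₀ i₁, integral_const_mul, integral_const_mul] at h0
  exact (sub_eq_zero.1 h0).symm

/-- Gaussian Fourier moments are polynomials times a Gaussian. -/
lemma exists_polynomial_integral_gaussChar (l : ℕ) : ∃ H : Polynomial ℂ, ∀ x : ℝ,
    ∫ u : ℝ, (u : ℂ) ^ l * gaussChar x u = H.eval (x : ℂ) * (Real.exp (-x ^ 2 / 2) : ℝ) := by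
  have key : ∀ l : ℕ, (∃ H : Polynomial ℂ, ∀ x : ℝ,
      ∫ u : ℝ, (u : ℂ) ^ l * gaussChar x u = H.eval (x : ℂ) * (Real.exp (-x ^ 2 / 2) : ℝ)) ∧
      ∃ H : Polynomial ℂ, ∀ x : ℝ,
      ∫ u : ℝ, (u : ℂ) ^ (l + 1) * gaussChar x u
        = H.eval (x : ℂ) * (Real.exp (-x ^ 2 / 2) : ℝ) := by
    intro l
    induction l with
    | zero =>
      have h0 : ∀ x : ℝ, ∫ u : ℝ, (u : ℂ) ^ 0 * gaussChar x u
          = (√(2 * Real.pi) : ℝ) * (Real.exp (-x ^ 2 / 2) : ℝ) := fun x => by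
        simp only [pow_zero, one_mul]; exact integral_gaussChar x
      refine ⟨⟨.C ((√(2 * Real.pi) : ℝ) : ℂ), fun x => by rw [h0, Polynomial.eval_C]⟩,
        ⟨.C (-Complex.I * ((√(2 * Real.pi) : ℝ) : ℂ)) * .X, fun x => ?_⟩⟩
      rw [integral_pow_succ_mul_gaussChar, h0]
      simp only [Polynomial.eval_mul, Polynomial.eval_C, Polynomial.eval_X]
      push_cast; ring
    | succ l ih =>
      obtain ⟨⟨H₁, h₁⟩, ⟨H₂, h₂⟩⟩ := ih
      refine ⟨⟨H₂, h₂⟩, ⟨.C ((l + 1 : ℕ) : ℂ) * H₁ + .C (-Complex.I) * .X * H₂, fun x => ?_⟩⟩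
      rw [integral_pow_succ_mul_gaussChar, h₂, Nat.add_sub_cancel, h₁]
      simp only [Polynomial.eval_add, Polynomial.eval_mul, Polynomial.eval_C, Polynomial.eval_X]
      ring
  exact (key l).1

/-- Real polynomials are enough for the real parts. -/
lemma exists_re_polynomial (H : Polynomial ℂ) : ∃ P : Polynomial ℝ, P.natDegree ≤ H.natDegree ∧
    (∀ i, |P.coeff i| ≤ ‖H.coeff i‖) ∧ ∀ x : ℝ, P.eval x = (H.eval (x : ℂ)).re := by
  refine ⟨∑ i ∈ Finset.range (H.natDegree + 1), Polynomial.monomial i (H.coeff i).re, ?_, ?_, ?_⟩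
  · refine Polynomial.natDegree_sum_le_of_forall_le _ _ fun i hi => ?_
    exact (Polynomial.natDegree_monomial_le _).trans (by simpa [Nat.lt_succ_iff] using hi)
  · intro i
    rw [Polynomial.finsetSum_coeff]
    simp only [Polynomial.coeff_monomial]
    rw [Finset.sum_ite_eq' ]
    split_ifs
    · exact Complex.abs_re_le_norm _
    · simp
  · intro x
    rw [Polynomial.eval_finsetSum, Polynomial.eval_eq_sum_range, Complex.re_sum]
    refine Finset.sum_congr rfl fun i _ => ?_
    rw [Polynomial.eval_monomial, ← Complex.ofReal_pow, Complex.re_mul_ofReal]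

/-! ### The contribution of a neighbourhood of the origin -/

lemma exists_norm_coeff_pow_le (d : ℕ) (B : ℝ) (k : ℕ) : ∃ B' : ℝ, 0 ≤ B' ∧ ∀ p : Polynomial ℂ,
    p.natDegree ≤ d → (∀ i, ‖p.coeff i‖ ≤ B) → ∀ i, ‖(p ^ k).coeff i‖ ≤ B' := by
  induction k with
  | zero =>
    refine ⟨1, zero_le_one, fun p _ _ i => ?_⟩
    rw [pow_zero, Polynomial.coeff_one]
    split_ifs <;> simp
  | succ k ih =>
    obtain ⟨B', hB', H⟩ := ih
    refine ⟨((k + 1) * d + 1 : ℕ) * (B' * |B|), by positivity, fun p hp hpB i => ?_⟩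
    by_cases hi : (k + 1) * d < i
    · rw [Polynomial.coeff_eq_zero_of_natDegree_lt
        (lt_of_le_of_lt (Polynomial.natDegree_pow_le_of_le (k + 1) hp) hi), norm_zero]
      positivity
    · rw [pow_succ, Polynomial.coeff_mul]
      refine (norm_sum_le_of_le (n := fun _ => B' * |B|) _ fun x _ => ?_).trans ?_
      · rw [norm_mul]
        exact mul_le_mul (H p hp hpB _) ((hpB _).trans (le_abs_self B)) (norm_nonneg _) hB'
      · rw [Finset.sum_const, Finset.Nat.card_antidiagonal, nsmul_eq_mul]
        gcongr
        omega

/-- Polynomial truncation of the exponential of a polynomial. -/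
def truncExp (r : ℕ) (p : Polynomial ℂ) : Polynomial ℂ :=
  ∑ k ∈ Finset.range r, Polynomial.C ((k.factorial : ℂ)⁻¹) * p ^ k

lemma eval_truncExp (r : ℕ) (p : Polynomial ℂ) (v : ℂ) :
    (truncExp r p).eval v = ∑ k ∈ Finset.range r, p.eval v ^ k / (k.factorial : ℂ) := by
  rw [truncExp, Polynomial.eval_finsetSum]
  refine Finset.sum_congr rfl fun k _ => ?_
  rw [Polynomial.eval_mul, Polynomial.eval_C, Polynomial.eval_pow, div_eq_inv_mul]

lemma natDegree_truncExp_le (r : ℕ) {p : Polynomial ℂ} {d : ℕ} (hp : p.natDegree ≤ d) :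
    (truncExp r p).natDegree ≤ r * d := by
  refine Polynomial.natDegree_sum_le_of_forall_le _ _ fun k hk => ?_
  refine (Polynomial.natDegree_C_mul_le _ _).trans ?_
  refine (Polynomial.natDegree_pow_le_of_le k hp).trans ?_
  exact Nat.mul_le_mul_right _ (Finset.mem_range.1 hk).le

lemma exists_norm_coeff_truncExp_le (r d : ℕ) (B : ℝ) : ∃ B' : ℝ, 0 ≤ B' ∧ ∀ p : Polynomial ℂ,
    p.natDegree ≤ d → (∀ i, ‖p.coeff i‖ ≤ B) → ∀ i, ‖(truncExp r p).coeff i‖ ≤ B' := by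
  choose b hb hb' using exists_norm_coeff_pow_le d B
  refine ⟨∑ k ∈ Finset.range r, b k, Finset.sum_nonneg fun k _ => hb k, fun p hp hpB i => ?_⟩
  rw [truncExp, Polynomial.finsetSum_coeff]
  refine norm_sum_le_of_le _ fun k _ => ?_
  rw [Polynomial.coeff_C_mul, norm_mul, norm_inv, Complex.norm_natCast]
  have hf : (1 : ℝ) ≤ k.factorial := by exact_mod_cast k.factorial_pos
  calc _ ≤ 1 * b k := mul_le_mul (inv_le_one_of_one_le₀ hf) (hb' k p hp hpB i) (norm_nonneg _)
        zero_le_one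
    _ = b k := one_mul _

lemma norm_exp_sub_truncExp_le {χ T : ℂ} {b : ℝ} (hχ : ‖χ‖ ≤ b) (hT : ‖T‖ ≤ b) (r : ℕ) :
    ‖Complex.exp χ - ∑ k ∈ Finset.range r, T ^ k / (k.factorial : ℂ)‖
      ≤ (‖χ - T‖ + ‖T‖ ^ r) * Real.exp (3 * b) := by
  have hb : 0 ≤ b := (norm_nonneg _).trans hχ
  have h1 : ‖Complex.exp χ - Complex.exp T‖ ≤ ‖χ - T‖ * Real.exp (3 * b) := by
    have e : Complex.exp χ - Complex.exp T = Complex.exp T * (Complex.exp (χ - T) - 1) := by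
      rw [mul_sub, ← Complex.exp_add]; ring_nf
    have h2 := Complex.norm_exp_sub_sum_le_norm_mul_exp (χ - T) 1
    simp only [Finset.sum_range_one, pow_zero, Nat.factorial_zero, Nat.cast_one, div_one,
      pow_one] at h2
    rw [e, norm_mul]
    calc ‖Complex.exp T‖ * ‖Complex.exp (χ - T) - 1‖
        ≤ Real.exp b * (‖χ - T‖ * Real.exp (2 * b)) := by
          gcongr
          · exact (Complex.norm_exp_le_exp_norm T).trans (Real.exp_le_exp.2 hT)
          · refine h2.trans (mul_le_mul_of_nonneg_left (Real.exp_le_exp.2 ?_) (norm_nonneg _))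
            exact (norm_sub_le _ _).trans (by linarith)
      _ = ‖χ - T‖ * Real.exp (3 * b) := by
          rw [mul_left_comm, ← Real.exp_add]; ring_nf
  have h3 : ‖Complex.exp T - ∑ k ∈ Finset.range r, T ^ k / (k.factorial : ℂ)‖
      ≤ ‖T‖ ^ r * Real.exp (3 * b) := by
    refine (Complex.norm_exp_sub_sum_le_norm_mul_exp T r).trans ?_
    gcongr
    linarith
  calc _ ≤ _ := norm_sub_le_norm_sub_add_norm_sub _ (Complex.exp T) _
    _ ≤ _ := add_le_add h1 h3
    _ = _ := by ring

lemma gaussChar_mul (y h : ℝ) {σ : ℝ} (hσ : σ ≠ 0) : gaussChar (y / σ) (h * σ)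
    = Complex.exp (-(Complex.I * h * y)) * Complex.exp (-((h : ℂ) ^ 2 * (σ : ℂ) ^ 2 / 2)) := by
  have : (σ : ℂ) ≠ 0 := by exact_mod_cast hσ
  rw [gaussChar, ← Complex.exp_add]
  congr 1
  push_cast
  field_simp
  ring

lemma integral_comp_mul_sub_intervalIntegral_le {F : ℝ → ℂ} (hF : Integrable F) {B σ δ : ℝ}
    (hB : 0 ≤ B) (hσ : 0 < σ) (hδ : 0 < δ)
    (hFB : ∀ v, ‖F v‖ ≤ B * Real.exp (-(1 / 4 * v ^ 2))) :
    ‖(∫ h in (-δ)..δ, F (h * σ)) - (σ⁻¹ : ℝ) * ∫ v, F v‖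
      ≤ B * Real.exp (-(δ ^ 2 / 8 * σ ^ 2)) * (√(8 * Real.pi) * σ⁻¹) := by
  have h1 : ∫ h : ℝ, F (h * σ) = (σ⁻¹ : ℝ) * ∫ v, F v := by
    rw [Measure.integral_comp_mul_right, abs_of_pos (by positivity)]; simp
  have hi : Integrable fun h : ℝ => F (h * σ) := hF.comp_mul_right' hσ.ne'
  rw [← h1, intervalIntegral.integral_of_le (by linarith),
    ← integral_add_compl (measurableSet_Ioc (a := -δ) (b := δ)) hi, sub_add_cancel_left, norm_neg]
  have hb : 0 < 1 / 8 * σ ^ 2 := by positivity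
  have hgi := (integrable_exp_neg_mul_sq hb).const_mul (B * Real.exp (-(δ ^ 2 / 8 * σ ^ 2)))
  have hpt : ∀ h ∈ (Set.Ioc (-δ) δ)ᶜ, ‖F (h * σ)‖
      ≤ B * Real.exp (-(δ ^ 2 / 8 * σ ^ 2)) * Real.exp (-(1 / 8 * σ ^ 2) * h ^ 2) := by
    intro h hh
    refine (hFB _).trans ?_
    rw [mul_assoc, ← Real.exp_add]
    refine mul_le_mul_of_nonneg_left (Real.exp_le_exp.2 ?_) hB
    have hd : δ ^ 2 ≤ h ^ 2 := by
      rw [Set.mem_compl_iff, Set.mem_Ioc, not_and_or] at hh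
      rcases hh with hh | hh
      · nlinarith
      · nlinarith
    nlinarith [mul_le_mul_of_nonneg_right hd (sq_nonneg σ)]
  calc _ ≤ ∫ h in (Set.Ioc (-δ) δ)ᶜ, ‖F (h * σ)‖ := norm_integral_le_integral_norm _
    _ ≤ ∫ h in (Set.Ioc (-δ) δ)ᶜ,
        B * Real.exp (-(δ ^ 2 / 8 * σ ^ 2)) * Real.exp (-(1 / 8 * σ ^ 2) * h ^ 2) :=
        setIntegral_mono_on hi.norm.integrableOn hgi.integrableOn measurableSet_Ioc.compl hpt
    _ ≤ ∫ h : ℝ, B * Real.exp (-(δ ^ 2 / 8 * σ ^ 2)) * Real.exp (-(1 / 8 * σ ^ 2) * h ^ 2) :=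
        setIntegral_le_integral hgi (ae_of_all _ fun h => by positivity)
    _ = _ := by
        rw [integral_const_mul, integral_gaussian]
        congr 1
        rw [show Real.pi / (1 / 8 * σ ^ 2) = 8 * Real.pi / σ ^ 2 by field_simp,
          Real.sqrt_div' _ (by positivity), Real.sqrt_sq hσ.le, div_eq_mul_inv]

/-- A polynomial times a Gaussian has an explicit Fourier integral, up to the cut-off. -/
lemma exists_polynomial_main_term (d r : ℕ) {B δ : ℝ} (hB : 0 ≤ B) (hδ : 0 < δ) :
    ∃ (D : ℕ) (Cb C : ℝ), 0 ≤ C ∧ ∀ M : Polynomial ℂ, M.natDegree ≤ d → (∀ i, ‖M.coeff i‖ ≤ B) →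
      ∃ P : Polynomial ℝ, P.natDegree ≤ D ∧ (∀ i, |P.coeff i| ≤ Cb) ∧
        ∀ (σ y : ℝ), 0 < σ →
          |(∫ h in (-δ)..δ, M.eval ((h * σ : ℝ) : ℂ) * gaussChar (y / σ) (h * σ)).re /
            (2 * Real.pi) - σ⁻¹ * P.eval (y / σ) * gaussDensity (y / σ)| ≤ C * σ⁻¹ ^ (r + 1) := by
  choose H hH using exists_polynomial_integral_gaussChar
  choose a ha ha' using fun l : ℕ => exists_pow_mul_exp_neg_sq_le l (κ := 1 / 2) (by norm_num)
  obtain ⟨A, hA, hA'⟩ := exists_pow_mul_exp_neg_sq_le r (κ := δ ^ 2 / 8) (by positivity)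
  set q : ℝ := √(2 * Real.pi) / (2 * Real.pi) with hq
  have hq0 : 0 < q := by positivity
  set B' : ℝ := B * ∑ l ∈ Finset.range (d + 1), a l with hB'
  have hB'0 : 0 ≤ B' := mul_nonneg hB (Finset.sum_nonneg fun l _ => (ha l).le)
  refine ⟨∑ l ∈ Finset.range (d + 1), (H l).natDegree,
    ∑ l ∈ Finset.range (d + 1), B * q * ∑ i ∈ (H l).support, ‖(H l).coeff i‖,
    B' * A * √(8 * Real.pi) / (2 * Real.pi), by positivity, fun M hM hMB => ?_⟩
  set Pc : Polynomial ℂ := ∑ l ∈ Finset.range (d + 1), .C (M.coeff l * q) * H l with hPc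
  obtain ⟨P, hP1, hP2, hP3⟩ := exists_re_polynomial Pc
  refine ⟨P, hP1.trans ?_, fun i => (hP2 i).trans ?_, fun σ y hσ => ?_⟩
  · refine Polynomial.natDegree_sum_le_of_forall_le _ _ fun l hl => ?_
    refine (Polynomial.natDegree_C_mul_le _ _).trans ?_
    exact Finset.single_le_sum (f := fun l => (H l).natDegree) (fun _ _ => Nat.zero_le _) hl
  · rw [hPc, Polynomial.finsetSum_coeff]
    refine norm_sum_le_of_le _ fun l _ => ?_
    rw [Polynomial.coeff_C_mul, norm_mul, norm_mul, Complex.norm_real, Real.norm_of_nonneg hq0.le]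
    refine mul_le_mul (mul_le_mul_of_nonneg_right (hMB l) hq0.le) ?_ (norm_nonneg _) (by positivity)
    by_cases hi : i ∈ (H l).support
    · exact Finset.single_le_sum (f := fun i => ‖(H l).coeff i‖) (fun _ _ => norm_nonneg _) hi
    · rw [Polynomial.notMem_support_iff.1 hi, norm_zero]
      exact Finset.sum_nonneg fun _ _ => norm_nonneg _
  · set x := y / σ with hx
    set F : ℝ → ℂ := fun v => M.eval (v : ℂ) * gaussChar x v with hF
    have hFs : F = fun v : ℝ => ∑ l ∈ Finset.range (d + 1), M.coeff l * ((v : ℂ) ^ l * gaussChar x v) := by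
      funext v
      rw [hF]
      simp only [Polynomial.eval_eq_sum_range' (Nat.lt_succ_of_le hM), Finset.sum_mul, mul_assoc]
    have hFi : Integrable F := by
      rw [hFs]
      exact integrable_finsetSum _ fun l _ => (integrable_pow_mul_gaussChar l x).const_mul _
    have hFB : ∀ v, ‖F v‖ ≤ B' * Real.exp (-(1 / 4 * v ^ 2)) := by
      intro v
      rw [hFs, hB', Finset.mul_sum, Finset.sum_mul]
      refine norm_sum_le_of_le _ fun l _ => ?_
      rw [norm_mul, norm_mul, norm_pow, Complex.norm_real, norm_gaussChar, Real.norm_eq_abs,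
        mul_assoc]
      refine mul_le_mul (hMB l) ?_ (by positivity) hB
      have := ha' l |v| (abs_nonneg v)
      rw [sq_abs] at this
      refine this.trans (le_of_eq ?_)
      congr 3; ring
    have h1 := integral_comp_mul_sub_intervalIntegral_le hFi hB'0 hσ hδ hFB
    have h2 : ∫ v, F v = ((2 * Real.pi : ℝ) : ℂ) * (Pc.eval (x : ℂ) * (gaussDensity x : ℝ)) := by
      rw [hFs, integral_finsetSum _ fun l _ => (integrable_pow_mul_gaussChar l x).const_mul _]
      simp only [integral_const_mul, hH]
      rw [hPc, Polynomial.eval_finsetSum, Finset.sum_mul, Finset.mul_sum]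
      refine Finset.sum_congr rfl fun l _ => ?_
      rw [Polynomial.eval_mul, Polynomial.eval_C]
      have e : (2 * Real.pi) * (q * (√(2 * Real.pi))⁻¹) = 1 := by rw [hq]; field_simp
      have e' : ((2 * Real.pi : ℝ) : ℂ) * ((q : ℝ) * (((√(2 * Real.pi))⁻¹ : ℝ) : ℂ)) = 1 := by
        exact_mod_cast e
      have e'' : ((gaussDensity x : ℝ) : ℂ) =
          (((√(2 * Real.pi))⁻¹ : ℝ) : ℂ) * (Real.exp (-x ^ 2 / 2) : ℝ) := by
        rw [gaussDensity, Complex.ofReal_mul]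
      rw [e'']
      generalize (((√(2 * Real.pi))⁻¹ : ℝ) : ℂ) = s at e' ⊢
      generalize ((Real.exp (-x ^ 2 / 2) : ℝ) : ℂ) = v
      generalize ((2 * Real.pi : ℝ) : ℂ) = w at e' ⊢
      linear_combination (-(M.coeff l * ((H l).eval (x : ℂ) * v))) * e'
    have h3 : ((σ⁻¹ : ℝ) * ∫ v, F v).re / (2 * Real.pi) = σ⁻¹ * P.eval x * gaussDensity x := by
      rw [h2, hP3, Complex.re_ofReal_mul, Complex.re_ofReal_mul, Complex.re_mul_ofReal]
      field_simp
    rw [← h3, ← sub_div, ← Complex.sub_re, abs_div, abs_of_pos (by positivity : 0 < 2 * Real.pi)]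
    have h4 := hA' σ hσ.le
    have h5 : Real.exp (-(δ ^ 2 / 8 * σ ^ 2)) ≤ A * σ⁻¹ ^ r := by
      have h6 : σ ^ r * Real.exp (-(δ ^ 2 / 8 * σ ^ 2)) ≤ A := h4.trans
        (mul_le_of_le_one_right hA.le (Real.exp_le_one_iff.2 (by
          have : 0 ≤ δ ^ 2 / 8 / 2 * σ ^ 2 := by positivity
          linarith)))
      rw [inv_pow, ← div_eq_mul_inv, le_div_iff₀ (by positivity)]
      linarith
    calc _ ≤ (B' * Real.exp (-(δ ^ 2 / 8 * σ ^ 2)) * (√(8 * Real.pi) * σ⁻¹)) / (2 * Real.pi) := by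
          gcongr
          exact (Complex.abs_re_le_norm _).trans h1
      _ ≤ (B' * (A * σ⁻¹ ^ r) * (√(8 * Real.pi) * σ⁻¹)) / (2 * Real.pi) := by gcongr
      _ = _ := by ring

lemma exists_one_add_pow_mul_exp_le (m : ℕ) : ∃ A : ℝ, 0 < A ∧ ∀ u : ℝ, 0 ≤ u →
    (1 + u) ^ m * Real.exp (-(u ^ 2 / 4)) ≤ A * Real.exp (-(u ^ 2 / 8)) := by
  obtain ⟨A, hA, H⟩ := exists_pow_mul_exp_neg_sq_le m (κ := 1 / 16) (by norm_num)
  refine ⟨A * Real.exp (1 / 8), by positivity, fun u hu => ?_⟩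
  have h1 := H (1 + u) (by positivity)
  have h2 : Real.exp (-(1 / 16 / 2 * (1 + u) ^ 2)) ≤ 1 := Real.exp_le_one_iff.2 (by
    have : 0 ≤ 1 / 16 / 2 * (1 + u) ^ 2 := by positivity
    linarith)
  have h3 : Real.exp (-(u ^ 2 / 4))
      ≤ Real.exp (-(1 / 16 * (1 + u) ^ 2)) * (Real.exp (1 / 8) * Real.exp (-(u ^ 2 / 8))) := by
    rw [← Real.exp_add, ← Real.exp_add]
    refine Real.exp_le_exp.2 ?_
    have := sq_nonneg (u - 1)
    linarith [this, show (u - 1) ^ 2 + (1 + u) ^ 2 = 2 + 2 * u ^ 2 by ring]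
  calc _ ≤ (1 + u) ^ m * (Real.exp (-(1 / 16 * (1 + u) ^ 2)) *
        (Real.exp (1 / 8) * Real.exp (-(u ^ 2 / 8)))) := by gcongr
    _ = ((1 + u) ^ m * Real.exp (-(1 / 16 * (1 + u) ^ 2))) *
        (Real.exp (1 / 8) * Real.exp (-(u ^ 2 / 8))) := by ring
    _ ≤ A * (Real.exp (1 / 8) * Real.exp (-(u ^ 2 / 8))) := by
        gcongr
        exact h1.trans (mul_le_of_le_one_right hA.le h2)
    _ = _ := by ring

/-- The polynomial cumulant bound used below. -/
lemma norm_sum_cumulant_le {A ρ σ h : ℝ} {r : ℕ} (hr : 1 ≤ r) (hA : 0 ≤ A) (hρ : 0 < ρ)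
    (hh : |h| ≤ ρ) {c : ℕ → ℂ} (hc2 : ‖c 2‖ ≤ A)
    (hc : ∀ j, 3 ≤ j → ‖c j‖ ≤ A * σ ^ 2 * ρ⁻¹ ^ j) :
    ‖∑ j ∈ Finset.Icc 2 (r + 1), c j * (h : ℂ) ^ j‖
      ≤ A * h ^ 2 + (r + 1) * (A * σ ^ 2 * (|h| / ρ) ^ 3) := by
  rw [← Finset.insert_Icc_add_one_left_eq_Icc (by omega : 2 ≤ r + 1),
    Finset.sum_insert (by simp)]
  refine (norm_add_le _ _).trans (add_le_add ?_ ?_)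
  · rw [norm_mul, norm_pow, Complex.norm_real, Real.norm_eq_abs, sq_abs]
    gcongr
  · refine (norm_sum_le_of_le (n := fun _ => A * σ ^ 2 * (|h| / ρ) ^ 3) _ fun j hj => ?_).trans ?_
    · have hj3 : 3 ≤ j := (Finset.mem_Icc.1 hj).1
      rw [norm_mul, norm_pow, Complex.norm_real, Real.norm_eq_abs]
      calc ‖c j‖ * |h| ^ j ≤ (A * σ ^ 2 * ρ⁻¹ ^ j) * |h| ^ j := by gcongr; exact hc j hj3
        _ = A * σ ^ 2 * (|h| / ρ) ^ j := by rw [div_pow, inv_pow]; ring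
        _ ≤ A * σ ^ 2 * (|h| / ρ) ^ 3 := by
            refine mul_le_mul_of_nonneg_left ?_ (by positivity)
            exact pow_le_pow_of_le_one (by positivity) ((div_le_one hρ).2 hh) hj3
    · rw [Finset.sum_const, nsmul_eq_mul, Nat.card_Icc]
      gcongr
      have : (r + 1 + 1 - (2 + 1) : ℕ) ≤ r + 1 := by omega
      exact_mod_cast this

lemma norm_sum_cumulant_le' {A ρ σ h : ℝ} {r : ℕ} (hA : 0 ≤ A) (hρ : 0 < ρ) (hρ1 : ρ ≤ 1)
    (hσ : 1 ≤ σ) {c : ℕ → ℂ} (hc2 : ‖c 2‖ ≤ A)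
    (hc : ∀ j, 3 ≤ j → ‖c j‖ ≤ A * σ ^ 2 * ρ⁻¹ ^ j) :
    ‖∑ j ∈ Finset.Icc 2 (r + 1), c j * (h : ℂ) ^ j‖
      ≤ σ⁻¹ * (r * (A * ρ⁻¹ ^ (r + 1)) * (1 + |h| * σ) ^ (r + 1)) := by
  have hσ0 : 0 < σ := by linarith
  have hρi : 1 ≤ ρ⁻¹ := (one_le_inv₀ hρ).2 hρ1
  have hσi : σ⁻¹ ≤ 1 := inv_le_one_of_one_le₀ hσ
  have hu : (0 : ℝ) ≤ |h| * σ := by positivity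
  refine (norm_sum_le_of_le
    (n := fun _ => σ⁻¹ * ((A * ρ⁻¹ ^ (r + 1)) * (1 + |h| * σ) ^ (r + 1))) _ fun j hj => ?_).trans ?_
  · obtain ⟨hj2, hjr⟩ := Finset.mem_Icc.1 hj
    have hcj : ‖c j‖ ≤ A * σ ^ (j - 1) * ρ⁻¹ ^ (r + 1) := by
      rcases hj2.eq_or_lt with rfl | h3
      · refine hc2.trans ?_
        rw [mul_assoc]
        exact le_mul_of_one_le_right hA (one_le_mul_of_one_le_of_one_le (one_le_pow₀ hσ)
          (one_le_pow₀ hρi))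
      · refine (hc j h3).trans ?_
        gcongr
        omega
    rw [norm_mul, norm_pow, Complex.norm_real, Real.norm_eq_abs]
    calc ‖c j‖ * |h| ^ j ≤ (A * σ ^ (j - 1) * ρ⁻¹ ^ (r + 1)) * |h| ^ j := by gcongr
      _ = σ⁻¹ * ((A * ρ⁻¹ ^ (r + 1)) * (|h| * σ) ^ j) := by
          obtain ⟨i, rfl⟩ : ∃ i, j = i + 1 := ⟨j - 1, by omega⟩
          rw [Nat.add_sub_cancel, mul_pow, pow_succ σ i]
          field_simp
      _ ≤ σ⁻¹ * ((A * ρ⁻¹ ^ (r + 1)) * (1 + |h| * σ) ^ (r + 1)) := by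
          have : (|h| * σ) ^ j ≤ (1 + |h| * σ) ^ (r + 1) :=
            (pow_le_pow_left₀ hu (by linarith) j).trans (pow_le_pow_right₀ (by linarith) hjr)
          gcongr
  · rw [Finset.sum_const, nsmul_eq_mul, Nat.card_Icc]
    refine le_of_eq ?_
    rw [show r + 1 + 1 - 2 = r by omega]
    ring

/-- The local expansion of the density from cumulant bounds near the origin. -/
lemma exists_polynomial_of_cumulants {A ρ : ℝ} {r : ℕ} (hr : 1 ≤ r) (hA : 1 ≤ A) (hρ : 0 < ρ)
    (hρ1 : ρ ≤ 1) : ∃ δ₀ : ℝ, 0 < δ₀ ∧ ∀ δ : ℝ, 0 < δ → δ ≤ δ₀ →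
    ∃ (D : ℕ) (Cb C : ℝ), ∀ (σ : ℝ) (χ : ℝ → ℂ) (c : ℕ → ℂ), 24 * A ≤ σ →
      ContinuousOn χ (Set.Icc (-δ) δ) → ‖c 2‖ ≤ A →
      (∀ j, 3 ≤ j → ‖c j‖ ≤ A * σ ^ 2 * ρ⁻¹ ^ j) →
      (∀ h : ℝ, |h| ≤ δ → ‖χ h - ∑ j ∈ Finset.Icc 2 (r + 1), c j * (h : ℂ) ^ j‖
        ≤ A * σ ^ 2 * (|h| / ρ) ^ (r + 2)) →
      ∃ P : Polynomial ℝ, P.natDegree ≤ D ∧ (∀ i, |P.coeff i| ≤ Cb) ∧ ∀ y : ℝ,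
        |(∫ h in (-δ)..δ, Complex.exp (-(Complex.I * h * y)) *
            Complex.exp (-((h : ℂ) ^ 2 * (σ : ℂ) ^ 2 / 2) + χ h)).re / (2 * Real.pi)
          - σ⁻¹ * P.eval (y / σ) * gaussDensity (y / σ)| ≤ C * σ⁻¹ ^ (r + 1) := by
  have hA0 : 0 < A := by linarith
  refine ⟨ρ ^ 3 / (24 * (r + 2) * A), by positivity, fun δ hδ hδ₀ => ?_⟩
  have hδρ : δ ≤ ρ := by
    refine hδ₀.trans ((div_le_self (by positivity) ?_).trans ?_)
    · have : (0 : ℝ) ≤ r := Nat.cast_nonneg r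
      nlinarith
    · exact pow_le_of_le_one hρ.le hρ1 (by norm_num)
  obtain ⟨B, hB, HB⟩ := exists_norm_coeff_truncExp_le r (r + 1) (A * ρ⁻¹ ^ (r + 1))
  obtain ⟨D, Cb, C₁, hC₁, H₁⟩ := exists_polynomial_main_term (r * (r + 1)) r hB hδ
  set m := (r + 2) + (r + 1) * r with hm
  obtain ⟨A₂, hA₂, H₂⟩ := exists_one_add_pow_mul_exp_le m
  set B₃ := A * ρ⁻¹ ^ (r + 2) + (r * (A * ρ⁻¹ ^ (r + 1))) ^ r with hB₃
  have hB₃0 : 0 ≤ B₃ := by positivity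
  refine ⟨D, Cb, C₁ + B₃ * A₂ * √(8 * Real.pi), fun σ χ c hσA hχ hc2 hc hχc => ?_⟩
  have hσ1 : 1 ≤ σ := by linarith
  have hσ : 0 < σ := by linarith
  have hσc : (σ : ℂ) ≠ 0 := by exact_mod_cast hσ.ne'
  have hρi : 1 ≤ ρ⁻¹ := (one_le_inv₀ hρ).2 hρ1
  set Tp : Polynomial ℂ :=
    ∑ j ∈ Finset.Icc 2 (r + 1), Polynomial.monomial j (c j * (σ : ℂ)⁻¹ ^ j) with hTp
  have hTd : Tp.natDegree ≤ r + 1 :=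
    Polynomial.natDegree_sum_le_of_forall_le _ _ fun j hj =>
      (Polynomial.natDegree_monomial_le _).trans (Finset.mem_Icc.1 hj).2
  have hTe : ∀ h : ℝ, Tp.eval ((h * σ : ℝ) : ℂ) = ∑ j ∈ Finset.Icc 2 (r + 1), c j * (h : ℂ) ^ j := by
    intro h
    rw [hTp, Polynomial.eval_finsetSum]
    refine Finset.sum_congr rfl fun j _ => ?_
    rw [Polynomial.eval_monomial]
    push_cast
    rw [mul_pow, inv_pow]
    field_simp
  have hTc : ∀ i, ‖Tp.coeff i‖ ≤ A * ρ⁻¹ ^ (r + 1) := by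
    intro i
    rw [hTp, Polynomial.finsetSum_coeff]
    simp only [Polynomial.coeff_monomial]
    rw [Finset.sum_ite_eq']
    split_ifs with hi
    · obtain ⟨hi2, hir⟩ := Finset.mem_Icc.1 hi
      have hσi : σ⁻¹ ≤ 1 := inv_le_one_of_one_le₀ hσ1
      rw [norm_mul, norm_pow, norm_inv, Complex.norm_real, Real.norm_of_nonneg hσ.le]
      rcases hi2.eq_or_lt with rfl | h3
      · exact mul_le_mul hc2 ((pow_le_one₀ (by positivity) hσi).trans (one_le_pow₀ hρi))
          (by positivity) hA0.le
      · calc ‖c i‖ * σ⁻¹ ^ i ≤ A * σ ^ 2 * ρ⁻¹ ^ i * σ⁻¹ ^ 2 := by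
              exact mul_le_mul (hc i h3) (pow_le_pow_of_le_one (by positivity) hσi hi2)
                (by positivity) (by positivity)
          _ = A * ρ⁻¹ ^ i := by field_simp
          _ ≤ _ := by gcongr
    · rw [norm_zero]; positivity
  obtain ⟨P, hP1, hP2, hP3⟩ := H₁ (truncExp r Tp) (natDegree_truncExp_le r hTd) (HB Tp hTd hTc)
  refine ⟨P, hP1, hP2, fun y => ?_⟩
  have hpt : ∀ h : ℝ, |h| ≤ δ →
      ‖Complex.exp (-(Complex.I * h * y)) * Complex.exp (-((h : ℂ) ^ 2 * (σ : ℂ) ^ 2 / 2) + χ h)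
        - (truncExp r Tp).eval ((h * σ : ℝ) : ℂ) * gaussChar (y / σ) (h * σ)‖
      ≤ σ⁻¹ ^ r * (B₃ * A₂) * Real.exp (-(1 / 8 * σ ^ 2) * h ^ 2) := by
    intro h hh
    set u := |h| * σ with hu
    have hu0 : 0 ≤ u := by positivity
    have hu2 : u ^ 2 = h ^ 2 * σ ^ 2 := by rw [hu, mul_pow, sq_abs]
    have hhρ : |h| / ρ ≤ 1 := (div_le_one hρ).2 (hh.trans hδρ)
    set T := ∑ j ∈ Finset.Icc 2 (r + 1), c j * (h : ℂ) ^ j with hT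
    have hcub : (r + 2) * (A * σ ^ 2 * (|h| / ρ) ^ 3) ≤ u ^ 2 / 24 := by
      have h1 : |h| * (24 * (r + 2) * A) ≤ ρ ^ 3 :=
        (le_div_iff₀ (by positivity)).1 (hh.trans hδ₀)
      have h2 : (r + 2) * A * (|h| / ρ ^ 3) ≤ 1 / 24 := by
        rw [mul_div_assoc', div_le_div_iff₀ (by positivity) (by norm_num)]
        linarith
      calc (r + 2) * (A * σ ^ 2 * (|h| / ρ) ^ 3)
          = u ^ 2 * ((r + 2) * A * (|h| / ρ ^ 3)) := by rw [hu, div_pow]; ring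
        _ ≤ u ^ 2 * (1 / 24) := by gcongr
        _ = _ := by ring
    have hsqr : A * h ^ 2 ≤ u ^ 2 / 24 := by
      rw [hu2]
      have : 24 * A ≤ σ ^ 2 := hσA.trans (by rw [pow_two]; exact le_mul_of_one_le_left hσ.le hσ1)
      nlinarith [mul_le_mul_of_nonneg_right this (sq_nonneg h)]
    have hTb0 := norm_sum_cumulant_le hr hA0.le hρ (hh.trans hδρ) hc2 hc
    rw [← hT] at hTb0
    have hrem : A * σ ^ 2 * (|h| / ρ) ^ (r + 2) ≤ A * σ ^ 2 * (|h| / ρ) ^ 3 := by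
      refine mul_le_mul_of_nonneg_left ?_ (by positivity)
      exact pow_le_pow_of_le_one (by positivity) hhρ (by omega)
    have hq0 : 0 ≤ A * σ ^ 2 * (|h| / ρ) ^ 3 := by positivity
    have hTb : ‖T‖ ≤ u ^ 2 / 12 := by linarith
    have hχb : ‖χ h‖ ≤ u ^ 2 / 12 := by
      have h1 := norm_le_norm_add_norm_sub' (χ h) T
      have h2 := hχc h hh
      linarith
    have hTs := norm_sum_cumulant_le' (h := h) (r := r) hA0.le hρ hρ1 hσ1 hc2 hc
    rw [← hT, ← hu] at hTs
    have hdiff := norm_exp_sub_truncExp_le hχb hTb r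
    have e : Complex.exp (-(Complex.I * h * y)) *
          Complex.exp (-((h : ℂ) ^ 2 * (σ : ℂ) ^ 2 / 2) + χ h)
        - (truncExp r Tp).eval ((h * σ : ℝ) : ℂ) * gaussChar (y / σ) (h * σ)
        = gaussChar (y / σ) (h * σ) *
          (Complex.exp (χ h) - ∑ k ∈ Finset.range r, T ^ k / (k.factorial : ℂ)) := by
      rw [eval_truncExp, hTe, ← hT, gaussChar_mul _ _ hσ.ne', Complex.exp_add]
      ring
    have hu1 : 1 ≤ 1 + u := by linarith
    have h3 : ‖χ h - T‖ ≤ σ⁻¹ ^ r * (A * ρ⁻¹ ^ (r + 2) * (1 + u) ^ m) := by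
      calc ‖χ h - T‖ ≤ A * σ ^ 2 * (|h| / ρ) ^ (r + 2) := hχc h hh
        _ = σ⁻¹ ^ r * (A * ρ⁻¹ ^ (r + 2) * u ^ (r + 2)) := by
            rw [hu, mul_pow, div_pow, inv_pow, inv_pow, pow_add σ r 2]
            field_simp
        _ ≤ _ := by
            have : u ^ (r + 2) ≤ (1 + u) ^ m :=
              (pow_le_pow_left₀ hu0 (by linarith) _).trans (pow_le_pow_right₀ hu1 (by omega))
            gcongr
    have h4 : ‖T‖ ^ r ≤ σ⁻¹ ^ r * ((r * (A * ρ⁻¹ ^ (r + 1))) ^ r * (1 + u) ^ m) := by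
      refine (pow_le_pow_left₀ (norm_nonneg _) hTs r).trans ?_
      rw [mul_pow, mul_pow _ ((1 + u) ^ (r + 1)) r, ← pow_mul]
      have : (1 + u) ^ ((r + 1) * r) ≤ (1 + u) ^ m := pow_le_pow_right₀ hu1 (by omega)
      gcongr
    rw [e, norm_mul, norm_gaussChar]
    have hexp : Real.exp (-(1 / 2 * (h * σ) ^ 2)) * Real.exp (3 * (u ^ 2 / 12))
        = Real.exp (-(u ^ 2 / 4)) := by
      rw [← Real.exp_add, hu2]; ring_nf
    calc _ ≤ Real.exp (-(1 / 2 * (h * σ) ^ 2)) *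
          ((σ⁻¹ ^ r * (A * ρ⁻¹ ^ (r + 2) * (1 + u) ^ m) +
            σ⁻¹ ^ r * ((r * (A * ρ⁻¹ ^ (r + 1))) ^ r * (1 + u) ^ m)) *
              Real.exp (3 * (u ^ 2 / 12))) := by
          gcongr
          exact hdiff.trans (by gcongr)
      _ = σ⁻¹ ^ r * B₃ * ((1 + u) ^ m *
          (Real.exp (-(1 / 2 * (h * σ) ^ 2)) * Real.exp (3 * (u ^ 2 / 12)))) := by
          rw [hB₃]; ring
      _ ≤ σ⁻¹ ^ r * B₃ * (A₂ * Real.exp (-(u ^ 2 / 8))) := by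
          rw [hexp]
          exact mul_le_mul_of_nonneg_left (H₂ u hu0) (by positivity)
      _ = _ := by
          rw [hu2, show -(h ^ 2 * σ ^ 2 / 8) = -(1 / 8 * σ ^ 2) * h ^ 2 by ring]
          ring
  have hcont1 : ContinuousOn (fun h : ℝ => Complex.exp (-(Complex.I * h * y)) *
      Complex.exp (-((h : ℂ) ^ 2 * (σ : ℂ) ^ 2 / 2) + χ h)) (Set.Icc (-δ) δ) := by fun_prop
  have hcont2 : Continuous (fun h : ℝ => (truncExp r Tp).eval ((h * σ : ℝ) : ℂ) *
      gaussChar (y / σ) (h * σ)) := by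
    refine Continuous.mul ?_ ((continuous_gaussChar _).comp (by fun_prop))
    exact (truncExp r Tp).continuous.comp (by fun_prop)
  have hb : 0 < 1 / 8 * σ ^ 2 := by positivity
  have hgi := (integrable_exp_neg_mul_sq hb).const_mul (σ⁻¹ ^ r * (B₃ * A₂))
  have hle : -δ ≤ δ := by linarith
  have hi1 := hcont1.intervalIntegrable_of_Icc (μ := volume) hle
  have hi2 := hcont2.intervalIntegrable (μ := volume) (-δ) δ
  have hI : ‖(∫ h in (-δ)..δ, Complex.exp (-(Complex.I * h * y)) *
        Complex.exp (-((h : ℂ) ^ 2 * (σ : ℂ) ^ 2 / 2) + χ h)) -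
      ∫ h in (-δ)..δ, (truncExp r Tp).eval ((h * σ : ℝ) : ℂ) * gaussChar (y / σ) (h * σ)‖
      ≤ σ⁻¹ ^ r * (B₃ * A₂) * (√(8 * Real.pi) * σ⁻¹) := by
    rw [← intervalIntegral.integral_sub hi1 hi2]
    refine (intervalIntegral.norm_integral_le_of_norm_le hle
      (g := fun h => σ⁻¹ ^ r * (B₃ * A₂) * Real.exp (-(1 / 8 * σ ^ 2) * h ^ 2))
      (ae_of_all _ fun h hh => hpt h (abs_le.2 ⟨hh.1.le, hh.2⟩)) hgi.intervalIntegrable).trans ?_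
    rw [intervalIntegral.integral_of_le hle]
    refine (setIntegral_le_integral hgi (ae_of_all _ fun h => by positivity)).trans ?_
    rw [integral_const_mul, integral_gaussian, show Real.pi / (1 / 8 * σ ^ 2) = 8 * Real.pi / σ ^ 2
      by field_simp, Real.sqrt_div' _ (by positivity), Real.sqrt_sq hσ.le, div_eq_mul_inv]
  have hM := hP3 σ y hσ
  set I₁ := ∫ h in (-δ)..δ, Complex.exp (-(Complex.I * h * y)) *
        Complex.exp (-((h : ℂ) ^ 2 * (σ : ℂ) ^ 2 / 2) + χ h)
  set I₂ := ∫ h in (-δ)..δ, (truncExp r Tp).eval ((h * σ : ℝ) : ℂ) * gaussChar (y / σ) (h * σ)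
  have hI' : |I₁.re / (2 * Real.pi) - I₂.re / (2 * Real.pi)|
      ≤ σ⁻¹ ^ r * (B₃ * A₂) * (√(8 * Real.pi) * σ⁻¹) := by
    rw [← sub_div, ← Complex.sub_re, abs_div, abs_of_pos (by positivity : 0 < 2 * Real.pi)]
    refine (div_le_self (abs_nonneg _) ?_).trans ((Complex.abs_re_le_norm _).trans hI)
    linarith [Real.pi_gt_three]
  calc _ ≤ _ := abs_sub_le _ (I₂.re / (2 * Real.pi)) _
    _ ≤ _ := add_le_add hI' (by simpa using hM)
    _ = _ := by rw [pow_succ]; ring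

section

/-! ### Identification of the cumulants -/

lemma eq_zero_of_norm_le_mul {v : ℂ} {D : ℝ} {δ : ℝ} (hδ : 0 < δ)
    (h : ∀ t : ℝ, 0 < t → t < δ → ‖v‖ ≤ D * t) : v = 0 := by
  by_contra hv
  have hv' : 0 < ‖v‖ := norm_pos_iff.2 hv
  set t := min (δ / 2) (‖v‖ / (2 * (|D| + 1))) with ht
  have ht0 : 0 < t := lt_min (by positivity) (by positivity)
  have h1 := h t ht0 ((min_le_left _ _).trans_lt (by linarith))
  have h2 : (|D| + 1) * t ≤ ‖v‖ / 2 := by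
    calc (|D| + 1) * t ≤ (|D| + 1) * (‖v‖ / (2 * (|D| + 1))) := by
          gcongr; exact min_le_right _ _
      _ = ‖v‖ / 2 := by field_simp
  have h3 : D * t ≤ (|D| + 1) * t := by gcongr; linarith [le_abs_self D]
  linarith

lemma eq_zero_of_norm_quadratic_le {β γ : ℂ} {D δ : ℝ} (hδ : 0 < δ)
    (h : ∀ t : ℝ, 0 < t → t < δ → ‖β * t + γ * (t : ℂ) ^ 2‖ ≤ D * t ^ 3) : β = 0 ∧ γ = 0 := by
  have hβ : β = 0 := by
    refine eq_zero_of_norm_le_mul (D := |D| + ‖γ‖) (lt_min hδ one_pos) fun t ht htd => ?_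
    have h1 := h t ht (htd.trans_le (min_le_left _ _))
    have h2 : ‖β * t‖ ≤ ‖β * t + γ * (t : ℂ) ^ 2‖ + ‖γ * (t : ℂ) ^ 2‖ := by
      have := norm_sub_le (β * t + γ * (t : ℂ) ^ 2) (γ * (t : ℂ) ^ 2)
      rwa [add_sub_cancel_right] at this
    rw [norm_mul, norm_mul _ ((t : ℂ) ^ 2), norm_pow, Complex.norm_real,
      Real.norm_of_nonneg ht.le] at h2
    have ht1 : t ≤ 1 := htd.le.trans (min_le_right _ _)
    have h4 : D * t ^ 3 ≤ |D| * t ^ 2 :=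
      mul_le_mul (le_abs_self D) (pow_le_pow_of_le_one ht.le ht1 (by norm_num)) (by positivity)
        (abs_nonneg D)
    refine le_of_mul_le_mul_right ?_ ht
    calc ‖β‖ * t ≤ |D| * t ^ 2 + ‖γ‖ * t ^ 2 := by linarith
      _ = _ := by ring
  refine ⟨hβ, eq_zero_of_norm_le_mul (D := D) hδ fun t ht htd => ?_⟩
  have h1 := h t ht htd
  rw [hβ, zero_mul, zero_add, norm_mul, norm_pow, Complex.norm_real,
    Real.norm_of_nonneg ht.le] at h1
  refine le_of_mul_le_mul_right ?_ (pow_pos ht 2)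
  calc _ ≤ _ := h1
    _ = _ := by ring

lemma norm_exp_sub_quadratic_le (z : ℂ) {b : ℝ} (hz : ‖z‖ ≤ b) :
    ‖Complex.exp z - (1 + z + z ^ 2 / 2)‖ ≤ b ^ 3 * Real.exp b := by
  have h := Complex.norm_exp_sub_sum_le_norm_mul_exp z 3
  simp only [Finset.sum_range_succ, Finset.range_zero, Finset.sum_empty, pow_zero, pow_one,
    Nat.factorial, Nat.cast_one, div_one, zero_add] at h
  norm_num at h
  refine h.trans ?_
  have := (norm_nonneg z).trans hz
  gcongr

/-- The first two Taylor coefficients of the logarithm of a characteristic function. -/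
lemma cumulants_eq {Y : Type*} [MeasurableSpace Y] {Q : Measure Y} [IsProbabilityMeasure Q]
    {U : Y → ℝ} (hU : Measurable U) {L : ℝ} (hL : ∀ x, |U x| ≤ L) {ψ : ℂ → ℂ} {a : ℕ → ℂ} {R B : ℝ}
    (hR : 0 < R) (ha0 : a 0 = 0)
    (hψ : ∀ h : ℝ, 0 < h → h < R → Complex.exp (ψ h) = ∫ x, Complex.exp (Complex.I * h * U x) ∂Q)
    (hψa : ∀ h : ℝ, 0 < h → h < R →
      ‖ψ h - ∑ j ∈ Finset.range 3, a j * (h : ℂ) ^ j‖ ≤ B * h ^ 3) :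
    a 1 = Complex.I * (∫ x, U x ∂Q : ℝ) ∧ a 2 = -((variance U Q / 2 : ℝ) : ℂ) := by
  obtain ⟨x₀⟩ : Nonempty Y := nonempty_of_isProbabilityMeasure Q
  have hL0 : 0 ≤ L := (abs_nonneg _).trans (hL x₀)
  have hUm : MemLp U 2 Q := MemLp.of_bound hU.aestronglyMeasurable L (ae_of_all _ hL)
  have hUi : Integrable U Q := hUm.integrable one_le_two
  have hU2 : Integrable (fun x => U x ^ 2) Q := hUm.integrable_sq
  set m := ∫ x, U x ∂Q with hm
  set s := ∫ x, U x ^ 2 ∂Q with hs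
  have hvar : variance U Q = s - m ^ 2 := by
    rw [variance_eq_sub hUm]; rfl
  set δ := min R 1 with hδ
  have hδ0 : 0 < δ := lt_min hR one_pos
  have hB : 0 ≤ B := by
    have := (norm_nonneg _).trans (hψa (δ / 2) (by positivity)
      (by linarith [min_le_left R 1]))
    exact nonneg_of_mul_nonneg_left this (by positivity)
  set D₁ := ‖a 1‖ + ‖a 2‖ + B with hD₁
  have hD₁0 : 0 ≤ D₁ := by positivity
  have key : ∀ t : ℝ, 0 < t → t < δ →
      ‖(Complex.I * m - a 1) * t + (-(s / 2) - a 2 - a 1 ^ 2 / 2) * (t : ℂ) ^ 2‖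
        ≤ (L ^ 3 * Real.exp L + D₁ ^ 3 * Real.exp D₁ + B + D₁ * (‖a 2‖ + B)) * t ^ 3 := by
    intro t ht htd
    have htR : t < R := htd.trans_le (min_le_left _ _)
    have ht1 : t ≤ 1 := htd.le.trans (min_le_right _ _)
    have hnt : ‖(t : ℂ)‖ = t := by rw [Complex.norm_real, Real.norm_of_nonneg ht.le]
    -- the characteristic function
    have hI : ∫ x, (1 + Complex.I * t * U x + (Complex.I * t * U x) ^ 2 / 2) ∂Q
        = 1 + Complex.I * m * t - s / 2 * (t : ℂ) ^ 2 := by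
      have e : ∀ x, (1 + Complex.I * t * U x + (Complex.I * t * U x) ^ 2 / 2 : ℂ)
          = 1 + (Complex.I * t) * ((U x : ℝ) : ℂ) + (-(t : ℂ) ^ 2 / 2) * ((U x ^ 2 : ℝ) : ℂ) := by
        intro x
        push_cast
        rw [mul_pow, mul_pow, Complex.I_sq]
        ring
      simp only [e]
      rw [integral_add, integral_add, integral_const_mul, integral_const_mul, integral_complex_ofReal,
        integral_complex_ofReal, ← hm, ← hs]
      · simp
        ring
      · exact integrable_const _
      · exact hUi.ofReal.const_mul _
      · exact (integrable_const _).add (hUi.ofReal.const_mul _)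
      · exact hU2.ofReal.const_mul _
    have hIi : Integrable (fun x => Complex.exp (Complex.I * t * U x)) Q := by
      refine Integrable.of_bound (by fun_prop) 1 (ae_of_all _ fun x => ?_)
      rw [show Complex.I * t * U x = ((t * U x : ℝ) : ℂ) * Complex.I by push_cast; ring,
        Complex.norm_exp_ofReal_mul_I]
    have h1 : ‖Complex.exp (ψ t) - (1 + Complex.I * m * t - s / 2 * (t : ℂ) ^ 2)‖
        ≤ L ^ 3 * Real.exp L * t ^ 3 := by
      rw [hψ t ht htR, ← hI, ← integral_sub hIi]
      · refine (norm_integral_le_of_norm_le_const (C := L ^ 3 * Real.exp L * t ^ 3)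
          (ae_of_all _ fun x => ?_)).trans (by simp)
        have hb : ‖Complex.I * t * U x‖ ≤ t * L := by
          rw [norm_mul, norm_mul, Complex.norm_I, one_mul, hnt, Complex.norm_real]
          exact mul_le_mul_of_nonneg_left (hL x) ht.le
        refine (norm_exp_sub_quadratic_le _ hb).trans ?_
        have : Real.exp (t * L) ≤ Real.exp L := Real.exp_le_exp.2 (mul_le_of_le_one_left hL0 ht1)
        calc (t * L) ^ 3 * Real.exp (t * L) ≤ (t * L) ^ 3 * Real.exp L := by gcongr
          _ = _ := by ring
      · refine Integrable.of_bound (by fun_prop) (1 + t * L + (t * L) ^ 2 / 2)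
          (ae_of_all _ fun x => ?_)
        have hb : ‖Complex.I * t * U x‖ ≤ t * L := by
          rw [norm_mul, norm_mul, Complex.norm_I, one_mul, hnt, Complex.norm_real]
          exact mul_le_mul_of_nonneg_left (hL x) ht.le
        refine (norm_add₃_le).trans ?_
        rw [norm_one, norm_div, norm_pow, Complex.norm_ofNat]
        gcongr
    -- the logarithm
    have hrem := hψa t ht htR
    set ρ := ψ t - ∑ j ∈ Finset.range 3, a j * (t : ℂ) ^ j with hρ
    have hψe : ψ t = a 1 * t + (a 2 * (t : ℂ) ^ 2 + ρ) := by
      rw [hρ]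
      simp only [Finset.sum_range_succ, Finset.range_zero, Finset.sum_empty, ha0]
      ring
    have ht3 : t ^ 3 ≤ t ^ 2 := pow_le_pow_of_le_one ht.le ht1 (by norm_num)
    have ht2 : t ^ 2 ≤ t := pow_le_of_le_one ht.le ht1 (by norm_num)
    set θ := a 2 * (t : ℂ) ^ 2 + ρ with hθ
    have hθn : ‖θ‖ ≤ (‖a 2‖ + B) * t ^ 2 := by
      refine (norm_add_le _ _).trans ?_
      rw [norm_mul, norm_pow, hnt, add_mul]
      gcongr
      exact hrem.trans (by gcongr)
    have hψn : ‖ψ t‖ ≤ D₁ * t := by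
      rw [hψe]
      refine (norm_add_le _ _).trans ?_
      rw [norm_mul, hnt, hD₁, add_assoc, add_mul]
      gcongr
      exact hθn.trans (by gcongr)
    have h2 : ‖Complex.exp (ψ t) - (1 + ψ t + ψ t ^ 2 / 2)‖ ≤ D₁ ^ 3 * Real.exp D₁ * t ^ 3 := by
      refine (norm_exp_sub_quadratic_le _ hψn).trans ?_
      have : Real.exp (D₁ * t) ≤ Real.exp D₁ := Real.exp_le_exp.2 (mul_le_of_le_one_right hD₁0 ht1)
      calc (D₁ * t) ^ 3 * Real.exp (D₁ * t) ≤ (D₁ * t) ^ 3 * Real.exp D₁ := by gcongr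
        _ = _ := by ring
    have h3 : ‖θ * (ψ t + a 1 * t) / 2‖ ≤ D₁ * (‖a 2‖ + B) * t ^ 3 := by
      rw [norm_div, norm_mul, Complex.norm_ofNat]
      have : ‖ψ t + a 1 * t‖ ≤ 2 * (D₁ * t) := by
        refine (norm_add_le _ _).trans ?_
        rw [norm_mul, hnt]
        have : ‖a 1‖ * t ≤ D₁ * t := by
          gcongr; rw [hD₁]; linarith [norm_nonneg (a 2)]
        linarith
      calc ‖θ‖ * ‖ψ t + a 1 * t‖ / 2 ≤ ((‖a 2‖ + B) * t ^ 2) * (2 * (D₁ * t)) / 2 := by gcongr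
        _ = _ := by ring
    have e : (Complex.I * m - a 1) * t + (-(s / 2) - a 2 - a 1 ^ 2 / 2) * (t : ℂ) ^ 2
        = -(Complex.exp (ψ t) - (1 + Complex.I * m * t - s / 2 * (t : ℂ) ^ 2))
          + (Complex.exp (ψ t) - (1 + ψ t + ψ t ^ 2 / 2)) + ρ + θ * (ψ t + a 1 * t) / 2 := by
      have : θ = ψ t - a 1 * t := by rw [hψe]; ring
      have hρ' : ρ = ψ t - a 1 * t - a 2 * (t : ℂ) ^ 2 := by rw [hψe, hθ]; ring
      rw [this, hρ']
      ring
    rw [e]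
    refine (norm_add_le _ _).trans ((add_le_add_left (norm_add₃_le) _).trans ?_)
    rw [norm_neg]
    linarith
  obtain ⟨h1, h2⟩ := eq_zero_of_norm_quadratic_le hδ0 key
  have ha1 : a 1 = Complex.I * m := (sub_eq_zero.1 h1).symm
  refine ⟨ha1, ?_⟩
  rw [ha1, mul_pow, Complex.I_sq] at h2
  rw [hvar]
  push_cast
  linear_combination -h2

/-- The sum of the values of `g` along a path. -/
def pathSum (g : ℕ → E → ℤ) (N : ℕ) (x : ℕ → E) : ℤ := ∑ i ∈ Finset.range N, g i (x i)

lemma measurable_pathSum {g : ℕ → E → ℤ} (hg : ∀ n, Measurable (g n)) (N : ℕ) :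
    Measurable (pathSum g N) := by
  unfold pathSum
  exact Finset.measurable_fun_sum _ fun i _ => (hg i).comp (measurable_pi_apply i)

lemma abs_pathSum_le {g : ℕ → E → ℤ} {G : ℝ} (hG : ∀ n x, |(g n x : ℝ)| ≤ G) (N : ℕ) (x : ℕ → E) :
    |(pathSum g N x : ℝ)| ≤ N * G := by
  rw [pathSum, Int.cast_sum]
  refine (Finset.abs_sum_le_sum_abs _ _).trans ((Finset.sum_le_sum fun i _ => hG i (x i)).trans ?_)
  rw [Finset.sum_const, Finset.card_range, nsmul_eq_mul]

variable {ν : ℕ → Measure E} {k : ℕ → E → E → ℝ} {c : ℝ} {g : ℕ → E → ℤ} {N : ℕ}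
  {Q : Measure (ℕ → E)}

lemma prod_phase_eq_exp_pathSum (z : ℂ) (x : ℕ → E) :
    ∏ i ∈ Finset.range N, phase z (g i) (x i)
      = Complex.exp (Complex.I * z * ((pathSum g N x : ℝ) : ℂ)) := by
  unfold phase pathSum
  push_cast
  rw [Finset.mul_sum, Complex.exp_sum]

lemma IsPathLaw.integral_exp_pathSum (hQ : IsPathLaw ν k N Q) (hg : ∀ n, Measurable (g n)) {G : ℝ}
    (hG : ∀ n x, |(g n x : ℝ)| ≤ G) (z : ℂ) (y : E) :
    ∫ x, Complex.exp (Complex.I * z * ((pathSum g N x : ℝ) : ℂ)) ∂Q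
      = bwd ν k (fun n => phase z (g n)) N y := by
  rw [← hQ.2 _ (fun n => (holBdd_phase (hg n) (hG n)).bddMeas z) y]
  simp only [prod_phase_eq_exp_pathSum]

/-- The cumulant expansion of the characteristic function along the path. -/
lemma exists_cumulant_expansion (hB : IsBackwardKernel ν k c) (hQ : IsPathLaw ν k N Q)
    (hg : ∀ n, Measurable (g n)) {G : ℝ} (hG1 : 1 ≤ G) (hG : ∀ n x, |(g n x : ℝ)| ≤ G) (y : E)
    {W M : ℝ} (hW : W = ∑ n ∈ Finset.range N, (ν n).real {x | g n x ≠ 0})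
    (hM : M = 54 * G / c ^ 2 * rad c G * W) :
    ∃ (ψ : ℂ → ℂ) (a : ℕ → ℂ), ContinuousOn ψ (Metric.ball 0 (rad c G)) ∧
      (∀ h ∈ Metric.ball (0 : ℂ) (rad c G),
        bwd ν k (fun n => phase h (g n)) N y = Complex.exp (ψ h)) ∧
      (∀ j, ‖a j‖ ≤ M * (2 / rad c G) ^ j) ∧
      a 0 = 0 ∧ a 1 = Complex.I * (∫ x, (pathSum g N x : ℝ) ∂Q : ℝ) ∧
      a 2 = -((variance (fun x => (pathSum g N x : ℝ)) Q / 2 : ℝ) : ℂ) ∧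
      ∀ n z, ‖z‖ ≤ rad c G / 4 →
        ‖ψ z - ∑ j ∈ Finset.range n, a j * z ^ j‖ ≤ 2 * M * (2 * ‖z‖ / rad c G) ^ n := by
  have hR := rad_pos hB.pos hG1
  have hc := hB.pos
  have := hQ.1
  obtain ⟨ψ, hψd, hψ⟩ := exists_exp_eq_bwd_phase hB hg hG1 hG N y
  have hW0 : 0 ≤ W := by rw [hW]; exact Finset.sum_nonneg fun _ _ => measureReal_nonneg
  obtain ⟨a, ha1, ha0, -, ha⟩ := exists_taylor_of_differentiableOn (M := M) hR hψd fun z hz => by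
    refine (hψ z hz).2.trans ?_
    rw [← hW, hM]
    have : ‖z‖ ≤ rad c G := (mem_ball_zero_iff.1 hz).le
    gcongr
  have hψ0 : ψ 0 = 0 := by
    have := (hψ 0 (by simpa using hR)).2
    simpa using this
  obtain ⟨e1, e2⟩ := cumulants_eq (Q := Q) (U := fun x => (pathSum g N x : ℝ)) (ψ := ψ) (a := a)
    (R := rad c G / 4) (B := 2 * M * (2 / rad c G) ^ 3)
    (measurable_from_top.comp (measurable_pathSum hg N)) (abs_pathSum_le hG N) (by positivity)
    (ha0.trans hψ0)
    (fun h h0 hh => by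
      rw [hQ.integral_exp_pathSum hg hG _ y, (hψ h _).1]
      rw [mem_ball_zero_iff, Complex.norm_real, Real.norm_of_nonneg h0.le]
      linarith)
    (fun h h0 hh => by
      refine (ha 3 h ?_).trans (le_of_eq ?_)
      · rw [Complex.norm_real, Real.norm_of_nonneg h0.le]; exact hh.le
      · rw [Complex.norm_real, Real.norm_of_nonneg h0.le]
        ring)
  exact ⟨ψ, a, hψd.continuousOn, fun h hh => (hψ h hh).1, ha1, ha0.trans hψ0, e1, e2, ha⟩

end

/-! ### Fourier inversion and comparison of the variance with the number of non-trivial sites -/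

lemma intervalIntegral_exp_int_mul (δ : ℝ) (n : ℤ) :
    ∫ t in (-δ)..(2 * Real.pi - δ), Complex.exp (Complex.I * t * n)
      = if n = 0 then ((2 * Real.pi : ℝ) : ℂ) else 0 := by
  split_ifs with h
  · subst h
    simp
  · have hc : Complex.I * n ≠ 0 := mul_ne_zero Complex.I_ne_zero (by exact_mod_cast h)
    have e : ∀ t : ℝ, Complex.exp (Complex.I * t * n) = Complex.exp ((Complex.I * n) * t) :=
      fun t => by ring_nf
    simp only [e]
    rw [integral_exp_mul_complex hc]
    have : Complex.I * n * ((2 * Real.pi - δ : ℝ) : ℂ)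
        = Complex.I * n * ((-δ : ℝ) : ℂ) + n * (2 * Real.pi * Complex.I) := by
      push_cast; ring
    rw [this, Complex.exp_add, Complex.exp_int_mul_two_pi_mul_I, mul_one, sub_self, zero_div]

lemma measureReal_eq_intervalIntegral {Y : Type*} [MeasurableSpace Y] {Q : Measure Y}
    [IsProbabilityMeasure Q] {U : Y → ℤ} (hU : Measurable U) (δ : ℝ) (k : ℤ) :
    ∫ t in (-δ)..(2 * Real.pi - δ), Complex.exp (-(Complex.I * t * k)) *
        ∫ x, Complex.exp (Complex.I * t * ((U x : ℝ) : ℂ)) ∂Q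
      = ((2 * Real.pi * Q.real {x | U x = k} : ℝ) : ℂ) := by
  have hle : -δ ≤ 2 * Real.pi - δ := by linarith [Real.pi_pos]
  have hUr : Measurable fun x => (U x : ℝ) := measurable_from_top.comp hU
  have e : ∀ t : ℝ, Complex.exp (-(Complex.I * t * k)) *
        ∫ x, Complex.exp (Complex.I * t * ((U x : ℝ) : ℂ)) ∂Q
      = ∫ x, Complex.exp (Complex.I * t * ((U x : ℝ) - k : ℂ)) ∂Q := by
    intro t
    rw [← integral_const_mul]
    refine integral_congr_ae (ae_of_all _ fun x => ?_)
    simp only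
    rw [← Complex.exp_add]
    ring_nf
  simp only [e]
  rw [intervalIntegral.integral_of_le hle, integral_integral_swap]
  · have e2 : ∀ x, ∫ t in Set.Ioc (-δ) (2 * Real.pi - δ),
          Complex.exp (Complex.I * t * ((U x : ℝ) - k : ℂ))
        = ({x | U x = k} : Set Y).indicator (fun _ => ((2 * Real.pi : ℝ) : ℂ)) x := by
      intro x
      rw [← intervalIntegral.integral_of_le hle]
      have := intervalIntegral_exp_int_mul δ (U x - k)
      rw [Set.indicator_apply]
      simp only [sub_eq_zero, Int.cast_sub] at this
      simpa using this
    simp only [e2]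
    have hk : MeasurableSet {x | U x = k} := hU (measurableSet_singleton k)
    rw [integral_indicator_const _ hk, Complex.real_smul,
      ← Complex.ofReal_mul, mul_comm]
  · refine Integrable.of_bound (C := 1) ?_ (ae_of_all _ fun p => ?_)
    · refine Measurable.aestronglyMeasurable ?_
      have h1 : Measurable fun p : ℝ × Y => (U p.2 : ℝ) := hUr.comp measurable_snd
      have h2 : Measurable fun p : ℝ × Y => p.1 := measurable_fst
      simp only [Function.uncurry_def]
      fun_prop
    · simp only [Function.uncurry]
      rw [show Complex.I * p.1 * ((U p.2 : ℝ) - k : ℂ) = ((p.1 * (U p.2 - k) : ℝ) : ℂ) * Complex.I by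
        push_cast; ring, Complex.norm_exp_ofReal_mul_I]

lemma exists_variance_bounds {c a : ℝ} {G : ℕ} (hc : 0 < c) (ha : 0 < a) (hG1 : 1 ≤ G) :
    ∃ A : ℝ, 1 ≤ A ∧ ∀ {ν : ℕ → Measure E} {k : ℕ → E → E → ℝ} {g : ℕ → E → ℤ} {N : ℕ}
      {Q : Measure (ℕ → E)}, IsBackwardKernel ν k c → IsPathLaw ν k N Q →
      (∀ n, Measurable (g n)) → (∀ n x, |g n x| ≤ G) → (∀ n, a ≤ (ν n).real {x | g n x = 0}) →
      ∀ {W : ℝ}, W = ∑ n ∈ Finset.range N, (ν n).real {x | g n x ≠ 0} →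
      variance (fun x => (pathSum g N x : ℝ)) Q ≤ A * W ∧
      W ≤ A * (variance (fun x => (pathSum g N x : ℝ)) Q + 1) := by
  have hG1' : (1 : ℝ) ≤ G := by exact_mod_cast hG1
  obtain ⟨κ, hκ, H⟩ := exists_norm_bwd_phase_le_near (E := E) G hc ha 0
  have hR := rad_pos hc hG1'
  set R := rad c G with hRdef
  set b := 54 * G / c ^ 2 * R with hb
  have hb0 : 0 < b := by positivity
  set h := min (min κ (R / 8)) (κ * R ^ 3 / (32 * b)) with hh
  have hh0 : 0 < h := by positivity
  refine ⟨1 + 2 * b * (2 / R) ^ 2 + (2 / h ^ 2 + 1) / κ, by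
    have : 0 ≤ 2 * b * (2 / R) ^ 2 := by positivity
    have : 0 ≤ (2 / h ^ 2 + 1) / κ := by positivity
    linarith, fun {ν k g N Q} hB hQ hg hG hga W hW => ?_⟩
  have hW0 : 0 ≤ W := by rw [hW]; exact Finset.sum_nonneg fun _ _ => measureReal_nonneg
  obtain ⟨y⟩ := hB.nonempty
  have hG' : ∀ n x, |(g n x : ℝ)| ≤ G := fun n x => by exact_mod_cast hG n x
  obtain ⟨ψ, α, -, hψ, hα, hα0, hα1, hα2, hrem⟩ :=
    exists_cumulant_expansion hB hQ hg hG1' hG' y hW rfl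
  rw [← hRdef] at hψ hα hrem
  set V := variance (fun x => (pathSum g N x : ℝ)) Q with hV
  have hV0 : 0 ≤ V := variance_nonneg _ _
  have hq1 : 0 ≤ 2 * b * (2 / R) ^ 2 := by positivity
  have hq2 : 0 ≤ (2 / h ^ 2 + 1) / κ := by positivity
  constructor
  · have h2 := hα 2
    rw [hα2, norm_neg, Complex.norm_real, Real.norm_of_nonneg (by positivity), ← hb] at h2
    calc V ≤ 2 * b * (2 / R) ^ 2 * W := by linarith
      _ ≤ _ := by
          refine mul_le_mul_of_nonneg_right ?_ hW0
          linarith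
  · have hhκ : h ≤ κ := (min_le_left _ _).trans (min_le_left _ _)
    have hhR : h ≤ R / 8 := (min_le_left _ _).trans (min_le_right _ _)
    have hhb : h * (32 * b) ≤ κ * R ^ 3 := (le_div_iff₀ (by positivity)).1 (min_le_right _ _)
    have hnh : ‖(h : ℂ)‖ = h := by rw [Complex.norm_real, Real.norm_of_nonneg hh0.le]
    have h1 := H hB hg hG hga N y h (by rwa [abs_of_pos hh0])
    rw [zero_add, hψ h (by rw [mem_ball_zero_iff, hnh]; linarith), Complex.norm_exp, ← hW] at h1
    have h2 : Real.exp (ψ h).re ≤ Real.exp (1 - κ * (h ^ 2 * W)) := by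
      refine h1.trans ?_
      rw [sub_eq_add_neg, Real.exp_add]
      have h5 : (2 : ℝ) ≤ Real.exp 1 := by linarith [Real.add_one_le_exp (1 : ℝ)]
      have h6 : 0 ≤ ∑ n ∈ Finset.range N, (ν n).real {x | phase ((0 : ℝ) : ℂ) (g n) x ≠ 1} :=
        Finset.sum_nonneg fun _ _ => measureReal_nonneg
      refine mul_le_mul h5 (Real.exp_le_exp.2 ?_) (Real.exp_pos _).le (Real.exp_pos _).le
      exact neg_le_neg (mul_le_mul_of_nonneg_left (by linarith) hκ.le)
    have h3 := Real.exp_le_exp.1 h2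
    have h4 := hrem 3 h (by rw [hnh]; linarith)
    have h5 := (Complex.abs_re_le_norm _).trans h4
    have e : (∑ j ∈ Finset.range 3, α j * (h : ℂ) ^ j).re = -(V / 2) * h ^ 2 := by
      have e1 : ∑ j ∈ Finset.range 3, α j * (h : ℂ) ^ j =
          ((-(V / 2) * h ^ 2 : ℝ) : ℂ) + (((∫ x, (pathSum g N x : ℝ) ∂Q) * h : ℝ) : ℂ) * Complex.I := by
        simp only [Finset.sum_range_succ, Finset.range_zero, Finset.sum_empty, hα0, hα1, hα2]
        push_cast
        ring
      rw [e1, Complex.add_re, Complex.ofReal_re, Complex.re_ofReal_mul, Complex.I_re, mul_zero,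
        add_zero]
    rw [Complex.sub_re, e, hnh, ← hb] at h5
    have h6 := (abs_le.1 h5).1
    have h7 : 2 * (b * W) * (2 * h / R) ^ 3 ≤ κ / 2 * (h ^ 2 * W) := by
      have : 16 * b * h / R ^ 3 ≤ κ / 2 := by
        rw [div_le_iff₀ (by positivity)]; linarith
      calc 2 * (b * W) * (2 * h / R) ^ 3 = (16 * b * h / R ^ 3) * (h ^ 2 * W) := by
            rw [div_pow]; ring
        _ ≤ _ := by gcongr
    have h8 : κ * h ^ 2 * W ≤ 2 + V * h ^ 2 := by linarith
    have h9 : W ≤ (2 / h ^ 2 + V) / κ := by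
      rw [le_div_iff₀ hκ, ← sub_le_iff_le_add, le_div_iff₀ (by positivity)]
      linarith
    calc W ≤ (2 / h ^ 2 + V) / κ := h9
      _ ≤ ((2 / h ^ 2 + 1) * (V + 1)) / κ := by
          gcongr
          have : 0 ≤ 2 / h ^ 2 * V := by positivity
          linarith
      _ = (2 / h ^ 2 + 1) / κ * (V + 1) := by ring
      _ ≤ _ := by
          refine mul_le_mul_of_nonneg_right ?_ (by positivity)
          linarith

/-! ### The contribution of the frequencies away from the origin -/

/-- The non-zero resonant frequencies. -/
def resonances (G : ℕ) : Finset ℝ :=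
  ((Finset.range G ×ˢ Finset.range (G + 1)).filter fun p => 0 < p.1 ∧ p.1 < p.2).image
    fun p => 2 * Real.pi * p.1 / p.2

lemma mem_resonances {G : ℕ} {t : ℝ} : t ∈ resonances G ↔
    ∃ l m : ℕ, 0 < l ∧ l < m ∧ m ≤ G ∧ t = 2 * Real.pi * l / m := by
  simp only [resonances, Finset.mem_image, Finset.mem_filter, Finset.mem_product, Finset.mem_range,
    Prod.exists]
  constructor
  · rintro ⟨l, m, ⟨⟨-, h1⟩, h2, h3⟩, rfl⟩
    exact ⟨l, m, h2, h3, by omega, rfl⟩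
  · rintro ⟨l, m, h2, h3, h4, rfl⟩
    exact ⟨l, m, ⟨⟨by omega, by omega⟩, h2, h3⟩, rfl⟩

lemma mem_resonances_of_cos_eq_one {G : ℕ} {t : ℝ} (ht0 : 0 < t) (ht : t < 2 * Real.pi) {g : ℤ}
    (hg : g ≠ 0) (hgG : |g| ≤ G) (h : Real.cos (t * g) = 1) : t ∈ resonances G := by
  have h' : Real.cos (t * |g|) = 1 := by
    rcases abs_choice g with h1 | h1 <;> rw [h1]
    · exact h
    · rw [Int.cast_neg, mul_neg, Real.cos_neg]; exact h
  obtain ⟨n, hn⟩ := (Real.cos_eq_one_iff _).1 h'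
  obtain ⟨m, hm⟩ := Int.eq_ofNat_of_zero_le (abs_nonneg g)
  have hm0 : 0 < m := by
    have := abs_pos.2 hg
    omega
  have hmr : (0 : ℝ) < m := by exact_mod_cast hm0
  rw [hm, Int.cast_natCast] at hn
  have hπ := Real.pi_pos
  have hn0 : 0 < n := by
    have : (0 : ℝ) < n := by
      by_contra hcon
      have h1 : (n : ℝ) * (2 * Real.pi) ≤ 0 := mul_nonpos_of_nonpos_of_nonneg (not_lt.1 hcon) (by positivity)
      have h2 : 0 < t * m := by positivity
      linarith
    exact_mod_cast this
  have hnm : n < m := by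
    have : (n : ℝ) < m := by
      have h1 : t * m < 2 * Real.pi * m := by gcongr
      rw [← hn, mul_comm] at h1
      exact lt_of_mul_lt_mul_left h1 (by positivity)
    exact_mod_cast this
  obtain ⟨l, rfl⟩ := Int.eq_ofNat_of_zero_le hn0.le
  refine mem_resonances.2 ⟨l, m, by exact_mod_cast hn0, by exact_mod_cast hnm, by omega, ?_⟩
  rw [eq_div_iff hmr.ne', ← hn]
  push_cast
  ring

theorem exists_intervalIntegral_tail_le {c a : ℝ} {G r : ℕ} (hc : 0 < c) (hc1 : c < 1) (ha : 0 < a)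
    (hG1 : 1 ≤ G) (hr : 1 ≤ r) :
    ∃ δ₀ : ℝ, 0 < δ₀ ∧ ∀ δ, 0 < δ → δ ≤ δ₀ → ∀ ε > 0, ∃ η > 0, ∃ W₀ : ℝ, 0 < W₀ ∧
      ∀ {ν : ℕ → Measure E} {k : ℕ → E → E → ℝ} {g : ℕ → E → ℤ} {N : ℕ} {Q : Measure (ℕ → E)},
      IsBackwardKernel ν k c → IsPathLaw ν k N Q → (∀ n, Measurable (g n)) →
      (∀ n x, |g n x| ≤ G) → (∀ n, a ≤ (ν n).real {x | g n x = 0}) → ∀ (y : E) {W : ℝ},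
      W = ∑ n ∈ Finset.range N, (ν n).real {x | g n x ≠ 0} → W₀ ≤ W →
      (∀ t₀ ∈ resonances G, ∀ j < r, ∀ p : Fin j → ℕ, (∀ b, p b < N) →
        ‖∫ x, (∏ i ∈ Finset.range N, phase (t₀ : ℂ) (g i) (x i)) *
          ∏ b, (g (p b) (x (p b)) : ℂ) ∂Q‖ ≤ η * (√W)⁻¹ ^ (r - 1)) →
      ∫ t in δ..(2 * Real.pi - δ), ‖bwd ν k (fun n => phase (t : ℂ) (g n)) N y‖
        ≤ ε * (√W)⁻¹ ^ r := by
  have hπ := Real.pi_gt_three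
  obtain ⟨δ₁, hδ₁, H⟩ := exists_pos_forall_le_of_finset (resonances G)
    (p := fun t₀ d => ∀ δ, 0 < δ → δ ≤ d → ∀ ε > 0, ∃ η > 0, ∃ W₀ : ℝ,
      ∀ {ν : ℕ → Measure E} {k : ℕ → E → E → ℝ} {g : ℕ → E → ℤ} {N : ℕ} {Q : Measure (ℕ → E)},
      IsBackwardKernel ν k c → IsPathLaw ν k N Q → (∀ n, Measurable (g n)) →
      (∀ n x, |g n x| ≤ G) → (∀ n, a ≤ (ν n).real {x | g n x = 0}) → ∀ (y : E) {W : ℝ},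
      W = ∑ n ∈ Finset.range N, (ν n).real {x | g n x ≠ 0} → W₀ ≤ W →
      (∀ j < r, ∀ p : Fin j → ℕ, (∀ b, p b < N) →
        ‖∫ x, (∏ i ∈ Finset.range N, phase (t₀ : ℂ) (g i) (x i)) *
          ∏ b, (g (p b) (x (p b)) : ℂ) ∂Q‖ ≤ η * (√W)⁻¹ ^ (r - 1)) →
      ∫ h in (-δ)..δ, ‖bwd ν k (fun n => phase ((t₀ + h : ℝ) : ℂ) (g n)) N y‖
        ≤ ε * (√W)⁻¹ ^ r)
    fun t₀ _ => by
      obtain ⟨d, hd, h⟩ := exists_integral_norm_bwd_le (E := E) (r := r) hc hc1 ha hG1 hr t₀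
      exact ⟨d, hd, fun b _ hb δ hδ hδb => h δ hδ (hδb.trans hb)⟩
  refine ⟨min δ₁ 1, by positivity, fun δ hδ hδ₀ ε hε => ?_⟩
  have hδ1 : δ ≤ 1 := hδ₀.trans (min_le_right _ _)
  set T : Set ℝ := Set.Icc δ (2 * Real.pi - δ) \ ⋃ t₀ ∈ resonances G, Metric.ball t₀ δ with hT
  have hTc : IsCompact T := isCompact_Icc.diff
    (isOpen_biUnion fun _ _ => Metric.isOpen_ball)
  obtain ⟨κ, hκ, Hfar⟩ := exists_norm_bwd_phase_le_far (E := E) G hc ha hTc (by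
    intro t ht g hg hgG hcos
    refine ht.2 (Set.mem_biUnion (x := t) ?_ (Metric.mem_ball_self hδ))
    exact mem_resonances_of_cos_eq_one (hδ.trans_le ht.1.1) (by linarith [ht.1.2]) hg hgG hcos)
  set ε' := ε / (2 * ((resonances G).card + 1)) with hε'
  have hε'0 : 0 < ε' := by positivity
  have H' : ∀ t₀ ∈ resonances G, ∃ η > 0, ∃ W₀ : ℝ,
      ∀ {ν : ℕ → Measure E} {k : ℕ → E → E → ℝ} {g : ℕ → E → ℤ} {N : ℕ} {Q : Measure (ℕ → E)},
      IsBackwardKernel ν k c → IsPathLaw ν k N Q → (∀ n, Measurable (g n)) →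
      (∀ n x, |g n x| ≤ G) → (∀ n, a ≤ (ν n).real {x | g n x = 0}) → ∀ (y : E) {W : ℝ},
      W = ∑ n ∈ Finset.range N, (ν n).real {x | g n x ≠ 0} → W₀ ≤ W →
      (∀ j < r, ∀ p : Fin j → ℕ, (∀ b, p b < N) →
        ‖∫ x, (∏ i ∈ Finset.range N, phase (t₀ : ℂ) (g i) (x i)) *
          ∏ b, (g (p b) (x (p b)) : ℂ) ∂Q‖ ≤ η * (√W)⁻¹ ^ (r - 1)) →
      ∫ h in (-δ)..δ, ‖bwd ν k (fun n => phase ((t₀ + h : ℝ) : ℂ) (g n)) N y‖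
        ≤ ε' * (√W)⁻¹ ^ r := fun t₀ h => H t₀ h δ hδ (hδ₀.trans (min_le_left _ _)) ε' hε'0
  choose! η hη W₁ HW using H'
  obtain ⟨η₀, hη₀, hη₀'⟩ := exists_pos_forall_le_of_finset (resonances G)
    (p := fun t₀ d => d ≤ η t₀) fun t₀ ht₀ => ⟨η t₀, hη t₀ ht₀, fun b _ hb => hb⟩
  obtain ⟨W₂, hW₂⟩ := ((tendsto_pow_mul_exp_neg_mul r hκ).eventually
    (ge_mem_nhds (show (0 : ℝ) < ε / (8 * Real.pi) by positivity))).exists_forall_of_atTop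
  refine ⟨η₀, hη₀, 1 + |W₂| + ∑ t₀ ∈ resonances G, |W₁ t₀|, by positivity, ?_⟩
  intro ν k g N Q hB hQ hg hG hga y W hW hWW hmom
  have hs0 : 0 ≤ ∑ t₀ ∈ resonances G, |W₁ t₀| := Finset.sum_nonneg fun _ _ => abs_nonneg _
  have hW1 : 1 ≤ W := by linarith [abs_nonneg W₂]
  have hW0 : 0 < W := by linarith
  have hG' : ∀ n x, |(g n x : ℝ)| ≤ G := fun n x => by exact_mod_cast hG n x
  set F : ℝ → ℝ := fun t => ‖bwd ν k (fun n => phase (t : ℂ) (g n)) N y‖ with hF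
  have hFc : Continuous F := (continuous_bwd_phase hB hg hG' N y).norm
  have hF0 : ∀ t, 0 ≤ F t := fun t => norm_nonneg _
  have hres : ∀ t₀ ∈ resonances G, ∫ t in (t₀ - δ)..(t₀ + δ), F t ≤ ε' * (√W)⁻¹ ^ r := by
    intro t₀ ht₀
    have h1 : W₁ t₀ ≤ W := by
      have := Finset.single_le_sum (f := fun t => |W₁ t|) (fun _ _ => abs_nonneg _) ht₀
      linarith [le_abs_self (W₁ t₀), abs_nonneg W₂]
    have h2 := HW t₀ ht₀ hB hQ hg hG hga y hW h1 fun j hj p hp =>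
      (hmom t₀ ht₀ j hj p hp).trans (by gcongr; exact hη₀' t₀ ht₀)
    refine le_trans (le_of_eq ?_) h2
    rw [show t₀ - δ = t₀ + -δ by ring, ← intervalIntegral.integral_comp_add_left]
  have hexp : 2 * Real.exp (-(κ * W)) ≤ ε / (4 * Real.pi) * (√W)⁻¹ ^ r := by
    have h1 := hW₂ W (by linarith [le_abs_self W₂])
    have h2 : √W ^ r ≤ W ^ r := by
      gcongr
      exact Real.sqrt_le_iff.2 ⟨hW0.le, le_self_pow₀ hW1 two_ne_zero⟩
    have h3 : √W ^ r * Real.exp (-(κ * W)) ≤ ε / (8 * Real.pi) := le_trans (by gcongr) h1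
    have h4 : 0 < √W ^ r := by positivity
    rw [inv_pow, ← div_eq_mul_inv, le_div_iff₀ h4]
    have : ε / (4 * Real.pi) = 2 * (ε / (8 * Real.pi)) := by field_simp; norm_num
    rw [this]
    linarith
  have hpt : ∀ t ∈ Set.Ioc δ (2 * Real.pi - δ), F t ≤ 2 * Real.exp (-(κ * W)) +
      ∑ t₀ ∈ resonances G, (Set.Ioc (t₀ - δ) (t₀ + δ)).indicator F t := by
    intro t ht
    have hnn : ∀ t₀ ∈ resonances G, 0 ≤ (Set.Ioc (t₀ - δ) (t₀ + δ)).indicator F t := fun t₀ _ =>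
      Set.indicator_nonneg (fun t _ => hF0 t) t
    by_cases htT : t ∈ T
    · have := Hfar hB hg hG hga N y t htT
      rw [← hW] at this
      exact this.trans (le_add_of_nonneg_right (Finset.sum_nonneg hnn))
    · have : t ∈ ⋃ t₀ ∈ resonances G, Metric.ball t₀ δ := by
        by_contra hcon
        exact htT ⟨⟨ht.1.le, ht.2⟩, hcon⟩
      obtain ⟨t₀, ht₀, hb⟩ := Set.mem_iUnion₂.1 this
      rw [Real.ball_eq_Ioo] at hb
      have h1 := Finset.single_le_sum hnn ht₀
      rw [Set.indicator_of_mem (Set.Ioo_subset_Ioc_self hb)] at h1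
      have := Real.exp_pos (-(κ * W))
      linarith
  have hle : δ ≤ 2 * Real.pi - δ := by linarith
  have hind : ∀ t₀, Integrable ((Set.Ioc (t₀ - δ) (t₀ + δ)).indicator F) := fun t₀ =>
    ((hFc.integrableOn_Icc).mono_set Set.Ioc_subset_Icc_self).integrable_indicator measurableSet_Ioc
  have hindI : ∀ t₀ ∈ resonances G, ∫ t in Set.Ioc δ (2 * Real.pi - δ),
      (Set.Ioc (t₀ - δ) (t₀ + δ)).indicator F t ≤ ε' * (√W)⁻¹ ^ r := by
    intro t₀ ht₀
    refine (setIntegral_le_integral (hind t₀) (ae_of_all _ fun t =>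
      Set.indicator_nonneg (fun t _ => hF0 t) t)).trans ?_
    rw [integral_indicator measurableSet_Ioc, ← intervalIntegral.integral_of_le (by linarith)]
    exact hres t₀ ht₀
  rw [intervalIntegral.integral_of_le hle]
  have hconst : IntegrableOn (fun _ : ℝ => 2 * Real.exp (-(κ * W))) (Set.Ioc δ (2 * Real.pi - δ)) :=
    integrableOn_const (by simp)
  have hsumi : IntegrableOn (fun t => ∑ t₀ ∈ resonances G,
      (Set.Ioc (t₀ - δ) (t₀ + δ)).indicator F t) (Set.Ioc δ (2 * Real.pi - δ)) :=
    integrable_finsetSum _ fun t₀ _ => (hind t₀).integrableOn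
  have hpow : 0 ≤ (√W)⁻¹ ^ r := by positivity
  calc ∫ t in Set.Ioc δ (2 * Real.pi - δ), F t
      ≤ ∫ t in Set.Ioc δ (2 * Real.pi - δ), (2 * Real.exp (-(κ * W)) +
        ∑ t₀ ∈ resonances G, (Set.Ioc (t₀ - δ) (t₀ + δ)).indicator F t) :=
        setIntegral_mono_on ((hFc.integrableOn_Icc).mono_set Set.Ioc_subset_Icc_self)
          (hconst.add hsumi) measurableSet_Ioc hpt
    _ = (2 * Real.pi - δ - δ) * (2 * Real.exp (-(κ * W))) +
        ∑ t₀ ∈ resonances G, ∫ t in Set.Ioc δ (2 * Real.pi - δ),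
          (Set.Ioc (t₀ - δ) (t₀ + δ)).indicator F t := by
        rw [integral_add hconst hsumi, integral_finsetSum _ fun t₀ _ => (hind t₀).integrableOn,
          setIntegral_const, Real.volume_real_Ioc_of_le hle, smul_eq_mul]
    _ ≤ (2 * Real.pi) * (ε / (4 * Real.pi) * (√W)⁻¹ ^ r) +
        ∑ _t₀ ∈ resonances G, ε' * (√W)⁻¹ ^ r := by
        refine add_le_add (mul_le_mul (by linarith) hexp (by positivity) (by positivity))
          (Finset.sum_le_sum hindI)
    _ = (ε / 2 + (resonances G).card * ε') * (√W)⁻¹ ^ r := by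
        rw [Finset.sum_const, nsmul_eq_mul]
        field_simp
        ring
    _ ≤ ε * (√W)⁻¹ ^ r := by
        refine mul_le_mul_of_nonneg_right ?_ hpow
        have : (resonances G).card * ε' ≤ ε / 2 := by
          rw [hε', mul_div_assoc', div_le_div_iff₀ (by positivity) (by norm_num)]
          linarith
        linarith

lemma exists_polynomial_main_part {c A₀ A₁ : ℝ} {G r : ℕ} (hc : 0 < c) (hc1 : c < 1) (hG1 : 1 ≤ G)
    (hr : 1 ≤ r) (hA₀ : 0 ≤ A₀) (hA₁ : 0 ≤ A₁) :
    ∃ δ₀ : ℝ, 0 < δ₀ ∧ ∀ δ, 0 < δ → δ ≤ δ₀ → ∃ (D : ℕ) (Cb C₁ σ₁ : ℝ),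
      ∀ {ν : ℕ → Measure E} {k : ℕ → E → E → ℝ} {g : ℕ → E → ℤ} {N : ℕ} {Q : Measure (ℕ → E)},
      IsBackwardKernel ν k c → IsPathLaw ν k N Q → (∀ n, Measurable (g n)) →
      (∀ n x, |g n x| ≤ G) → ∀ (y : E) {σ : ℝ}, σ₁ ≤ σ →
      ∑ n ∈ Finset.range N, (ν n).real {x | g n x ≠ 0} ≤ A₁ * σ ^ 2 →
      |variance (fun x => (pathSum g N x : ℝ)) Q - σ ^ 2| ≤ A₀ →
      ∃ P : Polynomial ℝ, P.natDegree ≤ D ∧ (∀ i, |P.coeff i| ≤ Cb) ∧ ∀ u : ℝ,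
        |(∫ h in (-δ)..δ, Complex.exp (-(Complex.I * h * u)) *
            bwd ν k (fun n => phase (h : ℂ) (g n)) N y).re / (2 * Real.pi)
          - σ⁻¹ * P.eval ((u - ∫ x, (pathSum g N x : ℝ) ∂Q) / σ) *
            gaussDensity ((u - ∫ x, (pathSum g N x : ℝ) ∂Q) / σ)| ≤ C₁ * σ⁻¹ ^ (r + 1) := by
  have hG1' : (1 : ℝ) ≤ G := by exact_mod_cast hG1
  have hR := rad_pos hc hG1'
  have hR1 : rad c G ≤ 1 := by
    have h1 := mul_rad_eq (c := c) hG1'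
    have h2 := pow_le_one₀ (n := 3) hc.le hc1.le
    have h3 : rad c G * 1 ≤ rad c G * G := by gcongr
    linarith
  set R := rad c G with hRdef
  set b := 54 * (G : ℝ) / c ^ 2 * R with hb
  have hb0 : 0 < b := by positivity
  set A := 1 + A₀ + 2 * (b * A₁) with hA
  have hbA : 0 ≤ b * A₁ := by positivity
  have hA1 : 1 ≤ A := by linarith
  obtain ⟨δ₀, hδ₀, H⟩ := exists_polynomial_of_cumulants (A := A) (ρ := R / 2) hr hA1
    (by positivity) (by linarith)
  refine ⟨min δ₀ (R / 4), by positivity, fun δ hδ hδ' => ?_⟩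
  have hδR : δ ≤ R / 4 := hδ'.trans (min_le_right _ _)
  obtain ⟨D, Cb, C₁, H⟩ := H δ hδ (hδ'.trans (min_le_left _ _))
  refine ⟨D, Cb, C₁, 24 * A, fun {ν k g N Q} hB hQ hg hG y σ hσ hWσ hVσ => ?_⟩
  have hG' : ∀ n x, |(g n x : ℝ)| ≤ G := fun n x => by exact_mod_cast hG n x
  set W := ∑ n ∈ Finset.range N, (ν n).real {x | g n x ≠ 0} with hW
  obtain ⟨ψ, α, hψc, hψ, hα, hα0, hα1, hα2, hrem⟩ :=
    exists_cumulant_expansion hB hQ hg hG1' hG' y hW rfl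
  rw [← hRdef] at hψc hψ hα hrem
  rw [← hb] at hα hrem
  set V := variance (fun x => (pathSum g N x : ℝ)) Q with hV
  set m := ∫ x, (pathSum g N x : ℝ) ∂Q with hm
  have hbW : b * W ≤ b * A₁ * σ ^ 2 := by
    rw [mul_assoc b]; exact mul_le_mul_of_nonneg_left hWσ hb0.le
  have hσ2 : 0 ≤ σ ^ 2 := sq_nonneg σ
  have hAσ : 2 * (b * W) ≤ A * σ ^ 2 := by
    have : 0 ≤ (1 + A₀) * σ ^ 2 := by positivity
    rw [hA]; linarith
  have hWn : 0 ≤ W := Finset.sum_nonneg fun _ _ => measureReal_nonneg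
  have hbW0 : 0 ≤ b * W := by positivity
  have hinv : (R / 2)⁻¹ = 2 / R := inv_div _ _
  have hball : ∀ h : ℝ, |h| ≤ δ → (h : ℂ) ∈ Metric.ball (0 : ℂ) R := fun h hh => by
    rw [mem_ball_zero_iff, Complex.norm_real, Real.norm_eq_abs]; linarith
  set χ : ℝ → ℂ := fun h => ψ h - Complex.I * m * h + (h : ℂ) ^ 2 * (σ : ℂ) ^ 2 / 2 with hχ
  set d : ℕ → ℂ := fun j => if j = 2 then α 2 + (σ : ℂ) ^ 2 / 2 else α j with hd
  have hχc : ContinuousOn χ (Set.Icc (-δ) δ) := by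
    have h1 : ContinuousOn (fun h : ℝ => ψ h) (Set.Icc (-δ) δ) :=
      hψc.comp Complex.continuous_ofReal.continuousOn fun h hh => hball h (abs_le.2 hh)
    refine (h1.sub (by fun_prop)).add (by fun_prop)
  have hd2 : ‖d 2‖ ≤ A := by
    simp only [hd, if_true]
    have : α 2 + (σ : ℂ) ^ 2 / 2 = ((-((V - σ ^ 2) / 2) : ℝ) : ℂ) := by
      rw [hα2]; push_cast; ring
    rw [this, Complex.norm_real, Real.norm_eq_abs, abs_neg, abs_div, abs_two]
    linarith
  have hd3 : ∀ j, 3 ≤ j → ‖d j‖ ≤ A * σ ^ 2 * (R / 2)⁻¹ ^ j := by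
    intro j hj
    simp only [hd]
    rw [if_neg (by omega), hinv]
    refine (hα j).trans (mul_le_mul_of_nonneg_right ?_ (by positivity))
    linarith
  have hrem' : ∀ h : ℝ, |h| ≤ δ → ‖χ h - ∑ j ∈ Finset.Icc 2 (r + 1), d j * (h : ℂ) ^ j‖
      ≤ A * σ ^ 2 * (|h| / (R / 2)) ^ (r + 2) := by
    intro h hh
    have e : ψ h - Complex.I * m * h + (h : ℂ) ^ 2 * (σ : ℂ) ^ 2 / 2 -
        ∑ j ∈ Finset.Icc 2 (r + 1), (if j = 2 then α 2 + (σ : ℂ) ^ 2 / 2 else α j) * (h : ℂ) ^ j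
        = ψ h - ∑ j ∈ Finset.range (r + 2), α j * (h : ℂ) ^ j := by
      have h1 : ∑ j ∈ Finset.Icc 2 (r + 1),
          (if j = 2 then α 2 + (σ : ℂ) ^ 2 / 2 else α j) * (h : ℂ) ^ j =
          (h : ℂ) ^ 2 * (σ : ℂ) ^ 2 / 2 + ∑ j ∈ Finset.Icc 2 (r + 1), α j * (h : ℂ) ^ j := by
        rw [← Finset.add_sum_erase _ _ (Finset.mem_Icc.2 ⟨le_rfl, by omega⟩ : 2 ∈ Finset.Icc 2 (r + 1)),
          ← Finset.add_sum_erase _ _ (Finset.mem_Icc.2 ⟨le_rfl, by omega⟩ : 2 ∈ Finset.Icc 2 (r + 1)),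
          Finset.sum_congr rfl (g := fun j => α j * (h : ℂ) ^ j) fun j hj => by
            rw [if_neg (Finset.ne_of_mem_erase hj)], if_pos rfl]
        ring
      have h2 : ∑ j ∈ Finset.range (r + 2), α j * (h : ℂ) ^ j =
          Complex.I * m * h + ∑ j ∈ Finset.Icc 2 (r + 1), α j * (h : ℂ) ^ j := by
        rw [Finset.range_eq_Ico, Finset.sum_eq_sum_Ico_succ_bot (by omega),
          Finset.sum_eq_sum_Ico_succ_bot (by omega), hα0, hα1]
        simp only [zero_mul, zero_add, pow_one]
        rfl
      rw [h1, h2]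
      ring
    simp only [hχ, hd]
    rw [e]
    refine (hrem (r + 2) h ?_).trans ?_
    · rw [Complex.norm_real, Real.norm_eq_abs]; linarith
    · rw [Complex.norm_real, Real.norm_eq_abs, show 2 * |h| / R = |h| / (R / 2) by field_simp]
      gcongr
  obtain ⟨P, hP1, hP2, hP⟩ := H σ χ d hσ hχc hd2 hd3 hrem'
  refine ⟨P, hP1, hP2, fun u => ?_⟩
  refine le_trans (le_of_eq ?_) (hP (u - m))
  congr 4
  refine intervalIntegral.integral_congr fun h hh => ?_
  rw [Set.uIcc_of_le (by linarith)] at hh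
  simp only [hχ]
  rw [hψ h (hball h (abs_le.2 hh)), ← Complex.exp_add, ← Complex.exp_add]
  congr 1
  push_cast
  ring

/-- The local expansion for a path system, uniformly over all systems with given constants. -/
theorem exists_local_expansion {c a A₀ : ℝ} {G r : ℕ} (hc : 0 < c) (hc1 : c < 1) (ha : 0 < a)
    (hG1 : 1 ≤ G) (hr : 1 ≤ r) (hA₀ : 0 ≤ A₀) :
    ∃ (D : ℕ) (Cb σ₁ : ℝ) (η σ₀ : ℝ → ℝ), (∀ ε > 0, 0 < η ε) ∧
      ∀ {ν : ℕ → Measure E} {k : ℕ → E → E → ℝ} {g : ℕ → E → ℤ} {N : ℕ} {Q : Measure (ℕ → E)},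
      IsBackwardKernel ν k c → IsPathLaw ν k N Q → (∀ n, Measurable (g n)) →
      (∀ n x, |g n x| ≤ G) → (∀ n, a ≤ (ν n).real {x | g n x = 0}) → ∀ {σ : ℝ}, σ₁ ≤ σ →
      |variance (fun x => (pathSum g N x : ℝ)) Q - σ ^ 2| ≤ A₀ →
      ∃ P : Polynomial ℝ, P.natDegree ≤ D ∧ (∀ i, |P.coeff i| ≤ Cb) ∧ ∀ ε > 0, σ₀ ε ≤ σ →
        (∀ t₀ ∈ resonances G, ∀ j < r, ∀ p : Fin j → ℕ, (∀ b, p b < N) →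
          ‖∫ x, (∏ i ∈ Finset.range N, phase (t₀ : ℂ) (g i) (x i)) *
            ∏ b, (g (p b) (x (p b)) : ℂ) ∂Q‖ ≤ η ε * σ⁻¹ ^ (r - 1)) →
        ∀ u : ℤ, |Q.real {x | pathSum g N x = u}
          - σ⁻¹ * P.eval ((u - ∫ x, (pathSum g N x : ℝ) ∂Q) / σ) *
            gaussDensity ((u - ∫ x, (pathSum g N x : ℝ) ∂Q) / σ)| ≤ ε * σ⁻¹ ^ r := by
  obtain ⟨A₁, hA₁, HV⟩ := exists_variance_bounds (E := E) hc ha hG1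
  set A₂ := 2 * A₁ with hA₂
  have hA₂0 : 0 < A₂ := by linarith
  obtain ⟨δ₁, hδ₁, Hmain⟩ := exists_polynomial_main_part (E := E) hc hc1 hG1 hr hA₀ hA₂0.le
  obtain ⟨δ₂, hδ₂, Htail⟩ := exists_intervalIntegral_tail_le (E := E) hc hc1 ha hG1 hr
  set δ := min (min δ₁ δ₂) 1 with hδ
  have hδ0 : 0 < δ := lt_min (lt_min hδ₁ hδ₂) one_pos
  obtain ⟨D, Cb, C₁, σ₁, Hmain⟩ := Hmain δ hδ0 ((min_le_left _ _).trans (min_le_left _ _))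
  have Htail' : ∀ ε : ℝ, ∃ η : ℝ, ∃ W₀ : ℝ, ε > 0 → 0 < η ∧ 0 < W₀ ∧
      ∀ {ν : ℕ → Measure E} {k : ℕ → E → E → ℝ} {g : ℕ → E → ℤ} {N : ℕ} {Q : Measure (ℕ → E)},
      IsBackwardKernel ν k c → IsPathLaw ν k N Q → (∀ n, Measurable (g n)) →
      (∀ n x, |g n x| ≤ G) → (∀ n, a ≤ (ν n).real {x | g n x = 0}) → ∀ (y : E) {W : ℝ},
      W = ∑ n ∈ Finset.range N, (ν n).real {x | g n x ≠ 0} → W₀ ≤ W →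
      (∀ t₀ ∈ resonances G, ∀ j < r, ∀ p : Fin j → ℕ, (∀ b, p b < N) →
        ‖∫ x, (∏ i ∈ Finset.range N, phase (t₀ : ℂ) (g i) (x i)) *
          ∏ b, (g (p b) (x (p b)) : ℂ) ∂Q‖ ≤ η * (√W)⁻¹ ^ (r - 1)) →
      ∫ t in δ..(2 * Real.pi - δ), ‖bwd ν k (fun n => phase (t : ℂ) (g n)) N y‖
        ≤ ε * (√W)⁻¹ ^ r := by
    intro ε
    by_cases hε : ε > 0
    · obtain ⟨η, hη, W₀, hW₀, h⟩ := Htail δ hδ0 ((min_le_left _ _).trans (min_le_right _ _)) ε hε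
      exact ⟨η, W₀, fun _ => ⟨hη, hW₀, h⟩⟩
    · exact ⟨0, 0, fun h => absurd h hε⟩
  choose η W₀ HT using Htail'
  set s := √A₂ with hs
  have hs0 : 0 < s := Real.sqrt_pos.2 hA₂0
  set e : ℝ → ℝ := fun ε => ε / (2 * s ^ r) with he
  have he0 : ∀ ε > 0, 0 < e ε := fun ε hε => by simp only [he]; positivity
  refine ⟨D, Cb, max (max σ₁ 1) (2 * A₀ + 2), fun ε => η (e ε) / s ^ (r - 1),
    fun ε => max (max (A₂ * W₀ (e ε)) (2 * C₁ / ε)) 1,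
    fun ε hε => div_pos (HT _ (he0 ε hε)).1 (by positivity), ?_⟩
  intro ν k g N Q hB hQ hg hG hga σ hσ hVσ
  have := hQ.1
  obtain ⟨y⟩ := hB.nonempty
  have hG' : ∀ n x, |(g n x : ℝ)| ≤ G := fun n x => by exact_mod_cast hG n x
  have hσ1 : 1 ≤ σ := (le_max_right _ _).trans ((le_max_left _ _).trans hσ)
  have hσA : 2 * A₀ + 2 ≤ σ := (le_max_right _ _).trans hσ
  have hσ0 : 0 < σ := by linarith
  have hσσ : σ ≤ σ ^ 2 := le_self_pow₀ hσ1 two_ne_zero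
  set W := ∑ n ∈ Finset.range N, (ν n).real {x | g n x ≠ 0} with hW
  obtain ⟨hV1, hV2⟩ := HV hB hQ hg hG hga hW
  set V := variance (fun x => (pathSum g N x : ℝ)) Q with hV
  have hVσ' := abs_le.1 hVσ
  have hWσ : W ≤ A₂ * σ ^ 2 := by
    refine hV2.trans ?_
    rw [hA₂, mul_assoc, mul_left_comm]
    refine mul_le_mul_of_nonneg_left (by linarith) (by linarith)
  have hσW : σ ^ 2 ≤ A₂ * W := by rw [hA₂]; linarith
  obtain ⟨P, hP1, hP2, hP⟩ := Hmain hB hQ hg hG y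
    ((le_max_left _ _).trans ((le_max_left _ _).trans hσ)) hWσ hVσ
  refine ⟨P, hP1, hP2, fun ε hε hσε hmom u => ?_⟩
  have hσε1 : A₂ * W₀ (e ε) ≤ σ := (le_max_left _ _).trans ((le_max_left _ _).trans hσε)
  have hσε2 : 2 * C₁ / ε ≤ σ := (le_max_right _ _).trans ((le_max_left _ _).trans hσε)
  obtain ⟨hη0, hW₀0, hT⟩ := HT (e ε) (he0 ε hε)
  have hWW : W₀ (e ε) ≤ W := by
    have : A₂ * W₀ (e ε) ≤ A₂ * W := hσε1.trans (hσσ.trans hσW)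
    exact le_of_mul_le_mul_left this hA₂0
  have hW0 : 0 < W := hW₀0.trans_le hWW
  have hsW : √W ≤ s * σ := by
    rw [hs, ← Real.sqrt_sq hσ0.le, ← Real.sqrt_mul hA₂0.le]
    exact Real.sqrt_le_sqrt hWσ
  have hsσ : σ ≤ s * √W := by
    rw [hs, ← Real.sqrt_mul hA₂0.le]
    exact Real.le_sqrt_of_sq_le hσW
  have hW0s : 0 < √W := Real.sqrt_pos.2 hW0
  have hi1 : σ⁻¹ ≤ s * (√W)⁻¹ := by
    rw [← div_eq_mul_inv, inv_le_iff_one_le_mul₀ hσ0, div_mul_eq_mul_div, le_div_iff₀ hW0s]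
    linarith
  have hi2 : (√W)⁻¹ ≤ s * σ⁻¹ := by
    rw [← div_eq_mul_inv, inv_le_iff_one_le_mul₀ hW0s, div_mul_eq_mul_div, le_div_iff₀ hσ0]
    linarith
  have htail := hT hB hQ hg hG hga y hW hWW fun t₀ ht₀ j hj p hp => by
    refine (hmom t₀ ht₀ j hj p hp).trans ?_
    rw [div_mul_eq_mul_div, div_le_iff₀ (by positivity), mul_assoc, ← mul_pow, mul_comm (√W)⁻¹ s]
    gcongr
  have htail2 : ∫ t in δ..(2 * Real.pi - δ), ‖bwd ν k (fun n => phase (t : ℂ) (g n)) N y‖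
      ≤ ε / 2 * σ⁻¹ ^ r := by
    refine htail.trans ?_
    have h1 : (√W)⁻¹ ^ r ≤ s ^ r * σ⁻¹ ^ r := by
      rw [← mul_pow]; gcongr
    calc e ε * (√W)⁻¹ ^ r ≤ e ε * (s ^ r * σ⁻¹ ^ r) := by
          have := he0 ε hε
          gcongr
      _ = ε / 2 * σ⁻¹ ^ r := by simp only [he]; field_simp
  have hmain := hP u
  have hmain2 : C₁ * σ⁻¹ ^ (r + 1) ≤ ε / 2 * σ⁻¹ ^ r := by
    rw [pow_succ, mul_comm (σ⁻¹ ^ r), ← mul_assoc]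
    refine mul_le_mul_of_nonneg_right ?_ (by positivity)
    rw [div_le_iff₀ hε] at hσε2
    rw [← div_eq_mul_inv, div_le_iff₀ hσ0]
    linarith
  have hinv := measureReal_eq_intervalIntegral (Q := Q) (measurable_pathSum hg N) δ u
  have hpc : ∀ t : ℝ, Complex.exp (-(Complex.I * t * u)) *
      ∫ x, Complex.exp (Complex.I * t * ((pathSum g N x : ℝ) : ℂ)) ∂Q =
      Complex.exp (-(Complex.I * t * (u : ℝ))) * bwd ν k (fun n => phase (t : ℂ) (g n)) N y :=
    fun t => by rw [hQ.integral_exp_pathSum hg hG' (t : ℂ) y, Complex.ofReal_intCast]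
  simp only [hpc] at hinv
  have hcont : Continuous fun t : ℝ => Complex.exp (-(Complex.I * t * (u : ℝ))) *
      bwd ν k (fun n => phase (t : ℂ) (g n)) N y :=
    (by fun_prop : Continuous fun t : ℝ => Complex.exp (-(Complex.I * t * (u : ℝ)))).mul
      (continuous_bwd_phase hB hg hG' N y)
  rw [← intervalIntegral.integral_add_adjacent_intervals (b := δ)
    (hcont.intervalIntegrable _ _) (hcont.intervalIntegrable _ _)] at hinv
  have hre := congrArg Complex.re hinv
  rw [Complex.add_re, Complex.ofReal_re] at hre
  have hδπ : δ ≤ 2 * Real.pi - δ := by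
    have : δ ≤ 1 := min_le_right _ _
    linarith [Real.pi_gt_three]
  have hT2 : |(∫ t in δ..(2 * Real.pi - δ), Complex.exp (-(Complex.I * t * (u : ℝ))) *
      bwd ν k (fun n => phase (t : ℂ) (g n)) N y).re| ≤ ε / 2 * σ⁻¹ ^ r := by
    refine (Complex.abs_re_le_norm _).trans
      ((intervalIntegral.norm_integral_le_integral_norm hδπ).trans (le_of_eq_of_le ?_ htail2))
    refine intervalIntegral.integral_congr fun t _ => ?_
    simp only [norm_mul]
    rw [show -(Complex.I * t * (u : ℝ)) = ((-(t * u) : ℝ) : ℂ) * Complex.I by push_cast; ring,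
      Complex.norm_exp_ofReal_mul_I, one_mul]
  set T := (∫ t in δ..(2 * Real.pi - δ), Complex.exp (-(Complex.I * t * (u : ℝ))) *
      bwd ν k (fun n => phase (t : ℂ) (g n)) N y).re with hTdef
  have hπ := Real.pi_gt_three
  have hQe : Q.real {x | pathSum g N x = u} = (∫ t in (-δ)..δ,
      Complex.exp (-(Complex.I * t * (u : ℝ))) *
      bwd ν k (fun n => phase (t : ℂ) (g n)) N y).re / (2 * Real.pi) + T / (2 * Real.pi) := by
    rw [← add_div, hre, mul_div_cancel_left₀ _ (by positivity)]
  have hT3 : |T / (2 * Real.pi)| ≤ ε / 2 * σ⁻¹ ^ r := by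
    rw [abs_div, abs_of_pos (by positivity : 0 < 2 * Real.pi)]
    exact (div_le_self (abs_nonneg _) (by linarith)).trans hT2
  rw [hQe, add_sub_right_comm]
  refine (abs_add_le _ _).trans ?_
  linarith

/-! ### Resampling coordinates of a product measure -/

section Resampling

variable {ν : ℕ → Measure E} [∀ n, IsProbabilityMeasure (ν n)]

lemma measurable_piecewise (J : Finset ℕ) :
    Measurable fun z : (ℕ → E) × (ℕ → E) => J.piecewise z.1 z.2 := by
  refine measurable_pi_iff.2 fun i => ?_
  by_cases hi : i ∈ J
  · simp only [Finset.piecewise_eq_of_mem _ _ _ hi]; fun_prop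
  · simp only [Finset.piecewise_eq_of_notMem _ _ _ hi]; fun_prop

lemma measurable_piecewise_left (J : Finset ℕ) (y : ℕ → E) :
    Measurable fun x : ℕ → E => J.piecewise x y :=
  (measurable_piecewise J).comp (measurable_id.prodMk measurable_const)

lemma measurable_piecewise_right (J : Finset ℕ) (x : ℕ → E) :
    Measurable fun y : ℕ → E => J.piecewise x y :=
  (measurable_piecewise J).comp (measurable_const.prodMk measurable_id)

lemma map_piecewise_prod (J : Finset ℕ) :
    ((Measure.infinitePi ν).prod (Measure.infinitePi ν)).map
      (fun z => J.piecewise z.1 z.2) = Measure.infinitePi ν := by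
  refine Measure.eq_infinitePi ν fun s t ht => ?_
  have e : (fun z : (ℕ → E) × (ℕ → E) => J.piecewise z.1 z.2) ⁻¹' Set.pi s t =
      (Set.pi (s ∩ J : Finset ℕ) t) ×ˢ (Set.pi (s \ J : Finset ℕ) t) := by
    ext ⟨x, y⟩
    simp only [Set.mem_preimage, Set.mem_pi, Set.mem_prod, Finset.mem_coe, Finset.mem_inter,
      Finset.mem_sdiff]
    refine ⟨fun h => ⟨fun i hi => ?_, fun i hi => ?_⟩, fun h i hi => ?_⟩
    · simpa [hi.2] using h i hi.1
    · simpa [hi.2] using h i hi.1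
    · by_cases hJ : i ∈ J
      · simpa [hJ] using h.1 i ⟨hi, hJ⟩
      · simpa [hJ] using h.2 i ⟨hi, hJ⟩
  rw [Measure.map_apply (measurable_piecewise J)
    (MeasurableSet.pi s.countable_toSet fun i _ => ht i), e, Measure.prod_prod,
    Measure.infinitePi_pi _ fun i _ => ht i, Measure.infinitePi_pi _ fun i _ => ht i,
    Finset.prod_inter_mul_prod_sdiff]

/-- Freezing the sites of `J` at the values of `x`. -/
def pinned (ν : ℕ → Measure E) (J : Finset ℕ) (x : ℕ → E) (n : ℕ) : Measure E :=
  if n ∈ J then Measure.dirac (x n) else ν n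

instance (J : Finset ℕ) (x : ℕ → E) (n : ℕ) : IsProbabilityMeasure (pinned ν J x n) := by
  unfold pinned; split_ifs <;> infer_instance

lemma infinitePi_pinned (J : Finset ℕ) (x : ℕ → E) :
    Measure.infinitePi (pinned ν J x) = (Measure.infinitePi ν).map (J.piecewise x ·) := by
  refine (Measure.eq_infinitePi _ fun s t ht => ?_).symm
  rw [Measure.map_apply (measurable_piecewise_right J x)
    (MeasurableSet.pi s.countable_toSet fun i _ => ht i), ← Finset.prod_inter_mul_prod_sdiff s J]
  have h2 : ∏ i ∈ s \ J, pinned ν J x i (t i) = Measure.infinitePi ν (Set.pi (s \ J : Finset ℕ) t) := by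
    rw [Measure.infinitePi_pi _ fun i _ => ht i]
    exact Finset.prod_congr rfl fun i hi => by
      rw [pinned, if_neg (Finset.mem_sdiff.1 hi).2]
  rw [h2]
  by_cases hx : ∀ i ∈ s ∩ J, x i ∈ t i
  · rw [Finset.prod_eq_one, one_mul]
    · congr 1
      ext y
      simp only [Set.mem_preimage, Set.mem_pi, Finset.mem_coe, Finset.mem_sdiff]
      refine ⟨fun h i hi => by simpa [hi.2] using h i hi.1, fun h i hi => ?_⟩
      by_cases hJ : i ∈ J
      · simpa [hJ] using hx i (Finset.mem_inter.2 ⟨hi, hJ⟩)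
      · simpa [hJ] using h i ⟨hi, hJ⟩
    · intro i hi
      rw [pinned, if_pos (Finset.mem_inter.1 hi).2, Measure.dirac_apply' _ (ht i),
        Set.indicator_of_mem (hx i hi), Pi.one_apply]
  · push Not at hx
    obtain ⟨i, hi, hxi⟩ := hx
    rw [Finset.prod_eq_zero hi, zero_mul]
    · convert measure_empty (μ := Measure.infinitePi ν)
      ext y
      simp only [Set.mem_preimage, Set.mem_pi, Finset.mem_coe, Set.mem_empty_iff_false, iff_false]
      intro h
      have := h i (Finset.mem_inter.1 hi).1
      rw [Finset.piecewise_eq_of_mem _ _ _ (Finset.mem_inter.1 hi).2] at this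
      exact hxi this
    · rw [pinned, if_pos (Finset.mem_inter.1 hi).2, Measure.dirac_apply' _ (ht i),
        Set.indicator_of_notMem hxi]

lemma integral_piecewise {F : (ℕ → E) → ℂ} (hF : Measurable F) (hFi : Integrable F (Measure.infinitePi ν))
    (J : Finset ℕ) :
    ∫ x, ∫ y, F (J.piecewise x y) ∂Measure.infinitePi ν ∂Measure.infinitePi ν
      = ∫ x, F x ∂Measure.infinitePi ν := by
  have hm := measurable_piecewise (E := E) J
  have hFi' := hFi
  rw [← map_piecewise_prod J] at hFi'
  conv_rhs => rw [← map_piecewise_prod (ν := ν) J]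
  rw [integral_map hm.aemeasurable hF.aestronglyMeasurable]
  exact (integral_prod _ (hFi'.comp_measurable hm)).symm

lemma measurable_update_eval (j : ℕ) :
    Measurable fun z : (ℕ → E) × (ℕ → E) => Function.update z.1 j (z.2 j) := by
  refine measurable_pi_iff.2 fun i => ?_
  by_cases hi : i = j
  · subst hi; simp only [Function.update_self]; fun_prop
  · simp only [Function.update_of_ne hi]; fun_prop

lemma map_update_prod (j : ℕ) :
    ((Measure.infinitePi ν).prod (Measure.infinitePi ν)).map
      (fun z => Function.update z.1 j (z.2 j)) = Measure.infinitePi ν := by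
  have h1 := map_piecewise_prod (ν := ν) {j}
  rw [← Measure.prod_swap, Measure.map_map (measurable_piecewise _) measurable_swap] at h1
  convert h1 using 2
  funext z
  simp only [Function.comp, Prod.swap, Finset.piecewise_singleton]

/-- Integrating out a single coordinate. -/
lemma integral_update {F : (ℕ → E) → ℂ} (hF : Measurable F)
    (hFi : Integrable F (Measure.infinitePi ν)) (j : ℕ) :
    ∫ x, ∫ y, F (Function.update x j y) ∂ν j ∂Measure.infinitePi ν
      = ∫ x, F x ∂Measure.infinitePi ν := by
  have hm := measurable_update_eval (E := E) j
  have hFi' := hFi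
  rw [← map_update_prod j] at hFi'
  conv_rhs => rw [← map_update_prod (ν := ν) j]
  rw [integral_map hm.aemeasurable hF.aestronglyMeasurable]
  refine Eq.trans ?_ (integral_prod _ (hFi'.comp_measurable hm)).symm
  refine integral_congr_ae (ae_of_all _ fun x => ?_)
  simp only [Function.comp]
  conv_lhs => rw [← Measure.infinitePi_map_eval ν j]
  have hu : Measurable fun y : E => Function.update x j y := measurable_update x
  rw [integral_map (measurable_pi_apply j).aemeasurable (hF.comp hu).aestronglyMeasurable]

lemma lintegral_update {F : (ℕ → E) → ℝ≥0∞} (hF : Measurable F) (j : ℕ) :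
    ∫⁻ x, ∫⁻ y, F (Function.update x j y) ∂ν j ∂Measure.infinitePi ν
      = ∫⁻ x, F x ∂Measure.infinitePi ν := by
  have hm := measurable_update_eval (E := E) j
  conv_rhs => rw [← map_update_prod (ν := ν) j]
  rw [lintegral_map hF hm]
  refine Eq.trans ?_ (lintegral_prod
    (fun z : (ℕ → E) × (ℕ → E) => F (Function.update z.1 j (z.2 j))) (hF.comp hm).aemeasurable).symm
  refine lintegral_congr fun x => ?_
  conv_lhs => rw [← Measure.infinitePi_map_eval ν j]
  have hu : Measurable fun y : E => Function.update x j y := measurable_update x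
  exact lintegral_map (hF.comp hu) (measurable_pi_apply j)

end Resampling

/-! ### Path laws with elliptic pair densities -/

/-- Pair densities `p n`, with respect to `ν n ⊗ ν (n + 1)`, bounded between `C⁻¹` and `C`. -/
structure IsPairDens (ν : ℕ → Measure E) (p : ℕ → E → E → ℝ) (C : ℝ) : Prop where
  prob : ∀ n, IsProbabilityMeasure (ν n)
  one_lt : 1 < C
  meas : ∀ n, Measurable (Function.uncurry (p n))
  lower : ∀ n x y, C⁻¹ ≤ p n x y
  upper : ∀ n x y, p n x y ≤ C

/-- The unweighted partition functions of the first `n` sites. -/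
def mass (ν : ℕ → Measure E) (p : ℕ → E → E → ℝ) : ℕ → E → ℝ
  | 0 => fun _ => 1
  | n + 1 => fun y => ∫ x, mass ν p n x * p n x y ∂ν n

/-- The weighted partition functions of the first `n` sites. -/
def fwd (ν : ℕ → Measure E) (p : ℕ → E → E → ℝ) (w : ℕ → E → ℂ) : ℕ → E → ℂ :=
  bwd ν (fun n y x => p n x y) w

/-- The transition densities of the time reversed chain. -/
def revKernel (ν : ℕ → Measure E) (p : ℕ → E → E → ℝ) (n : ℕ) (y x : E) : ℝ :=
  mass ν p n x * p n x y / mass ν p (n + 1) y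

/-- The product of the pair densities along a path. -/
def pathDens (p : ℕ → E → E → ℝ) (N : ℕ) (x : ℕ → E) : ℝ :=
  ∏ i ∈ Finset.range N, p i (x i) (x (i + 1))

/-- The total mass of the path density. -/
def partition (ν : ℕ → Measure E) (p : ℕ → E → E → ℝ) (N : ℕ) : ℝ :=
  ∫ x, pathDens p N x ∂Measure.infinitePi ν

/-- The normalized path law. -/
def pathLaw (ν : ℕ → Measure E) (p : ℕ → E → E → ℝ) (N : ℕ) : Measure (ℕ → E) :=
  (Measure.infinitePi ν).withDensity fun x => ENNReal.ofReal (pathDens p N x / partition ν p N)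

namespace IsPairDens

variable {ν : ℕ → Measure E} {p : ℕ → E → E → ℝ} {C : ℝ} {w : ℕ → E → ℂ}

lemma pos (h : IsPairDens ν p C) : 0 < C := one_pos.trans h.one_lt

lemma dens_pos (h : IsPairDens ν p C) (n : ℕ) (x y : E) : 0 < p n x y :=
  (inv_pos.2 h.pos).trans_le (h.lower n x y)

lemma norm_dens_le (h : IsPairDens ν p C) (n : ℕ) (x y : E) : ‖(p n x y : ℂ)‖ ≤ C := by
  rw [Complex.norm_real, Real.norm_of_nonneg (h.dens_pos n x y).le]
  exact h.upper n x y

lemma measurable_left (h : IsPairDens ν p C) (n : ℕ) (y : E) : Measurable fun x => p n x y :=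
  (h.meas n).comp (measurable_id.prodMk measurable_const)

lemma mass_spec (h : IsPairDens ν p C) (n : ℕ) :
    Measurable (mass ν p n) ∧ (∀ y, 0 < mass ν p n y) ∧
      ∀ y z, mass ν p n y ≤ C ^ 2 * mass ν p n z := by
  have hC := h.pos
  have hC1 := h.one_lt
  induction n with
  | zero =>
    refine ⟨measurable_const, fun _ => one_pos, fun _ _ => ?_⟩
    simp only [mass, mul_one]
    exact one_le_pow₀ hC1.le
  | succ n ih =>
    obtain ⟨hm, hp, hb⟩ := ih
    have := h.prob n
    obtain ⟨z⟩ := (ν n).nonempty_of_neZero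
    have hi : Integrable (mass ν p n) (ν n) :=
      Integrable.of_bound hm.aestronglyMeasurable (C ^ 2 * mass ν p n z)
        (ae_of_all _ fun y => by rw [Real.norm_of_nonneg (hp y).le]; exact hb y z)
    have hI : 0 < ∫ x, mass ν p n x ∂ν n := by
      have h1 : ∫ x, mass ν p n z / C ^ 2 ∂ν n ≤ ∫ x, mass ν p n x ∂ν n :=
        integral_mono (integrable_const _) hi fun x => by
          rw [div_le_iff₀ (by positivity), mul_comm]; exact hb z x
      rw [integral_const, probReal_univ, one_smul] at h1
      exact (div_pos (hp z) (by positivity)).trans_le h1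
    have hpi : ∀ y, Integrable (fun x => mass ν p n x * p n x y) (ν n) := fun y =>
      hi.mul_bdd (h.measurable_left n y).aestronglyMeasurable (ae_of_all _ fun x => by
        rw [Real.norm_of_nonneg (h.dens_pos n x y).le]; exact h.upper n x y)
    have hlo : ∀ y, C⁻¹ * ∫ x, mass ν p n x ∂ν n ≤ mass ν p (n + 1) y := fun y => by
      rw [← integral_const_mul]
      refine integral_mono (hi.const_mul _) (hpi y) fun x => ?_
      simp only
      rw [mul_comm]
      exact mul_le_mul_of_nonneg_left (h.lower n x y) (hp x).le
    have hup : ∀ y, mass ν p (n + 1) y ≤ C * ∫ x, mass ν p n x ∂ν n := fun y => by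
      rw [← integral_const_mul]
      refine integral_mono (hpi y) (hi.const_mul _) fun x => ?_
      simp only
      rw [mul_comm C]
      exact mul_le_mul_of_nonneg_left (h.upper n x y) (hp x).le
    refine ⟨?_, fun y => (by positivity : 0 < C⁻¹ * ∫ x, mass ν p n x ∂ν n).trans_le (hlo y),
      fun y z => (hup y).trans ?_⟩
    · have : Measurable (Function.uncurry fun y x => mass ν p n x * p n x y) :=
        (hm.comp measurable_snd).mul ((h.meas n).comp measurable_swap)
      exact (this.stronglyMeasurable.integral_prod_right (ν := ν n)).measurable
    · have := mul_le_mul_of_nonneg_left (hlo z) (by positivity : (0 : ℝ) ≤ C ^ 2)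
      refine le_trans (le_of_eq ?_) this
      field_simp

lemma measurable_mass (h : IsPairDens ν p C) (n : ℕ) : Measurable (mass ν p n) := (h.mass_spec n).1

lemma mass_pos (h : IsPairDens ν p C) (n : ℕ) (y : E) : 0 < mass ν p n y := (h.mass_spec n).2.1 y

lemma mass_le (h : IsPairDens ν p C) (n : ℕ) (y z : E) : mass ν p n y ≤ C ^ 2 * mass ν p n z :=
  (h.mass_spec n).2.2 y z

lemma integrable_mass_mul (h : IsPairDens ν p C) (n : ℕ) (y : E) :
    Integrable (fun x => mass ν p n x * p n x y) (ν n) := by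
  have := h.prob n
  refine Integrable.of_bound ((h.measurable_mass n).mul (h.measurable_left n y)).aestronglyMeasurable
    (C ^ 2 * mass ν p n y * C) (ae_of_all _ fun x => ?_)
  rw [Real.norm_of_nonneg (mul_nonneg (h.mass_pos n x).le (h.dens_pos n x y).le)]
  exact mul_le_mul (h.mass_le n x y) (h.upper n x y) (h.dens_pos n x y).le
    (mul_nonneg (by positivity) (h.mass_pos n y).le)

lemma mass_succ_bounds (h : IsPairDens ν p C) (n : ℕ) (x y : E) :
    mass ν p n x ≤ C ^ 3 * mass ν p (n + 1) y ∧ mass ν p (n + 1) y ≤ C ^ 3 * mass ν p n x := by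
  have := h.prob n
  have hC := h.pos
  constructor
  · have h1 : ∫ _, mass ν p n x / C ^ 3 ∂ν n ≤ mass ν p (n + 1) y := by
      refine integral_mono (integrable_const _) (h.integrable_mass_mul n y) fun z => ?_
      have h2 := mul_le_mul (h.mass_le n x z) (h.lower n z y) (inv_nonneg.2 hC.le)
        (mul_nonneg (by positivity) (h.mass_pos n z).le)
      simp only
      calc mass ν p n x / C ^ 3 = mass ν p n x * C⁻¹ / C ^ 2 := by field_simp
        _ ≤ C ^ 2 * mass ν p n z * p n z y / C ^ 2 := by gcongr
        _ = _ := by field_simp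
    rw [integral_const, probReal_univ, one_smul, div_le_iff₀ (by positivity), mul_comm] at h1
    exact h1
  · have h1 : mass ν p (n + 1) y ≤ ∫ _, C ^ 3 * mass ν p n x ∂ν n := by
      refine integral_mono (h.integrable_mass_mul n y) (integrable_const _) fun z => ?_
      refine (mul_le_mul (h.mass_le n z x) (h.upper n z y) (h.dens_pos n z y).le
        (mul_nonneg (by positivity) (h.mass_pos n x).le)).trans (le_of_eq ?_)
      ring
    rwa [integral_const, probReal_univ, one_smul] at h1

lemma isBackwardKernel (h : IsPairDens ν p C) :
    IsBackwardKernel ν (revKernel ν p) (C ^ 4)⁻¹ := by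
  have hC := h.pos
  refine ⟨h.prob, fun n => ?_, fun n y => ⟨?_, by positivity, ?_, fun x => ?_, fun x => ?_, ?_⟩⟩
  · exact (((h.measurable_mass n).comp measurable_snd).mul ((h.meas n).comp measurable_swap)).div
      ((h.measurable_mass (n + 1)).comp measurable_fst)
  · exact ((h.measurable_mass n).mul (h.measurable_left n y)).div_const _
  · exact inv_lt_one_of_one_lt₀ (one_lt_pow₀ h.one_lt (by norm_num))
  · rw [revKernel, le_div_iff₀ (h.mass_pos _ _)]
    have h1 := (h.mass_succ_bounds n x y).2
    have h2 := h.mass_pos n x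
    calc (C ^ 4)⁻¹ * mass ν p (n + 1) y ≤ (C ^ 4)⁻¹ * (C ^ 3 * mass ν p n x) := by gcongr
      _ = mass ν p n x * C⁻¹ := by field_simp
      _ ≤ _ := mul_le_mul_of_nonneg_left (h.lower n x y) h2.le
  · rw [revKernel, inv_inv, div_le_iff₀ (h.mass_pos _ _)]
    have h1 := (h.mass_succ_bounds n x y).1
    have h2 := h.mass_pos (n + 1) y
    calc mass ν p n x * p n x y ≤ C ^ 3 * mass ν p (n + 1) y * C :=
        mul_le_mul h1 (h.upper n x y) (h.dens_pos n x y).le (by positivity)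
      _ = _ := by ring
  · simp only [revKernel]
    rw [integral_div]
    exact div_self (h.mass_pos (n + 1) y).ne'

lemma fwd_eq (h : IsPairDens ν p C) (w : ℕ → E → ℂ) (n : ℕ) (y : E) :
    fwd ν p w n y = bwd ν (revKernel ν p) w n y * mass ν p n y := by
  induction n generalizing y with
  | zero => simp [fwd, bwd, mass]
  | succ n ih =>
    have hm := h.mass_pos (n + 1) y
    change ∫ x, fwd ν p w n x * w n x * (p n x y : ℂ) ∂ν n
      = (∫ x, bwd ν (revKernel ν p) w n x * w n x * (revKernel ν p n y x : ℂ) ∂ν n) * _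
    rw [← integral_mul_const]
    refine integral_congr_ae (ae_of_all _ fun x => ?_)
    simp only
    rw [ih, revKernel]
    have : (mass ν p (n + 1) y : ℂ) ≠ 0 := by exact_mod_cast hm.ne'
    push_cast
    field_simp

lemma fwd_bddMeas (h : IsPairDens ν p C) (hw : ∀ n, BddMeas (w n)) (n : ℕ) :
    BddMeas (fwd ν p w n) := by
  have := h.prob n
  obtain ⟨z⟩ := (ν n).nonempty_of_neZero
  have h1 : BddMeas fun y => (mass ν p n y : ℂ) :=
    .of_norm_le (Complex.measurable_ofReal.comp (h.measurable_mass n)) fun y => by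
      rw [Complex.norm_real, Real.norm_of_nonneg (h.mass_pos n y).le]
      exact h.mass_le n y z
  rw [show fwd ν p w n = _ from funext (h.fwd_eq w n)]
  exact (bwd_bddMeas h.isBackwardKernel hw n).mul h1

lemma bddMeas_left (h : IsPairDens ν p C) (n : ℕ) (y : E) : BddMeas fun x => (p n x y : ℂ) :=
  .of_norm_le (Complex.measurable_ofReal.comp (h.measurable_left n y))
    fun x => h.norm_dens_le n x y

lemma measurable_pair (h : IsPairDens ν p C) (n : ℕ) :
    Measurable fun x : ℕ → E => p n (x n) (x (n + 1)) := by
  have : Measurable fun x : ℕ → E => (x n, x (n + 1)) :=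
    (measurable_pi_apply n).prodMk (measurable_pi_apply (n + 1))
  exact (h.meas n).comp this

lemma bddMeas_pair (h : IsPairDens ν p C) (n : ℕ) :
    BddMeas fun x : ℕ → E => (p n (x n) (x (n + 1)) : ℂ) :=
  .of_norm_le (Complex.measurable_ofReal.comp (h.measurable_pair n))
    fun x => h.norm_dens_le n _ _

end IsPairDens

lemma BddMeas.site {u : E → ℂ} (hu : BddMeas u) (n : ℕ) : BddMeas fun x : ℕ → E => u (x n) := by
  obtain ⟨hm, b, hb⟩ := hu
  exact ⟨hm.comp (measurable_pi_apply n), b, fun x => hb _⟩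

lemma BddMeas.prod {ι : Type*} {u : ι → E → ℂ} (s : Finset ι) (hu : ∀ i ∈ s, BddMeas (u i)) :
    BddMeas fun x => ∏ i ∈ s, u i x := by
  classical
  induction s using Finset.induction_on with
  | empty => simpa using BddMeas.const (1 : ℂ)
  | insert i s hi ih =>
    simp only [Finset.prod_insert hi]
    exact (hu i (Finset.mem_insert_self _ _)).mul
      (ih fun j hj => hu j (Finset.mem_insert_of_mem hj))

namespace IsPairDens

variable {ν : ℕ → Measure E} {p : ℕ → E → E → ℝ} {C : ℝ} {w : ℕ → E → ℂ}

lemma integral_path_eq [∀ n, IsProbabilityMeasure (ν n)] (h : IsPairDens ν p C)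
    (hw : ∀ n, BddMeas (w n)) (n : ℕ) {v : E → ℂ}
    (hv : BddMeas v) :
    ∫ x, (∏ i ∈ Finset.range n, w i (x i) * (p i (x i) (x (i + 1)) : ℂ)) * v (x n)
      ∂Measure.infinitePi ν = ∫ y, fwd ν p w n y * v y ∂ν n := by
  induction n generalizing v with
  | zero =>
    simp only [Finset.range_zero, Finset.prod_empty, one_mul, fwd, bwd]
    conv_rhs => rw [← Measure.infinitePi_map_eval ν 0]
    rw [integral_map (measurable_pi_apply 0).aemeasurable hv.1.aestronglyMeasurable]
  | succ n ih =>
    have hprod : ∀ m, BddMeas fun x : ℕ → E =>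
        ∏ i ∈ Finset.range m, w i (x i) * (p i (x i) (x (i + 1)) : ℂ) := fun m =>
      BddMeas.prod _ fun i _ => ((hw i).site i).mul (h.bddMeas_pair i)
    have hF := (hprod (n + 1)).mul (hv.site (n + 1))
    rw [← integral_update hF.1 (hF.integrable _) (n + 1)]
    have hpv : Measurable (Function.uncurry fun x y => (p n x y : ℂ) * v y) :=
      (Complex.measurable_ofReal.comp (h.meas n)).mul (hv.1.comp measurable_snd)
    have hv' : BddMeas fun x => w n x * ∫ y, (p n x y : ℂ) * v y ∂ν (n + 1) := by
      refine (hw n).mul ⟨(hpv.stronglyMeasurable.integral_prod_right (ν := ν (n + 1))).measurable, ?_⟩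
      obtain ⟨-, b, hb⟩ := hv
      refine ⟨C * b, fun x => ?_⟩
      refine (norm_integral_le_of_norm_le_const (C := C * b) (ae_of_all _ fun y => ?_)).trans
        (by simp)
      rw [norm_mul]
      exact mul_le_mul (h.norm_dens_le n x y) (hb y) (norm_nonneg _) h.pos.le
    have e : ∀ x : ℕ → E, ∫ y, (∏ i ∈ Finset.range (n + 1), w i (Function.update x (n + 1) y i) *
        (p i (Function.update x (n + 1) y i) (Function.update x (n + 1) y (i + 1)) : ℂ)) *
          v (Function.update x (n + 1) y (n + 1)) ∂ν (n + 1)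
        = (∏ i ∈ Finset.range n, w i (x i) * (p i (x i) (x (i + 1)) : ℂ)) *
          (w n (x n) * ∫ y, (p n (x n) y : ℂ) * v y ∂ν (n + 1)) := by
      intro x
      rw [← mul_assoc, ← integral_const_mul]
      refine integral_congr_ae (ae_of_all _ fun y => ?_)
      simp only
      rw [Finset.prod_range_succ, Finset.prod_congr rfl fun i hi => ?_,
        Function.update_self, Function.update_of_ne (by omega)]
      · ring
      · have := Finset.mem_range.1 hi
        rw [Function.update_of_ne (by omega), Function.update_of_ne (by omega)]
    simp_rw [e]
    rw [ih hv']
    have hfw := (h.fwd_bddMeas hw n).mul (hw n)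
    have hint : Integrable (Function.uncurry fun x y => fwd ν p w n x * w n x * ((p n x y : ℂ) * v y))
        ((ν n).prod (ν (n + 1))) := by
      have : BddMeas fun z : E × E => fwd ν p w n z.1 * w n z.1 * ((p n z.1 z.2 : ℂ) * v z.2) := by
        obtain ⟨hm, b, hb⟩ := hfw
        obtain ⟨hm', b', hb'⟩ := hv
        refine BddMeas.mul ⟨hm.comp measurable_fst, b, fun z => hb z.1⟩ (BddMeas.mul
          (.of_norm_le (Complex.measurable_ofReal.comp (h.meas n))
            fun z => h.norm_dens_le n z.1 z.2) ⟨hm'.comp measurable_snd, b', fun z => hb' z.2⟩)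
      exact this.integrable _
    have h1 := integral_integral_swap hint
    rw [show (∫ y, fwd ν p w n y * (w n y * ∫ y', (p n y y' : ℂ) * v y' ∂ν (n + 1)) ∂ν n)
      = ∫ x, ∫ y, fwd ν p w n x * w n x * ((p n x y : ℂ) * v y) ∂ν (n + 1) ∂ν n from ?_, h1]
    · refine integral_congr_ae (ae_of_all _ fun y => ?_)
      simp only
      change _ = (∫ x, fwd ν p w n x * w n x * (p n x y : ℂ) ∂ν n) * v y
      rw [← integral_mul_const]
      refine integral_congr_ae (ae_of_all _ fun x => ?_)
      simp only
      ring
    · refine integral_congr_ae (ae_of_all _ fun y => ?_)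
      simp only
      rw [integral_const_mul, mul_assoc]

lemma pathDens_pos (h : IsPairDens ν p C) (N : ℕ) (x : ℕ → E) : 0 < pathDens p N x :=
  Finset.prod_pos fun i _ => h.dens_pos i _ _

lemma measurable_pathDens (h : IsPairDens ν p C) (N : ℕ) : Measurable (pathDens p N) :=
  Finset.measurable_fun_prod _ fun i _ => h.measurable_pair i

lemma bddMeas_pathDens (h : IsPairDens ν p C) (N : ℕ) :
    BddMeas fun x => (pathDens p N x : ℂ) := by
  simp only [pathDens, Complex.ofReal_prod]
  exact BddMeas.prod _ fun i _ => h.bddMeas_pair i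

lemma integrable_pathDens [∀ n, IsProbabilityMeasure (ν n)] (h : IsPairDens ν p C) (N : ℕ) :
    Integrable (pathDens p N) (Measure.infinitePi ν) := by
  have := ((h.bddMeas_pathDens N).integrable (Measure.infinitePi ν)).re
  simpa using this

lemma partition_pos [∀ n, IsProbabilityMeasure (ν n)] (h : IsPairDens ν p C) (N : ℕ) :
    0 < partition ν p N := by
  have h1 : ∫ _, (C⁻¹) ^ N ∂Measure.infinitePi ν ≤ partition ν p N := by
    refine integral_mono (integrable_const _) (h.integrable_pathDens N) fun x => ?_
    have : ∏ i ∈ Finset.range N, C⁻¹ ≤ pathDens p N x :=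
      Finset.prod_le_prod (fun _ _ => inv_nonneg.2 h.pos.le) fun i _ => h.lower i _ _
    simpa using this
  rw [integral_const, probReal_univ, one_smul] at h1
  exact (pow_pos (inv_pos.2 h.pos) N).trans_le h1

lemma integral_pathLaw [∀ n, IsProbabilityMeasure (ν n)] (h : IsPairDens ν p C) (N : ℕ)
    {F : Type*} [NormedAddCommGroup F] [NormedSpace ℝ F] (g : (ℕ → E) → F) :
    ∫ x, g x ∂pathLaw ν p N
      = ∫ x, (pathDens p N x / partition ν p N) • g x ∂Measure.infinitePi ν := by
  rw [pathLaw, integral_withDensity_eq_integral_toReal_smul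
    ((h.measurable_pathDens N).div_const _).ennreal_ofReal (ae_of_all _ fun _ => ENNReal.ofReal_lt_top)]
  refine integral_congr_ae (ae_of_all _ fun x => ?_)
  simp only
  rw [ENNReal.toReal_ofReal (div_nonneg (h.pathDens_pos N x).le (h.partition_pos N).le)]

lemma isProbabilityMeasure_pathLaw [∀ n, IsProbabilityMeasure (ν n)] (h : IsPairDens ν p C) (N : ℕ) :
    IsProbabilityMeasure (pathLaw ν p N) := by
  refine ⟨?_⟩
  rw [pathLaw, withDensity_apply _ MeasurableSet.univ, Measure.restrict_univ,
    ← ofReal_integral_eq_lintegral_ofReal ((h.integrable_pathDens N).div_const _)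
      (ae_of_all _ fun x => div_nonneg (h.pathDens_pos N x).le (h.partition_pos N).le),
    integral_div]
  change ENNReal.ofReal (partition ν p N / partition ν p N) = 1
  rw [div_self (h.partition_pos N).ne', ENNReal.ofReal_one]

lemma integral_pathDens_mul_prod [∀ n, IsProbabilityMeasure (ν n)] (h : IsPairDens ν p C) {N : ℕ}
    (hN : 1 ≤ N) (hend : ∀ x y, p (N - 1) x y = 1) (hw : ∀ n, BddMeas (w n)) (y : E) :
    ∫ x, (pathDens p N x : ℂ) * ∏ i ∈ Finset.range N, w i (x i) ∂Measure.infinitePi ν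
      = fwd ν p w N y := by
  have h1 := h.integral_path_eq hw N (BddMeas.const 1)
  have hconst : ∀ y', fwd ν p w N y' = fwd ν p w N y := by
    obtain ⟨n, rfl⟩ : ∃ n, N = n + 1 := ⟨N - 1, by omega⟩
    intro y'
    simp only [Nat.add_sub_cancel] at hend
    simp only [fwd, bwd, transfer, hend]
  simp only [hconst, mul_one, integral_const, probReal_univ, one_smul] at h1
  rw [← h1]
  refine integral_congr_ae (ae_of_all _ fun x => ?_)
  simp only [pathDens]
  rw [Complex.ofReal_prod, Finset.prod_mul_distrib, mul_comm]

lemma partition_eq_mass [∀ n, IsProbabilityMeasure (ν n)] (h : IsPairDens ν p C) {N : ℕ}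
    (hN : 1 ≤ N) (hend : ∀ x y, p (N - 1) x y = 1) (y : E) : partition ν p N = mass ν p N y := by
  have h1 := h.integral_pathDens_mul_prod hN hend (w := fun _ _ => 1) (fun _ => .const 1) y
  rw [h.fwd_eq, bwd_one h.isBackwardKernel, one_mul] at h1
  simp only [Finset.prod_const_one, mul_one] at h1
  rw [integral_complex_ofReal] at h1
  exact_mod_cast h1

lemma isPathLaw [∀ n, IsProbabilityMeasure (ν n)] (h : IsPairDens ν p C) {N : ℕ}
    (hN : 1 ≤ N) (hend : ∀ x y, p (N - 1) x y = 1) :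
    IsPathLaw ν (revKernel ν p) N (pathLaw ν p N) := by
  refine ⟨h.isProbabilityMeasure_pathLaw N, fun w hw y => ?_⟩
  have hZ : (partition ν p N : ℂ) ≠ 0 := by exact_mod_cast (h.partition_pos N).ne'
  have h1 := h.integral_pathDens_mul_prod hN hend hw y
  rw [h.fwd_eq, ← h.partition_eq_mass hN hend] at h1
  rw [h.integral_pathLaw, eq_comm, ← mul_left_inj' hZ, ← h1, ← integral_mul_const]
  refine integral_congr_ae (ae_of_all _ fun x => ?_)
  simp only [Complex.real_smul]
  push_cast
  field_simp

end IsPairDens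

/-! ### The effect of pinning a site on the variance -/

section Pinning

variable {ν : ℕ → Measure E} {k : ℕ → E → E → ℝ} {p : ℕ → E → E → ℝ} {c C : ℝ} {w : ℕ → E → ℂ}
  {x : ℕ → E} {j : ℕ}

/-- Iterates of the same operators from another initial function remain comparable. -/
lemma norm_div_bwd_le (hB : IsBackwardKernel ν k c) (hw : ∀ i, BddMeas (w i)) {N : ℕ} (hjN : j < N)
    (hg : ∀ i < N, GoodWeight (ν i) c (w i)) {v : ℕ → E → ℂ} (hv : BddMeas (v (j + 1)))
    (hstep : ∀ n, j < n → v (n + 1) = transfer (ν n) (k n) (w n) (v n)) {A : ℝ}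
    (hA : ∀ x, ‖v (j + 1) x / bwd ν k w (j + 1) x‖ ≤ A) (y : E) :
    ‖v N y / bwd ν k w N y‖ ≤ 9 / c * A := by
  have hc := hB.pos
  have hc1 := hB.lt_one
  suffices h : ∃ D b : ℝ, b + 4 / c * D ≤ A + 4 / c * (2 * A) ∧ BddMeas (v N) ∧
      (∀ x x', ‖v N x / bwd ν k w N x - v N x' / bwd ν k w N x'‖ ≤ D) ∧
      ∀ x, ‖v N x / bwd ν k w N x‖ ≤ b by
    obtain ⟨D, b, hDb, -, hD, hb⟩ := h
    have hD0 : 0 ≤ D := (norm_nonneg _).trans (hD y y)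
    have hA0 : 0 ≤ A := (norm_nonneg _).trans (hA y)
    refine (hb y).trans ?_
    have h1 : 0 ≤ 4 / c * D := by positivity
    have h2 : A ≤ A / c := by rw [le_div_iff₀ hc]; nlinarith
    have e : 9 / c * A = A / c + 4 / c * (2 * A) := by ring
    linarith
  induction N, hjN using Nat.le_induction with
  | base =>
    refine ⟨2 * A, A, le_rfl, hv, fun x x' => ?_, hA⟩
    refine (norm_sub_le _ _).trans ?_
    linarith [hA x, hA x']
  | succ N hN ih =>
    obtain ⟨D, b, hDb, hvN, hD, hb⟩ := ih fun i hi => hg i (by omega)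
    have := hB.prob N
    obtain ⟨h1, h2⟩ := (bwd_nearConst hB hw fun i hi => hg i (by omega)).div_transfer
      (hB.dens N) (bwd_bddMeas hB hw N) hvN (hg N (by omega)) hD
    rw [hstep N hN]
    refine ⟨(1 - c / 2) * D, b + 2 * D, ?_,
      transfer_bddMeas (hB.meas N) (hB.dens N) (hw N) hvN, h1, fun x => ?_⟩
    · have : 4 / c * ((1 - c / 2) * D) = 4 / c * D - 2 * D := by field_simp; ring
      linarith
    · have := norm_le_norm_add_norm_sub'
        (transfer (ν N) (k N) (w N) (v N) x / bwd ν k w (N + 1) x)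
        (v N x / bwd ν k w N x)
      have := h2 x x
      simp only [bwd] at *
      linarith [hb x]

variable [∀ n, IsProbabilityMeasure (ν n)]

lemma IsPairDens.pinned (h : IsPairDens ν p C) (J : Finset ℕ) (x : ℕ → E) :
    IsPairDens (pinned ν J x) p C :=
  ⟨fun _ => inferInstance, h.one_lt, h.meas, h.lower, h.upper⟩

lemma pinned_of_ne {n : ℕ} (hn : n ≠ j) : EdgeworthMC.pinned ν {j} x n = ν n := by
  simp [EdgeworthMC.pinned, hn]

lemma fwd_pinned_of_le {n : ℕ} (hn : n ≤ j) :
    fwd (pinned ν {j} x) p w n = fwd ν p w n := by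
  induction n with
  | zero => rfl
  | succ n ih =>
    change transfer (pinned ν {j} x n) _ _ (fwd (pinned ν {j} x) p w n)
      = transfer (ν n) _ _ (fwd ν p w n)
    rw [ih (by omega), pinned_of_ne (by omega)]

lemma IsPairDens.fwd_pinned_succ (h : IsPairDens ν p C) (hw : ∀ n, BddMeas (w n)) (y : E) :
    fwd (EdgeworthMC.pinned ν {j} x) p w (j + 1) y
      = fwd ν p w j (x j) * w j (x j) * (p j (x j) y : ℂ) := by
  change ∫ z, fwd (EdgeworthMC.pinned ν {j} x) p w j z * w j z * (p j z y : ℂ)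
    ∂EdgeworthMC.pinned ν {j} x j = _
  rw [fwd_pinned_of_le le_rfl, EdgeworthMC.pinned, if_pos (Finset.mem_singleton_self j)]
  exact integral_dirac' _ _
    (((h.fwd_bddMeas hw j).mul (hw j)).mul (h.bddMeas_left j y)).1.stronglyMeasurable

/-- The partition functions of the pinned system relative to the unpinned total masses. -/
lemma IsPairDens.fwd_pinned_div_mass_succ (h : IsPairDens ν p C) {n : ℕ} (hn : j < n) (y : E) :
    fwd (EdgeworthMC.pinned ν {j} x) p w (n + 1) y / mass ν p (n + 1) y
      = transfer (ν n) (revKernel ν p n) (w n)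
        (fun z => fwd (EdgeworthMC.pinned ν {j} x) p w n z / mass ν p n z) y := by
  change (∫ z, fwd (EdgeworthMC.pinned ν {j} x) p w n z * w n z * (p n z y : ℂ)
    ∂EdgeworthMC.pinned ν {j} x n) / _ = ∫ z, _ ∂ν n
  rw [pinned_of_ne (by omega), ← integral_div]
  refine integral_congr_ae (ae_of_all _ fun z => ?_)
  have h1 : (mass ν p n z : ℂ) ≠ 0 := by exact_mod_cast (h.mass_pos n z).ne'
  have h2 : (mass ν p (n + 1) y : ℂ) ≠ 0 := by exact_mod_cast (h.mass_pos (n + 1) y).ne'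
  simp only [revKernel]
  push_cast
  field_simp

lemma IsPairDens.mass_eq_fwd (h : IsPairDens ν p C) (n : ℕ) (y : E) :
    (mass ν p n y : ℂ) = fwd ν p (fun _ _ => 1) n y := by
  rw [h.fwd_eq, bwd_one h.isBackwardKernel, one_mul]

lemma IsPairDens.le_mass_pinned (h : IsPairDens ν p C) {n : ℕ} (hn : j < n) (y : E) :
    (C ^ 4)⁻¹ * mass ν p n y ≤ mass (EdgeworthMC.pinned ν {j} x) p n y := by
  induction n, hn using Nat.le_induction generalizing y with
  | base =>
    have h1 := h.fwd_pinned_succ (w := fun _ _ => 1) (x := x) (j := j) (fun _ => .const 1) y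
    rw [← (h.pinned {j} x).mass_eq_fwd, ← h.mass_eq_fwd, mul_one] at h1
    have h2 : mass (EdgeworthMC.pinned ν {j} x) p (j + 1) y = mass ν p j (x j) * p j (x j) y := by
      exact_mod_cast h1
    have h3 := (h.isBackwardKernel.dens j y).lower (x j)
    rw [revKernel, le_div_iff₀ (h.mass_pos _ _)] at h3
    rw [h2]
    exact h3
  | succ n hn ih =>
    have h1 := (h.pinned {j} x).integrable_mass_mul n y
    change _ ≤ ∫ z, mass (EdgeworthMC.pinned ν {j} x) p n z * p n z y ∂EdgeworthMC.pinned ν {j} x n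
    rw [pinned_of_ne (by omega)] at h1 ⊢
    change _ * ∫ z, mass ν p n z * p n z y ∂ν n ≤ _
    rw [← integral_const_mul]
    refine integral_mono ((h.integrable_mass_mul n y).const_mul _) h1 fun z => ?_
    simp only
    rw [← mul_assoc]
    exact mul_le_mul_of_nonneg_right (ih z) (h.dens_pos n z y).le

/-- Pinning a site changes the characteristic function near the origin by a bounded factor. -/
lemma IsPairDens.norm_bwd_pinned_div_le (h : IsPairDens ν p C) {f : ℕ → E → ℤ} {G : ℝ}
    (hf : ∀ n, Measurable (f n)) (hG1 : 1 ≤ G) (hG : ∀ n x, |(f n x : ℝ)| ≤ G) {N : ℕ} (hjN : j < N)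
    {z : ℂ} (hz : z ∈ Metric.ball (0 : ℂ) (rad (C ^ 4)⁻¹ G)) (y : E) :
    ‖bwd (EdgeworthMC.pinned ν {j} x) (revKernel (EdgeworthMC.pinned ν {j} x) p)
        (fun n => phase z (f n)) N y / bwd ν (revKernel ν p) (fun n => phase z (f n)) N y‖
      ≤ 72 * C ^ 12 := by
  have hB := h.isBackwardKernel
  have hC := h.pos
  set c := (C ^ 4)⁻¹ with hc
  have hc0 : 0 < c := hB.pos
  have hc1 := hB.lt_one
  set w : ℕ → E → ℂ := fun n => phase z (f n) with hw
  have hwb : ∀ n, BddMeas (w n) := fun n => (holBdd_phase (hf n) (hG n)).bddMeas z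
  have hg : ∀ n, GoodWeight (ν n) c (w n) := goodWeight_phase hB hf hG1 hG hz
  have hE := hB.nonempty
  set v : ℕ → E → ℂ := fun n y => fwd (EdgeworthMC.pinned ν {j} x) p w n y / mass ν p n y with hv
  have hv1 : ∀ y, v (j + 1) y
      = bwd ν (revKernel ν p) w j (x j) * w j (x j) * (revKernel ν p j y (x j) : ℂ) := fun y => by
    simp only [hv]
    rw [h.fwd_pinned_succ hwb, h.fwd_eq, revKernel]
    push_cast
    ring
  have hvb : BddMeas (v (j + 1)) := by
    rw [show v (j + 1) = _ from funext hv1]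
    refine (BddMeas.const _).mul (.of_norm_le (Complex.measurable_ofReal.comp
      ((hB.meas j).comp (measurable_id.prodMk measurable_const))) (b := c⁻¹) fun y => ?_)
    rw [Complex.norm_real, Real.norm_of_nonneg ((hB.dens j y).nonneg _)]
    exact (hB.dens j y).upper _
  have hn : NearConst c (bwd ν (revKernel ν p) w j) := bwd_nearConst hB hwb fun i _ => hg i
  have hA : ∀ y, ‖v (j + 1) y / bwd ν (revKernel ν p) w (j + 1) y‖ ≤ 8 / c := by
    intro y
    have h1 := hn.norm_transfer_ge (hB.dens j) (bwd_bddMeas hB hwb j) (hg j) y y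
    have h2 := hn.norm_le (x j) y
    have h3 : ‖w j (x j)‖ ≤ 3 := by
      refine (norm_phase_le (hG j) z (x j)).trans ?_
      have := (norm_mul_le_of_mem_ball hG1 hz).trans (cube_div_le_one hB)
      exact (Real.exp_le_exp.2 this).trans (Real.exp_one_lt_d9.le.trans (by norm_num))
    have h4 : ‖(revKernel ν p j y (x j) : ℂ)‖ ≤ c⁻¹ := by
      rw [Complex.norm_real, Real.norm_of_nonneg ((hB.dens j y).nonneg _)]
      exact (hB.dens j y).upper _
    have hpos := norm_pos_iff.2 (hn.1 y)
    have hden : 0 < ‖bwd ν (revKernel ν p) w (j + 1) y‖ :=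
      (by positivity : 0 < 7 / 8 * ‖bwd ν (revKernel ν p) w j y‖).trans_le h1
    rw [norm_div, div_le_iff₀ hden, hv1, norm_mul, norm_mul]
    calc ‖bwd ν (revKernel ν p) w j (x j)‖ * ‖w j (x j)‖ * ‖(revKernel ν p j y (x j) : ℂ)‖
        ≤ (1 + 1 / 16) * ‖bwd ν (revKernel ν p) w j y‖ * 3 * c⁻¹ := by
          gcongr
          exact h2.trans (by gcongr)
      _ ≤ 8 / c * (7 / 8 * ‖bwd ν (revKernel ν p) w j y‖) := by
          have : 0 < c⁻¹ * ‖bwd ν (revKernel ν p) w j y‖ := by positivity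
          have e8 : 8 / c = 8 * c⁻¹ := div_eq_mul_inv _ _
          rw [e8]
          linarith
      _ ≤ _ := by gcongr; exact h1
  have key := norm_div_bwd_le hB hwb hjN (fun i _ => hg i) hvb
    (fun n hn => funext fun y => h.fwd_pinned_div_mass_succ hn y) hA y
  have hm := h.mass_pos N y
  have hm' := (h.pinned {j} x).mass_pos N y
  have hmm := h.le_mass_pinned (x := x) hjN y
  have e : bwd (EdgeworthMC.pinned ν {j} x) (revKernel (EdgeworthMC.pinned ν {j} x) p) w N y
      / bwd ν (revKernel ν p) w N y
      = v N y / bwd ν (revKernel ν p) w N y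
        * ((mass ν p N y / mass (EdgeworthMC.pinned ν {j} x) p N y : ℝ) : ℂ) := by
    simp only [hv]
    rw [(h.pinned {j} x).fwd_eq]
    have h1 : (mass ν p N y : ℂ) ≠ 0 := by exact_mod_cast hm.ne'
    have h2 : (mass (EdgeworthMC.pinned ν {j} x) p N y : ℂ) ≠ 0 := by exact_mod_cast hm'.ne'
    push_cast
    field_simp
  rw [e, norm_mul, Complex.norm_real, Real.norm_of_nonneg (by positivity)]
  have h5 : mass ν p N y / mass (EdgeworthMC.pinned ν {j} x) p N y ≤ c⁻¹ := by
    rw [div_le_iff₀ hm', inv_mul_eq_div, le_div_iff₀ hc0, mul_comm]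
    exact hmm
  calc _ ≤ 9 / c * (8 / c) * c⁻¹ := by gcongr
    _ = 72 * C ^ 12 := by rw [hc]; field_simp; norm_num

/-- Pinning one site changes the variance by a bounded amount. -/
lemma exists_variance_pinned_singleton_sub_le {C : ℝ} (hC : 1 < C) {G : ℝ} (hG1 : 1 ≤ G) :
    ∃ A : ℝ, 0 ≤ A ∧ ∀ {ν : ℕ → Measure E} {p : ℕ → E → E → ℝ} {f : ℕ → E → ℤ} {N j : ℕ}
      [∀ n, IsProbabilityMeasure (ν n)], IsPairDens ν p C → (∀ x y, p (N - 1) x y = 1) →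
      (∀ n, Measurable (f n)) → (∀ n x, |(f n x : ℝ)| ≤ G) → j < N → ∀ x : ℕ → E,
      |variance (fun x => (pathSum f N x : ℝ)) (pathLaw (pinned ν {j} x) p N)
        - variance (fun x => (pathSum f N x : ℝ)) (pathLaw ν p N)| ≤ A := by
  have hC0 : 0 < C := by linarith
  set c := (C ^ 4)⁻¹ with hc
  have hc0 : 0 < c := by positivity
  have hR := rad_pos hc0 hG1
  set R := rad c G with hRdef
  set M := 72 * C ^ 12 with hM
  have hM1 : 1 ≤ M := by
    have := one_le_pow₀ (n := 12) hC.le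
    linarith
  set δ := R / (8 * M) with hδ
  have hδ0 : 0 < δ := by positivity
  have hδR : δ ≤ R / 4 := by
    rw [hδ]
    exact div_le_div_of_nonneg_left hR.le (by norm_num) (by linarith)
  refine ⟨2 * (1 * (2 / δ) ^ 2), by positivity, ?_⟩
  intro ν p f N j hν h hend hf hG hj x
  have hN : 1 ≤ N := by omega
  have hB := h.isBackwardKernel
  have h' := h.pinned {j} x
  have hB' := h'.isBackwardKernel
  have hQ := h.isPathLaw hN hend
  have hQ' := h'.isPathLaw hN hend
  obtain ⟨y⟩ := hB.nonempty
  set φ : ℂ → ℂ := fun z => bwd ν (revKernel ν p) (fun n => phase z (f n)) N y with hφ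
  set φ' : ℂ → ℂ := fun z => bwd (pinned ν {j} x) (revKernel (pinned ν {j} x) p)
    (fun n => phase z (f n)) N y with hφ'
  have hφne : ∀ z ∈ Metric.ball (0 : ℂ) R, φ z ≠ 0 := fun z hz =>
    (bwd_nearConst hB (fun n => (holBdd_phase (hf n) (hG n)).bddMeas z)
      fun i _ => goodWeight_phase hB hf hG1 hG hz i).1 y
  have hd : DifferentiableOn ℂ (fun z => φ' z / φ z) (Metric.ball 0 R) :=
    DifferentiableOn.div
      ((holBdd_bwd hB' (fun n => holBdd_phase (hf n) (hG n)) N).2.1 y).differentiableOn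
      ((holBdd_bwd hB (fun n => holBdd_phase (hf n) (hG n)) N).2.1 y).differentiableOn hφne
  have hbd : ∀ z ∈ Metric.ball (0 : ℂ) R, ‖φ' z / φ z‖ ≤ M := fun z hz =>
    h.norm_bwd_pinned_div_le hf hG1 hG hj hz y
  have hz0 : φ' 0 / φ 0 = 1 := by
    have e : (fun n => phase 0 (f n)) = fun (_ : ℕ) (_ : E) => (1 : ℂ) := by
      funext n x; exact phase_zero x
    simp only [hφ, hφ', e, bwd_one hB, bwd_one hB', div_one]
  obtain ⟨b, -, hb0, -, hb⟩ := exists_taylor_of_differentiableOn hR hd hbd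
  have hhalf : ∀ z ∈ Metric.ball (0 : ℂ) δ, ‖φ' z / φ z - 1‖ ≤ 1 / 2 := by
    intro z hz
    rw [mem_ball_zero_iff] at hz
    have h1 := hb 1 z (hz.le.trans hδR)
    simp only [Finset.range_one, Finset.sum_singleton, pow_zero, mul_one, hb0, hz0, pow_one] at h1
    refine h1.trans ?_
    calc 2 * M * (2 * ‖z‖ / R) ≤ 2 * M * (2 * δ / R) := by gcongr
      _ = 1 / 2 := by rw [hδ]; field_simp; norm_num
  have hsub : Metric.ball (0 : ℂ) δ ⊆ Metric.ball 0 R :=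
    Metric.ball_subset_ball (by linarith)
  have hdL : DifferentiableOn ℂ (fun z => Complex.log (φ' z / φ z)) (Metric.ball 0 δ) := by
    refine DifferentiableOn.clog (hd.mono hsub) fun z hz => ?_
    have := Complex.mem_slitPlane_of_norm_lt_one (z := φ' z / φ z - 1)
      ((hhalf z hz).trans_lt (by norm_num))
    simpa using this
  have hLb : ∀ z ∈ Metric.ball (0 : ℂ) δ, ‖Complex.log (φ' z / φ z)‖ ≤ 1 := by
    intro z hz
    have h1 := Complex.norm_log_one_add_half_le_self (hhalf z hz)
    rw [add_sub_cancel] at h1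
    linarith [hhalf z hz]
  obtain ⟨d, hd1, hd0, -, hdr⟩ := exists_taylor_of_differentiableOn hδ0 hdL hLb
  obtain ⟨ψ, a, -, hψ, -, ha0, -, ha2, har⟩ := exists_cumulant_expansion hB hQ hf hG1 hG y rfl rfl
  set M₀ := 54 * G / c ^ 2 * rad c G * ∑ n ∈ Finset.range N, (ν n).real {x | f n x ≠ 0} with hM₀
  have hQp := hQ'.1
  have hU : Measurable fun x => (pathSum f N x : ℝ) :=
    measurable_from_top.comp (measurable_pathSum hf N)
  have key := cumulants_eq (Q := pathLaw (pinned ν {j} x) p N) hU (abs_pathSum_le hG N)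
    (ψ := fun z => ψ z + Complex.log (φ' z / φ z)) (a := fun i => a i + d i) (R := δ / 4)
    (B := 2 * M₀ * (2 / R) ^ 3 + 2 * 1 * (2 / δ) ^ 3) (by positivity)
    (by rw [ha0, hd0, hz0, Complex.log_one, add_zero]) (fun t ht htδ => ?_) (fun t ht htδ => ?_)
  · have e2 := key.2
    rw [ha2] at e2
    have e3 : d 2 = (((variance (fun x => (pathSum f N x : ℝ)) (pathLaw ν p N)
        - variance (fun x => (pathSum f N x : ℝ)) (pathLaw (pinned ν {j} x) p N)) / 2 : ℝ) : ℂ) := by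
      push_cast at e2 ⊢
      linear_combination e2
    have h1 := hd1 2
    rw [e3, Complex.norm_real, Real.norm_eq_abs, abs_div, abs_two, abs_sub_comm] at h1
    linarith
  · have htb : ((t : ℝ) : ℂ) ∈ Metric.ball (0 : ℂ) δ := by
      rw [mem_ball_zero_iff, Complex.norm_real, Real.norm_of_nonneg ht.le]; linarith
    have hne : φ' t / φ t ≠ 0 := fun h0 => by
      have := hhalf t htb
      rw [h0] at this
      norm_num at this
    rw [hQ'.integral_exp_pathSum hf hG t y, Complex.exp_add, Complex.exp_log hne,
      ← hψ t (hsub htb)]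
    exact mul_div_cancel₀ _ (hφne t (hsub htb))
  · have hnt : ‖(t : ℂ)‖ = t := by rw [Complex.norm_real, Real.norm_of_nonneg ht.le]
    have h1 := har 3 t (by rw [hnt]; linarith)
    have h2 := hdr 3 t (by rw [hnt]; linarith)
    rw [hnt] at h1 h2
    have e : ψ t + Complex.log (φ' t / φ t) - ∑ i ∈ Finset.range 3, (a i + d i) * (t : ℂ) ^ i
        = (ψ t - ∑ i ∈ Finset.range 3, a i * (t : ℂ) ^ i)
          + (Complex.log (φ' t / φ t) - ∑ i ∈ Finset.range 3, d i * (t : ℂ) ^ i) := by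
      simp only [add_mul, Finset.sum_add_distrib]; ring
    rw [e]
    refine (norm_add_le _ _).trans ((add_le_add h1 h2).trans (le_of_eq ?_))
    ring

lemma pinned_pinned_singleton (J : Finset ℕ) (j : ℕ) :
    EdgeworthMC.pinned (EdgeworthMC.pinned ν J x) {j} x = EdgeworthMC.pinned ν (insert j J) x := by
  funext n
  by_cases hn : n = j
  · simp [EdgeworthMC.pinned, hn]
  · simp [EdgeworthMC.pinned, hn]

/-- Pinning `ℓ` sites changes the variance by at most a constant multiple of `ℓ`. -/
lemma exists_variance_pinned_sub_le {C : ℝ} (hC : 1 < C) {G : ℝ} (hG1 : 1 ≤ G) :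
    ∃ A : ℝ, 0 ≤ A ∧ ∀ {ν : ℕ → Measure E} {p : ℕ → E → E → ℝ} {f : ℕ → E → ℤ} {N : ℕ}
      [∀ n, IsProbabilityMeasure (ν n)], IsPairDens ν p C → (∀ x y, p (N - 1) x y = 1) →
      (∀ n, Measurable (f n)) → (∀ n x, |(f n x : ℝ)| ≤ G) → ∀ J ⊆ Finset.range N, ∀ x : ℕ → E,
      |variance (fun x => (pathSum f N x : ℝ)) (pathLaw (pinned ν J x) p N)
        - variance (fun x => (pathSum f N x : ℝ)) (pathLaw ν p N)| ≤ J.card * A := by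
  obtain ⟨A, hA0, hA⟩ := exists_variance_pinned_singleton_sub_le (E := E) hC hG1
  refine ⟨A, hA0, ?_⟩
  intro ν p f N hν h hend hf hG J hJ x
  induction J using Finset.induction_on with
  | empty => simp [show pinned ν ∅ x = ν from funext fun n => by simp [pinned]]
  | insert j J hj ih =>
    have h1 := ih ((Finset.subset_insert _ _).trans hJ)
    have h2 := hA (h.pinned J x) hend hf hG
      (Finset.mem_range.1 (hJ (Finset.mem_insert_self _ _))) x
    rw [pinned_pinned_singleton] at h2
    rw [Finset.card_insert_of_notMem hj]
    push_cast
    rw [add_mul, one_mul, add_comm]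
    exact (abs_sub_le _ _ _).trans (add_le_add h2 h1)

end Pinning

/-! ### Densities with respect to product measures -/

lemma measure_le_prod_of_rect {J : Measure (E × E)} {ν₀ ν₁ : Measure E} [IsFiniteMeasure ν₀]
    [IsFiniteMeasure ν₁]
    (h : ∀ A B, MeasurableSet A → MeasurableSet B → J (A ×ˢ B) ≤ ν₀ A * ν₁ B) :
    J ≤ ν₀.prod ν₁ := by
  have hmp := measurePreserving_finTwoArrow_vec ν₀ ν₁
  have : ∀ i, IsFiniteMeasure (![ν₀, ν₁] i) := by
    intro i; fin_cases i <;> simpa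
  set e := (MeasurableEquiv.finTwoArrow (α := E)) with he
  have key : J.map e.symm ≤ Measure.pi ![ν₀, ν₁] := by
    refine Measure.le_iff.2 fun S hS => ?_
    have h2 : (J.map e.symm).toOuterMeasure ≤
        OuterMeasure.pi fun i => (![ν₀, ν₁] i).toOuterMeasure := by
      refine OuterMeasure.le_pi.2 fun s _ => ?_
      have hsub : Set.pi Set.univ s ⊆ Set.pi Set.univ fun i => toMeasurable (![ν₀, ν₁] i) (s i) :=
        Set.pi_mono fun i _ => subset_toMeasurable _ _
      refine (measure_mono hsub).trans ?_
      change J.map e.symm _ ≤ _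
      rw [Measure.map_apply e.symm.measurable (MeasurableSet.univ_pi fun i =>
        measurableSet_toMeasurable _ _)]
      have hpre : e.symm ⁻¹' (Set.pi Set.univ fun i => toMeasurable (![ν₀, ν₁] i) (s i))
          = toMeasurable ν₀ (s 0) ×ˢ toMeasurable ν₁ (s 1) := by
        ext z
        simp [he, Set.mem_pi, Fin.forall_fin_two, MeasurableEquiv.finTwoArrow]
      rw [hpre]
      refine (h _ _ (measurableSet_toMeasurable _ _) (measurableSet_toMeasurable _ _)).trans ?_
      simp [measure_toMeasurable, Fin.prod_univ_two]
    rw [Measure.pi, toMeasure_apply _ _ hS]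
    exact h2 S
  have h3 := Measure.map_mono key e.measurable
  rwa [hmp.map_eq, e.map_map_symm] at h3

lemma exists_dens_of_rect {J : Measure (E × E)} {ν₀ ν₁ : Measure E} [IsProbabilityMeasure J]
    [IsProbabilityMeasure ν₀] [IsProbabilityMeasure ν₁] {C : ℝ} (hC : 1 < C)
    (hu : ∀ A B, MeasurableSet A → MeasurableSet B →
      J (A ×ˢ B) ≤ ENNReal.ofReal C * (ν₀ A * ν₁ B))
    (hl : ∀ A B, MeasurableSet A → MeasurableSet B →
      ν₀ A * ν₁ B ≤ ENNReal.ofReal C * J (A ×ˢ B)) :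
    ∃ q : E → E → ℝ, Measurable (Function.uncurry q) ∧ (∀ x y, C⁻¹ ≤ q x y) ∧
      (∀ x y, q x y ≤ C) ∧
      J = (ν₀.prod ν₁).withDensity fun z => ENNReal.ofReal (q z.1 z.2) := by
  have hC0 : 0 < C := one_pos.trans hC
  have hCi : C⁻¹ ≤ C := (inv_le_one_of_one_le₀ hC.le).trans hC.le
  set c : ℝ≥0∞ := ENNReal.ofReal C with hc
  have hct : c ≠ ∞ := ENNReal.ofReal_ne_top
  have hup : J ≤ c • ν₀.prod ν₁ := by
    have : IsFiniteMeasure (c • ν₀) := ν₀.smul_finite hct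
    rw [← Measure.prod_smul_left]
    refine measure_le_prod_of_rect fun A B hA hB => ?_
    rw [Measure.smul_apply, smul_eq_mul, mul_assoc]
    exact hu A B hA hB
  have hlow : ENNReal.ofReal C⁻¹ • ν₀.prod ν₁ ≤ J := by
    have h1 : c • ν₀.prod ν₁ - J ≤ (ENNReal.ofReal (C - C⁻¹) • ν₀).prod ν₁ := by
      have : IsFiniteMeasure (ENNReal.ofReal (C - C⁻¹) • ν₀) := ν₀.smul_finite ENNReal.ofReal_ne_top
      refine measure_le_prod_of_rect fun A B hA hB => ?_
      rw [Measure.sub_apply (hA.prod hB) hup, Measure.smul_apply, Measure.smul_apply,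
        Measure.prod_prod, smul_eq_mul, smul_eq_mul, ENNReal.ofReal_sub _ (inv_nonneg.2 hC0.le),
        mul_assoc, ENNReal.sub_mul fun _ _ => ENNReal.mul_ne_top (measure_ne_top _ _) (measure_ne_top _ _)]
      refine tsub_le_tsub_left ?_ _
      rw [ENNReal.ofReal_inv_of_pos hC0]
      calc (ENNReal.ofReal C)⁻¹ * (ν₀ A * ν₁ B)
          ≤ (ENNReal.ofReal C)⁻¹ * (ENNReal.ofReal C * J (A ×ˢ B)) := by
            exact mul_le_mul' le_rfl (hl A B hA hB)
        _ = J (A ×ˢ B) := by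
            rw [← mul_assoc, ENNReal.inv_mul_cancel (ENNReal.ofReal_pos.2 hC0).ne' hct, one_mul]
    refine Measure.le_iff.2 fun S hS => ?_
    have h2 := h1 S
    rw [Measure.prod_smul_left, Measure.sub_apply hS hup, Measure.smul_apply, Measure.smul_apply,
      smul_eq_mul, smul_eq_mul, tsub_le_iff_right, hc] at h2
    rw [Measure.smul_apply, smul_eq_mul]
    have h3 : ENNReal.ofReal C = ENNReal.ofReal (C - C⁻¹) + ENNReal.ofReal C⁻¹ := by
      rw [← ENNReal.ofReal_add (sub_nonneg.2 hCi) (inv_nonneg.2 hC0.le), sub_add_cancel]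
    rw [h3, add_mul] at h2
    exact (ENNReal.add_le_add_iff_left
      (ENNReal.mul_ne_top ENNReal.ofReal_ne_top (measure_ne_top _ _))).1 h2
  have hac : J ≪ ν₀.prod ν₁ :=
    (Measure.absolutelyContinuous_of_le hup).trans Measure.smul_absolutelyContinuous
  set d := J.rnDeriv (ν₀.prod ν₁) with hd
  have hJ : (ν₀.prod ν₁).withDensity d = J := Measure.withDensity_rnDeriv_eq _ _ hac
  have hdm : Measurable d := Measure.measurable_rnDeriv _ _
  have hdJ : ∀ s, MeasurableSet s → ∫⁻ z in s, d z ∂ν₀.prod ν₁ = J s := fun s hs => by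
    rw [← withDensity_apply _ hs, hJ]
  have hd1 : d ≤ᵐ[ν₀.prod ν₁] fun _ => c := by
    refine ae_le_of_forall_setLIntegral_le_of_sigmaFinite hdm fun s hs _ => ?_
    rw [hdJ s hs, setLIntegral_const]
    exact hup s
  have hd2 : (fun _ => ENNReal.ofReal C⁻¹) ≤ᵐ[ν₀.prod ν₁] d := by
    refine ae_le_of_forall_setLIntegral_le_of_sigmaFinite measurable_const fun s hs _ => ?_
    rw [hdJ s hs, setLIntegral_const]
    exact hlow s
  refine ⟨fun x y => max C⁻¹ (min C (d (x, y)).toReal), ?_, fun x y => le_max_left _ _,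
    fun x y => max_le hCi (min_le_left _ _), ?_⟩
  · exact measurable_const.max (measurable_const.min hdm.ennreal_toReal)
  · conv_lhs => rw [← hJ]
    refine withDensity_congr_ae ?_
    filter_upwards [hd1, hd2] with z h1 h2
    have ht : d z ≠ ∞ := ne_top_of_le_ne_top hct h1
    have e1 : (d z).toReal ≤ C := ENNReal.toReal_le_of_le_ofReal hC0.le h1
    have e2 : C⁻¹ ≤ (d z).toReal := (ENNReal.ofReal_le_iff_le_toReal ht).1 h2
    rw [Prod.mk.eta, min_eq_right e1, max_eq_right e2, ENNReal.ofReal_toReal ht]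

/-! ### The chain as a path law -/

section Chain

variable {μ : Measure Ω} {X : ℕ → Ω → E} {κ : ℕ → Kernel E E} {C : ℝ}

lemma UEChain.measure_inter_preimage (h : UEChain μ X κ C) {n : ℕ} {s : Set Ω}
    (hs : MeasurableSet[⨆ i : Fin (n + 1), MeasurableSpace.comap (X i) inferInstance] s)
    {A : Set E} (hA : MeasurableSet A) :
    μ (s ∩ X (n + 1) ⁻¹' A) = ∫⁻ ω in s, κ n (X n ω) A ∂μ := by
  obtain ⟨hp, hX, hκ, hM, -⟩ := h
  have hle : (⨆ i : Fin (n + 1), MeasurableSpace.comap (X i)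
      (inferInstance : MeasurableSpace E)) ≤ ‹MeasurableSpace Ω› :=
    iSup_le fun i => (hX i).comap_le
  have hsm := hle s hs
  have e0 : (fun ω => A.indicator (fun _ => (1 : ℝ)) (X (n + 1) ω))
      = (X (n + 1) ⁻¹' A).indicator fun _ => 1 := rfl
  have hint : Integrable (fun ω => A.indicator (fun _ => (1 : ℝ)) (X (n + 1) ω)) μ := by
    rw [e0]; exact (integrable_const 1).indicator (hX _ hA)
  have h1 := setIntegral_condExp hle hint hs
  rw [setIntegral_congr_ae hsm ((hM n A hA).mono fun ω hω _ => hω), e0,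
    setIntegral_indicator (hX _ hA), setIntegral_const, smul_eq_mul, mul_one] at h1
  have hm : Measurable fun ω => κ n (X n ω) A :=
    ((κ n).measurable_coe hA).comp (hX n)
  rw [integral_toReal hm.aemeasurable (ae_of_all _ fun ω => measure_lt_top _ _)] at h1
  have hfin : ∫⁻ ω in s, κ n (X n ω) A ∂μ ≠ ∞ := by
    refine ne_top_of_le_ne_top (b := ∫⁻ ω in s, 1 ∂μ) ?_ (lintegral_mono fun ω => prob_le_one)
    rw [setLIntegral_const]; simp
  exact ((ENNReal.toReal_eq_toReal_iff' hfin (measure_ne_top _ _)).1 h1).symm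

lemma measurableSet_iSup_comap {ι : Type*} {Z : ι → Ω → E} (i : ι) {A : Set E}
    (hA : MeasurableSet A) : MeasurableSet[⨆ i, MeasurableSpace.comap (Z i) inferInstance]
      (Z i ⁻¹' A) :=
  le_iSup (fun i => MeasurableSpace.comap (Z i) inferInstance) i _ ⟨A, hA, rfl⟩

lemma UEChain.exists_dens (h : UEChain μ X κ C) (hC : 1 < C) (n : ℕ) :
    ∃ q : E → E → ℝ, Measurable (Function.uncurry q) ∧ (∀ x y, C⁻¹ ≤ q x y) ∧
      (∀ x y, q x y ≤ C) ∧ ∀ A, MeasurableSet A → ∀ᵐ ω ∂μ,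
        κ n (X n ω) A = ∫⁻ y in A, ENNReal.ofReal (q (X n ω) y) ∂μ.map (X (n + 1)) := by
  have hp := h.1
  have hX := h.2.1
  have hκ := h.2.2.1
  have hE := h.2.2.2.2
  have : ∀ m, IsProbabilityMeasure (μ.map (X m)) := fun m =>
    Measure.isProbabilityMeasure_map (hX m).aemeasurable
  have hXX : Measurable fun ω => (X n ω, X (n + 1) ω) := (hX n).prodMk (hX (n + 1))
  set J := μ.map fun ω => (X n ω, X (n + 1) ω) with hJ
  have hJp : IsProbabilityMeasure J := Measure.isProbabilityMeasure_map hXX.aemeasurable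
  have hrect : ∀ A B, MeasurableSet A → MeasurableSet B →
      J (A ×ˢ B) = ∫⁻ ω in X n ⁻¹' A, κ n (X n ω) B ∂μ := by
    intro A B hA hB
    rw [hJ, Measure.map_apply hXX (hA.prod hB)]
    exact h.measure_inter_preimage
      (measurableSet_iSup_comap (Z := fun i : Fin (n + 1) => X i) (Fin.last n) hA) hB
  have hu : ∀ A B, MeasurableSet A → MeasurableSet B →
      J (A ×ˢ B) ≤ ENNReal.ofReal C * (μ.map (X n) A * μ.map (X (n + 1)) B) := by
    intro A B hA hB
    rw [hrect A B hA hB, Measure.map_apply (hX n) hA]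
    calc ∫⁻ ω in X n ⁻¹' A, κ n (X n ω) B ∂μ
        ≤ ∫⁻ ω in X n ⁻¹' A, ENNReal.ofReal C * μ.map (X (n + 1)) B ∂μ :=
          lintegral_mono_ae (ae_restrict_of_ae ((hE n B hB).mono fun ω hω => hω.1))
      _ = _ := by rw [setLIntegral_const]; ring
  have hl : ∀ A B, MeasurableSet A → MeasurableSet B →
      μ.map (X n) A * μ.map (X (n + 1)) B ≤ ENNReal.ofReal C * J (A ×ˢ B) := by
    intro A B hA hB
    rw [hrect A B hA hB, Measure.map_apply (hX n) hA,
      ← lintegral_const_mul (f := fun ω => κ n (X n ω) B) _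
        (((κ n).measurable_coe hB).comp (hX n))]
    calc μ (X n ⁻¹' A) * μ.map (X (n + 1)) B
        = ∫⁻ ω in X n ⁻¹' A, μ.map (X (n + 1)) B ∂μ := by rw [setLIntegral_const, mul_comm]
      _ ≤ _ := lintegral_mono_ae (ae_restrict_of_ae ((hE n B hB).mono fun ω hω => hω.2))
  obtain ⟨q, hq, hq1, hq2, hqJ⟩ := exists_dens_of_rect hC hu hl
  refine ⟨q, hq, hq1, hq2, fun A hA => ?_⟩
  have hqm : Measurable fun z : E × E => ENNReal.ofReal (q z.1 z.2) := hq.ennreal_ofReal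
  have hmeas : Measurable fun x => ∫⁻ y in A, ENNReal.ofReal (q x y) ∂μ.map (X (n + 1)) :=
    hqm.lintegral_prod_right'
  refine ae_of_ae_map (hX n).aemeasurable
    (p := fun x => κ n x A = ∫⁻ y in A, ENNReal.ofReal (q x y) ∂μ.map (X (n + 1))) ?_
  refine ae_eq_of_forall_setLIntegral_eq_of_sigmaFinite ((κ n).measurable_coe hA) hmeas
    fun B hB _ => ?_
  rw [setLIntegral_map hB ((κ n).measurable_coe hA) (hX n), ← hrect B A hB hA, hqJ,
    withDensity_apply _ (hB.prod hA), ← Measure.prod_restrict, lintegral_prod _ hqm.aemeasurable]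

/-- The law of the chain on boxes, in terms of transition densities. -/
lemma UEChain.setLIntegral_box (h : UEChain μ X κ C) {q : ℕ → E → E → ℝ}
    [∀ i, IsProbabilityMeasure (μ.map (X (i + 1)))]
    (hq : ∀ n, Measurable (Function.uncurry (q n)))
    (hqκ : ∀ n A, MeasurableSet A → ∀ᵐ ω ∂μ, κ (n + 1) (X (n + 1) ω) A
      = ∫⁻ y in A, ENNReal.ofReal (q n (X (n + 1) ω) y) ∂μ.map (X (n + 2)))
    {t : ℕ → Set E} (ht : ∀ i, MeasurableSet (t i)) (n : ℕ) :
    ∀ u : E → ℝ≥0∞, Measurable u →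
      ∫⁻ ω in {ω | ∀ i < n, X (i + 1) ω ∈ t i}, u (X (n + 1) ω) ∂μ
        = ∫⁻ x, (∏ i ∈ range n, (t i).indicator 1 (x i) * ENNReal.ofReal (q i (x i) (x (i + 1))))
            * u (x n) ∂Measure.infinitePi fun i => μ.map (X (i + 1)) := by
  have hp := h.1
  have hX := h.2.1
  have hqm : ∀ n, Measurable fun z : E × E => ENNReal.ofReal (q n z.1 z.2) :=
    fun n => (hq n).ennreal_ofReal
  induction n with
  | zero =>
    intro u hu
    simp only [not_lt_zero, IsEmpty.forall_iff, implies_true, Set.ofPred_true, Measure.restrict_univ,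
      Finset.range_zero, Finset.prod_empty, one_mul, zero_add]
    rw [← lintegral_map hu (hX 1)]
    conv_lhs => rw [← Measure.infinitePi_map_eval (fun i => μ.map (X (i + 1))) 0]
    rw [lintegral_map hu (measurable_pi_apply 0)]
  | succ n ih =>
    intro u hu
    set s : ℕ → Set Ω := fun n => {ω | ∀ i < n, X (i + 1) ω ∈ t i} with hs
    have hss : s (n + 1) = s n ∩ X (n + 1) ⁻¹' t n := by
      ext ω
      simp only [hs, Set.mem_ofPred_eq, Set.mem_inter_iff, Set.mem_preimage, Nat.lt_succ_iff]
      exact ⟨fun H => ⟨fun i hi => H i hi.le, H n le_rfl⟩, fun H i hi =>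
        hi.lt_or_eq.elim (H.1 i) fun e => e ▸ H.2⟩
    have hsF : ∀ m ≤ n + 1, MeasurableSet[⨆ i : Fin (n + 1 + 1),
        MeasurableSpace.comap (X i) (inferInstance : MeasurableSpace E)] (s m) := by
      intro m hm
      have e : s m = ⋂ i : Fin m, X (i + 1) ⁻¹' t i := by
        ext ω; simp [hs, Fin.forall_iff]
      rw [e]
      exact MeasurableSet.iInter fun i => measurableSet_iSup_comap
        (Z := fun i : Fin (n + 1 + 1) => X i) ⟨i + 1, by have := i.2; omega⟩ (ht _)
    have hsm : ∀ m, MeasurableSet (s m) := fun m => by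
      have e : s m = ⋂ i : Fin m, X (i + 1) ⁻¹' t i := by
        ext ω; simp [hs, Fin.forall_iff]
      rw [e]
      exact MeasurableSet.iInter fun i => hX _ (ht _)
    have hqX : Measurable fun z : Ω × E => ENNReal.ofReal (q n (X (n + 1) z.1) z.2) :=
      (hqm n).comp (((hX (n + 1)).comp measurable_fst).prodMk measurable_snd)
    have hlaw : (μ.restrict (s (n + 1))).map (X (n + 2)) = (μ.map (X (n + 2))).withDensity
        fun y => ∫⁻ ω in s (n + 1), ENNReal.ofReal (q n (X (n + 1) ω) y) ∂μ := by
      refine Measure.ext fun A hA => ?_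
      rw [Measure.map_apply (hX _) hA, withDensity_apply _ hA, Measure.restrict_apply (hX _ hA),
        Set.inter_comm, h.measure_inter_preimage (hsF _ le_rfl) hA,
        lintegral_congr_ae (ae_restrict_of_ae (hqκ n A hA))]
      exact lintegral_lintegral_swap hqX.aemeasurable
    have h1 : ∫⁻ ω in s (n + 1), u (X (n + 2) ω) ∂μ = ∫⁻ ω in s (n + 1),
        ∫⁻ y, ENNReal.ofReal (q n (X (n + 1) ω) y) * u y ∂μ.map (X (n + 2)) ∂μ := by
      rw [← lintegral_map hu (hX _), hlaw, lintegral_withDensity_eq_lintegral_mul _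
        hqX.lintegral_prod_left' hu]
      have hqu : Measurable fun z : Ω × E => ENNReal.ofReal (q n (X (n + 1) z.1) z.2) * u z.2 :=
        hqX.mul (hu.comp measurable_snd)
      rw [lintegral_lintegral_swap hqu.aemeasurable]
      refine lintegral_congr fun y => ?_
      rw [Pi.mul_apply, lintegral_mul_const]
      exact hqX.comp (measurable_id.prodMk measurable_const)
    have hvm : Measurable fun x => ∫⁻ y, ENNReal.ofReal (q n x y) * u y ∂μ.map (X (n + 2)) :=
      Measurable.lintegral_prod_right' (f := fun z : E × E => ENNReal.ofReal (q n z.1 z.2) * u z.2)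
        ((hqm n).mul (hu.comp measurable_snd))
    have h2 := ih ((t n).indicator fun x => ∫⁻ y, ENNReal.ofReal (q n x y) * u y ∂μ.map (X (n + 2)))
      (hvm.indicator (ht n))
    have h3 : ∫⁻ ω in s n, (t n).indicator (fun x => ∫⁻ y, ENNReal.ofReal (q n x y) * u y
        ∂μ.map (X (n + 2))) (X (n + 1) ω) ∂μ = ∫⁻ ω in s (n + 1),
        ∫⁻ y, ENNReal.ofReal (q n (X (n + 1) ω) y) * u y ∂μ.map (X (n + 2)) ∂μ := by
      rw [hss, Set.inter_comm, ← Measure.restrict_restrict (hX _ (ht n)),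
        ← lintegral_indicator (hX _ (ht n))]
      rfl
    have hFm : Measurable fun x : ℕ → E => (∏ i ∈ range (n + 1), (t i).indicator 1 (x i)
        * ENNReal.ofReal (q i (x i) (x (i + 1)))) * u (x (n + 1)) := by
      refine (Finset.measurable_fun_prod _ fun i _ => ?_).mul (hu.comp (measurable_pi_apply _))
      have hpair : Measurable fun x : ℕ → E => (x i, x (i + 1)) :=
        (measurable_pi_apply i).prodMk (measurable_pi_apply (i + 1))
      exact ((measurable_one.indicator (ht i)).comp (measurable_pi_apply i)).mul
        ((hqm i).comp hpair)
    rw [h1, ← h3, h2, ← lintegral_update (ν := fun i => μ.map (X (i + 1))) hFm (n + 1)]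
    refine lintegral_congr fun x => ?_
    have hprod : ∀ y, ∏ i ∈ range n, (t i).indicator 1 (Function.update x (n + 1) y i)
          * ENNReal.ofReal (q i (Function.update x (n + 1) y i) (Function.update x (n + 1) y (i + 1)))
        = ∏ i ∈ range n, (t i).indicator 1 (x i) * ENNReal.ofReal (q i (x i) (x (i + 1))) := by
      intro y
      refine Finset.prod_congr rfl fun i hi => ?_
      have := Finset.mem_range.1 hi
      rw [Function.update_of_ne (by omega), Function.update_of_ne (by omega)]
    simp only [Finset.prod_range_succ, hprod, Function.update_self,
      Function.update_of_ne (Nat.succ_ne_self n).symm]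
    have hqx : Measurable fun y => ENNReal.ofReal (q n (x n) y) * u y :=
      ((hqm n).comp (measurable_const.prodMk measurable_id)).mul hu
    simp only [mul_assoc]
    rw [lintegral_const_mul _ (by fun_prop), lintegral_const_mul _ hqx]
    congr 1
    by_cases hx : x n ∈ t n <;> simp [hx]

lemma measure_ext_of_boxes {m m' : Measure (ℕ → E)} [IsFiniteMeasure m]
    (h : ∀ t : ℕ → Set E, (∀ i, MeasurableSet (t i)) →
      m (Set.pi Set.univ t) = m' (Set.pi Set.univ t)) : m = m' := by
  have hgen : (MeasurableSpace.pi : MeasurableSpace (ℕ → E)) = MeasurableSpace.generateFrom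
      (Set.pi Set.univ '' Set.pi Set.univ fun _ => {s : Set E | MeasurableSet s}) := by
    refine le_antisymm (iSup_le fun n => ?_) (MeasurableSpace.generateFrom_le ?_)
    · rintro _ ⟨A, hA, rfl⟩
      refine MeasurableSpace.measurableSet_generateFrom
        ⟨Function.update (fun _ => Set.univ) n A, fun i _ => ?_, by
          rw [Set.univ_pi_update_univ]⟩
      by_cases hi : i = n
      · subst hi; simpa using hA
      · simp [Function.update_of_ne hi]
    · rintro _ ⟨t, ht, rfl⟩
      exact MeasurableSet.univ_pi fun i => ht i (Set.mem_univ i)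
  refine ext_of_generate_finite _ hgen isPiSystem_pi ?_ ?_
  · rintro _ ⟨t, ht, rfl⟩
    exact h t fun i => ht i (Set.mem_univ i)
  · have := h (fun _ => Set.univ) fun _ => MeasurableSet.univ
    simpa using this

/-- A uniformly elliptic chain has a density with respect to the product of its marginals. -/
theorem UEChain.exists_isPairDens (h : UEChain μ X κ C) (hC : 1 < C) {N : ℕ} (hN : 1 ≤ N) :
    ∃ p : ℕ → E → E → ℝ, IsPairDens (fun i => μ.map (X (i + 1))) p C ∧
      (∀ x y, p (N - 1) x y = 1) ∧
      ∀ F : (ℕ → E) → ℂ, Measurable F → (∀ x y, (∀ i < N, x i = y i) → F x = F y) →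
        ∫ ω, F (fun i => X (i + 1) ω) ∂μ
          = ∫ x, (pathDens p N x : ℂ) * F x ∂Measure.infinitePi fun i => μ.map (X (i + 1)) := by
  have hp := h.1
  have hX := h.2.1
  have hν : ∀ i, IsProbabilityMeasure (μ.map (X (i + 1))) := fun i =>
    Measure.isProbabilityMeasure_map (hX _).aemeasurable
  choose q hqm hq1 hq2 hqκ using fun n => h.exists_dens hC (n + 1)
  set p : ℕ → E → E → ℝ := fun i => if i + 1 < N then q i else fun _ _ => 1 with hpdef
  have hpd : IsPairDens (fun i => μ.map (X (i + 1))) p C := by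
    refine ⟨hν, hC, fun n => ?_, fun n x y => ?_, fun n x y => ?_⟩ <;> simp only [hpdef] <;>
      split_ifs
    · exact hqm n
    · exact measurable_const
    · exact hq1 n x y
    · exact inv_le_one_of_one_le₀ hC.le
    · exact hq2 n x y
    · exact hC.le
  refine ⟨p, hpd, fun x y => ?_, ?_⟩
  · simp only [hpdef]
    rw [if_neg (by omega)]
  obtain ⟨n, rfl⟩ : ∃ n, N = n + 1 := ⟨N - 1, by omega⟩
  have hdens : ∀ x, pathDens p (n + 1) x = ∏ i ∈ range n, q i (x i) (x (i + 1)) := by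
    intro x
    rw [pathDens, Finset.prod_range_succ]
    simp only [hpdef]
    rw [if_neg (by omega), mul_one]
    exact Finset.prod_congr rfl fun i hi => by
      rw [if_pos (by have := Finset.mem_range.1 hi; omega)]
  obtain ⟨ω₀⟩ : Nonempty Ω := nonempty_of_isProbabilityMeasure μ
  set Φ : Ω → ℕ → E := fun ω i => X (i + 1) ω with hΦ
  have hΦm : Measurable Φ := measurable_pi_iff.2 fun i => hX _
  set T : (ℕ → E) → ℕ → E := fun x => (range (n + 1)).piecewise x (Φ ω₀) with hT
  have hTm : Measurable T := measurable_piecewise_left _ _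
  have hTin : ∀ x, ∀ i < n + 1, T x i = x i := fun x i hi =>
    Finset.piecewise_eq_of_mem _ _ _ (Finset.mem_range.2 hi)
  have hTout : ∀ x i, n < i → T x i = Φ ω₀ i := fun x i hi =>
    Finset.piecewise_eq_of_notMem _ _ _ (by rw [Finset.mem_range]; omega)
  set R := (Measure.infinitePi fun i => μ.map (X (i + 1))).withDensity
    fun x => ENNReal.ofReal (pathDens p (n + 1) x) with hR
  have hρm : Measurable fun x => ENNReal.ofReal (pathDens p (n + 1) x) :=
    (hpd.measurable_pathDens _).ennreal_ofReal
  have hTpre : ∀ t : ℕ → Set E, (∀ i, n < i → Φ ω₀ i ∈ t i) →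
      T ⁻¹' Set.pi Set.univ t = {x | ∀ i < n + 1, x i ∈ t i} := by
    intro t ht
    ext x
    simp only [Set.mem_preimage, Set.mem_pi, Set.mem_univ, true_implies, Set.mem_ofPred_eq]
    refine ⟨fun H i hi => ?_, fun H i => ?_⟩
    · exact hTin x i hi ▸ H i
    · by_cases hi : i < n + 1
      · exact (hTin x i hi).symm ▸ H i hi
      · exact (hTout x i (by omega)).symm ▸ ht i (by omega)
  have key : (μ.map Φ).map T = R.map T := by
    have : IsProbabilityMeasure (μ.map Φ) := Measure.isProbabilityMeasure_map hΦm.aemeasurable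
    refine measure_ext_of_boxes fun t ht => ?_
    have hbox : MeasurableSet (Set.pi Set.univ t) := MeasurableSet.univ_pi ht
    rw [Measure.map_apply hTm hbox, Measure.map_apply hTm hbox, Measure.map_apply hΦm (hTm hbox)]
    by_cases hout : ∀ i, n < i → Φ ω₀ i ∈ t i
    · have hb := hTm hbox
      rw [hTpre t hout] at hb ⊢
      have h1 := h.setLIntegral_box hqm hqκ ht n ((t n).indicator 1)
        (measurable_one.indicator (ht n))
      have e1 : ∫⁻ ω in {ω | ∀ i < n, X (i + 1) ω ∈ t i}, (t n).indicator 1 (X (n + 1) ω) ∂μ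
          = μ (Φ ⁻¹' {x | ∀ i < n + 1, x i ∈ t i}) := by
        have e2 : (fun ω => (t n).indicator (1 : E → ℝ≥0∞) (X (n + 1) ω))
            = (X (n + 1) ⁻¹' t n).indicator 1 := rfl
        rw [e2, lintegral_indicator_one (hX _ (ht n)), Measure.restrict_apply (hX _ (ht n))]
        congr 1
        ext ω
        simp only [Set.mem_inter_iff, Set.mem_preimage, Set.mem_ofPred_eq, Nat.lt_succ_iff, hΦ]
        exact ⟨fun H i hi => hi.lt_or_eq.elim (H.2 i) fun e => e ▸ H.1,
          fun H => ⟨H n le_rfl, fun i hi => H i hi.le⟩⟩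
      rw [← e1, h1, hR, withDensity_apply _ hb, ← lintegral_indicator hb]
      refine lintegral_congr fun x => ?_
      rw [Finset.prod_mul_distrib, mul_right_comm, ← Finset.prod_range_succ
        (fun i => (t i).indicator (1 : E → ℝ≥0∞) (x i)),
        ← ENNReal.ofReal_prod_of_nonneg fun i _ => (inv_nonneg.2 (by linarith)).trans (hq1 i _ _),
        ← hdens]
      by_cases hx : ∀ i < n + 1, x i ∈ t i
      · rw [Set.indicator_of_mem (by exact hx), Finset.prod_eq_one, one_mul]
        intro i hi
        rw [Set.indicator_of_mem (hx i (Finset.mem_range.1 hi)), Pi.one_apply]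
      · rw [Set.indicator_of_notMem (by exact hx)]
        push Not at hx
        obtain ⟨i, hi, hxi⟩ := hx
        rw [Finset.prod_eq_zero (Finset.mem_range.2 hi) (Set.indicator_of_notMem hxi _), zero_mul]
    · have : T ⁻¹' Set.pi Set.univ t = ∅ := by
        push Not at hout
        obtain ⟨i, hi, hxi⟩ := hout
        refine Set.eq_empty_of_forall_notMem fun x hx => hxi ?_
        exact hTout x i hi ▸ hx i (Set.mem_univ i)
      rw [this]
      simp
  intro F hF hFN
  have hFT : ∀ x, F (T x) = F x := fun x => hFN _ _ (hTin x)
  have h1 : ∫ x, F x ∂(μ.map Φ).map T = ∫ ω, F (Φ ω) ∂μ := by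
    rw [integral_map hTm.aemeasurable hF.aestronglyMeasurable]
    simp only [hFT]
    rw [integral_map hΦm.aemeasurable hF.aestronglyMeasurable]
  have h2 : ∫ x, F x ∂(R.map T) = ∫ x, (pathDens p (n + 1) x : ℂ) * F x
      ∂Measure.infinitePi fun i => μ.map (X (i + 1)) := by
    rw [integral_map hTm.aemeasurable hF.aestronglyMeasurable]
    simp only [hFT]
    rw [hR, integral_withDensity_eq_integral_toReal_smul hρm
      (ae_of_all _ fun _ => ENNReal.ofReal_lt_top)]
    refine integral_congr_ae (ae_of_all _ fun x => ?_)
    simp only [ENNReal.toReal_ofReal (hpd.pathDens_pos _ x).le, Complex.real_smul]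
  rw [← h1, key, h2]

end Chain

/-! ### Conditioning on finitely many coordinates -/

/-- The trajectory of the chain from time one on. -/
def traj (X : ℕ → Ω → E) (ω : Ω) (i : ℕ) : E := X (i + 1) ω

/-- The marginal laws of the trajectory. -/
def marg (μ : Measure Ω) (X : ℕ → Ω → E) (i : ℕ) : Measure E := μ.map (X (i + 1))

/-- The first `N` steps of the chain have the path density given by `p`. -/
structure IsChainDens (μ : Measure Ω) (X : ℕ → Ω → E) (p : ℕ → E → E → ℝ) (C : ℝ) (N : ℕ) :
    Prop where
  prob : IsProbabilityMeasure μ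
  meas : ∀ n, Measurable (X n)
  pair : IsPairDens (marg μ X) p C
  last : ∀ x y, p (N - 1) x y = 1
  law : ∀ F : (ℕ → E) → ℂ, Measurable F → (∀ x y, (∀ i < N, x i = y i) → F x = F y) →
    ∫ ω, F (traj X ω) ∂μ = ∫ x, (pathDens p N x : ℂ) * F x ∂Measure.infinitePi (marg μ X)

/-- The unnormalized conditional expectation of `F` given the sites of `J`. -/
def condInt (ν : ℕ → Measure E) (p : ℕ → E → E → ℝ) (N : ℕ) (J : Finset ℕ) (F : (ℕ → E) → ℂ)
    (x : ℕ → E) : ℂ :=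
  ∫ y, (pathDens p N (J.piecewise x y) : ℂ) * F (J.piecewise x y) ∂Measure.infinitePi ν

section CondInt

variable {ν : ℕ → Measure E} [∀ n, IsProbabilityMeasure (ν n)] {p : ℕ → E → E → ℝ} {C : ℝ}
  {N : ℕ} {J : Finset ℕ} {F : (ℕ → E) → ℂ}

lemma IsPairDens.bddMeas_condInt (h : IsPairDens ν p C) (hF : BddMeas F) :
    BddMeas (condInt ν p N J F) := by
  obtain ⟨hm, b, hb⟩ := (h.bddMeas_pathDens N).mul hF
  have hmp : Measurable fun z : (ℕ → E) × (ℕ → E) =>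
      (pathDens p N (J.piecewise z.1 z.2) : ℂ) * F (J.piecewise z.1 z.2) :=
    hm.comp (measurable_piecewise J)
  refine ⟨(hmp.stronglyMeasurable.integral_prod_right').measurable, b, fun x => ?_⟩
  refine (norm_integral_le_of_norm_le_const (ae_of_all _ fun y => hb _)).trans ?_
  simp

lemma IsPairDens.ofReal_partition_pinned (h : IsPairDens ν p C) (x : ℕ → E) :
    (partition (EdgeworthMC.pinned ν J x) p N : ℂ) = condInt ν p N J (fun _ => 1) x := by
  rw [partition, infinitePi_pinned, integral_map (measurable_piecewise_right J x).aemeasurable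
    (h.measurable_pathDens N).aestronglyMeasurable, ← integral_complex_ofReal]
  simp only [condInt, mul_one]

lemma IsPairDens.integral_pathLaw_pinned (h : IsPairDens ν p C) (hF : BddMeas F) (x : ℕ → E) :
    ∫ y, F y ∂pathLaw (EdgeworthMC.pinned ν J x) p N
      = condInt ν p N J F x / condInt ν p N J (fun _ => 1) x := by
  rw [← h.ofReal_partition_pinned, (h.pinned J x).integral_pathLaw]
  set Z := partition (EdgeworthMC.pinned ν J x) p N
  have e : ∀ y : ℕ → E, (pathDens p N y / Z) • F y = (pathDens p N y : ℂ) * F y * (Z : ℂ)⁻¹ := by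
    intro y
    rw [Complex.real_smul]
    push_cast
    ring
  simp only [e]
  rw [integral_mul_const, infinitePi_pinned, integral_map
    (measurable_piecewise_right J x).aemeasurable
    ((h.bddMeas_pathDens N).mul hF).1.aestronglyMeasurable, div_eq_mul_inv, condInt]

/-- Integration against functions of the sites of `J`. -/
lemma IsPairDens.integral_mul_condInt (h : IsPairDens ν p C) (hF : BddMeas F)
    {G : (ℕ → E) → ℂ} (hG : BddMeas G) (hGJ : ∀ x x', (∀ i ∈ J, x i = x' i) → G x = G x') :
    ∫ x, (pathDens p N x : ℂ) * (G x * F x) ∂Measure.infinitePi ν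
      = ∫ x, G x * condInt ν p N J F x ∂Measure.infinitePi ν := by
  have hb := (h.bddMeas_pathDens N).mul (hG.mul hF)
  rw [← integral_piecewise hb.1 (hb.integrable _) J]
  refine integral_congr_ae (ae_of_all _ fun x => ?_)
  simp only [condInt]
  rw [← integral_const_mul]
  refine integral_congr_ae (ae_of_all _ fun y => ?_)
  have e : G (J.piecewise x y) = G x := hGJ _ _ fun i hi => by simp [hi]
  simp only [e]
  ring

end CondInt

section Conditioning

variable {μ : Measure Ω} {X : ℕ → Ω → E} {p : ℕ → E → E → ℝ} {C : ℝ} {N : ℕ}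

lemma IsChainDens.measurable_traj (h : IsChainDens μ X p C N) : Measurable (traj X) :=
  measurable_pi_iff.2 fun i => h.meas (i + 1)

lemma IsChainDens.isProbabilityMeasure_marg (h : IsChainDens μ X p C N) (i : ℕ) :
    IsProbabilityMeasure (marg μ X i) := h.pair.prob i

/-- The sites corresponding to the times `j`. -/
def sites {ℓ : ℕ} (j : Fin ℓ → ℕ) : Finset ℕ := Finset.univ.image fun i => j i - 1

variable {ℓ : ℕ} {j : Fin ℓ → ℕ}

lemma sites_subset (hj : ∀ i, j i ∈ Finset.Icc 1 N) : sites j ⊆ range N := by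
  intro n hn
  obtain ⟨i, -, rfl⟩ := Finset.mem_image.1 hn
  have := Finset.mem_Icc.1 (hj i)
  exact Finset.mem_range.2 (by omega)

lemma card_sites_le (j : Fin ℓ → ℕ) : (sites j).card ≤ ℓ :=
  Finset.card_image_le.trans (by simp)

lemma sigmaOf_eq_comap (hj : ∀ i, j i ∈ Finset.Icc 1 N) (e : ℕ → E) :
    sigmaOf X j = MeasurableSpace.comap (fun ω => (sites j).piecewise (traj X ω) e)
      MeasurableSpace.pi := by
  have hsite : ∀ i, j i - 1 ∈ sites j := fun i => Finset.mem_image_of_mem _ (Finset.mem_univ i)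
  have hsub : ∀ i, j i - 1 + 1 = j i := fun i => by
    have := Finset.mem_Icc.1 (hj i); omega
  refine le_antisymm (iSup_le fun i => ?_) ?_
  · rintro _ ⟨A, hA, rfl⟩
    refine ⟨(fun x : ℕ → E => x (j i - 1)) ⁻¹' A, measurable_pi_apply _ hA, ?_⟩
    ext ω
    simp [hsite i, traj, hsub]
  · refine measurable_iff_comap_le.1 ?_
    refine @measurable_pi_lambda _ _ _ (sigmaOf X j) _ _ fun n => ?_
    by_cases hn : n ∈ sites j
    · obtain ⟨i, -, rfl⟩ := Finset.mem_image.1 hn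
      simp only [Finset.piecewise_eq_of_mem _ _ _ hn, traj, hsub]
      exact measurable_iff_comap_le.2 (le_iSup (fun i => MeasurableSpace.comap (X (j i))
        (inferInstance : MeasurableSpace E)) i)
    · simp only [Finset.piecewise_eq_of_notMem _ _ _ hn]
      exact @measurable_const _ _ _ (sigmaOf X j) _

lemma IsChainDens.sigmaOf_le (h : IsChainDens μ X p C N) (j : Fin ℓ → ℕ) :
    sigmaOf X j ≤ ‹MeasurableSpace Ω› :=
  iSup_le fun i => (h.meas (j i)).comap_le

lemma IsChainDens.integral_mul_traj (h : IsChainDens μ X p C N) {J : Finset ℕ} (hJ : J ⊆ range N)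
    {F G : (ℕ → E) → ℂ} (hF : BddMeas F) (hFN : ∀ x y, (∀ i < N, x i = y i) → F x = F y)
    (hG : BddMeas G) (hGJ : ∀ x x', (∀ i ∈ J, x i = x' i) → G x = G x') :
    ∫ ω, G (traj X ω) * F (traj X ω) ∂μ
      = ∫ x, G x * condInt (marg μ X) p N J F x ∂Measure.infinitePi (marg μ X) := by
  have := h.isProbabilityMeasure_marg
  rw [← h.pair.integral_mul_condInt hF hG hGJ]
  refine h.law (fun x => G x * F x) (hG.mul hF).1 fun x y hxy => ?_
  rw [hFN x y hxy, hGJ x y fun i hi => hxy i (Finset.mem_range.1 (hJ hi))]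

lemma IsPairDens.condInt_one_ne_zero {ν : ℕ → Measure E} [∀ n, IsProbabilityMeasure (ν n)]
    (h : IsPairDens ν p C) (J : Finset ℕ) (x : ℕ → E) : condInt ν p N J (fun _ => 1) x ≠ 0 := by
  rw [← h.ofReal_partition_pinned]
  exact_mod_cast ((h.pinned J x).partition_pos N).ne'

lemma IsPairDens.bddMeas_integral_pinned {ν : ℕ → Measure E} [∀ n, IsProbabilityMeasure (ν n)]
    (h : IsPairDens ν p C) {F : (ℕ → E) → ℂ} (hF : BddMeas F) (J : Finset ℕ) :
    BddMeas fun x => ∫ y, F y ∂pathLaw (EdgeworthMC.pinned ν J x) p N := by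
  obtain ⟨hm, b, hb⟩ := hF
  refine ⟨?_, b, fun x => ?_⟩
  · simp only [h.integral_pathLaw_pinned ⟨hm, b, hb⟩]
    exact (h.bddMeas_condInt ⟨hm, b, hb⟩).1.div (h.bddMeas_condInt (.const 1)).1
  · have := (h.pinned J x).isProbabilityMeasure_pathLaw N
    refine (norm_integral_le_of_norm_le_const (ae_of_all _ fun y => hb _)).trans ?_
    simp

lemma integral_pinned_congr {ν : ℕ → Measure E} {J : Finset ℕ} (F : (ℕ → E) → ℂ) {x x' : ℕ → E}
    (hxx : ∀ i ∈ J, x i = x' i) :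
    ∫ y, F y ∂pathLaw (pinned ν J x) p N = ∫ y, F y ∂pathLaw (pinned ν J x') p N := by
  have : pinned ν J x = pinned ν J x' := by
    funext i
    by_cases hi : i ∈ J <;> simp [pinned, hi, hxx]
  rw [this]

/-- Conditional expectations of functions of the trajectory. -/
theorem IsChainDens.condExp_eq (h : IsChainDens μ X p C N) (hj : ∀ i, j i ∈ Finset.Icc 1 N)
    {F : (ℕ → E) → ℂ} (hF : BddMeas F) (hFN : ∀ x y, (∀ i < N, x i = y i) → F x = F y) :
    μ[fun ω => F (traj X ω) | sigmaOf X j] =ᵐ[μ]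
      fun ω => ∫ y, F y ∂pathLaw (pinned (marg μ X) (sites j) (traj X ω)) p N := by
  have hν := h.isProbabilityMeasure_marg
  have hp := h.prob
  have hm := h.sigmaOf_le j
  have hG := h.pair.bddMeas_integral_pinned (N := N) hF (sites j)
  obtain ⟨ω₀⟩ : Nonempty Ω := nonempty_of_isProbabilityMeasure μ
  set J := sites j with hJ
  have hpw : ∀ x y : ℕ → E, ∀ i ∈ J, J.piecewise x y i = x i := fun x y i hi => by simp [hi]
  have htraj : ∀ {u : (ℕ → E) → ℂ}, BddMeas u → Integrable (fun ω => u (traj X ω)) μ := by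
    rintro u ⟨hu, b, hb⟩
    exact BddMeas.integrable (u := fun ω => u (traj X ω))
      ⟨hu.comp h.measurable_traj, b, fun ω => hb _⟩ μ
  refine (ae_eq_condExp_of_forall_setIntegral_eq hm (htraj hF) (fun s _ _ =>
    (htraj hG).integrableOn) ?_ ?_).symm
  · intro s hs _
    have hs' := hm s hs
    rw [sigmaOf_eq_comap hj (traj X ω₀)] at hs
    obtain ⟨B, hB, rfl⟩ := hs
    rw [← hJ] at hs' ⊢
    set I : (ℕ → E) → ℂ := fun x => B.indicator (fun _ => 1) (J.piecewise x (traj X ω₀)) with hI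
    have hIb : BddMeas I := by
      refine ⟨(measurable_const.indicator hB).comp (measurable_piecewise_left J _), 1,
        fun x => ?_⟩
      by_cases hx : J.piecewise x (traj X ω₀) ∈ B <;> simp [hI, hx]
    have hIJ : ∀ x x', (∀ i ∈ J, x i = x' i) → I x = I x' := by
      intro x x' hxx
      have : J.piecewise x (traj X ω₀) = J.piecewise x' (traj X ω₀) := by
        funext i
        by_cases hi : i ∈ J <;> simp [hi, hxx]
      simp only [hI, this]
    have hset : ∀ u : (ℕ → E) → ℂ, ∫ ω in (fun ω => J.piecewise (traj X ω) (traj X ω₀)) ⁻¹' B,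
        u (traj X ω) ∂μ = ∫ ω, I (traj X ω) * u (traj X ω) ∂μ := by
      intro u
      rw [← integral_indicator hs']
      refine integral_congr_ae (ae_of_all _ fun ω => ?_)
      by_cases hω : J.piecewise (traj X ω) (traj X ω₀) ∈ B <;> simp [hI, hω]
    rw [hset F, hset fun x => ∫ y, F y ∂pathLaw (pinned (marg μ X) J x) p N, h.integral_mul_traj (sites_subset hj) hF hFN hIb hIJ]
    have h1 := h.integral_mul_traj (sites_subset hj) (.const 1) (fun _ _ _ => rfl) (hIb.mul hG)
      (fun x x' hxx => by rw [hIJ x x' hxx, integral_pinned_congr F hxx])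
    simp only [mul_one] at h1
    rw [h1]
    refine integral_congr_ae (ae_of_all _ fun x => ?_)
    simp only
    rw [h.pair.integral_pathLaw_pinned hF, mul_assoc,
      div_mul_cancel₀ _ (h.pair.condInt_one_ne_zero J x)]
  · have e : (fun ω => ∫ y, F y ∂pathLaw (pinned (marg μ X) J (traj X ω)) p N)
        = (fun x => ∫ y, F y ∂pathLaw (pinned (marg μ X) J x) p N) ∘
          fun ω => J.piecewise (traj X ω) (traj X ω₀) := by
      funext ω
      exact integral_pinned_congr F fun i hi => (hpw _ _ i hi).symm
    rw [e, sigmaOf_eq_comap hj (traj X ω₀)]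
    exact (hG.1.comp (comap_measurable _)).stronglyMeasurable.aestronglyMeasurable

lemma IsChainDens.condExp_real_eq (h : IsChainDens μ X p C N) (hj : ∀ i, j i ∈ Finset.Icc 1 N)
    {F : (ℕ → E) → ℝ} (hF : BddMeas fun x => (F x : ℂ))
    (hFN : ∀ x y, (∀ i < N, x i = y i) → F x = F y) :
    μ[fun ω => F (traj X ω) | sigmaOf X j] =ᵐ[μ]
      fun ω => ∫ y, F y ∂pathLaw (pinned (marg μ X) (sites j) (traj X ω)) p N := by
  have hp := h.prob
  have hint : Integrable (fun ω => F (traj X ω)) μ := by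
    obtain ⟨hu, b, hb⟩ := hF
    have := (BddMeas.integrable (u := fun ω => (F (traj X ω) : ℂ))
      ⟨hu.comp h.measurable_traj, b, fun ω => hb _⟩ μ).re
    simpa using this
  filter_upwards [h.condExp_eq hj hF (fun x y hxy => by rw [hFN x y hxy]),
    Complex.ofRealCLM.comp_condExp_comm (m := sigmaOf X j) hint] with ω h1 h2
  have h3 : ((μ[fun ω => F (traj X ω) | sigmaOf X j] ω : ℝ) : ℂ) = _ := h2.trans h1
  rw [integral_complex_ofReal] at h3
  exact_mod_cast h3

/-- The `L¹` norm of a conditional expectation. -/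
lemma IsChainDens.integral_norm_condExp (h : IsChainDens μ X p C N)
    (hj : ∀ i, j i ∈ Finset.Icc 1 N) {F : (ℕ → E) → ℂ} (hF : BddMeas F)
    (hFN : ∀ x y, (∀ i < N, x i = y i) → F x = F y) :
    ∫ ω, ‖(μ[fun ω => F (traj X ω) | sigmaOf X j]) ω‖ ∂μ
      = ∫ x, ‖condInt (marg μ X) p N (sites j) F x‖ ∂Measure.infinitePi (marg μ X) := by
  have hν := h.isProbabilityMeasure_marg
  have hG := h.pair.bddMeas_integral_pinned (N := N) hF (sites j)
  have hGn : BddMeas fun x => ((‖∫ y, F y ∂pathLaw (pinned (marg μ X) (sites j) x) p N‖ : ℝ) : ℂ) := by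
    obtain ⟨hm, b, hb⟩ := hG
    exact ⟨Complex.measurable_ofReal.comp hm.norm, b, fun x => by simpa using hb x⟩
  have h1 := h.integral_mul_traj (sites_subset hj) (.const 1) (fun _ _ _ => rfl) hGn
    (fun x x' hxx => by rw [integral_pinned_congr F hxx])
  simp only [mul_one] at h1
  have h2 : ∀ x, ((‖∫ y, F y ∂pathLaw (pinned (marg μ X) (sites j) x) p N‖ : ℝ) : ℂ)
      * condInt (marg μ X) p N (sites j) (fun _ => 1) x
      = ((‖condInt (marg μ X) p N (sites j) F x‖ : ℝ) : ℂ) := by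
    intro x
    have hpos := ((h.pair.pinned (sites j) x).partition_pos N)
    rw [h.pair.integral_pathLaw_pinned hF, norm_div, ← h.pair.ofReal_partition_pinned,
      Complex.norm_real, Real.norm_of_nonneg hpos.le]
    push_cast
    rw [div_mul_cancel₀]
    exact_mod_cast hpos.ne'
  simp only [h2] at h1
  rw [integral_complex_ofReal, integral_complex_ofReal] at h1
  rw [integral_congr_ae ((h.condExp_eq hj hF hFN).mono fun ω hω => congrArg norm hω)]
  exact_mod_cast h1

end Conditioning

/-! ### Oscillatory integrals under pinning -/

/-- The sites of the first `N` at distance at most one from `J`. -/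
def nbhd (N : ℕ) (J : Finset ℕ) : Finset ℕ :=
  (J ∪ J.image (· + 1) ∪ J.image (· - 1)) ∩ range N

lemma card_nbhd_le (N : ℕ) (J : Finset ℕ) : (nbhd N J).card ≤ 3 * J.card := by
  have h1 := Finset.card_le_card (Finset.inter_subset_left (s₁ := J ∪ J.image (· + 1) ∪
    J.image (· - 1)) (s₂ := range N))
  have h2 := Finset.card_union_le (J ∪ J.image (· + 1)) (J.image (· - 1))
  have h3 := Finset.card_union_le J (J.image (· + 1))
  have h4 := Finset.card_image_le (s := J) (f := (· + 1))
  have h5 := Finset.card_image_le (s := J) (f := (· - 1))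
  unfold nbhd
  omega

lemma mem_nbhd {N i n : ℕ} {J : Finset ℕ} (hi : i ∈ J ∨ i + 1 ∈ J) (hn : n = i ∨ n = i + 1)
    (hnN : n < N) : n ∈ nbhd N J := by
  refine Finset.mem_inter.2 ⟨?_, Finset.mem_range.2 hnN⟩
  simp only [Finset.mem_union, Finset.mem_image]
  rcases hi with hi | hi <;> rcases hn with rfl | rfl
  · exact .inl (.inl hi)
  · exact .inl (.inr ⟨i, hi, rfl⟩)
  · exact .inr ⟨n + 1, hi, rfl⟩
  · exact .inl (.inl hi)

section Transfer

variable {ν : ℕ → Measure E} {p : ℕ → E → E → ℝ} {C : ℝ} {N : ℕ} {J : Finset ℕ}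

/-- Changing `J.card` sites changes the path density by a bounded factor. -/
lemma IsPairDens.pathDens_le (h : IsPairDens ν p C) {x y : ℕ → E} (hxy : ∀ i ∉ J, x i = y i) :
    pathDens p N x ≤ C ^ (4 * J.card) * pathDens p N y := by
  have hC := h.pos
  set T := (range N).filter fun i => i ∈ J ∨ i + 1 ∈ J with hT
  have hcard : T.card ≤ 2 * J.card := by
    have h1 : T ⊆ J ∪ J.image (· - 1) := by
      intro i hi
      rcases (Finset.mem_filter.1 hi).2 with h | h
      · exact Finset.mem_union_left _ h
      · exact Finset.mem_union_right _ (Finset.mem_image.2 ⟨i + 1, h, rfl⟩)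
    have h2 := Finset.card_le_card h1
    have h3 := Finset.card_union_le J (J.image (· - 1))
    have h4 := Finset.card_image_le (s := J) (f := (· - 1))
    omega
  have h1 : pathDens p N x
      ≤ ∏ i ∈ range N, (if i ∈ J ∨ i + 1 ∈ J then C ^ 2 else 1) * p i (y i) (y (i + 1)) := by
    refine Finset.prod_le_prod (fun i _ => (h.dens_pos i _ _).le) fun i _ => ?_
    split_ifs with hi
    · calc p i (x i) (x (i + 1)) ≤ C := h.upper _ _ _
        _ = C ^ 2 * C⁻¹ := by field_simp
        _ ≤ _ := by gcongr; exact h.lower _ _ _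
    · push Not at hi
      rw [one_mul, hxy i hi.1, hxy (i + 1) hi.2]
  refine h1.trans ?_
  rw [Finset.prod_mul_distrib, ← Finset.prod_filter, Finset.prod_const, ← pow_mul, ← hT]
  refine mul_le_mul_of_nonneg_right ?_ (h.pathDens_pos N y).le
  exact pow_le_pow_right₀ h.one_lt.le (by omega)

variable [∀ n, IsProbabilityMeasure (ν n)]

lemma IsPairDens.le_partition_pinned (h : IsPairDens ν p C) (hone : partition ν p N = 1)
    (x : ℕ → E) : 1 ≤ C ^ (4 * J.card) * partition (EdgeworthMC.pinned ν J x) p N := by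
  have hm := measurable_piecewise_right (E := E) J x
  have hi := (h.pinned J x).integrable_pathDens N
  rw [infinitePi_pinned] at hi
  have h1 : ∫ y, pathDens p N y ∂Measure.infinitePi ν
      ≤ ∫ y, C ^ (4 * J.card) * pathDens p N (J.piecewise x y) ∂Measure.infinitePi ν := by
    refine integral_mono (h.integrable_pathDens N) ((hi.comp_measurable hm).const_mul _) fun y => ?_
    exact h.pathDens_le fun i hi => by simp [hi]
  rw [integral_const_mul] at h1
  rw [← hone]
  refine h1.trans (le_of_eq ?_)
  rw [partition, infinitePi_pinned, integral_map hm.aemeasurable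
    (h.measurable_pathDens N).aestronglyMeasurable]

/-- An oscillatory integral under the pinned law is controlled by a conditional expectation
under the original law. -/
lemma IsPairDens.norm_integral_pinned_le (h : IsPairDens ν p C) (hone : partition ν p N = 1)
    (hlast : ∀ x y, p (N - 1) x y = 1) {e : ℕ → E → ℂ} (he : ∀ i, Measurable (e i))
    (he1 : ∀ i x, ‖e i x‖ = 1) {M : (ℕ → E) → ℂ} (hM : Measurable M) {b : ℝ}
    (hMb : ∀ x, ‖M x‖ ≤ b) {T : Finset ℕ} (hMT : ∀ x y, (∀ i ∈ T, x i = y i) → M x = M y)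
    (x : ℕ → E) :
    ‖∫ y, (∏ i ∈ range N, e i (y i)) * M y ∂pathLaw (EdgeworthMC.pinned ν J x) p N‖
      ≤ C ^ (8 * J.card) * b * ∫ y, ‖condInt ν p N (nbhd N J ∪ T)
        (fun y => ∏ i ∈ range N, e i (y i)) y‖ ∂Measure.infinitePi ν := by
  have hC := h.pos
  have hm := measurable_piecewise_right (E := E) J x
  set F : (ℕ → E) → ℂ := fun y => ∏ i ∈ range N, e i (y i) with hF
  have hFb : BddMeas F := BddMeas.prod _ fun i _ =>
    BddMeas.site (.of_norm_le (he i) fun x => (he1 i x).le) i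
  have hF1 : ∀ y, ‖F y‖ = 1 := fun y => by simp [hF, norm_prod, he1]
  have hb : 0 ≤ b := (norm_nonneg _).trans (hMb x)
  set z : (ℕ → E) → ℕ → E := fun y => J.piecewise x y with hz
  have hzJ : ∀ y, ∀ i ∉ J, z y i = y i := fun y i hi => by simp [hz, hi]
  have hzJ' : ∀ y y', ∀ i ∈ J, z y i = z y' i := fun y y' i hi => by simp [hz, hi]
  have hzz : ∀ {y y' : ℕ → E} {i : ℕ}, y i = y' i → z y i = z y' i := fun {y y' i} hyy => by
    by_cases hi : i ∈ J
    · exact hzJ' _ _ i hi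
    · rw [hzJ _ _ hi, hzJ _ _ hi, hyy]
  set R : (ℕ → E) → ℂ := fun y => ((pathDens p N (z y) / pathDens p N y : ℝ) : ℂ) with hR
  set B : (ℕ → E) → ℂ := fun y => R y * (F (z y) / F y) * M (z y) with hB
  have hBm : Measurable B :=
    ((Complex.measurable_ofReal.comp (((h.measurable_pathDens N).comp hm).div
      (h.measurable_pathDens N))).mul ((hFb.1.comp hm).div hFb.1)).mul (hM.comp hm)
  have hRb : ∀ y, ‖R y‖ ≤ C ^ (4 * J.card) := fun y => by
    have h1 := h.pathDens_pos N (z y)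
    have h2 := h.pathDens_pos N y
    rw [hR, Complex.norm_real, Real.norm_of_nonneg (by positivity), div_le_iff₀ h2]
    exact h.pathDens_le (hzJ y)
  have hBb : ∀ y, ‖B y‖ ≤ C ^ (4 * J.card) * b := fun y => by
    rw [hB, norm_mul, norm_mul, norm_div, hF1, hF1, div_one, mul_one]
    exact mul_le_mul (hRb y) (hMb _) (norm_nonneg _) (by positivity)
  have hBH : ∀ y y', (∀ i ∈ nbhd N J ∪ T, y i = y' i) → B y = B y' := by
    intro y y' hyy
    have hn : ∀ i ∈ nbhd N J, y i = y' i := fun i hi => hyy i (Finset.mem_union_left _ hi)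
    have h1 : R y = R y' := by
      simp only [hR, pathDens, ← Finset.prod_div_distrib]
      congr 1
      refine Finset.prod_congr rfl fun i hi => ?_
      have hiN := Finset.mem_range.1 hi
      by_cases hiJ : i ∈ J ∨ i + 1 ∈ J
      · have e1 := hn i (mem_nbhd hiJ (.inl rfl) hiN)
        rcases Nat.lt_or_ge (i + 1) N with hi1 | hi1
        · have e2 := hn (i + 1) (mem_nbhd hiJ (.inr rfl) hi1)
          rw [hzz e1, hzz e2, e1, e2]
        · obtain rfl : i = N - 1 := by omega
          simp only [hlast]
      · push Not at hiJ
        rw [hzJ _ _ hiJ.1, hzJ _ _ hiJ.2, hzJ _ _ hiJ.1, hzJ _ _ hiJ.2,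
          div_self (h.dens_pos _ _ _).ne', div_self (h.dens_pos _ _ _).ne']
    have h2 : F (z y) / F y = F (z y') / F y' := by
      simp only [hF, ← Finset.prod_div_distrib]
      refine Finset.prod_congr rfl fun i hi => ?_
      by_cases hiJ : i ∈ J
      · have e1 := hn i (mem_nbhd (.inl hiJ) (.inl rfl) (Finset.mem_range.1 hi))
        rw [hzz e1, e1]
      · have h0 : ∀ w, e i w ≠ 0 := fun w => norm_pos_iff.1 (by rw [he1]; exact one_pos)
        rw [hzJ _ _ hiJ, hzJ _ _ hiJ, div_self (h0 _), div_self (h0 _)]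
    have h3 : M (z y) = M (z y') :=
      hMT _ _ fun i hi => hzz (hyy i (Finset.mem_union_right _ hi))
    simp only [hB, h1, h2, h3]
  have hBbm : BddMeas B := ⟨hBm, _, hBb⟩
  have hMbm : BddMeas M := ⟨hM, _, hMb⟩
  have hnum : ‖condInt ν p N J (fun y => F y * M y) x‖ ≤ C ^ (4 * J.card) * b *
      ∫ y, ‖condInt ν p N (nbhd N J ∪ T) F y‖ ∂Measure.infinitePi ν := by
    have e1 : condInt ν p N J (fun y => F y * M y) x
        = ∫ y, (pathDens p N y : ℂ) * (B y * F y) ∂Measure.infinitePi ν := by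
      refine integral_congr_ae (ae_of_all _ fun y => ?_)
      have h0 : F y ≠ 0 := norm_pos_iff.1 (by rw [hF1]; exact one_pos)
      have h1 : (pathDens p N y : ℂ) ≠ 0 := by exact_mod_cast (h.pathDens_pos N y).ne'
      simp only [hB, hR]
      push_cast
      field_simp
      ring
    rw [e1, h.integral_mul_condInt hFb hBbm hBH, ← integral_const_mul]
    refine norm_integral_le_of_norm_le (((h.bddMeas_condInt hFb).integrable _).norm.const_mul _)
      (ae_of_all _ fun y => ?_)
    rw [norm_mul]
    exact mul_le_mul_of_nonneg_right (hBb y) (norm_nonneg _)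
  rw [h.integral_pathLaw_pinned (hFb.mul hMbm), norm_div, ← h.ofReal_partition_pinned,
    Complex.norm_real, Real.norm_of_nonneg ((h.pinned J x).partition_pos N).le,
    div_le_iff₀ ((h.pinned J x).partition_pos N)]
  set I := ∫ y, ‖condInt ν p N (nbhd N J ∪ T) F y‖ ∂Measure.infinitePi ν
  have hI : 0 ≤ I := integral_nonneg fun y => norm_nonneg _
  refine hnum.trans ?_
  have h1 := h.le_partition_pinned (J := J) hone x
  calc C ^ (4 * J.card) * b * I = C ^ (4 * J.card) * b * I * 1 := (mul_one _).symm
    _ ≤ C ^ (4 * J.card) * b * I * (C ^ (4 * J.card) * partition (EdgeworthMC.pinned ν J x) p N) :=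
        mul_le_mul_of_nonneg_left h1 (by positivity)
    _ = _ := by rw [show 8 * J.card = 4 * J.card + 4 * J.card by ring, pow_add]; ring

end Transfer

/-! ### The expansion for pinned path laws -/

/-- Some level of a bounded integer valued function carries a definite mass. -/
lemma exists_le_measureReal_level {ν : Measure E} [IsProbabilityMeasure ν] {f : E → ℤ} {K : ℕ}
    (hK : ∀ x, |f x| ≤ K) : ∃ m : ℤ, |m| ≤ K ∧ ((2 * K + 1 : ℝ))⁻¹ ≤ ν.real {x | f x = m} := by
  by_contra! hcon
  have h1 : (1 : ℝ) ≤ ∑ m ∈ Finset.Icc (-(K : ℤ)) K, ν.real {x | f x = m} := by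
    have h2 : (Set.univ : Set E) ⊆ ⋃ m ∈ Finset.Icc (-(K : ℤ)) K, {x | f x = m} := by
      intro x _
      simp only [Set.mem_iUnion]
      exact ⟨f x, Finset.mem_Icc.2 (abs_le.1 (hK x)), rfl⟩
    calc (1 : ℝ) = ν.real Set.univ := by simp
      _ ≤ _ := measureReal_mono h2 (measure_ne_top _ _)
      _ ≤ _ := measureReal_biUnion_finset_le _ _
  have h2 : ∑ m ∈ Finset.Icc (-(K : ℤ)) K, ν.real {x | f x = m}
      < ∑ m ∈ Finset.Icc (-(K : ℤ)) K, ((2 * K + 1 : ℝ))⁻¹ :=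
    Finset.sum_lt_sum_of_nonempty ⟨0, by simp⟩ fun m hm => hcon m (abs_le.2 (Finset.mem_Icc.1 hm))
  have hc : (Finset.Icc (-(K : ℤ)) K).card = 2 * K + 1 := by
    rw [Int.card_Icc]; omega
  rw [Finset.sum_const, hc, nsmul_eq_mul] at h2
  push_cast at h2
  rw [mul_inv_cancel₀ (by positivity)] at h2
  linarith

lemma pathSum_sub (f : ℕ → E → ℤ) (m : ℕ → ℤ) (N : ℕ) (x : ℕ → E) :
    pathSum (fun n x => f n x - m n) N x = pathSum f N x - ∑ i ∈ range N, m i := by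
  simp [pathSum, Finset.sum_sub_distrib]

lemma phase_sub (z : ℂ) (f : E → ℤ) (m : ℤ) (x : E) :
    phase z (fun x => f x - m) x = Complex.exp (-(Complex.I * z * m)) * phase z f x := by
  rw [phase, phase, ← Complex.exp_add]
  push_cast
  ring_nf

/-- The local expansion for path laws with at most `ℓ` pinned sites. -/
theorem exists_pinned_expansion {C : ℝ} (hC : 1 < C) {K r : ℕ} (hK : 1 ≤ K) (hr : 1 ≤ r) (ℓ : ℕ) :
    ∃ (D : ℕ) (Cb σ₁ : ℝ) (η σ₀ : ℝ → ℝ), (∀ ε > 0, 0 < η ε) ∧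
      ∀ {ν : ℕ → Measure E} {p : ℕ → E → E → ℝ} {f : ℕ → E → ℤ} {N : ℕ}
      [∀ n, IsProbabilityMeasure (ν n)], IsPairDens ν p C → partition ν p N = 1 →
      (∀ x y, p (N - 1) x y = 1) → 1 ≤ N → (∀ n, Measurable (f n)) → (∀ n x, |f n x| ≤ K) →
      ∀ J ⊆ range N, J.card ≤ ℓ → ∀ (x : ℕ → E) {σ : ℝ}, σ₁ ≤ σ →
      σ ^ 2 = variance (fun x => (pathSum f N x : ℝ)) (pathLaw ν p N) →
      ∃ P : Polynomial ℝ, P.natDegree ≤ D ∧ (∀ i, |P.coeff i| ≤ Cb) ∧ ∀ ε > 0, σ₀ ε ≤ σ →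
        (∀ t₀ ∈ resonances (2 * K), ∀ H ⊆ range N, H.card ≤ 3 * ℓ + (r - 1) →
          ∫ y, ‖condInt ν p N H (fun y => ∏ i ∈ range N, phase (t₀ : ℂ) (f i) (y i)) y‖
            ∂Measure.infinitePi ν ≤ η ε * σ⁻¹ ^ (r - 1)) →
        ∀ u : ℤ, |(pathLaw (pinned ν J x) p N).real {y | pathSum f N y = u}
          - σ⁻¹ * P.eval ((u - ∫ y, (pathSum f N y : ℝ) ∂pathLaw (pinned ν J x) p N) / σ) *
            gaussDensity ((u - ∫ y, (pathSum f N y : ℝ) ∂pathLaw (pinned ν J x) p N) / σ)|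
          ≤ ε * σ⁻¹ ^ r := by
  have hC0 : 0 < C := one_pos.trans hC
  obtain ⟨A, hA0, hA⟩ := exists_variance_pinned_sub_le (E := E) hC (G := K) (by exact_mod_cast hK)
  obtain ⟨D, Cb, σ₁, η, σ₀, hη, hmain⟩ := exists_local_expansion (E := E) (c := (C ^ 4)⁻¹)
    (a := (2 * K + 1 : ℝ)⁻¹) (A₀ := ℓ * A) (G := 2 * K) (r := r) (by positivity)
    (inv_lt_one_of_one_lt₀ (one_lt_pow₀ hC (by norm_num))) (by positivity) (by omega) hr
    (by positivity)
  set L : ℝ := C ^ (8 * ℓ) * (2 * K) ^ r with hL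
  have hL0 : 0 < L := by positivity
  refine ⟨D, Cb, σ₁, fun ε => η ε / L, σ₀, fun ε hε => div_pos (hη ε hε) hL0, ?_⟩
  intro ν p f N _ h hone hlast hN hf hfK J hJ hJℓ x σ hσ hσV
  choose m₀ hm₀ hm₀' using fun n => exists_le_measureReal_level (ν := ν n) (hfK n)
  set m : ℕ → ℤ := fun n => if n ∈ J then f n (x n) else m₀ n with hm
  have hmK : ∀ n, |m n| ≤ K := fun n => by
    simp only [hm]
    split_ifs
    · exact hfK _ _
    · exact hm₀ n
  set g : ℕ → E → ℤ := fun n x => f n x - m n with hg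
  have hgm : ∀ n, Measurable (g n) := fun n => (hf n).sub measurable_const
  have hgG : ∀ n x, |g n x| ≤ ((2 * K : ℕ) : ℤ) := fun n x => by
    have := abs_sub (f n x) (m n)
    have := hfK n x
    have := hmK n
    change |f n x - m n| ≤ _
    push_cast
    linarith
  have hg0 : ∀ n, (2 * K + 1 : ℝ)⁻¹ ≤ (pinned ν J x n).real {y | g n y = 0} := fun n => by
    have hms : MeasurableSet {y | g n y = 0} := hgm n (measurableSet_singleton 0)
    by_cases hn : n ∈ J
    · have h1 : (pinned ν J x n).real {y | g n y = 0} = 1 := by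
        have : x n ∈ {y | g n y = 0} := by simp [hg, hm, hn]
        rw [measureReal_def, pinned, if_pos hn, Measure.dirac_apply' _ hms]
        simp [this]
      rw [h1]
      exact inv_le_one_of_one_le₀ (by linarith [(Nat.cast_nonneg K : (0 : ℝ) ≤ K)])
    · have : {y | g n y = 0} = {y | f n y = m₀ n} := by
        ext y
        simp [hg, hm, hn, sub_eq_zero]
      rw [this, pinned, if_neg hn]
      exact hm₀' n
  have hQ := h.pinned J x
  have hprob := hQ.isProbabilityMeasure_pathLaw N
  set Q := pathLaw (pinned ν J x) p N with hQdef
  set s : ℤ := ∑ i ∈ range N, m i with hs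
  have hsum : ∀ y, pathSum g N y = pathSum f N y - s := fun y => pathSum_sub f m N y
  have hfK' : ∀ n x, |(f n x : ℝ)| ≤ K := fun n x => by exact_mod_cast hfK n x
  have hint : Integrable (fun y => (pathSum f N y : ℝ)) Q := by
    refine Integrable.of_bound (measurable_from_top.comp
      (measurable_pathSum hf N)).aestronglyMeasurable (N * K) (ae_of_all _ fun y => ?_)
    exact abs_pathSum_le hfK' N y
  have hvar : variance (fun y => (pathSum g N y : ℝ)) Q
      = variance (fun y => (pathSum f N y : ℝ)) Q := by
    simp only [hsum, Int.cast_sub]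
    exact variance_sub_const hint.aestronglyMeasurable _
  have hmean : ∫ y, (pathSum g N y : ℝ) ∂Q = ∫ y, (pathSum f N y : ℝ) ∂Q - s := by
    simp only [hsum, Int.cast_sub]
    rw [integral_sub hint (integrable_const _)]
    simp
  obtain ⟨P, hPd, hPc, hP⟩ := hmain hQ.isBackwardKernel (hQ.isPathLaw hN hlast) hgm hgG hg0 hσ
    (by
      rw [hvar, hσV]
      refine (hA h hlast hf hfK' J hJ x).trans ?_
      gcongr)
  refine ⟨P, hPd, hPc, fun ε hε hσε hyp u => ?_⟩
  have key := hP ε hε hσε ?_ (u - s)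
  · have e1 : {y | pathSum g N y = u - s} = {y | pathSum f N y = u} := by
      ext y
      simp [hsum]
    have e2 : (((u - s : ℤ) : ℝ) - ∫ y, (pathSum g N y : ℝ) ∂Q)
        = u - ∫ y, (pathSum f N y : ℝ) ∂Q := by
      rw [hmean]
      push_cast
      ring
    rwa [e1, e2] at key
  · intro t₀ ht₀ j hj q hq
    set T : Finset ℕ := Finset.univ.image q with hT
    have hTN : T ⊆ range N := fun n hn => by
      obtain ⟨b, -, rfl⟩ := Finset.mem_image.1 hn
      exact Finset.mem_range.2 (hq b)
    have hTc : T.card ≤ j := Finset.card_image_le.trans (by simp)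
    have hHc : (nbhd N J ∪ T).card ≤ 3 * ℓ + (r - 1) := by
      have := Finset.card_union_le (nbhd N J) T
      have := card_nbhd_le N J
      omega
    have hb : ∀ y : ℕ → E, ‖∏ b, (g (q b) (y (q b)) : ℂ)‖ ≤ (2 * K : ℝ) ^ j := fun y => by
      rw [norm_prod]
      refine (Finset.prod_le_prod (fun _ _ => norm_nonneg _) (g := fun _ => (2 * K : ℝ))
        fun b _ => ?_).trans (by simp)
      rw [Complex.norm_intCast]
      exact_mod_cast hgG (q b) (y (q b))
    have h1 := h.norm_integral_pinned_le (J := J) hone hlast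
      (e := fun i => phase (t₀ : ℂ) (f i)) (fun i => measurable_phase (hf i) _)
      (fun i y => norm_phase_ofReal t₀ y) (M := fun y => ∏ b, (g (q b) (y (q b)) : ℂ))
      (Finset.measurable_fun_prod _ fun b _ => (measurable_from_top (f := fun n : ℤ => (n : ℂ))).comp
        ((hgm (q b)).comp (measurable_pi_apply _)))
      hb (T := T) (fun y y' hyy => Finset.prod_congr rfl fun b _ => by
        rw [hyy (q b) (Finset.mem_image_of_mem _ (Finset.mem_univ b))]) x
    have h2 := hyp t₀ ht₀ (nbhd N J ∪ T)
      (Finset.union_subset Finset.inter_subset_right hTN) hHc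
    have e1 : ∀ y : ℕ → E, (∏ i ∈ range N, phase (t₀ : ℂ) (g i) (y i)) *
        ∏ b, (g (q b) (y (q b)) : ℂ) = (∏ i ∈ range N, Complex.exp (-(Complex.I * t₀ * m i))) *
        ((∏ i ∈ range N, phase (t₀ : ℂ) (f i) (y i)) * ∏ b, (g (q b) (y (q b)) : ℂ)) := by
      intro y
      rw [← mul_assoc, ← Finset.prod_mul_distrib]
      congr 1
      exact Finset.prod_congr rfl fun i _ => phase_sub _ _ _ _
    have e2 : ‖∏ i ∈ range N, Complex.exp (-(Complex.I * t₀ * m i))‖ = 1 := by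
      rw [norm_prod]
      refine Finset.prod_eq_one fun i _ => ?_
      rw [show -(Complex.I * t₀ * m i) = ((-(t₀ * m i) : ℝ) : ℂ) * Complex.I by push_cast; ring]
      exact Complex.norm_exp_ofReal_mul_I _
    simp only [e1]
    rw [integral_const_mul, norm_mul, e2, one_mul]
    have hbL : C ^ (8 * J.card) * (2 * K : ℝ) ^ j ≤ L := by
      have hK1 : (1 : ℝ) ≤ 2 * K := by
        have : (1 : ℝ) ≤ K := by exact_mod_cast hK
        linarith
      exact mul_le_mul (pow_le_pow_right₀ hC.le (by omega)) (pow_le_pow_right₀ hK1 hj.le)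
        (by positivity) (by positivity)
    calc _ ≤ _ := h1
      _ ≤ L * (η ε / L * σ⁻¹ ^ (r - 1)) :=
          mul_le_mul hbL h2 (integral_nonneg fun _ => norm_nonneg _) hL0.le
      _ = _ := by field_simp

/-! ### Conclusion -/

/-- The observables along the trajectory, truncated to `[-K, K]`. -/
def clamped (f : ℕ → E → ℤ) (K : ℕ) (i : ℕ) (x : E) : ℤ := max (-(K : ℤ)) (min K (f (i + 1) x))

lemma abs_clamped_le (f : ℕ → E → ℤ) (K i : ℕ) (x : E) : |clamped f K i x| ≤ K := by
  unfold clamped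
  rw [abs_le]
  omega

lemma measurable_clamped {f : ℕ → E → ℤ} (hf : ∀ n, Measurable (f n)) (K i : ℕ) :
    Measurable (clamped f K i) :=
  (measurable_from_top (f := fun m : ℤ => max (-(K : ℤ)) (min K m))).comp (hf (i + 1))

lemma S_eq_pathSum {X : ℕ → Ω → E} {f : ℕ → E → ℤ} {K : ℕ} (hb : ∀ n ω, |f n (X n ω)| ≤ (K : ℤ))
    (N : ℕ) (ω : Ω) : S X f N ω = pathSum (clamped f K) N (traj X ω) := by
  have hcl : ∀ i, clamped f K i (traj X ω i) = f (i + 1) (X (i + 1) ω) := fun i => by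
    have := abs_le.1 (hb (i + 1) ω)
    unfold clamped traj
    omega
  simp only [S, pathSum, hcl]
  induction N with
  | zero => simp
  | succ n ih => rw [Finset.sum_Icc_succ_top (by omega), ih, Finset.sum_range_succ]

lemma pathSum_congr (g : ℕ → E → ℤ) {N : ℕ} {x y : ℕ → E} (h : ∀ i < N, x i = y i) :
    pathSum g N x = pathSum g N y :=
  Finset.sum_congr rfl fun i hi => by rw [h i (Finset.mem_range.1 hi)]

lemma IsResonant.of_mem_resonances {K : ℕ} {t : ℝ} (ht : t ∈ resonances (2 * K)) :
    IsResonant K t ∧ t ≠ 0 := by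
  obtain ⟨l, m, hl, hlm, hm, rfl⟩ := mem_resonances.1 ht
  refine ⟨⟨l, m, by omega, hm, hlm, rfl⟩, ?_⟩
  have h1 : (0 : ℝ) < l := by exact_mod_cast hl
  have h2 : (0 : ℝ) < m := by exact_mod_cast hl.trans hlm
  have := Real.pi_pos
  positivity

section Chain

variable {μ : Measure Ω} {X : ℕ → Ω → E} {κ : ℕ → Kernel E E} {p : ℕ → E → E → ℝ} {C : ℝ} {N : ℕ}
  {f : ℕ → E → ℤ} {K : ℕ}

lemma UEChain.exists_isChainDens (h : UEChain μ X κ C) (hC : 1 < C) (hN : 1 ≤ N) :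
    ∃ p, IsChainDens μ X p C N := by
  obtain ⟨p, h1, h2, h3⟩ := h.exists_isPairDens hC hN
  exact ⟨p, h.1, h.2.1, h1, h2, h3⟩

lemma IsChainDens.partition_eq_one (h : IsChainDens μ X p C N) : partition (marg μ X) p N = 1 := by
  have := h.prob
  have h1 := h.law (fun _ => 1) measurable_const fun _ _ _ => rfl
  simp only [mul_one, integral_const, probReal_univ, one_smul] at h1
  rw [integral_complex_ofReal] at h1
  exact_mod_cast h1.symm

lemma IsChainDens.integral_traj (h : IsChainDens μ X p C N) {F : (ℕ → E) → ℝ} (hF : Measurable F)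
    (hFN : ∀ x y, (∀ i < N, x i = y i) → F x = F y) :
    ∫ ω, F (traj X ω) ∂μ = ∫ x, F x ∂pathLaw (marg μ X) p N := by
  have := h.isProbabilityMeasure_marg
  have h1 := h.law (fun x => (F x : ℂ)) (Complex.measurable_ofReal.comp hF)
    fun x y hxy => by rw [hFN x y hxy]
  rw [integral_complex_ofReal] at h1
  simp only [← Complex.ofReal_mul] at h1
  rw [integral_complex_ofReal] at h1
  rw [h.pair.integral_pathLaw, h.partition_eq_one]
  simp only [div_one, smul_eq_mul]
  exact_mod_cast h1

lemma IsChainDens.meanS_eq (h : IsChainDens μ X p C N) (hf : ∀ n, Measurable (f n))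
    (hb : ∀ n ω, |f n (X n ω)| ≤ (K : ℤ)) :
    meanS μ X f N = ∫ x, (pathSum (clamped f K) N x : ℝ) ∂pathLaw (marg μ X) p N := by
  simp only [meanS, S_eq_pathSum hb]
  exact h.integral_traj (F := fun x => (pathSum (clamped f K) N x : ℝ))
    (measurable_from_top.comp (measurable_pathSum (measurable_clamped hf K) N))
    fun x y hxy => by rw [pathSum_congr _ hxy]

lemma IsChainDens.VN_eq (h : IsChainDens μ X p C N) (hf : ∀ n, Measurable (f n))
    (hb : ∀ n ω, |f n (X n ω)| ≤ (K : ℤ)) :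
    VN μ X f N
      = variance (fun x => (pathSum (clamped f K) N x : ℝ)) (pathLaw (marg μ X) p N) := by
  have hm : Measurable fun x : ℕ → E => (pathSum (clamped f K) N x : ℝ) :=
    measurable_from_top.comp (measurable_pathSum (measurable_clamped hf K) N)
  have h1 := h.meanS_eq hf hb
  simp only [meanS, S_eq_pathSum hb] at h1
  simp only [VN, S_eq_pathSum hb]
  rw [variance_eq_integral (X := fun ω => (pathSum (clamped f K) N (traj X ω) : ℝ))
      (hm.comp h.measurable_traj).aemeasurable,
    variance_eq_integral hm.aemeasurable, ← h1]
  set c := ∫ ω, (pathSum (clamped f K) N (traj X ω) : ℝ) ∂μ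
  exact h.integral_traj (F := fun x => ((pathSum (clamped f K) N x : ℝ) - c) ^ 2)
    ((hm.sub_const c).pow_const 2) fun x y hxy => by rw [pathSum_congr _ hxy]

lemma IsChainDens.measure_S_eq (h : IsChainDens μ X p C N) (hf : ∀ n, Measurable (f n))
    (hb : ∀ n ω, |f n (X n ω)| ≤ (K : ℤ)) (k : ℤ) :
    (μ {ω | S X f N ω = k}).toReal
      = (pathLaw (marg μ X) p N).real {x | pathSum (clamped f K) N x = k} := by
  have hm := measurable_pathSum (measurable_clamped hf K) N
  have hs : MeasurableSet {x | pathSum (clamped f K) N x = k} := hm (measurableSet_singleton k)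
  have h1 := h.integral_traj (F := {x | pathSum (clamped f K) N x = k}.indicator fun _ => 1)
    (measurable_const.indicator hs) fun x y hxy => by
      simp only [Set.indicator_apply, Set.mem_ofPred_eq, pathSum_congr _ hxy]
  rw [integral_indicator_const _ hs, smul_eq_mul, mul_one] at h1
  rw [← h1]
  have hs' : MeasurableSet (traj X ⁻¹' {x | pathSum (clamped f K) N x = k}) :=
    h.measurable_traj hs
  have h2 : ∫ ω, {x | pathSum (clamped f K) N x = k}.indicator (fun _ => (1 : ℝ)) (traj X ω) ∂μ
      = ∫ ω, (traj X ⁻¹' {x | pathSum (clamped f K) N x = k}).indicator (fun _ => (1 : ℝ)) ω ∂μ :=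
    rfl
  rw [h2, integral_indicator_const _ hs', smul_eq_mul, mul_one, measureReal_def]
  congr 3
  ext ω
  simp [S_eq_pathSum hb]

lemma bddMeas_prod_phase {g : ℕ → E → ℤ} (hg : ∀ n, Measurable (g n)) (t : ℝ) (N : ℕ) :
    BddMeas fun y : ℕ → E => ∏ i ∈ range N, phase (t : ℂ) (g i) (y i) :=
  BddMeas.prod _ fun i _ =>
    BddMeas.site (.of_norm_le (measurable_phase (hg i) _) fun x => (norm_phase_ofReal t x).le) i

/-- The conditional characteristic functions control the conditional integrals over all finite sets
of sites. -/
lemma IsChainDens.integral_norm_condInt_le (h : IsChainDens μ X p C N) (hf : ∀ n, Measurable (f n))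
    (hb : ∀ n ω, |f n (X n ω)| ≤ (K : ℤ)) {t δ : ℝ} {H : Finset ℕ} (hH : H ⊆ range N)
    (hyp : ∀ j : Fin H.card → ℕ, (∀ i, j i ∈ Finset.Icc 1 N) →
      (∫ ω, ‖condChar μ X f t N j ω‖ ∂μ) ≤ δ) :
    ∫ y, ‖condInt (marg μ X) p N H
      (fun y => ∏ i ∈ range N, phase (t : ℂ) (clamped f K i) (y i)) y‖
      ∂Measure.infinitePi (marg μ X) ≤ δ := by
  set j : Fin H.card → ℕ := fun i => H.orderEmbOfFin rfl i + 1 with hj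
  have hjN : ∀ i, j i ∈ Finset.Icc 1 N := fun i => by
    have := Finset.mem_range.1 (hH (H.orderEmbOfFin_mem rfl i))
    exact Finset.mem_Icc.2 ⟨Nat.le_add_left 1 _, this⟩
  have hsites : sites j = H := by
    ext n
    simp only [sites, hj, Finset.mem_image, Finset.mem_univ, true_and, Nat.add_sub_cancel]
    constructor
    · rintro ⟨i, rfl⟩
      exact H.orderEmbOfFin_mem rfl i
    · intro hn
      have : n ∈ Set.range (H.orderEmbOfFin rfl) := by
        rw [H.range_orderEmbOfFin rfl]
        exact hn
      exact this
  have h1 := h.integral_norm_condExp hjN (bddMeas_prod_phase (measurable_clamped hf K) t N)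
    fun x y hxy => Finset.prod_congr rfl fun i hi => by rw [hxy i (Finset.mem_range.1 hi)]
  rw [hsites] at h1
  rw [← h1]
  refine le_trans (le_of_eq ?_) (hyp j hjN)
  unfold condChar
  simp only [prod_phase_eq_exp_pathSum, S_eq_pathSum hb, Complex.ofReal_intCast]

lemma IsChainDens.condProb_eq (h : IsChainDens μ X p C N) (hf : ∀ n, Measurable (f n))
    (hb : ∀ n ω, |f n (X n ω)| ≤ (K : ℤ)) {ℓ : ℕ} {j : Fin ℓ → ℕ}
    (hj : ∀ i, j i ∈ Finset.Icc 1 N) :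
    ∀ᵐ ω ∂μ, ∀ k : ℤ, condProb μ (sigmaOf X j) {ω' | S X f N ω' = k} ω
      = (pathLaw (pinned (marg μ X) (sites j) (traj X ω)) p N).real
        {x | pathSum (clamped f K) N x = k} := by
  refine ae_all_iff.2 fun k => ?_
  have hm := measurable_pathSum (measurable_clamped hf K) N
  have hs : MeasurableSet {x | pathSum (clamped f K) N x = k} := hm (measurableSet_singleton k)
  have hF : BddMeas fun x => (({x | pathSum (clamped f K) N x = k}.indicator
      (fun _ => (1 : ℝ)) x : ℝ) : ℂ) := by
    refine .of_norm_le (b := 1) (Complex.measurable_ofReal.comp (measurable_const.indicator hs))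
      fun x => ?_
    by_cases hx : pathSum (clamped f K) N x = k <;> simp [hx]
  filter_upwards [h.condExp_real_eq hj hF fun x y hxy => by
    simp only [Set.indicator_apply, Set.mem_ofPred_eq, pathSum_congr _ hxy]] with ω hω
  rw [integral_indicator_const _ hs, smul_eq_mul, mul_one] at hω
  rw [← hω, condProb]
  have e : {ω' | S X f N ω' = k}.indicator (fun _ => (1 : ℝ))
      = fun ω => {x | pathSum (clamped f K) N x = k}.indicator (fun _ => (1 : ℝ)) (traj X ω) := by
    funext ω'
    simp only [Set.indicator_apply, Set.mem_ofPred_eq, S_eq_pathSum hb]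
  rw [e]

lemma IsChainDens.condExp_S_eq (h : IsChainDens μ X p C N) (hf : ∀ n, Measurable (f n))
    (hb : ∀ n ω, |f n (X n ω)| ≤ (K : ℤ)) {ℓ : ℕ} {j : Fin ℓ → ℕ}
    (hj : ∀ i, j i ∈ Finset.Icc 1 N) :
    μ[fun ω' => ((S X f N ω' : ℝ)) | sigmaOf X j] =ᵐ[μ] fun ω =>
      ∫ y, (pathSum (clamped f K) N y : ℝ)
        ∂pathLaw (pinned (marg μ X) (sites j) (traj X ω)) p N := by
  have hm : Measurable fun x : ℕ → E => (pathSum (clamped f K) N x : ℝ) :=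
    measurable_from_top.comp (measurable_pathSum (measurable_clamped hf K) N)
  simp only [S_eq_pathSum hb]
  refine h.condExp_real_eq hj (F := fun x => (pathSum (clamped f K) N x : ℝ))
    (.of_norm_le (b := N * K) (Complex.measurable_ofReal.comp hm) fun x => ?_)
    fun x y hxy => by rw [pathSum_congr _ hxy]
  rw [Complex.norm_real]
  exact abs_pathSum_le (fun n x => by exact_mod_cast abs_clamped_le f K n x) N x

end Chain

lemma sum_Icc_ite_one {r : ℕ} (hr : 1 ≤ r) (P : Polynomial ℝ) (s u g : ℝ) :
    ∑ b ∈ Finset.Icc 1 r, s ^ b * (if b = 1 then P else 0).eval u * g = s * P.eval u * g := by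
  rw [Finset.sum_eq_single_of_mem 1 (Finset.mem_Icc.2 ⟨le_rfl, hr⟩) fun b _ hb => by simp [hb]]
  simp

end EdgeworthMC

namespace EdgeworthMC

variable {Ω E : Type*} [MeasurableSpace Ω] [MeasurableSpace E]

/-- Proposition 6.2. If for every nonzero resonant point `t`,
`max_{k ≤ 8r-4} sup_{1≤j_1,…,j_k≤N} ‖𝔼[e^{itS_N}|X_{j_1},…,X_{j_k}]‖_{L¹} = o(σ_N^{-(r-1)})`,
then `S_N` obeys the usual Edgeworth expansion of order `r`. Moreover, if for every nonzero
resonant point `t` and every `ℓ`,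
`sup_{1≤j_1,…,j_ℓ≤N} ‖𝔼[e^{itS_N}|X_{j_1},…,X_{j_ℓ}]‖_{L¹} = o_ℓ(σ_N^{-(r-1)})`,
then the Edgeworth expansion of order `r` holds in a conditionally stable way. -/
theorem edgeworth_of_condChar_small
    (μ : Measure Ω) (X : ℕ → Ω → E) (κ : ℕ → Kernel E E) (f : ℕ → E → ℤ)
    (C : ℝ) (K r : ℕ) (hC : 1 < C) (hK : 1 ≤ K) (hr : 1 ≤ r)
    (hchain : UEChain μ X κ C) (hf : ∀ n, Measurable (f n))
    (hbound : ∀ n ω, |f n (X n ω)| ≤ (K : ℤ))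
    (hV : Tendsto (fun N => VN μ X f N) atTop atTop) :
    ((∀ t : ℝ, IsResonant K t → t ≠ 0 →
        ∀ ε > 0, ∃ N₀, ∀ N ≥ N₀, ∀ k : ℕ, k ≤ 8 * r - 4 →
          ∀ j : Fin k → ℕ, (∀ i, j i ∈ Finset.Icc 1 N) →
            (∫ ω, ‖condChar μ X f t N j ω‖ ∂μ) ≤ ε * (sigN μ X f N)⁻¹ ^ (r - 1)) →
      Edgeworth μ X f r) ∧
    ((∀ t : ℝ, IsResonant K t → t ≠ 0 → ∀ ℓ : ℕ,
        ∀ ε > 0, ∃ N₀, ∀ N ≥ N₀, ∀ j : Fin ℓ → ℕ, (∀ i, j i ∈ Finset.Icc 1 N) →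
          (∫ ω, ‖condChar μ X f t N j ω‖ ∂μ) ≤ ε * (sigN μ X f N)⁻¹ ^ (r - 1)) →
      CondStableEdgeworth μ X f r) := by
  have hσ : Tendsto (fun N => sigN μ X f N) atTop atTop := Real.tendsto_sqrt_atTop.comp hV
  have hσ2 : ∀ N, sigN μ X f N ^ 2 = VN μ X f N := fun N => Real.sq_sqrt (variance_nonneg _ _)
  have hcm := measurable_clamped hf K
  have hcK := abs_clamped_le f K
  constructor
  · intro hyp
    obtain ⟨D, Cb, σ₁, η, σ₀, hη, H⟩ := exists_pinned_expansion (E := E) hC hK hr 0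
    have hN : ∀ N, ∃ P : Polynomial ℝ, P.natDegree ≤ D ∧ (∀ i, |P.coeff i| ≤ max Cb 0) ∧
        (1 ≤ N → σ₁ ≤ sigN μ X f N → ∀ ε > 0, σ₀ ε ≤ sigN μ X f N →
          (∀ t ∈ resonances (2 * K), ∀ k ≤ 8 * r - 4, ∀ j : Fin k → ℕ,
            (∀ i, j i ∈ Finset.Icc 1 N) →
            (∫ ω, ‖condChar μ X f t N j ω‖ ∂μ) ≤ η ε * (sigN μ X f N)⁻¹ ^ (r - 1)) →
          ∀ k : ℤ, |(μ {ω | S X f N ω = k}).toReal - (sigN μ X f N)⁻¹ *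
            P.eval (((k : ℝ) - meanS μ X f N) / sigN μ X f N) *
            gaussDensity (((k : ℝ) - meanS μ X f N) / sigN μ X f N)|
              ≤ ε * (sigN μ X f N)⁻¹ ^ r) := by
      intro N
      by_cases hN : 1 ≤ N ∧ σ₁ ≤ sigN μ X f N
      · obtain ⟨p, hp⟩ := hchain.exists_isChainDens hC hN.1
        have := hp.isProbabilityMeasure_marg
        have := hp.prob
        obtain ⟨ω₀⟩ : Nonempty Ω := nonempty_of_isProbabilityMeasure μ
        obtain ⟨P, hPd, hPc, hP⟩ := H hp.pair hp.partition_eq_one hp.last hN.1 hcm hcK ∅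
          (Finset.empty_subset _) le_rfl (traj X ω₀) hN.2 (by rw [hσ2, hp.VN_eq hf hbound])
        refine ⟨P, hPd, fun i => (hPc i).trans (le_max_left _ _), fun _ _ ε hε hσε hsm k => ?_⟩
        have h1 := hP ε hε hσε (fun t ht J hJ hJc => hp.integral_norm_condInt_le hf hbound hJ
          (hsm t ht _ (by omega))) k
        have e : pinned (marg μ X) ∅ (traj X ω₀) = marg μ X := funext fun n => by simp [pinned]
        rwa [e, ← hp.measure_S_eq hf hbound, ← hp.meanS_eq hf hbound] at h1
      · exact ⟨0, by simp, by simp, fun h1 h2 => absurd ⟨h1, h2⟩ hN⟩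
    choose P hPd hPc hP using hN
    refine ⟨D, max Cb 0, fun b N => if b = 1 then P N else 0, fun b N => ?_, fun b N i => ?_,
      fun ε hε => ?_⟩
    · dsimp only
      split_ifs
      exacts [hPd N, by simp]
    · dsimp only
      split_ifs
      exacts [hPc N i, by simp]
    · have hsm : ∀ᶠ N in atTop, ∀ t ∈ resonances (2 * K), ∀ k ≤ 8 * r - 4, ∀ j : Fin k → ℕ,
          (∀ i, j i ∈ Finset.Icc 1 N) →
          (∫ ω, ‖condChar μ X f t N j ω‖ ∂μ) ≤ η ε * (sigN μ X f N)⁻¹ ^ (r - 1) := by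
        refine (eventually_all_finset _).2 fun t ht => ?_
        obtain ⟨h1, h2⟩ := IsResonant.of_mem_resonances ht
        exact eventually_atTop.2 (hyp t h1 h2 (η ε) (hη ε hε))
      refine eventually_atTop.1 ?_
      filter_upwards [hsm, eventually_ge_atTop 1, hσ.eventually_ge_atTop σ₁,
        hσ.eventually_ge_atTop (σ₀ ε)] with N h1 h2 h3 h4 k
      rw [sum_Icc_ite_one hr]
      exact hP N h2 h3 ε hε h4 h1 k
  · intro hyp ℓ
    obtain ⟨D, Cb, σ₁, η, σ₀, hη, H⟩ := exists_pinned_expansion (E := E) hC hK hr ℓ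
    refine ⟨D, max Cb 0, fun ε hε => ?_⟩
    have hsm : ∀ᶠ N in atTop, ∀ t ∈ resonances (2 * K), ∀ k ∈ range (3 * ℓ + (r - 1) + 1),
        ∀ j : Fin k → ℕ, (∀ i, j i ∈ Finset.Icc 1 N) →
        (∫ ω, ‖condChar μ X f t N j ω‖ ∂μ) ≤ η ε * (sigN μ X f N)⁻¹ ^ (r - 1) := by
      refine (eventually_all_finset _).2 fun t ht => (eventually_all_finset _).2 fun k _ => ?_
      obtain ⟨h1, h2⟩ := IsResonant.of_mem_resonances ht
      exact eventually_atTop.2 (hyp t h1 h2 k (η ε) (hη ε hε))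
    refine eventually_atTop.1 ?_
    filter_upwards [hsm, eventually_ge_atTop 1, hσ.eventually_ge_atTop σ₁,
      hσ.eventually_ge_atTop (σ₀ ε)] with N h1 h2 h3 h4 j hj
    obtain ⟨p, hp⟩ := hchain.exists_isChainDens hC h2
    have := hp.isProbabilityMeasure_marg
    choose P hPd hPc hP using fun ω => H hp.pair hp.partition_eq_one hp.last h2 hcm hcK
      (sites j) (sites_subset hj) (card_sites_le j) (traj X ω) h3
      (by rw [hσ2, hp.VN_eq hf hbound])
    refine ⟨fun b ω => if b = 1 then P ω else 0, fun b ω => ?_, fun b ω i => ?_, ?_⟩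
    · dsimp only
      split_ifs
      exacts [hPd ω, by simp]
    · dsimp only
      split_ifs
      exacts [(hPc ω i).trans (le_max_left _ _), by simp]
    · filter_upwards [hp.condProb_eq hf hbound hj, hp.condExp_S_eq hf hbound hj] with ω h5 h6 k
      rw [sum_Icc_ite_one hr, h5, h6]
      exact hP ω ε hε h4 (fun t ht J hJ hJc => hp.integral_norm_condInt_le hf hbound hJ
        (h1 t ht _ (Finset.mem_range.2 (by omega)))) k

end EdgeworthMC
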